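/- For any subanalytic set X ⊆ ℚ_p^m and subanalytic functions f_i : X → ℚ_p, i = 1,…,r, there exist an integer N ≥ 1, a semialgebraic set Y ⊆ ℚ_p^N, a subanalytic bijection F : X → Y, and semialgebraic maps g_i : Y → ℚ_p such that |g_i(F(x))| = |f_i(x)| for each x ∈ X and each i = 1,…,r. -/

import Mathlib

open Filter MeasureTheory
open scoped ENNReal

namespace PadicSub

variable (p : ℕ) [Fact p.Prime]

/-- The coefficients (indexed by multi-indices) of a restricted power series:
they tend to `0` along the cofinite filter. -/
def IsRestrictedCoeffs {m : ℕ} (a : (Fin m → ℕ) → ℚ_[p]) : Prop :=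
  Filter.Tendsto a Filter.cofinite (nhds 0)

/-- The restricted analytic function associated to a family of coefficients:
the sum of the power series on `ℤ_p^m`, and `0` outside `ℤ_p^m`. -/
noncomputable def ranalFn {m : ℕ} (a : (Fin m → ℕ) → ℚ_[p]) (x : Fin m → ℚ_[p]) : ℚ_[p] :=
  if ∀ j, ‖x j‖ ≤ 1 then ∑' i : (Fin m → ℕ), a i * ∏ j, x j ^ i j else 0

/-- `D`-functions: the functions obtained from restricted analytic functions, polynomial
maps, and the inverse function (with the convention `0⁻¹ = 0`) by repeated composition. -/
inductive IsDFunction : {m : ℕ} → ((Fin m → ℚ_[p]) → ℚ_[p]) → Prop where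
  | ranal {m : ℕ} (a : (Fin m → ℕ) → ℚ_[p]) (ha : IsRestrictedCoeffs p a) :
      IsDFunction (ranalFn p a)
  | poly {m : ℕ} (q : MvPolynomial (Fin m) ℚ_[p]) :
      IsDFunction (fun x => MvPolynomial.eval x q)
  | inv : IsDFunction (fun x : Fin 1 → ℚ_[p] => (x 0)⁻¹)
  | comp {m n : ℕ} (f : (Fin n → ℚ_[p]) → ℚ_[p]) (g : Fin n → (Fin m → ℚ_[p]) → ℚ_[p]) :
      IsDFunction f → (∀ i, IsDFunction (g i)) →
      IsDFunction (fun x => f (fun i => g i x))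

/-- `P_n`: the set of nonzero `n`-th powers in `ℚ_p`. -/
def Pset (n : ℕ) : Set ℚ_[p] := {x | ∃ y : ℚ_[p], y ≠ 0 ∧ y ^ n = x}

/-- The coset `μ P_n`. -/
def cosetP (μ : ℚ_[p]) (n : ℕ) : Set ℚ_[p] := {x | ∃ y ∈ Pset p n, x = μ * y}

/-- A (globally) subanalytic subset of `ℚ_p^m`: a finite union of finite intersections of
sets of the form `{x | f x = 0}` and `{x | f x ∈ P_n}`, `f` a `D`-function, `n > 0`. -/
def IsSubanalytic {m : ℕ} (X : Set (Fin m → ℚ_[p])) : Prop :=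
  ∃ (r s : ℕ) (F : Fin r → Fin s → Set (Fin m → ℚ_[p])),
    (∀ i j, (∃ f, IsDFunction p f ∧ F i j = {x | f x = 0}) ∨
            (∃ f n, IsDFunction p f ∧ 0 < n ∧ F i j = {x | f x ∈ Pset p n})) ∧
    X = ⋃ i, ⋂ j, F i j

/-- A semialgebraic subset of `ℚ_p^m`: a finite union of finite intersections of
sets of the form `{x | f x = 0}` and `{x | f x ∈ P_n}`, `f` a polynomial, `n > 0`. -/
def IsSemialgebraic {m : ℕ} (X : Set (Fin m → ℚ_[p])) : Prop :=
  ∃ (r s : ℕ) (F : Fin r → Fin s → Set (Fin m → ℚ_[p])),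
    (∀ i j, (∃ f : MvPolynomial (Fin m) ℚ_[p], F i j = {x | MvPolynomial.eval x f = 0}) ∨
            (∃ (f : MvPolynomial (Fin m) ℚ_[p]) (n : ℕ), 0 < n ∧
              F i j = {x | MvPolynomial.eval x f ∈ Pset p n})) ∧
    X = ⋃ i, ⋂ j, F i j

/-- The graph of the restriction to `X` of a map `ℚ_p^m → ℚ_p^n`, inside `ℚ_p^(m+n)`. -/
def graphMap {m n : ℕ} (X : Set (Fin m → ℚ_[p])) (F : (Fin m → ℚ_[p]) → (Fin n → ℚ_[p])) :
    Set (Fin (m + n) → ℚ_[p]) :=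
  {z | (fun i => z (Fin.castAdd n i)) ∈ X ∧
    F (fun i => z (Fin.castAdd n i)) = fun j => z (Fin.natAdd m j)}

/-- The graph of the restriction to `X` of a function `ℚ_p^m → ℚ_p`, inside `ℚ_p^(m+1)`. -/
def graphFun {m : ℕ} (X : Set (Fin m → ℚ_[p])) (f : (Fin m → ℚ_[p]) → ℚ_[p]) :
    Set (Fin (m + 1) → ℚ_[p]) :=
  {z | (fun i : Fin m => z i.castSucc) ∈ X ∧ f (fun i : Fin m => z i.castSucc) = z (Fin.last m)}

/-- A function `ℚ_p^m → ℚ_p` is subanalytic on `X` if its graph over `X` is subanalytic. -/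
def IsSubanalyticFnOn {m : ℕ} (X : Set (Fin m → ℚ_[p])) (f : (Fin m → ℚ_[p]) → ℚ_[p]) : Prop :=
  IsSubanalytic p (graphFun p X f)

/-- A (totally defined) subanalytic function `ℚ_p^m → ℚ_p`. -/
def IsSubanalyticFn {m : ℕ} (f : (Fin m → ℚ_[p]) → ℚ_[p]) : Prop :=
  IsSubanalyticFnOn p Set.univ f

/-- A function `ℚ_p^m → ℚ_p` is semialgebraic on `X` if its graph over `X` is
semialgebraic. -/
def IsSemialgebraicFnOn {m : ℕ} (X : Set (Fin m → ℚ_[p])) (f : (Fin m → ℚ_[p]) → ℚ_[p]) :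
    Prop :=
  IsSemialgebraic p (graphFun p X f)

/-- A subanalytic subset of `ℚ_p` (one-variable version). -/
def IsSubanalytic1 (X : Set ℚ_[p]) : Prop :=
  IsSubanalytic p {z : Fin 1 → ℚ_[p] | z 0 ∈ X}

/-- A semialgebraic subset of `ℚ_p` (one-variable version). -/
def IsSemialgebraic1 (X : Set ℚ_[p]) : Prop :=
  IsSemialgebraic p {z : Fin 1 → ℚ_[p] | z 0 ∈ X}

/-- A function `ℚ_p → ℚ_p` subanalytic on `X ⊆ ℚ_p`: its graph over `X` is a subanalytic
subset of `ℚ_p²`. -/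
def IsSubanalyticFnOn1 (X : Set ℚ_[p]) (f : ℚ_[p] → ℚ_[p]) : Prop :=
  IsSubanalytic p {z : Fin 2 → ℚ_[p] | z 0 ∈ X ∧ f (z 0) = z 1}

/-- A function `ℚ_p → ℚ_p` semialgebraic on `X ⊆ ℚ_p`: its graph over `X` is a
semialgebraic subset of `ℚ_p²`. -/
def IsSemialgebraicFnOn1 (X : Set ℚ_[p]) (f : ℚ_[p] → ℚ_[p]) : Prop :=
  IsSemialgebraic p {z : Fin 2 → ℚ_[p] | z 0 ∈ X ∧ f (z 0) = z 1}

/-- Interpretation of the symbols `□ᵢ` in the definition of cells: `true` means `<` and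
`false` means "no condition". -/
def sqRel (b : Bool) (x y : ℝ) : Prop := b = true → x < y

/-- A cell in `ℚ_p`, presented with its center `γ` and coset data `μ`, `n`. -/
def IsCell1 (A : Set ℚ_[p]) (γ μ : ℚ_[p]) (n : ℕ) : Prop :=
  0 < n ∧ A.Nonempty ∧
  ∃ (α β : ℚ_[p]) (b₁ b₂ : Bool), α ≠ 0 ∧ β ≠ 0 ∧
    A = {t | sqRel b₁ ‖α‖ ‖t - γ‖ ∧ sqRel b₂ ‖t - γ‖ ‖β‖ ∧ t - γ ∈ cosetP p μ n}

/-- Subanalytic cells in `ℚ_p^(m+1)`, defined inductively, presented with their center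
`γ : ℚ_p^m → ℚ_p` and coset data `μ`, `n`.  The projection of the cell onto the first `m`
coordinates is required to be a cell. -/
inductive IsCell : {m : ℕ} → Set (Fin (m + 1) → ℚ_[p]) →
    ((Fin m → ℚ_[p]) → ℚ_[p]) → ℚ_[p] → ℕ → Prop where
  | base (n : ℕ) (hn : 0 < n) (μ γ0 α β : ℚ_[p]) (hα : α ≠ 0) (hβ : β ≠ 0)
      (b₁ b₂ : Bool) (A : Set (Fin 1 → ℚ_[p])) (hne : A.Nonempty)
      (hA : A = {z | sqRel b₁ ‖α‖ ‖z 0 - γ0‖ ∧ sqRel b₂ ‖z 0 - γ0‖ ‖β‖ ∧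
        z 0 - γ0 ∈ cosetP p μ n}) :
      IsCell A (fun _ => γ0) μ n
  | succ {m : ℕ} {D : Set (Fin (m + 1) → ℚ_[p])} {γD : (Fin m → ℚ_[p]) → ℚ_[p]}
      {μD : ℚ_[p]} {nD : ℕ} (hD : IsCell D γD μD nD)
      (n : ℕ) (hn : 0 < n) (μ : ℚ_[p]) (α β γ : (Fin (m + 1) → ℚ_[p]) → ℚ_[p])
      (hα : IsSubanalyticFn p α) (hβ : IsSubanalyticFn p β) (hγ : IsSubanalyticFn p γ)
      (hα0 : ∀ x, α x ≠ 0) (hβ0 : ∀ x, β x ≠ 0)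
      (b₁ b₂ : Bool) (A : Set (Fin (m + 2) → ℚ_[p]))
      (hA : A = {z | (fun i : Fin (m + 1) => z i.castSucc) ∈ D ∧
          sqRel b₁ ‖α (fun i : Fin (m + 1) => z i.castSucc)‖
            ‖z (Fin.last (m + 1)) - γ (fun i : Fin (m + 1) => z i.castSucc)‖ ∧
          sqRel b₂ ‖z (Fin.last (m + 1)) - γ (fun i : Fin (m + 1) => z i.castSucc)‖
            ‖β (fun i : Fin (m + 1) => z i.castSucc)‖ ∧
          z (Fin.last (m + 1)) - γ (fun i : Fin (m + 1) => z i.castSucc) ∈ cosetP p μ n})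
      (hproj : (fun (z : Fin (m + 2) → ℚ_[p]) (i : Fin (m + 1)) => z i.castSucc) '' A = D) :
      IsCell A γ μ n

/-- Analytic cells in `ℚ_p^(m+1)`: as subanalytic cells, but at each stage of the inductive
definition the functions `α`, `β`, `γ` are moreover analytic on the projection of the cell. -/
inductive IsAnalyticCell : {m : ℕ} → Set (Fin (m + 1) → ℚ_[p]) →
    ((Fin m → ℚ_[p]) → ℚ_[p]) → ℚ_[p] → ℕ → Prop where
  | base (n : ℕ) (hn : 0 < n) (μ γ0 α β : ℚ_[p]) (hα : α ≠ 0) (hβ : β ≠ 0)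
      (b₁ b₂ : Bool) (A : Set (Fin 1 → ℚ_[p])) (hne : A.Nonempty)
      (hA : A = {z | sqRel b₁ ‖α‖ ‖z 0 - γ0‖ ∧ sqRel b₂ ‖z 0 - γ0‖ ‖β‖ ∧
        z 0 - γ0 ∈ cosetP p μ n}) :
      IsAnalyticCell A (fun _ => γ0) μ n
  | succ {m : ℕ} {D : Set (Fin (m + 1) → ℚ_[p])} {γD : (Fin m → ℚ_[p]) → ℚ_[p]}
      {μD : ℚ_[p]} {nD : ℕ} (hD : IsAnalyticCell D γD μD nD)
      (n : ℕ) (hn : 0 < n) (μ : ℚ_[p]) (α β γ : (Fin (m + 1) → ℚ_[p]) → ℚ_[p])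
      (hα : IsSubanalyticFn p α) (hβ : IsSubanalyticFn p β) (hγ : IsSubanalyticFn p γ)
      (hαan : AnalyticOn ℚ_[p] α D) (hβan : AnalyticOn ℚ_[p] β D)
      (hγan : AnalyticOn ℚ_[p] γ D)
      (hα0 : ∀ x, α x ≠ 0) (hβ0 : ∀ x, β x ≠ 0)
      (b₁ b₂ : Bool) (A : Set (Fin (m + 2) → ℚ_[p]))
      (hA : A = {z | (fun i : Fin (m + 1) => z i.castSucc) ∈ D ∧
          sqRel b₁ ‖α (fun i : Fin (m + 1) => z i.castSucc)‖
            ‖z (Fin.last (m + 1)) - γ (fun i : Fin (m + 1) => z i.castSucc)‖ ∧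
          sqRel b₂ ‖z (Fin.last (m + 1)) - γ (fun i : Fin (m + 1) => z i.castSucc)‖
            ‖β (fun i : Fin (m + 1) => z i.castSucc)‖ ∧
          z (Fin.last (m + 1)) - γ (fun i : Fin (m + 1) => z i.castSucc) ∈ cosetP p μ n})
      (hproj : (fun (z : Fin (m + 2) → ℚ_[p]) (i : Fin (m + 1)) => z i.castSucc) '' A = D) :
      IsAnalyticCell A γ μ n

/-- Generators of the algebra of subanalytic constructible functions on `ℚ_p^m`:
`ℤ`-valued valuations of nonvanishing subanalytic functions, and (`ℚ`-valued) norms of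
subanalytic functions. -/
def constructibleGens (m : ℕ) : Set ((Fin m → ℚ_[p]) → ℚ) :=
  {g | ∃ h : (Fin m → ℚ_[p]) → ℚ_[p], IsSubanalyticFn p h ∧ (∀ x, h x ≠ 0) ∧
        g = fun x => ((h x).valuation : ℚ)} ∪
  {g | ∃ h : (Fin m → ℚ_[p]) → ℚ_[p], IsSubanalyticFn p h ∧
        g = fun x => (padicNormE (h x) : ℚ)}

/-- The `ℚ`-algebra `C(ℚ_p^m)` of subanalytic constructible functions on `ℚ_p^m`. -/
noncomputable def ConstructibleAlg (m : ℕ) : Subalgebra ℚ ((Fin m → ℚ_[p]) → ℚ) :=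
  Algebra.adjoin ℚ (constructibleGens p m)

/-- `ℤ_p^m` as a subset of `ℚ_p^m`. -/
def ZpSet (m : ℕ) : Set (Fin m → ℚ_[p]) := {x | ∀ j, ‖x j‖ ≤ 1}

/-- A simple subset of `ℤ^n × ℚ_p^m`. -/
def IsSimpleSet (n m : ℕ) (A : Set ((Fin n → ℤ) × (Fin m → ℚ_[p]))) : Prop :=
  IsSubanalytic p {z : Fin (n + m) → ℚ_[p] |
    (∀ i : Fin n, z (Fin.castAdd m i) ≠ 0) ∧
    ((fun i : Fin n => (z (Fin.castAdd m i)).valuation),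
      fun j : Fin m => z (Fin.natAdd n j)) ∈ A}

/-- A simple function `ℤ^n × ℚ_p^m → ℤ`: one whose graph is a simple set. -/
def IsSimpleFn (n m : ℕ) (h : (Fin n → ℤ) × (Fin m → ℚ_[p]) → ℤ) : Prop :=
  IsSimpleSet p (n + 1) m
    {w | w.1 (Fin.last n) = h (fun i : Fin n => w.1 i.castSucc, w.2)}

/-- Generators of `C_simple(ℤ^n × ℚ_p^m)`: simple functions, and `p^h` for `h` simple. -/
def simpleGens (n m : ℕ) : Set ((Fin n → ℤ) × (Fin m → ℚ_[p]) → ℚ) :=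
  {g | ∃ h, IsSimpleFn p n m h ∧ g = fun w => (h w : ℚ)} ∪
  {g | ∃ h, IsSimpleFn p n m h ∧ g = fun w => (p : ℚ) ^ (h w)}

/-- The `ℚ`-algebra `C_simple(ℤ^n × ℚ_p^m)`. -/
noncomputable def SimpleAlg (n m : ℕ) : Subalgebra ℚ ((Fin n → ℤ) × (Fin m → ℚ_[p]) → ℚ) :=
  Algebra.adjoin ℚ (simpleGens p n m)

noncomputable instance : MeasurableSpace ℚ_[p] := borel _
instance : BorelSpace ℚ_[p] := ⟨rfl⟩

end PadicSub

section Part0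

end Part0


section Part1
open PadicSub

namespace PSub

variable {p : ℕ} [hp : Fact p.Prime]

/-! ### Powers and norms -/

theorem norm_eq_zpow (x : ℚ_[p]) (hx : x ≠ 0) : ∃ z : ℤ, ‖x‖ = (p : ℝ) ^ z :=
  ⟨-x.valuation, Padic.norm_eq_zpow_neg_valuation hx⟩

theorem one_lt_p : (1 : ℝ) < p := by exact_mod_cast hp.out.one_lt

theorem norm_p_lt : ‖(p : ℚ_[p])‖ < 1 := Padic.norm_p_lt_one

theorem norm_p_pos : 0 < ‖(p : ℚ_[p])‖ := by
  rw [norm_pos_iff]; exact_mod_cast hp.out.ne_zero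

theorem p_ne : (p : ℚ_[p]) ≠ 0 := by exact_mod_cast hp.out.ne_zero

theorem add_le_of {a b : ℚ_[p]} {r : ℝ} (ha : ‖a‖ ≤ r) (hb : ‖b‖ ≤ r) : ‖a + b‖ ≤ r :=
  (Padic.nonarchimedean a b).trans (max_le ha hb)

theorem sub_le_of {a b : ℚ_[p]} {r : ℝ} (ha : ‖a‖ ≤ r) (hb : ‖b‖ ≤ r) : ‖a - b‖ ≤ r := by
  rw [sub_eq_add_neg]; exact add_le_of ha (by rwa [norm_neg])

theorem add_lt_of {a b : ℚ_[p]} {r : ℝ} (ha : ‖a‖ < r) (hb : ‖b‖ < r) : ‖a + b‖ < r :=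
  (Padic.nonarchimedean a b).trans_lt (max_lt ha hb)

theorem sub_lt_of {a b : ℚ_[p]} {r : ℝ} (ha : ‖a‖ < r) (hb : ‖b‖ < r) : ‖a - b‖ < r := by
  rw [sub_eq_add_neg]; exact add_lt_of ha (by rwa [norm_neg])

theorem sum_le_of {α : Type*} (s : Finset α) (f : α → ℚ_[p]) {r : ℝ} (hr : 0 ≤ r)
    (h : ∀ i ∈ s, ‖f i‖ ≤ r) : ‖∑ i ∈ s, f i‖ ≤ r := by
  classical
  induction s using Finset.induction_on with
  | empty => simpa
  | insert a s ha ih =>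
    rw [Finset.sum_insert ha]
    exact add_le_of (h a (by simp)) (ih fun i hi => h i (by simp [hi]))

theorem sum_lt_of {α : Type*} (s : Finset α) (f : α → ℚ_[p]) {r : ℝ} (hr : 0 < r)
    (h : ∀ i ∈ s, ‖f i‖ < r) : ‖∑ i ∈ s, f i‖ < r := by
  classical
  induction s using Finset.induction_on with
  | empty => simpa
  | insert a s ha ih =>
    rw [Finset.sum_insert ha]
    exact add_lt_of (h a (by simp)) (ih fun i hi => h i (by simp [hi]))

/-- If `a` is strictly closer to `b` than the size of `b`, the norms agree. -/
theorem norm_eq_of_sub_lt {a b : ℚ_[p]} (h : ‖a - b‖ < ‖b‖) : ‖a‖ = ‖b‖ := by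
  apply le_antisymm
  · have : a = (a - b) + b := by ring
    rw [this]; exact add_le_of h.le le_rfl
  · by_contra hlt
    push Not at hlt
    have : b = a - (a - b) := by ring
    have h2 : ‖b‖ < ‖b‖ := by
      conv_lhs => rw [this]
      exact sub_lt_of hlt h
    exact lt_irrefl _ h2

theorem norm_eq_of_sub_lt' {a b : ℚ_[p]} (h : ‖a - b‖ < ‖a‖) : ‖a‖ = ‖b‖ :=
  (norm_eq_of_sub_lt (by rwa [norm_sub_rev])).symm

theorem norm_eq_of_sub_le {a b : ℚ_[p]} {ε : ℝ} (hε : ε < 1) (h : ‖a - b‖ ≤ ε * ‖b‖) :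
    ‖a‖ = ‖b‖ := by
  by_cases hb : b = 0
  · subst hb; simp at h; simp [h]
  · apply norm_eq_of_sub_lt
    have : 0 < ‖b‖ := norm_pos_iff.2 hb
    nlinarith

theorem Pset_ne {n : ℕ} {x : ℚ_[p]} (h : x ∈ Pset p n) : x ≠ 0 := by
  obtain ⟨y, hy, rfl⟩ := h; exact pow_ne_zero _ hy

theorem Pset_mul {n : ℕ} {x y : ℚ_[p]} (hx : x ∈ Pset p n) (hy : y ∈ Pset p n) :
    x * y ∈ Pset p n := by
  obtain ⟨a, ha, rfl⟩ := hx
  obtain ⟨b, hb, rfl⟩ := hy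
  exact ⟨a * b, mul_ne_zero ha hb, mul_pow _ _ _⟩

theorem Pset_pow {n : ℕ} {x : ℚ_[p]} (hx : x ≠ 0) : x ^ n ∈ Pset p n := ⟨x, hx, rfl⟩

theorem Pset_inv {n : ℕ} {x : ℚ_[p]} (hx : x ∈ Pset p n) : x⁻¹ ∈ Pset p n := by
  obtain ⟨a, ha, rfl⟩ := hx
  exact ⟨a⁻¹, inv_ne_zero ha, inv_pow _ _⟩

theorem Pset_mul_iff {n : ℕ} {x y : ℚ_[p]} (hy : y ∈ Pset p n) :
    x * y ∈ Pset p n ↔ x ∈ Pset p n := by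
  constructor
  · intro h
    have := Pset_mul h (Pset_inv hy)
    rwa [mul_inv_cancel_right₀ (Pset_ne hy)] at this
  · intro h; exact Pset_mul h hy

theorem Pset_near_aux (n : ℕ) (x : ℚ_[p]) (h : ‖x - 1‖ < ‖(n : ℚ_[p])‖ ^ 2) :
    x ∈ Pset p n := by
  have hn1 : ‖(n : ℚ_[p])‖ ≤ 1 := by
    exact_mod_cast Padic.norm_int_le_one (p := p) (n : ℤ)
  have hn0 : 0 ≤ ‖(n : ℚ_[p])‖ := norm_nonneg _
  have hx1 : ‖x - 1‖ < 1 := by nlinarith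
  have hx : ‖x‖ = 1 := by
    have := norm_eq_of_sub_lt (a := x) (b := 1) (by simpa using hx1)
    simpa using this
  let X : ℤ_[p] := ⟨x, hx.le⟩
  let F : Polynomial ℤ_[p] := Polynomial.X ^ n - Polynomial.C X
  have hF : ∀ a : ℤ_[p], F.aeval a = a ^ n - X := by intro a; simp [F]
  have hF2 : F.derivative.aeval (1 : ℤ_[p]) = (n : ℤ_[p]) := by
    simp [F, Polynomial.derivative_X_pow]
  have hcond : ‖F.aeval (1 : ℤ_[p])‖ < ‖F.derivative.aeval (1 : ℤ_[p])‖ ^ 2 := by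
    rw [hF, hF2]
    rw [PadicInt.norm_def, PadicInt.norm_def]
    push_cast
    rw [one_pow, norm_sub_rev]; exact h
  obtain ⟨z, hz, -⟩ := hensels_lemma hcond
  rw [hF] at hz
  have hz2 : (z : ℚ_[p]) ^ n = x := by
    have := congrArg (fun t : ℤ_[p] => (t : ℚ_[p])) (sub_eq_zero.1 hz)
    simpa [X] using this
  by_cases hn : n = 0
  · subst hn
    simp at h
    exact absurd h (not_lt.2 (norm_nonneg _))
  refine ⟨z, ?_, hz2⟩
  rintro h0
  rw [h0, zero_pow hn] at hz2
  rw [← hz2] at hx; simp at hx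

theorem Pset_near (n : ℕ) (hn : 0 < n) :
    ∃ η : ℝ, 0 < η ∧ η < 1 ∧ ∀ x : ℚ_[p], ‖x - 1‖ ≤ η → x ∈ Pset p n := by
  have hn0 : 0 < ‖(n : ℚ_[p])‖ := by
    rw [norm_pos_iff]; exact_mod_cast hn.ne'
  have hn1 : ‖(n : ℚ_[p])‖ ≤ 1 := by
    exact_mod_cast Padic.norm_int_le_one (p := p) (n : ℤ)
  refine ⟨‖(n : ℚ_[p])‖ ^ 2 / 2, by positivity, by nlinarith, fun x hx => ?_⟩
  apply Pset_near_aux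
  have : 0 < ‖(n : ℚ_[p])‖ ^ 2 := by positivity
  linarith

theorem Pset_close (n : ℕ) (hn : 0 < n) :
    ∃ η : ℝ, 0 < η ∧ η < 1 ∧ ∀ a b : ℚ_[p], ‖a - b‖ ≤ η * ‖b‖ →
      (a ∈ Pset p n ↔ b ∈ Pset p n) := by
  obtain ⟨η, h0, h1, h⟩ := Pset_near (p := p) n hn
  refine ⟨η, h0, h1, fun a b hab => ?_⟩
  by_cases hb : b = 0
  · subst hb
    have : a = 0 := by simpa using hab
    rw [this]
  · have h2 : a / b ∈ Pset p n := by
      apply h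
      rw [show a / b - 1 = (a - b) / b by field_simp, norm_div,
        div_le_iff₀ (norm_pos_iff.2 hb)]
      exact hab
    have := Pset_mul_iff (x := b) h2
    rw [mul_div_cancel₀ _ hb] at this
    exact this

theorem norm_le_iff (a b : ℚ_[p]) :
    ‖a‖ ≤ ‖b‖ ↔ (a = 0 ∧ b = 0) ∨ b ^ (p + 1) + p * a ^ (p + 1) ∈ Pset p (p + 1) := by
  have hp1 : ‖((p + 1 : ℕ) : ℚ_[p])‖ = 1 := by
    have : ‖((p + 1 : ℕ) : ℚ_[p]) - 1‖ < ‖(1 : ℚ_[p])‖ := by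
      push_cast; rw [add_sub_cancel_right, norm_one]; exact norm_p_lt
    rw [norm_eq_of_sub_lt this, norm_one]
  constructor
  · intro h
    by_cases hb : b = 0
    · left; subst hb; simpa using h
    · right
      have : b ^ (p + 1) + p * a ^ (p + 1) = (1 + p * (a / b) ^ (p + 1)) * b ^ (p + 1) := by
        rw [div_pow]
        have := pow_ne_zero (p + 1) hb
        field_simp
      rw [this, Pset_mul_iff (Pset_pow hb)]
      apply Pset_near_aux
      rw [hp1, add_sub_cancel_left, norm_mul, norm_pow, norm_div]
      have h1 : ‖a‖ / ‖b‖ ≤ 1 := div_le_one_of_le₀ h (norm_nonneg _)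
      have h2 : (‖a‖ / ‖b‖) ^ (p + 1) ≤ 1 := pow_le_one₀ (by positivity) h1
      have := norm_p_lt (p := p)
      have := norm_p_pos (p := p)
      nlinarith
  · rintro (⟨rfl, rfl⟩ | ⟨y, hy, h⟩)
    · simp
    by_contra hlt
    push Not at hlt
    have ha : a ≠ 0 := by rintro rfl; simp at hlt; exact absurd hlt (not_lt.2 (norm_nonneg _))
    have hn : ‖b ^ (p + 1)‖ < ‖p * a ^ (p + 1)‖ := by
      by_cases hb : b = 0
      · subst hb
        rw [zero_pow (by lia), norm_zero, norm_pos_iff]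
        exact mul_ne_zero p_ne (pow_ne_zero _ ha)
      obtain ⟨z, hz⟩ := norm_eq_zpow a ha
      obtain ⟨w, hw⟩ := norm_eq_zpow b hb
      rw [norm_mul, norm_pow, norm_pow, hz, hw, Padic.norm_p, ← zpow_natCast, ← zpow_mul,
        ← zpow_natCast, ← zpow_mul, ← zpow_neg_one, ← zpow_add₀ (by linarith [one_lt_p (p := p)])]
      rw [hz, hw, zpow_lt_zpow_iff_right₀ one_lt_p] at hlt
      rw [zpow_lt_zpow_iff_right₀ one_lt_p]
      push_cast
      have : (2 : ℤ) ≤ p := by exact_mod_cast hp.out.two_le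
      nlinarith
    have hy2 : ‖y ^ (p + 1)‖ = ‖p * a ^ (p + 1)‖ := by
      rw [h]
      apply norm_eq_of_sub_lt
      rwa [add_sub_cancel_right]
    obtain ⟨z, hz⟩ := norm_eq_zpow a ha
    obtain ⟨w, hw⟩ := norm_eq_zpow y hy
    rw [norm_mul, norm_pow, norm_pow, hz, hw, Padic.norm_p, ← zpow_natCast, ← zpow_mul,
        ← zpow_natCast, ← zpow_mul, ← zpow_neg_one, ← zpow_add₀ (by linarith [one_lt_p (p := p)])]
      at hy2
    have h3 := (zpow_right_injective₀ (by linarith [one_lt_p (p := p)])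
      (by linarith [one_lt_p (p := p)] : (p : ℝ) ≠ 1)) hy2
    have h4 : ((p + 1 : ℕ) : ℤ) ∣ 1 := ⟨z - w, by push_cast at h3 ⊢; linarith⟩
    have h5 : (p + 1 : ℕ) ∣ 1 := by exact_mod_cast h4
    have := Nat.le_of_dvd one_pos h5
    have := hp.out.two_le
    lia

theorem round_eps (ε : ℝ) (hε : 0 ≤ ε) :
    ∃ c : ℚ_[p], ∀ a b : ℚ_[p], ‖a‖ ≤ ε * ‖b‖ ↔ ‖a‖ ≤ ‖c * b‖ := by
  rcases hε.eq_or_lt with rfl | hε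
  · exact ⟨0, fun a b => by simp⟩
  obtain ⟨k, hk1, hk2⟩ := exists_mem_Ico_zpow hε (one_lt_p (p := p))
  refine ⟨(p : ℚ_[p]) ^ (-k), fun a b => ?_⟩
  have hn : ‖(p : ℚ_[p]) ^ (-k)‖ = (p : ℝ) ^ k := by
    rw [Padic.norm_p_zpow, neg_neg]
  rw [norm_mul, hn]
  constructor
  · intro h
    by_cases hb : b = 0
    · subst hb; simpa using h
    by_cases ha : a = 0
    · subst ha; simp; positivity
    have hb' : 0 < ‖b‖ := norm_pos_iff.2 hb
    obtain ⟨z, hz⟩ := norm_eq_zpow (a / b) (div_ne_zero ha hb)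
    rw [norm_div] at hz
    rw [← div_le_iff₀ hb', hz] at h ⊢
    have : (p : ℝ) ^ z < (p : ℝ) ^ (k + 1) := h.trans_lt hk2
    rw [zpow_lt_zpow_iff_right₀ one_lt_p] at this
    rw [zpow_le_zpow_iff_right₀ one_lt_p]
    lia
  · intro h
    exact h.trans (mul_le_mul_of_nonneg_right hk1 (norm_nonneg _))

/-- A finite net in the unit sphere. -/
theorem unit_net (ε : ℝ) (hε : 0 < ε) :
    ∃ Θ : Finset ℚ_[p], (∀ θ ∈ Θ, ‖θ‖ = 1) ∧
      ∀ u : ℚ_[p], ‖u‖ = 1 → ∃ θ ∈ Θ, ‖u - θ‖ ≤ ε := by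
  have hc : IsCompact (Metric.sphere (0 : ℚ_[p]) 1) := isCompact_sphere _ _
  obtain ⟨t, ht, htf, hcov⟩ := hc.finite_cover_balls hε
  refine ⟨htf.toFinset, fun θ hθ => ?_, fun u hu => ?_⟩
  · have := ht ((Set.Finite.mem_toFinset _).1 hθ); simpa using this
  · have := hcov (show u ∈ Metric.sphere (0 : ℚ_[p]) 1 by simpa using hu)
    simp only [Set.mem_iUnion, Metric.mem_ball, exists_prop] at this
    obtain ⟨θ, hθ, h⟩ := this
    exact ⟨θ, by simpa using hθ, by rw [← dist_eq_norm]; exact h.le⟩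

/-- Finitely many cosets of `n`-th powers. -/
theorem coset_reps (n : ℕ) (hn : 0 < n) :
    ∃ Λ : Finset ℚ_[p], (∀ l ∈ Λ, l ≠ 0) ∧
      ∀ x : ℚ_[p], x ≠ 0 → ∃ l ∈ Λ, x / l ∈ Pset p n := by
  classical
  obtain ⟨η, h0, h1, h⟩ := Pset_near (p := p) n hn
  obtain ⟨Θ, hΘ, hcov⟩ := unit_net (p := p) η h0
  refine ⟨(Finset.range n ×ˢ Θ).image (fun q => (p : ℚ_[p]) ^ (q.1) * q.2), ?_, ?_⟩
  · intro l hl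
    simp only [Finset.mem_image, Finset.mem_product] at hl
    obtain ⟨q, ⟨-, hq⟩, rfl⟩ := hl
    refine mul_ne_zero (pow_ne_zero _ p_ne) ?_
    intro h; have := hΘ _ hq; rw [h] at this; simp at this
  · intro x hx
    obtain ⟨z, hz⟩ := norm_eq_zpow x hx
    have hn' : (0 : ℤ) < n := by exact_mod_cast hn
    have hr := Int.emod_nonneg (-z) hn'.ne'
    have hr2 := Int.emod_lt_of_pos (-z) hn'
    set i := ((-z) % n).toNat with hi
    have hiz : (i : ℤ) = (-z) % n := Int.toNat_of_nonneg hr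
    have hdm : -z = i + n * ((-z) / n) := by
      rw [hiz]; exact (Int.emod_add_mul_ediv (-z) n).symm
    set u := x * (p : ℚ_[p]) ^ z with hu
    have hun : ‖u‖ = 1 := by
      rw [hu, norm_mul, hz, Padic.norm_p_zpow, ← zpow_add₀ (by linarith [one_lt_p (p := p)])]
      simp
    obtain ⟨θ, hθ, hcl⟩ := hcov u hun
    have hθ0 : θ ≠ 0 := by intro h; have := hΘ _ hθ; rw [h] at this; simp at this
    refine ⟨(p : ℚ_[p]) ^ i * θ, Finset.mem_image.2 ⟨(i, θ), ?_, rfl⟩, ?_⟩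
    · simp only [Finset.mem_product, Finset.mem_range]
      exact ⟨by lia, hθ⟩
    · have hx' : x = u * (p : ℚ_[p]) ^ (-z) := by
        rw [hu, mul_assoc, ← zpow_add₀ p_ne]; simp
      have hP : u / θ ∈ Pset p n := by
        apply h
        rw [show u / θ - 1 = (u - θ) / θ by field_simp, norm_div, hΘ _ hθ, div_one]
        exact hcl
      have h3 : x / ((p : ℚ_[p]) ^ i * θ) = (u / θ) * ((p : ℚ_[p]) ^ ((-z) / n)) ^ n := by
        rw [hx']
        conv_lhs => rw [hdm]
        rw [zpow_add₀ p_ne, zpow_natCast, mul_comm (n : ℤ), zpow_mul, zpow_natCast]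
        have := pow_ne_zero i (p_ne (p := p))
        field_simp
      rw [h3]
      exact Pset_mul hP (Pset_pow (zpow_ne_zero _ p_ne))

end PSub
end Part1


section Part2
open PadicSub

namespace PSub

variable {p : ℕ} [hp : Fact p.Prime]

/-! ### Semialgebraic sets over arbitrary index types -/

inductive SA {ι : Type} : Set (ι → ℚ_[p]) → Prop
  | zero (q : MvPolynomial ι ℚ_[p]) : SA {y | MvPolynomial.eval y q = 0}
  | pow (q : MvPolynomial ι ℚ_[p]) (n : ℕ) (hn : 0 < n) :
      SA {y | MvPolynomial.eval y q ∈ Pset p n}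
  | compl (A : Set (ι → ℚ_[p])) : SA A → SA Aᶜ
  | inter (A B : Set (ι → ℚ_[p])) : SA A → SA B → SA (A ∩ B)

variable {ι κ : Type}

theorem SA.union {A B : Set (ι → ℚ_[p])} (hA : SA A) (hB : SA B) : SA (A ∪ B) := by
  have := SA.compl _ (SA.inter _ _ (SA.compl _ hA) (SA.compl _ hB))
  rwa [← Set.compl_union, compl_compl] at this

theorem SA.diff {A B : Set (ι → ℚ_[p])} (hA : SA A) (hB : SA B) : SA (A \ B) :=
  SA.inter _ _ hA (SA.compl _ hB)

theorem SA.univ : SA (Set.univ : Set (ι → ℚ_[p])) := by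
  have := SA.zero (p := p) (ι := ι) 0
  simpa using this

theorem SA.empty : SA (∅ : Set (ι → ℚ_[p])) := by
  have := SA.compl _ (SA.univ (p := p) (ι := ι))
  simpa using this

theorem SA.const (P : Prop) : SA {_y : ι → ℚ_[p] | P} := by
  by_cases h : P
  · simp only [h, Set.ofPred_true]; exact SA.univ
  · simp only [h, Set.ofPred_false]; exact SA.empty

theorem SA.and {P Q : (ι → ℚ_[p]) → Prop} (hP : SA {y | P y}) (hQ : SA {y | Q y}) :
    SA {y | P y ∧ Q y} := SA.inter _ _ hP hQ

theorem SA.or {P Q : (ι → ℚ_[p]) → Prop} (hP : SA {y | P y}) (hQ : SA {y | Q y}) :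
    SA {y | P y ∨ Q y} := SA.union hP hQ

theorem SA.not {P : (ι → ℚ_[p]) → Prop} (hP : SA {y | P y}) :
    SA {y | ¬ P y} := SA.compl _ hP

theorem SA.finset_all {α : Type*} (s : Finset α) {P : α → (ι → ℚ_[p]) → Prop}
    (h : ∀ i ∈ s, SA {y | P i y}) : SA {y | ∀ i ∈ s, P i y} := by
  classical
  induction s using Finset.induction_on with
  | empty => simpa using SA.univ
  | insert a s ha ih =>
    have := SA.and (h a (by simp)) (ih fun i hi => h i (by simp [hi]))
    convert this using 2
    ext y; simp

theorem SA.finset_ex {α : Type*} (s : Finset α) {P : α → (ι → ℚ_[p]) → Prop}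
    (h : ∀ i ∈ s, SA {y | P i y}) : SA {y | ∃ i ∈ s, P i y} := by
  have := SA.not (SA.finset_all s (P := fun i y => ¬ P i y) fun i hi => SA.not (h i hi))
  convert this using 2
  ext y; simp

theorem SA.all {α : Type*} [Finite α] {P : α → (ι → ℚ_[p]) → Prop}
    (h : ∀ i, SA {y | P i y}) : SA {y | ∀ i, P i y} := by
  cases nonempty_fintype α
  have := SA.finset_all Finset.univ (P := P) fun i _ => h i
  simpa using this

theorem SA.ex {α : Type*} [Finite α] {P : α → (ι → ℚ_[p]) → Prop}
    (h : ∀ i, SA {y | P i y}) : SA {y | ∃ i, P i y} := by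
  cases nonempty_fintype α
  have := SA.finset_ex Finset.univ (P := P) fun i _ => h i
  simpa using this

theorem SA.preimage {Y : Set (ι → ℚ_[p])} (hY : SA Y) (q : ι → MvPolynomial κ ℚ_[p]) :
    SA {w | (fun i => MvPolynomial.eval w (q i)) ∈ Y} := by
  have key : ∀ (f : MvPolynomial ι ℚ_[p]) (w : κ → ℚ_[p]),
      MvPolynomial.eval (fun i => MvPolynomial.eval w (q i)) f
        = MvPolynomial.eval w (MvPolynomial.bind₁ q f) := by
    intro f w
    induction f using MvPolynomial.induction_on with
    | C a => simp
    | add f g hf hg => simp only [map_add, hf, hg]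
    | mul_X f k hf => simp only [map_mul, hf, MvPolynomial.eval_X, MvPolynomial.bind₁_X_right]
  induction hY with
  | zero f => simp only [Set.mem_ofPred_eq, key]; exact SA.zero _
  | pow f n hn => simp only [Set.mem_ofPred_eq, key]; exact SA.pow _ _ hn
  | compl A _ ih => exact SA.compl _ ih
  | inter A B _ _ ihA ihB => exact SA.inter _ _ ihA ihB

theorem SA.reindex {Y : Set (ι → ℚ_[p])} (hY : SA Y) (σ : ι → κ) :
    SA {w : κ → ℚ_[p] | (fun i => w (σ i)) ∈ Y} := by
  have := hY.preimage (fun i => (MvPolynomial.X (σ i) : MvPolynomial κ ℚ_[p]))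
  simpa using this

/-- The torus. -/
def tor (y : ι → ℚ_[p]) : Prop := ∀ i, y i ≠ 0

theorem SA.tor [Finite ι] : SA {y : ι → ℚ_[p] | tor y} := by
  unfold PSub.tor
  apply SA.all
  intro i
  apply SA.not
  have := SA.zero (p := p) (MvPolynomial.X i)
  simpa using this

/-! ### Rational functions regular on the torus -/

def Lau (l : (ι → ℚ_[p]) → ℚ_[p]) : Prop :=
  ∃ a b : MvPolynomial ι ℚ_[p], ∀ y, tor y →
    MvPolynomial.eval y b ≠ 0 ∧ l y * MvPolynomial.eval y b = MvPolynomial.eval y a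

theorem Lau.const (c : ℚ_[p]) : Lau (fun _ : ι → ℚ_[p] => c) :=
  ⟨MvPolynomial.C c, 1, fun y _ => by simp⟩

theorem Lau.coord (i : ι) : Lau (fun y : ι → ℚ_[p] => y i) :=
  ⟨MvPolynomial.X i, 1, fun y _ => by simp⟩

theorem Lau.coord_inv (i : ι) : Lau (fun y : ι → ℚ_[p] => (y i)⁻¹) :=
  ⟨1, MvPolynomial.X i, fun y hy => by simp [hy i]⟩

theorem Lau.add {l m : (ι → ℚ_[p]) → ℚ_[p]} (hl : Lau l) (hm : Lau m) :
    Lau (fun y => l y + m y) := by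
  obtain ⟨a, b, h⟩ := hl
  obtain ⟨a', b', h'⟩ := hm
  refine ⟨a * b' + a' * b, b * b', fun y hy => ?_⟩
  obtain ⟨h1, h2⟩ := h y hy
  obtain ⟨h1', h2'⟩ := h' y hy
  simp only [map_mul, map_add]
  exact ⟨mul_ne_zero h1 h1', by rw [← h2, ← h2']; ring⟩

theorem Lau.mul {l m : (ι → ℚ_[p]) → ℚ_[p]} (hl : Lau l) (hm : Lau m) :
    Lau (fun y => l y * m y) := by
  obtain ⟨a, b, h⟩ := hl
  obtain ⟨a', b', h'⟩ := hm
  refine ⟨a * a', b * b', fun y hy => ?_⟩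
  obtain ⟨h1, h2⟩ := h y hy
  obtain ⟨h1', h2'⟩ := h' y hy
  simp only [map_mul]
  exact ⟨mul_ne_zero h1 h1', by rw [← h2, ← h2']; ring⟩

theorem Lau.neg {l : (ι → ℚ_[p]) → ℚ_[p]} (hl : Lau l) : Lau (fun y => - l y) := by
  have := (Lau.const (ι := ι) (-1 : ℚ_[p])).mul hl
  simpa using this

theorem Lau.sub {l m : (ι → ℚ_[p]) → ℚ_[p]} (hl : Lau l) (hm : Lau m) :
    Lau (fun y => l y - m y) := by
  simp only [sub_eq_add_neg]; exact hl.add hm.neg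

theorem Lau.pow {l : (ι → ℚ_[p]) → ℚ_[p]} (hl : Lau l) (n : ℕ) : Lau (fun y => l y ^ n) := by
  induction n with
  | zero => simpa using Lau.const 1
  | succ n ih => simp only [pow_succ]; exact ih.mul hl

theorem Lau.sum {α : Type*} (s : Finset α) {l : α → (ι → ℚ_[p]) → ℚ_[p]}
    (h : ∀ i ∈ s, Lau (l i)) : Lau (fun y => ∑ i ∈ s, l i y) := by
  classical
  induction s using Finset.induction_on with
  | empty => simpa using Lau.const 0
  | insert a s ha ih =>
    simp only [Finset.sum_insert ha]
    exact (h a (by simp)).add (ih fun i hi => h i (by simp [hi]))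

theorem Lau.prod {α : Type*} (s : Finset α) {l : α → (ι → ℚ_[p]) → ℚ_[p]}
    (h : ∀ i ∈ s, Lau (l i)) : Lau (fun y => ∏ i ∈ s, l i y) := by
  classical
  induction s using Finset.induction_on with
  | empty => simpa using Lau.const 1
  | insert a s ha ih =>
    simp only [Finset.prod_insert ha]
    exact (h a (by simp)).mul (ih fun i hi => h i (by simp [hi]))

theorem Lau.zpow_coord (i : ι) (e : ℤ) : Lau (fun y : ι → ℚ_[p] => y i ^ e) := by
  obtain ⟨n, rfl | rfl⟩ := e.eq_nat_or_neg
  · simp only [zpow_natCast]; exact (Lau.coord i).pow n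
  · simp only [zpow_neg, zpow_natCast, ← inv_pow]; exact (Lau.coord_inv i).pow n

theorem Lau.mvpoly {l : κ → (ι → ℚ_[p]) → ℚ_[p]} (h : ∀ k, Lau (l k))
    (q : MvPolynomial κ ℚ_[p]) : Lau (fun y => MvPolynomial.eval (fun k => l k y) q) := by
  induction q using MvPolynomial.induction_on with
  | C a => simpa using Lau.const a
  | add f g hf hg => simp only [map_add]; exact hf.add hg
  | mul_X f k hf => simp only [map_mul, MvPolynomial.eval_X]; exact hf.mul (h k)

theorem SA.lau_zero [Finite ι] {l : (ι → ℚ_[p]) → ℚ_[p]} (hl : Lau l) :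
    SA {y | PSub.tor y ∧ l y = 0} := by
  obtain ⟨a, b, h⟩ := hl
  convert SA.and SA.tor (SA.zero a) using 2
  ext y
  constructor
  · rintro ⟨h1, h2⟩; exact ⟨h1, by rw [← (h y h1).2, h2, zero_mul]⟩
  · rintro ⟨h1, h2⟩
    refine ⟨h1, ?_⟩
    have := (h y h1).2
    rw [h2] at this
    exact (mul_eq_zero.1 this).resolve_right (h y h1).1

theorem SA.lau_pow [Finite ι] {l : (ι → ℚ_[p]) → ℚ_[p]} (hl : Lau l) (n : ℕ) (hn : 0 < n) :
    SA {y | PSub.tor y ∧ l y ∈ Pset p n} := by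
  obtain ⟨a, b, h⟩ := hl
  convert SA.and SA.tor (SA.pow (a * b ^ (n - 1)) n hn) using 2
  ext y
  refine and_congr_right fun h1 => ?_
  obtain ⟨h2, h3⟩ := h y h1
  rw [map_mul, map_pow, ← h3, mul_assoc, ← pow_succ', Nat.sub_add_cancel hn,
    Pset_mul_iff (Pset_pow h2)]

theorem SA.lau_preimage [Finite κ] {Y : Set (ι → ℚ_[p])} (hY : SA Y)
    {l : ι → (κ → ℚ_[p]) → ℚ_[p]} (hl : ∀ i, Lau (l i)) :
    SA {w | PSub.tor w ∧ (fun i => l i w) ∈ Y} := by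
  induction hY with
  | zero f => exact SA.lau_zero (Lau.mvpoly hl f)
  | pow f n hn => exact SA.lau_pow (Lau.mvpoly hl f) n hn
  | compl A _ ih =>
    convert SA.and SA.tor (SA.compl _ ih) using 2
    ext y
    simp only [Set.mem_compl_iff, Set.mem_ofPred_eq]
    tauto
  | inter A B _ _ ihA ihB =>
    convert SA.inter _ _ ihA ihB using 1
    ext y
    simp only [Set.mem_inter_iff, Set.mem_ofPred_eq]
    tauto

theorem SA.lau_le [Finite ι] {l m : (ι → ℚ_[p]) → ℚ_[p]} (hl : Lau l) (hm : Lau m)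
    (ε : ℝ) (hε : 0 ≤ ε) :
    SA {y | PSub.tor y ∧ ‖l y‖ ≤ ε * ‖m y‖} := by
  obtain ⟨c, hc⟩ := round_eps (p := p) ε hε
  simp only [hc, norm_le_iff]
  have h1 := (Lau.const (ι := ι) c).mul hm
  have h2 := SA.lau_zero hl
  have h3 := SA.lau_zero h1
  have h4 := SA.lau_pow ((h1.pow (p + 1)).add ((Lau.const (ι := ι) (p : ℚ_[p])).mul
    (hl.pow (p + 1)))) (p + 1) (by lia)
  convert SA.or (SA.and h2 h3) h4 using 2
  ext y
  tauto

theorem SA.lau_lt [Finite ι] {l m : (ι → ℚ_[p]) → ℚ_[p]} (hl : Lau l) (hm : Lau m)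
    (ε : ℝ) (hε : 0 < ε) :
    SA {y | PSub.tor y ∧ ‖l y‖ < ε * ‖m y‖} := by
  convert SA.and SA.tor (SA.not (SA.lau_le hm hl ε⁻¹ (by positivity))) using 2
  ext y
  refine and_congr_right fun h1 => ?_
  rw [not_and]
  have : ‖m y‖ ≤ ε⁻¹ * ‖l y‖ ↔ ε * ‖m y‖ ≤ ‖l y‖ := by
    rw [inv_mul_eq_div, le_div_iff₀ hε, mul_comm]
  rw [this]
  constructor
  · intro h _; exact not_le.2 h
  · intro h; exact not_le.1 (h h1)

/-! ### Monomials -/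

section mon
variable [Fintype ι] [Fintype κ]

noncomputable def mon (c : ℚ_[p]) (e : ι → ℤ) (y : ι → ℚ_[p]) : ℚ_[p] := c * ∏ i, y i ^ e i

theorem Lau.mon (c : ℚ_[p]) (e : ι → ℤ) : Lau (PSub.mon c e) :=
  (Lau.const c).mul (Lau.prod _ fun i _ => Lau.zpow_coord i (e i))

theorem mon_zero (c : ℚ_[p]) (y : ι → ℚ_[p]) : mon c 0 y = c := by simp [mon]

theorem mon_coord [DecidableEq ι] (i : ι) (y : ι → ℚ_[p]) : mon 1 (Pi.single i 1) y = y i := by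
  rw [mon, one_mul, Finset.prod_eq_single i]
  · simp
  · intro j _ hj; simp [hj]
  · simp

theorem mon_mul (c d : ℚ_[p]) (e f : ι → ℤ) (y : ι → ℚ_[p]) (hy : tor y) :
    mon (c * d) (e + f) y = mon c e y * mon d f y := by
  simp only [mon, Pi.add_apply]
  rw [Finset.prod_congr rfl fun i _ => zpow_add₀ (hy i) (e i) (f i), Finset.prod_mul_distrib]
  ring

theorem mon_inv (c : ℚ_[p]) (e : ι → ℤ) (y : ι → ℚ_[p]) :
    mon c⁻¹ (-e) y = (mon c e y)⁻¹ := by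
  simp only [mon, Pi.neg_apply, zpow_neg, Finset.prod_inv_distrib, mul_inv]

theorem mon_zpow (c : ℚ_[p]) (e : ι → ℤ) (k : ℤ) (y : ι → ℚ_[p]) :
    mon (c ^ k) (k • e) y = (mon c e y) ^ k := by
  simp only [mon, mul_zpow, Pi.smul_apply, smul_eq_mul, ← Finset.prod_zpow]
  congr 1
  refine Finset.prod_congr rfl fun i _ => ?_
  rw [mul_comm, zpow_mul]

theorem mon_ne {c : ℚ_[p]} (hc : c ≠ 0) (e : ι → ℤ) {y : ι → ℚ_[p]} (hy : tor y) :
    mon c e y ≠ 0 :=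
  mul_ne_zero hc (Finset.prod_ne_zero_iff.2 fun i _ => zpow_ne_zero _ (hy i))

theorem mon_smul (a c : ℚ_[p]) (e : ι → ℤ) (y : ι → ℚ_[p]) :
    mon (a * c) e y = a * mon c e y := by
  simp only [mon]; ring

/-- Composition of monomials with a monomial map. -/
theorem mon_comp (c : ℚ_[p]) (e : ι → ℤ) (d : ι → ℚ_[p]) (f : ι → κ → ℤ) (w : κ → ℚ_[p])
    (hw : tor w) :
    mon c e (fun i => mon (d i) (f i) w)
      = mon (c * ∏ i, d i ^ e i) (fun k => ∑ i, e i * f i k) w := by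
  simp only [mon]
  have : ∀ i, (d i * ∏ k, w k ^ f i k) ^ e i = d i ^ e i * ∏ k, w k ^ (e i * f i k) := by
    intro i
    rw [mul_zpow, ← Finset.prod_zpow]
    congr 1
    refine Finset.prod_congr rfl fun k _ => ?_
    rw [mul_comm, zpow_mul]
  simp only [this, Finset.prod_mul_distrib]
  rw [mul_assoc, Finset.prod_comm]
  congr 2
  refine Finset.prod_congr rfl fun k _ => ?_
  generalize (Finset.univ : Finset ι) = s
  classical
  induction s using Finset.induction_on with
  | empty => simp
  | insert a s ha ih => rw [Finset.prod_insert ha, Finset.sum_insert ha, zpow_add₀ (hw k), ih]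

/-- `f` is within relative distance `ε` of a monomial on `Y`. -/
def MonOn (ε : ℝ) (f : (ι → ℚ_[p]) → ℚ_[p]) (Y : Set (ι → ℚ_[p])) : Prop :=
  ∃ c e, ∀ y ∈ Y, ‖f y - mon c e y‖ ≤ ε * ‖mon c e y‖

variable {ε ε' : ℝ} {f g : (ι → ℚ_[p]) → ℚ_[p]} {Y Z : Set (ι → ℚ_[p])}

theorem MonOn.mono (h : MonOn ε f Y) (hε : ε ≤ ε') (hZ : Z ⊆ Y) : MonOn ε' f Z := by
  obtain ⟨c, e, h⟩ := h
  exact ⟨c, e, fun y hy => (h y (hZ hy)).trans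
    (mul_le_mul_of_nonneg_right hε (norm_nonneg _))⟩

theorem MonOn.congr (h : MonOn ε f Y) (hfg : ∀ y ∈ Y, g y = f y) : MonOn ε g Y := by
  obtain ⟨c, e, h⟩ := h
  exact ⟨c, e, fun y hy => by rw [hfg y hy]; exact h y hy⟩

theorem MonOn.mon (hε : 0 ≤ ε) (c : ℚ_[p]) (e : ι → ℤ) : MonOn ε (PSub.mon c e) Y :=
  ⟨c, e, fun y _ => by rw [sub_self, norm_zero]; positivity⟩

theorem MonOn.const (hε : 0 ≤ ε) (c : ℚ_[p]) : MonOn ε (fun _ => c) Y :=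
  (MonOn.mon hε c 0).congr fun y _ => (mon_zero c y).symm

theorem MonOn.coord (hε : 0 ≤ ε) (i : ι) : MonOn ε (fun y => y i) Y := by
  classical
  exact (MonOn.mon hε 1 (Pi.single i 1)).congr fun y _ => (mon_coord i y).symm

theorem MonOn.mul (hε : ε ≤ 1) (_hε0 : 0 ≤ ε) (hY : ∀ y ∈ Y, tor y) (hf : MonOn ε f Y)
    (hg : MonOn ε g Y) : MonOn ε (fun y => f y * g y) Y := by
  obtain ⟨c, e, hf⟩ := hf
  obtain ⟨d, k, hg⟩ := hg
  refine ⟨c * d, e + k, fun y hy => ?_⟩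
  rw [mon_mul _ _ _ _ _ (hY y hy)]
  have h1 := hf y hy
  have h2 := hg y hy
  set m := PSub.mon c e y
  set n := PSub.mon d k y
  have hfm : ‖f y‖ ≤ ‖m‖ := by
    have : f y = (f y - m) + m := by ring
    rw [this]
    exact add_le_of (h1.trans (by nlinarith [norm_nonneg m])) le_rfl
  have : f y * g y - m * n = f y * (g y - n) + (f y - m) * n := by ring
  rw [this, norm_mul m n]
  apply add_le_of
  · rw [norm_mul]
    calc _ ≤ ‖m‖ * (ε * ‖n‖) := by gcongr
      _ = _ := by ring
  · rw [norm_mul]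
    calc _ ≤ (ε * ‖m‖) * ‖n‖ := by gcongr
      _ = _ := by ring

theorem MonOn.norm_eq (hε : ε < 1) {c : ℚ_[p]} {e : ι → ℤ} {y : ι → ℚ_[p]}
    (h : ‖f y - PSub.mon c e y‖ ≤ ε * ‖PSub.mon c e y‖) : ‖f y‖ = ‖PSub.mon c e y‖ :=
  norm_eq_of_sub_le hε h

theorem MonOn.inv (hε : ε < 1) (hf : MonOn ε f Y) : MonOn ε (fun y => (f y)⁻¹) Y := by
  obtain ⟨c, e, hf⟩ := hf
  refine ⟨c⁻¹, -e, fun y hy => ?_⟩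
  rw [mon_inv]
  have h1 := hf y hy
  have h2 := MonOn.norm_eq hε h1
  set m := PSub.mon c e y
  by_cases hm : m = 0
  · have : f y = 0 := by rw [hm] at h2; simpa using h2
    simp [this, hm]
  · have hfy : f y ≠ 0 := by
      rw [← norm_pos_iff, h2]; exact norm_pos_iff.2 hm
    have : (f y)⁻¹ - m⁻¹ = -(f y - m) * ((f y)⁻¹ * m⁻¹) := by field_simp; ring
    have hm' : 0 < ‖m‖ := norm_pos_iff.2 hm
    rw [this, norm_mul, norm_neg, norm_mul, norm_inv, norm_inv, h2]
    calc _ ≤ (ε * ‖m‖) * (‖m‖⁻¹ * ‖m‖⁻¹) := by gcongr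
      _ = _ := by field_simp

theorem MonOn.pow (hε : ε ≤ 1) (hε0 : 0 ≤ ε) (hY : ∀ y ∈ Y, tor y) (hf : MonOn ε f Y) (n : ℕ) :
    MonOn ε (fun y => f y ^ n) Y := by
  induction n with
  | zero => simpa using MonOn.const hε0 1
  | succ n ih => simp only [pow_succ]; exact MonOn.mul hε hε0 hY ih hf

theorem MonOn.neg (hf : MonOn ε f Y) : MonOn ε (fun y => - f y) Y := by
  obtain ⟨c, e, h⟩ := hf
  refine ⟨-c, e, fun y hy => ?_⟩
  have : PSub.mon (-c) e y = - PSub.mon c e y := by simp [PSub.mon]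
  rw [this, norm_neg, ← norm_neg, show -(-f y - -PSub.mon c e y) = f y - PSub.mon c e y by ring]
  exact h y hy

/-- Transitivity: a function close to a `MonOn` function. -/
theorem MonOn.close (hε : ε < 1) (_hε0 : 0 ≤ ε) (hf : MonOn ε f Y)
    (h : ∀ y ∈ Y, ‖g y - f y‖ ≤ ε * ‖f y‖) : MonOn ε g Y := by
  obtain ⟨c, e, hf⟩ := hf
  refine ⟨c, e, fun y hy => ?_⟩
  have : g y - PSub.mon c e y = (g y - f y) + (f y - PSub.mon c e y) := by ring
  rw [this]
  refine add_le_of ?_ (hf y hy)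
  rw [← MonOn.norm_eq hε (hf y hy)]; exact h y hy

theorem MonOn.zero_or (hε : ε < 1) (hY : ∀ y ∈ Y, tor y) (hf : MonOn ε f Y) :
    (∀ y ∈ Y, f y = 0) ∨ (∀ y ∈ Y, f y ≠ 0) := by
  obtain ⟨c, e, hf⟩ := hf
  by_cases hc : c = 0
  · left; intro y hy
    have := hf y hy
    subst hc
    simpa [PSub.mon] using this
  · right; intro y hy h0
    have := MonOn.norm_eq hε (hf y hy)
    rw [h0, norm_zero] at this
    exact mon_ne hc e (hY y hy) (norm_eq_zero.1 this.symm)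

theorem MonOn.sa_zero (hε : ε < 1) (hY : ∀ y ∈ Y, tor y) (hYs : SA Y) (hf : MonOn ε f Y) :
    SA {y | y ∈ Y ∧ f y = 0} := by
  rcases hf.zero_or hε hY with h | h
  · convert hYs using 1
    ext y; simp only [Set.mem_ofPred_eq]; exact ⟨fun h => h.1, fun hy => ⟨hy, h y hy⟩⟩
  · convert SA.empty (p := p) (ι := ι) using 1
    ext y; simp only [Set.mem_ofPred_eq, Set.mem_empty_iff_false, iff_false]
    exact fun hh => h y hh.1 hh.2

theorem MonOn.sa_le (hε : ε < 1) (hY : ∀ y ∈ Y, tor y) (hYs : SA Y) (hf : MonOn ε f Y)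
    (hg : MonOn ε g Y) (r : ℝ) (hr : 0 ≤ r) :
    SA {y | y ∈ Y ∧ ‖f y‖ ≤ r * ‖g y‖} := by
  obtain ⟨c, e, hf⟩ := hf
  obtain ⟨d, k, hg⟩ := hg
  convert SA.and hYs (SA.lau_le (Lau.mon c e) (Lau.mon d k) r hr) using 2
  ext y
  refine and_congr_right fun hy => ?_
  rw [MonOn.norm_eq hε (hf y hy), MonOn.norm_eq hε (hg y hy)]
  simp [hY y hy]

theorem MonOn.sa_pow (n : ℕ) (hn : 0 < n) : ∃ η : ℝ, 0 < η ∧ η < 1 ∧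
    ∀ {ι : Type} [Fintype ι] {f : (ι → ℚ_[p]) → ℚ_[p]} {Y : Set (ι → ℚ_[p])},
    (∀ y ∈ Y, tor y) → SA Y → MonOn η f Y → SA {y | y ∈ Y ∧ f y ∈ Pset p n} := by
  obtain ⟨η, h0, h1, h⟩ := Pset_close (p := p) n hn
  refine ⟨η, h0, h1, fun {ι} _ {f Y} hY hYs hf => ?_⟩
  obtain ⟨c, e, hf⟩ := hf
  convert SA.and hYs (SA.lau_pow (Lau.mon c e) n hn) using 2
  ext y
  refine and_congr_right fun hy => ?_
  rw [h _ _ (hf y hy)]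
  simp [hY y hy]

theorem MonOn.comp (hf : MonOn ε f Y) {Z : Set (κ → ℚ_[p])} (d : ι → ℚ_[p]) (k : ι → κ → ℤ)
    (hZt : ∀ w ∈ Z, tor w) {m : (κ → ℚ_[p]) → ι → ℚ_[p]}
    (hm : ∀ w ∈ Z, ∀ i, m w i = PSub.mon (d i) (k i) w) (hmY : ∀ w ∈ Z, m w ∈ Y) :
    MonOn ε (fun w => f (m w)) Z := by
  obtain ⟨c, e, hf⟩ := hf
  refine ⟨c * ∏ i, d i ^ e i, fun l => ∑ i, e i * k i l, fun w hw => ?_⟩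
  rw [← mon_comp c e d k w (hZt w hw)]
  have : m w = fun i => PSub.mon (d i) (k i) w := funext fun i => hm w hw i
  rw [← this]
  exact hf _ (hmY w hw)

end mon

/-! ### Decision trees -/

inductive Ref (Q : Set (ι → ℚ_[p]) → Prop) : Set (ι → ℚ_[p]) → Prop
  | one (Y : Set (ι → ℚ_[p])) : SA Y → Q Y → Ref Q Y
  | split (Y A : Set (ι → ℚ_[p])) : SA A → Ref Q (Y ∩ A) → Ref Q (Y \ A) → Ref Q Y

theorem Ref.bind {Q Q' : Set (ι → ℚ_[p]) → Prop} {Y : Set (ι → ℚ_[p])} (h : Ref Q Y)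
    (hQ : ∀ Z, Z ⊆ Y → SA Z → Q Z → Ref Q' Z) : Ref Q' Y := by
  induction h with
  | one Y hY h => exact hQ Y subset_rfl hY h
  | split Y A hA h1 h2 ih1 ih2 =>
    exact Ref.split Y A hA (ih1 fun Z hZ => hQ Z (hZ.trans Set.inter_subset_left))
      (ih2 fun Z hZ => hQ Z (hZ.trans Set.sdiff_subset))

theorem Ref.ofCover {Q : Set (ι → ℚ_[p]) → Prop} {α : Type*} (s : Finset α)
    (A : α → Set (ι → ℚ_[p])) (hA : ∀ a ∈ s, SA (A a)) :
    ∀ (Y : Set (ι → ℚ_[p])), SA Y → (∀ y ∈ Y, ∃ a ∈ s, y ∈ A a) → Q ∅ →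
    (∀ Z ⊆ Y, SA Z → ∀ a ∈ s, Z ⊆ A a → Q Z) → Ref Q Y := by
  classical
  induction s using Finset.induction_on with
  | empty =>
    intro Y hY hcov h0 _
    have : Y = ∅ := by
      ext y; simp only [Set.mem_empty_iff_false, iff_false]; intro hy
      obtain ⟨a, ha, -⟩ := hcov y hy; simp at ha
    rw [this]; exact Ref.one _ SA.empty h0
  | insert a s ha ih =>
    intro Y hY hcov h0 h
    refine Ref.split Y (A a) (hA a (by simp)) (Ref.one _ (SA.inter _ _ hY (hA a (by simp))) ?_) ?_
    · exact h _ Set.inter_subset_left (SA.inter _ _ hY (hA a (by simp))) a (by simp)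
        Set.inter_subset_right
    · refine ih (fun b hb => hA b (by simp [hb])) _ (SA.diff hY (hA a (by simp))) ?_ h0 ?_
      · rintro y ⟨hy, hya⟩
        obtain ⟨b, hb, hyb⟩ := hcov y hy
        rcases Finset.mem_insert.1 hb with rfl | hb
        · exact absurd hyb hya
        · exact ⟨b, hb, hyb⟩
      · intro Z hZ hZs b hb hZb
        exact h Z (hZ.trans Set.sdiff_subset) hZs b (by simp [hb]) hZb

theorem Ref.finset {α : Type*} (s : Finset α) (Q : α → Set (ι → ℚ_[p]) → Prop)
    (hher : ∀ a ∈ s, ∀ Y Z, Z ⊆ Y → Q a Y → Q a Z) (Y : Set (ι → ℚ_[p])) (hY : SA Y)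
    (h : ∀ a ∈ s, ∀ Z ⊆ Y, SA Z → Ref (Q a) Z) : Ref (fun Z => ∀ a ∈ s, Q a Z) Y := by
  classical
  induction s using Finset.induction_on with
  | empty => exact Ref.one _ hY (by simp)
  | insert a s ha ih =>
    refine (ih (fun b hb => hher b (by simp [hb])) fun b hb => h b (by simp [hb])).bind ?_
    intro Z hZ hZs hQ
    refine (h a (by simp) Z hZ hZs).bind ?_
    intro Z' hZ' hZs' hQ'
    refine Ref.one _ hZs' ?_
    intro b hb
    rcases Finset.mem_insert.1 hb with rfl | hb
    · exact hQ'
    · exact hher b (by simp [hb]) _ _ hZ' (hQ b hb)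

/-- A finite net in the unit ball. -/
theorem ball_net (ε : ℝ) (hε : 0 < ε) :
    ∃ Θ : Finset ℚ_[p], ∀ u : ℚ_[p], ‖u‖ ≤ 1 → ∃ θ ∈ Θ, ‖u - θ‖ ≤ ε := by
  have hc : IsCompact (Metric.closedBall (0 : ℚ_[p]) 1) := isCompact_closedBall _ _
  obtain ⟨t, ht, htf, hcov⟩ := hc.finite_cover_balls hε
  refine ⟨htf.toFinset, fun u hu => ?_⟩
  have := hcov (show u ∈ Metric.closedBall (0 : ℚ_[p]) 1 by simpa using hu)
  simp only [Set.mem_iUnion, Metric.mem_ball, exists_prop] at this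
  obtain ⟨θ, hθ, h⟩ := this
  exact ⟨θ, by simpa using hθ, by rw [← dist_eq_norm]; exact h.le⟩

/-- Sums without too much cancellation are piecewise close to monomials. -/
theorem PW1 (δ ε : ℝ) (hδ : 0 < δ) (hε : 0 < ε) : ∃ ε1 : ℝ, 0 < ε1 ∧ ε1 < 1 ∧
    ∀ {ι : Type} [Fintype ι] {α : Type} (s : Finset α) (g : α → (ι → ℚ_[p]) → ℚ_[p])
      (Y : Set (ι → ℚ_[p])),
    (∀ y ∈ Y, tor y) → SA Y → (∀ a ∈ s, MonOn ε1 (g a) Y) →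
    (∀ y ∈ Y, ∀ a ∈ s, δ * ‖g a y‖ ≤ ‖∑ b ∈ s, g b y‖) →
    Ref (MonOn ε (fun y => ∑ b ∈ s, g b y)) Y := by
  set ε1 := min (1 / 2) (δ * (min ε (1 / 2))) with hε1
  have hεpos1 : 0 < ε1 := by positivity
  have hεlt1 : ε1 < 1 := (min_le_left _ _).trans_lt (by norm_num)
  have hεδ1 : ε1 ≤ δ * min ε (1 / 2) := min_le_right _ _
  refine ⟨ε1, hεpos1, hεlt1, ?_⟩
  intro ι _ α s g Y hYt hYs hg hest
  classical
  choose! c e hce using hg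
  obtain ⟨Θ, hΘ⟩ := ball_net (p := p) ε1 hεpos1
  rcases s.eq_empty_or_nonempty with rfl | hne
  · exact Ref.one _ hYs (by simpa using MonOn.const hε.le 0)
  refine Ref.ofCover (s ×ˢ Θ) (fun kρ => {y | (∀ l ∈ s, tor y ∧
      ‖PSub.mon (c l) (e l) y‖ ≤ 1 * ‖PSub.mon (c kρ.1) (e kρ.1) y‖) ∧ (tor y ∧
      ‖∑ l ∈ s, PSub.mon (c l) (e l) y - kρ.2 * PSub.mon (c kρ.1) (e kρ.1) y‖ ≤
        ε1 * ‖PSub.mon (c kρ.1) (e kρ.1) y‖)}) ?_ Y hYs ?_ ?_ ?_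
  · rintro ⟨k, ρ⟩ -
    refine SA.and (SA.finset_all _ fun l _ => SA.lau_le (Lau.mon _ _) (Lau.mon _ _) 1 (by simp)) ?_
    exact SA.lau_le ((Lau.sum _ fun l _ => Lau.mon _ _).sub
      ((Lau.const _).mul (Lau.mon _ _))) (Lau.mon _ _) _ hεpos1.le
  · intro y hy
    obtain ⟨k, hk, hmax⟩ := s.exists_max_image (fun l => ‖PSub.mon (c l) (e l) y‖) hne
    have hsum : ‖∑ l ∈ s, PSub.mon (c l) (e l) y‖ ≤ ‖PSub.mon (c k) (e k) y‖ :=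
      sum_le_of _ _ (norm_nonneg _) hmax
    have ht := hYt y hy
    by_cases h0 : PSub.mon (c k) (e k) y = 0
    · obtain ⟨ρ, hρ, -⟩ := hΘ 0 (by simp)
      refine ⟨(k, ρ), Finset.mem_product.2 ⟨hk, hρ⟩,
        fun l hl => ⟨ht, by rw [one_mul]; exact hmax l hl⟩, ht, ?_⟩
      simp only [h0, norm_zero, mul_zero, sub_zero] at hsum ⊢
      exact hsum
    · have hpos : 0 < ‖PSub.mon (c k) (e k) y‖ := norm_pos_iff.2 h0
      obtain ⟨ρ, hρ, hcl⟩ := hΘ ((∑ l ∈ s, PSub.mon (c l) (e l) y) / PSub.mon (c k) (e k) y)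
        (by rw [norm_div]; exact div_le_one_of_le₀ hsum (norm_nonneg _))
      refine ⟨(k, ρ), Finset.mem_product.2 ⟨hk, hρ⟩,
        fun l hl => ⟨ht, by rw [one_mul]; exact hmax l hl⟩, ht, ?_⟩
      have : ∑ l ∈ s, PSub.mon (c l) (e l) y - ρ * PSub.mon (c k) (e k) y =
        ((∑ l ∈ s, PSub.mon (c l) (e l) y) / PSub.mon (c k) (e k) y - ρ) *
          PSub.mon (c k) (e k) y := by field_simp
      simp only [this, norm_mul]
      gcongr
  · exact ⟨0, 0, by simp⟩
  · rintro Z hZ hZs ⟨k, ρ⟩ hkρ hZA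
    have hk := (Finset.mem_product.1 hkρ).1
    refine ⟨ρ * c k, e k, fun y hy => ?_⟩
    obtain ⟨h1, -, h2⟩ := hZA hy
    simp only at h1 h2
    rw [mon_smul]
    set m := PSub.mon (c k) (e k) y with hm
    have hd : ‖∑ b ∈ s, g b y - ρ * m‖ ≤ ε1 * ‖m‖ := by
      have : ∑ b ∈ s, g b y - ρ * m = ∑ b ∈ s, (g b y - PSub.mon (c b) (e b) y) +
        (∑ l ∈ s, PSub.mon (c l) (e l) y - ρ * m) := by
        rw [Finset.sum_sub_distrib]; ring
      rw [this]
      refine add_le_of (sum_le_of _ _ (by positivity) fun l hl => ?_) h2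
      refine (hce l hl y (hZ hy)).trans ?_
      have := (h1 l hl).2
      rw [one_mul] at this
      gcongr
    have hgk : ‖g k y‖ = ‖m‖ := MonOn.norm_eq hεlt1 (hce k hk y (hZ hy))
    have hb := hest y (hZ hy) k hk
    rw [hgk] at hb
    set F := ∑ b ∈ s, g b y
    have hmin : (0:ℝ) < min ε (1 / 2) := by positivity
    have hd2 : ‖F - ρ * m‖ ≤ min ε (1 / 2) * ‖F‖ := by
      calc _ ≤ ε1 * ‖m‖ := hd
        _ ≤ (δ * min ε (1 / 2)) * ‖m‖ := by gcongr
        _ = min ε (1 / 2) * (δ * ‖m‖) := by ring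
        _ ≤ _ := by gcongr
    have hFn : ‖ρ * m‖ = ‖F‖ := by
      refine norm_eq_of_sub_le (ε := min ε (1/2)) ((min_le_right _ _).trans_lt (by norm_num)) ?_
      rwa [norm_sub_rev]
    rw [hFn]
    exact hd2.trans (by gcongr; exact min_le_left _ _)

end PSub
end Part2


section Part3
open PadicSub

namespace PSub

variable {p : ℕ} [hp : Fact p.Prime]

/-! ### D-functions over arbitrary index types -/

inductive DF {ι : Type} : ((ι → ℚ_[p]) → ℚ_[p]) → Prop
  | const (c : ℚ_[p]) : DF (fun _ => c)
  | coord (i : ι) : DF (fun y => y i)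
  | add (f g : (ι → ℚ_[p]) → ℚ_[p]) : DF f → DF g → DF (fun y => f y + g y)
  | mul (f g : (ι → ℚ_[p]) → ℚ_[p]) : DF f → DF g → DF (fun y => f y * g y)
  | inv (f : (ι → ℚ_[p]) → ℚ_[p]) : DF f → DF (fun y => (f y)⁻¹)
  | ranal {m : ℕ} (a : (Fin m → ℕ) → ℚ_[p]) (ha : IsRestrictedCoeffs p a)
      (g : Fin m → (ι → ℚ_[p]) → ℚ_[p]) : (∀ i, DF (g i)) →
      DF (fun y => ranalFn p a (fun i => g i y))

variable {ι κ : Type}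

theorem DF.subst {f : (κ → ℚ_[p]) → ℚ_[p]} (hf : DF f) {g : κ → (ι → ℚ_[p]) → ℚ_[p]}
    (hg : ∀ k, DF (g k)) : DF (fun x => f (fun k => g k x)) := by
  induction hf with
  | const c => exact DF.const c
  | coord i => exact hg i
  | add f g _ _ h1 h2 => exact DF.add _ _ h1 h2
  | mul f g _ _ h1 h2 => exact DF.mul _ _ h1 h2
  | inv f _ h => exact DF.inv _ h
  | ranal a ha g _ h => exact DF.ranal a ha _ h

theorem DF.mvpoly (q : MvPolynomial ι ℚ_[p]) : DF (fun y => MvPolynomial.eval y q) := by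
  induction q using MvPolynomial.induction_on with
  | C a => simpa using DF.const a
  | add f g hf hg => simp only [map_add]; exact hf.add _ _ hg
  | mul_X f k hf => simp only [map_mul, MvPolynomial.eval_X]; exact hf.mul _ _ (DF.coord k)

theorem DF.toD {m : ℕ} {f : (Fin m → ℚ_[p]) → ℚ_[p]} (hf : DF f) : IsDFunction p f := by
  induction hf with
  | const c => simpa using IsDFunction.poly (p := p) (m := m) (MvPolynomial.C c)
  | coord i => simpa using IsDFunction.poly (p := p) (m := m) (MvPolynomial.X i)
  | add f g _ _ h1 h2 =>
    have := IsDFunction.comp (p := p) _ ![f, g] (IsDFunction.poly (p := p) (m := 2)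
      (MvPolynomial.X 0 + MvPolynomial.X 1)) (by intro i; fin_cases i <;> simpa)
    simpa using this
  | mul f g _ _ h1 h2 =>
    have := IsDFunction.comp (p := p) _ ![f, g] (IsDFunction.poly (p := p) (m := 2)
      (MvPolynomial.X 0 * MvPolynomial.X 1)) (by intro i; fin_cases i <;> simpa)
    simpa using this
  | inv f _ h => exact IsDFunction.comp (p := p) _ (fun _ => f) IsDFunction.inv (fun _ => h)
  | ranal a ha g _ h => exact IsDFunction.comp (p := p) _ g (IsDFunction.ranal a ha) h

theorem DF.ofD {m : ℕ} {f : (Fin m → ℚ_[p]) → ℚ_[p]} (hf : IsDFunction p f) : DF f := by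
  induction hf with
  | ranal a ha => exact DF.ranal a ha _ (fun i => DF.coord i)
  | poly q => exact DF.mvpoly q
  | inv => exact DF.inv _ (DF.coord 0)
  | comp f g _ _ h1 h2 => exact h1.subst h2

theorem DF.neg {f : (ι → ℚ_[p]) → ℚ_[p]} (hf : DF f) : DF (fun y => - f y) := by
  simpa using DF.mul _ _ (DF.const (-1)) hf

theorem DF.sub {f g : (ι → ℚ_[p]) → ℚ_[p]} (hf : DF f) (hg : DF g) : DF (fun y => f y - g y) := by
  simp only [sub_eq_add_neg]; exact hf.add _ _ hg.neg

theorem DF.pow {f : (ι → ℚ_[p]) → ℚ_[p]} (hf : DF f) (n : ℕ) : DF (fun y => f y ^ n) := by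
  induction n with
  | zero => simpa using DF.const 1
  | succ n ih => simp only [pow_succ]; exact ih.mul _ _ hf

theorem DF.zpow {f : (ι → ℚ_[p]) → ℚ_[p]} (hf : DF f) (e : ℤ) : DF (fun y => f y ^ e) := by
  obtain ⟨n, rfl | rfl⟩ := e.eq_nat_or_neg
  · simp only [zpow_natCast]; exact hf.pow n
  · simp only [zpow_neg, zpow_natCast]; exact (hf.pow n).inv _

theorem DF.sum {α : Type*} (s : Finset α) {l : α → (ι → ℚ_[p]) → ℚ_[p]}
    (h : ∀ i ∈ s, DF (l i)) : DF (fun y => ∑ i ∈ s, l i y) := by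
  classical
  induction s using Finset.induction_on with
  | empty => simpa using DF.const 0
  | insert a s ha ih =>
    simp only [Finset.sum_insert ha]
    exact (h a (by simp)).add _ _ (ih fun i hi => h i (by simp [hi]))

theorem DF.prod {α : Type*} (s : Finset α) {l : α → (ι → ℚ_[p]) → ℚ_[p]}
    (h : ∀ i ∈ s, DF (l i)) : DF (fun y => ∏ i ∈ s, l i y) := by
  classical
  induction s using Finset.induction_on with
  | empty => simpa using DF.const 1
  | insert a s ha ih =>
    simp only [Finset.prod_insert ha]
    exact (h a (by simp)).mul _ _ (ih fun i hi => h i (by simp [hi]))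

theorem DF.mon [Fintype ι] (c : ℚ_[p]) (e : ι → ℤ) : DF (PSub.mon c e) :=
  DF.mul _ _ (DF.const c) (DF.prod _ fun i _ => (DF.coord i).zpow (e i))

/-- `f` agrees on `Y` with a D-function. -/
def DOn (f : (ι → ℚ_[p]) → ℚ_[p]) (Y : Set (ι → ℚ_[p])) : Prop := ∃ φ, DF φ ∧ ∀ y ∈ Y, f y = φ y

section DOn
variable {f g : (ι → ℚ_[p]) → ℚ_[p]} {Y Z : Set (ι → ℚ_[p])}

theorem DF.don (hf : DF f) : DOn f Y := ⟨f, hf, fun _ _ => rfl⟩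

theorem DOn.mono (h : DOn f Y) (hZ : Z ⊆ Y) : DOn f Z := by
  obtain ⟨φ, h1, h2⟩ := h; exact ⟨φ, h1, fun y hy => h2 y (hZ hy)⟩

theorem DOn.congr (h : DOn f Y) (hfg : ∀ y ∈ Y, g y = f y) : DOn g Y := by
  obtain ⟨φ, h1, h2⟩ := h; exact ⟨φ, h1, fun y hy => by rw [hfg y hy, h2 y hy]⟩

theorem DOn.subst {F : (κ → ℚ_[p]) → ℚ_[p]} (hF : DF F) {g : κ → (ι → ℚ_[p]) → ℚ_[p]}
    (hg : ∀ k, DOn (g k) Y) : DOn (fun x => F (fun k => g k x)) Y := by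
  choose φ h1 h2 using hg
  refine ⟨_, hF.subst h1, fun y hy => ?_⟩
  simp only [h2 _ y hy]

theorem DOn.add (hf : DOn f Y) (hg : DOn g Y) : DOn (fun y => f y + g y) Y := by
  obtain ⟨φ, h1, h2⟩ := hf
  obtain ⟨ψ, h3, h4⟩ := hg
  exact ⟨_, h1.add _ _ h3, fun y hy => by simp only [h2 y hy, h4 y hy]⟩

theorem DOn.mul (hf : DOn f Y) (hg : DOn g Y) : DOn (fun y => f y * g y) Y := by
  obtain ⟨φ, h1, h2⟩ := hf
  obtain ⟨ψ, h3, h4⟩ := hg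
  exact ⟨_, h1.mul _ _ h3, fun y hy => by simp only [h2 y hy, h4 y hy]⟩

theorem DOn.inv (hf : DOn f Y) : DOn (fun y => (f y)⁻¹) Y := by
  obtain ⟨φ, h1, h2⟩ := hf
  exact ⟨_, h1.inv _, fun y hy => by simp only [h2 y hy]⟩

theorem DOn.pow (hf : DOn f Y) (n : ℕ) : DOn (fun y => f y ^ n) Y := by
  obtain ⟨φ, h1, h2⟩ := hf
  exact ⟨_, h1.pow n, fun y hy => by simp only [h2 y hy]⟩

theorem DOn.sum {α : Type*} (s : Finset α) {l : α → (ι → ℚ_[p]) → ℚ_[p]}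
    (h : ∀ i ∈ s, DOn (l i) Y) : DOn (fun y => ∑ i ∈ s, l i y) Y := by
  classical
  induction s using Finset.induction_on with
  | empty => exact (DF.const 0).don.congr (by simp)
  | insert a s ha ih =>
    simp only [Finset.sum_insert ha]
    exact (h a (by simp)).add (ih fun i hi => h i (by simp [hi]))

theorem DOn.comp (hf : DOn f Y) {Z : Set (κ → ℚ_[p])} {m : (κ → ℚ_[p]) → ι → ℚ_[p]}
    (hm : ∀ i, DOn (fun w => m w i) Z) (hmY : ∀ w ∈ Z, m w ∈ Y) :
    DOn (fun w => f (m w)) Z := by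
  obtain ⟨φ, h1, h2⟩ := hf
  exact (DOn.subst h1 hm).congr fun w hw => h2 _ (hmY w hw)

end DOn

/-! ### Charts and coverings -/

structure Chart (p : ℕ) [Fact p.Prime] (V : Type) where
  ι : Type
  [fin : Fintype ι]
  Y : Set (ι → ℚ_[p])
  h : (ι → ℚ_[p]) → V
  sa : SA Y
  tor : ∀ y ∈ Y, tor y

attribute [instance] Chart.fin

variable {V W : Type}

def Chart.img (c : Chart p V) : Set V := c.h '' c.Y

def Chart.restr (c : Chart p V) (Z : Set (c.ι → ℚ_[p])) (hZ : Z ⊆ c.Y) (hs : SA Z) :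
    Chart p V := ⟨c.ι, Z, c.h, hs, fun y hy => c.tor y (hZ hy)⟩

def Chart.map (c : Chart p V) (φ : V → W) : Chart p W := ⟨c.ι, c.Y, fun y => φ (c.h y), c.sa, c.tor⟩

inductive CovOn (Q : Chart p V → Prop) : Set V → Prop
  | empty : CovOn Q ∅
  | chart (c : Chart p V) : Q c → Set.InjOn c.h c.Y → CovOn Q c.img
  | union (S T : Set V) : Disjoint S T → CovOn Q S → CovOn Q T → CovOn Q (S ∪ T)

theorem CovOn.fib {Q : Chart p V → Prop} {Q' : Chart p W → Prop} {S : Set V} (T : Set W)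
    (ρ : W → V → Prop) (h : CovOn Q S) (hex : ∀ w ∈ T, ∃ v ∈ S, ρ w v)
    (huniq : ∀ w ∈ T, ∀ v ∈ S, ∀ v' ∈ S, ρ w v → ρ w v' → v = v')
    (hch : ∀ c : Chart p V, Q c → Set.InjOn c.h c.Y → c.img ⊆ S →
      CovOn Q' {w | w ∈ T ∧ ∃ v ∈ c.img, ρ w v}) : CovOn Q' T := by
  have key : ∀ S', S' ⊆ S → CovOn Q S' → CovOn Q' {w | w ∈ T ∧ ∃ v ∈ S', ρ w v} := by
    intro S' hS' h'
    induction h' with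
    | empty => convert CovOn.empty (Q := Q') using 1; ext w; simp
    | chart c hQ hinj => exact hch c hQ hinj hS'
    | union A B hd _ _ ihA ihB =>
      have hA := Set.subset_union_left.trans hS'
      have hB := Set.subset_union_right.trans hS'
      convert CovOn.union _ _ ?_ (ihA hA) (ihB hB) using 1
      · ext w
        simp only [Set.mem_ofPred_eq, Set.mem_union]
        constructor
        · rintro ⟨hw, v, hv | hv, hr⟩
          · exact Or.inl ⟨hw, v, hv, hr⟩
          · exact Or.inr ⟨hw, v, hv, hr⟩
        · rintro (⟨hw, v, hv, hr⟩ | ⟨hw, v, hv, hr⟩)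
          · exact ⟨hw, v, Or.inl hv, hr⟩
          · exact ⟨hw, v, Or.inr hv, hr⟩
      · rw [Set.disjoint_left]
        rintro w ⟨hw, v, hv, hr⟩ ⟨_, v', hv', hr'⟩
        have := huniq w hw v (hA hv) v' (hB hv') hr hr'
        subst this
        exact Set.disjoint_left.1 hd hv hv'
  have := key S subset_rfl h
  convert this using 1
  ext w
  exact ⟨fun hw => ⟨hw, hex w hw⟩, fun hw => hw.1⟩

theorem CovOn.bind {Q Q' : Chart p V → Prop} {S : Set V} (h : CovOn Q S)
    (hch : ∀ c : Chart p V, Q c → Set.InjOn c.h c.Y → c.img ⊆ S → CovOn Q' c.img) :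
    CovOn Q' S := by
  refine CovOn.fib S (fun w v => w = v) h (fun w hw => ⟨w, hw, rfl⟩) ?_ ?_
  · rintro w _ v _ v' _ rfl rfl; rfl
  · intro c hQ hinj hS
    convert hch c hQ hinj hS using 1
    ext w
    constructor
    · rintro ⟨_, v, hv, rfl⟩; exact hv
    · intro hw; exact ⟨hS hw, w, hw, rfl⟩

theorem CovOn.mono {Q Q' : Chart p V → Prop} {S : Set V} (h : CovOn Q S)
    (hQ : ∀ c, c.img ⊆ S → Q c → Q' c) : CovOn Q' S :=
  h.bind fun c hc hi hS => CovOn.chart c (hQ c hS hc) hi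

theorem CovOn.image {Q : Chart p V → Prop} {Q' : Chart p W → Prop} {S : Set V} (φ : V → W)
    (h : CovOn Q S) (hφ : Set.InjOn φ S)
    (hQ : ∀ c, c.img ⊆ S → Q c → Q' (c.map φ)) : CovOn Q' (φ '' S) := by
  refine CovOn.fib (φ '' S) (fun w v => w = φ v) h ?_ ?_ ?_
  · rintro w ⟨v, hv, rfl⟩; exact ⟨v, hv, rfl⟩
  · rintro w _ v hv v' hv' rfl h2; exact hφ hv hv' h2
  · intro c hc hinj hS
    convert CovOn.chart (c.map φ) (hQ c hS hc) ?_ using 1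
    · ext w
      constructor
      · rintro ⟨_, _, ⟨y, hy, rfl⟩, rfl⟩; exact ⟨y, hy, rfl⟩
      · rintro ⟨y, hy, rfl⟩
        exact ⟨⟨c.h y, hS ⟨y, hy, rfl⟩, rfl⟩, c.h y, ⟨y, hy, rfl⟩, rfl⟩
    · intro y hy y' hy' hh
      exact hinj hy hy' (hφ (hS ⟨y, hy, rfl⟩) (hS ⟨y', hy', rfl⟩) hh)

theorem CovOn.ofRef {Q : Chart p V → Prop} (c : Chart p V) (hinj : Set.InjOn c.h c.Y)
    {Q0 : Set (c.ι → ℚ_[p]) → Prop} (h : Ref Q0 c.Y)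
    (hQ : ∀ Z (hZ : Z ⊆ c.Y) (hs : SA Z), Q0 Z → Q (c.restr Z hZ hs)) : CovOn Q c.img := by
  have key : ∀ Y, Y ⊆ c.Y → Ref Q0 Y → CovOn Q (c.h '' Y) := by
    intro Y hY h
    induction h with
    | one Y hYs h0 => exact CovOn.chart (c.restr Y hY hYs) (hQ Y hY hYs h0) (hinj.mono hY)
    | split Y A hA _ _ ih1 ih2 =>
      have h1 : Y ∩ A ⊆ c.Y := Set.inter_subset_left.trans hY
      have h2 : Y \ A ⊆ c.Y := Set.sdiff_subset.trans hY
      have := CovOn.union _ _ ?_ (ih1 h1) (ih2 h2)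
      · rwa [← Set.image_union, Set.inter_union_sdiff] at this
      · rw [Set.disjoint_left]
        rintro _ ⟨y, hy, rfl⟩ ⟨y', hy', hh⟩
        have := hinj (h2 hy') (h1 hy) hh
        subst this
        exact hy'.2 hy.2
  exact key c.Y subset_rfl h

theorem CovOn.ofCover {α : Type*} (s : Finset α) (c : α → Chart p V) {Q : Chart p V → Prop}
    (hinj : ∀ a ∈ s, Set.InjOn (c a).h (c a).Y)
    (hov : ∀ a ∈ s, ∀ b ∈ s, SA {y | y ∈ (c a).Y ∧ (c a).h y ∈ (c b).img})
    (hQ : ∀ a ∈ s, ∀ Z (hZ : Z ⊆ (c a).Y) (hs : SA Z), Q ((c a).restr Z hZ hs)) :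
    CovOn Q {v | ∃ a ∈ s, v ∈ (c a).img} := by
  classical
  induction s using Finset.induction_on with
  | empty => convert CovOn.empty (Q := Q) using 1; ext w; simp
  | insert a s ha ih =>
    have ih' := ih (fun b hb => hinj b (by simp [hb]))
      (fun b hb d hd => hov b (by simp [hb]) d (by simp [hd])) (fun b hb => hQ b (by simp [hb]))
    set Z : Set ((c a).ι → ℚ_[p]) :=
      {y | y ∈ (c a).Y ∧ ∀ b ∈ s, ¬ (y ∈ (c a).Y ∧ (c a).h y ∈ (c b).img)} with hZdef
    have hZs : SA Z := SA.and (c a).sa (SA.finset_all s fun b hb =>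
      SA.not (hov a (by simp) b (by simp [hb])))
    have hZ : Z ⊆ (c a).Y := fun y hy => hy.1
    have h1 := CovOn.chart _ (hQ a (by simp) Z hZ hZs) ((hinj a (by simp)).mono hZ)
    have := CovOn.union _ _ ?_ h1 ih'
    · convert this using 1
      ext v
      simp only [Finset.mem_insert, exists_eq_or_imp, Set.mem_ofPred_eq, Set.mem_union]
      constructor
      · rintro (⟨y, hy, rfl⟩ | h)
        · by_cases hh : ∃ b ∈ s, (c a).h y ∈ (c b).img
          · exact Or.inr hh
          · left
            refine ⟨y, ⟨hy, fun b hb h3 => hh ⟨b, hb, h3.2⟩⟩, rfl⟩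
        · exact Or.inr h
      · rintro (⟨y, hy, rfl⟩ | h)
        · exact Or.inl ⟨y, hZ hy, rfl⟩
        · exact Or.inr h
    · rw [Set.disjoint_left]
      rintro _ ⟨y, hy, rfl⟩ ⟨b, hb, hh⟩
      exact hy.2 b hb ⟨hy.1, hh⟩

theorem CovOn.ofChart {Q : Chart p V → Prop} {S : Set V} (c : Chart p V)
    (hinj : Set.InjOn c.h c.Y) (hQ : Q c) (hS : c.img = S) : CovOn Q S := by
  rw [← hS]; exact CovOn.chart c hQ hinj

theorem CovOn.of_eq {Q : Chart p V → Prop} {S T : Set V} (h : CovOn Q S) (hST : S = T) :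
    CovOn Q T := hST ▸ h

theorem SA.of_ref {Y : Set (ι → ℚ_[p])} {P : (ι → ℚ_[p]) → Prop}
    (h : Ref (fun Z => SA {y | y ∈ Z ∧ P y}) Y) : SA {y | y ∈ Y ∧ P y} := by
  induction h with
  | one Y _ h => exact h
  | split Y A hA _ _ ih1 ih2 =>
    convert SA.or ih1 ih2 using 2
    ext y
    by_cases h : y ∈ A <;> simp [h]

/-! ### Good families -/

/-- Prepared function on a chart. -/
def Prep (ε : ℝ) (f : V → ℚ_[p]) (c : Chart p V) : Prop :=
  DOn (fun y => f (c.h y)) c.Y ∧ MonOn ε (fun y => f (c.h y)) c.Y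

theorem Prep.restr {ε ε' : ℝ} {f : V → ℚ_[p]} {c : Chart p V} (h : Prep ε f c) (hε : ε ≤ ε')
    (Z : Set (c.ι → ℚ_[p])) (hZ : Z ⊆ c.Y) (hs : SA Z) : Prep ε' f (c.restr Z hZ hs) :=
  ⟨h.1.mono hZ, h.2.mono hε hZ⟩

variable {R : Type} [CommRing R] {R' V' : Type} [CommRing R']

def Good (ev : V → R →+* ℚ_[p]) (S : Set V) : Prop :=
  ∀ (L : Set R) (_ : L.Finite) (ε : ℝ) (_ : 0 < ε),
    CovOn (fun c => ∀ a ∈ L, Prep ε (fun v => ev v a) c) S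

/-- Sets definable on sufficiently prepared charts. -/
def Dfn (ev : V → R →+* ℚ_[p]) (S : Set V) (C : Set (V × ℚ_[p])) : Prop :=
  ∃ L : Set R, L.Finite ∧ ∃ ε : ℝ, 0 < ε ∧ ∀ c : Chart p V, c.img ⊆ S →
    (∀ a ∈ L, MonOn ε (fun y => ev (c.h y) a) c.Y) →
    ∀ σ, MonOn ε σ c.Y → SA {y | y ∈ c.Y ∧ (c.h y, σ y) ∈ C}

theorem Dfn.inter {ev : V → R →+* ℚ_[p]} {S : Set V} {C C' : Set (V × ℚ_[p])}
    (h : Dfn ev S C) (h' : Dfn ev S C') : Dfn ev S (C ∩ C') := by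
  obtain ⟨L, hL, ε, hε, h⟩ := h
  obtain ⟨L', hL', ε', hε', h'⟩ := h'
  refine ⟨L ∪ L', hL.union hL', min ε ε', lt_min hε hε', fun c hc hM σ hσ => ?_⟩
  have h1 := h c hc (fun a ha => (hM a (Or.inl ha)).mono (min_le_left _ _) subset_rfl) σ
    (hσ.mono (min_le_left _ _) subset_rfl)
  have h2 := h' c hc (fun a ha => (hM a (Or.inr ha)).mono (min_le_right _ _) subset_rfl) σ
    (hσ.mono (min_le_right _ _) subset_rfl)
  convert SA.and h1 h2 using 2
  ext y; simp only [Set.mem_inter_iff]; tauto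

theorem Dfn.compl {ev : V → R →+* ℚ_[p]} {S : Set V} {C : Set (V × ℚ_[p])}
    (h : Dfn ev S C) : Dfn ev S Cᶜ := by
  obtain ⟨L, hL, ε, hε, h⟩ := h
  refine ⟨L, hL, ε, hε, fun c hc hM σ hσ => ?_⟩
  convert SA.diff c.sa (h c hc hM σ hσ) using 1
  ext y
  simp only [Set.mem_compl_iff, Set.mem_ofPred_eq, Set.mem_sdiff]
  tauto

theorem Dfn.pull {ev : V → R →+* ℚ_[p]} {S : Set V} {C : Set (V × ℚ_[p])}
    (h : Dfn ev S C) {ev' : V' → R' →+* ℚ_[p]} {S' : Set V'} (j : R → R') (π : V' → V)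
    (hπ : ∀ v ∈ S', π v ∈ S) (hev : ∀ v a, ev' v (j a) = ev (π v) a) :
    Dfn ev' S' {q | (π q.1, q.2) ∈ C} := by
  obtain ⟨L, hL, ε, hε, h⟩ := h
  refine ⟨j '' L, hL.image _, ε, hε, fun c hc hM σ hσ => ?_⟩
  refine h (c.map π) ?_ ?_ σ hσ
  · rintro _ ⟨y, hy, rfl⟩; exact hπ _ (hc ⟨y, hy, rfl⟩)
  · intro a ha
    have := hM (j a) ⟨a, ha, rfl⟩
    simp only [hev] at this
    exact this

end PSub
end Part3


section Part4
open PadicSub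

namespace PSub

variable {p : ℕ} [hp : Fact p.Prime] {V : Type}

theorem pow_sub_one_le {z : ℚ_[p]} (hz : ‖z‖ ≤ 1) (i : ℕ) : ‖z ^ i - 1‖ ≤ ‖z - 1‖ := by
  rw [← geom_sum_mul, norm_mul]
  have : ‖∑ k ∈ Finset.range i, z ^ k‖ ≤ 1 :=
    sum_le_of _ _ zero_le_one fun k _ => by rw [norm_pow]; exact pow_le_one₀ (norm_nonneg _) hz
  nlinarith [norm_nonneg (z - 1)]

theorem root_unique (n : ℕ) (hn : 0 < n) : ∃ M : ℕ, 0 < M ∧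
    ∀ w ∈ Pset p M, ∀ w' ∈ Pset p M, w ^ n = w' ^ n → w = w' := by
  have hn0 : 0 < ‖(n : ℚ_[p])‖ := by rw [norm_pos_iff]; exact_mod_cast hn.ne'
  obtain ⟨j, hj⟩ := exists_pow_lt_of_lt_one hn0 (norm_p_lt (p := p))
  refine ⟨Nat.totient (p ^ j), Nat.totient_pos.2 (pow_pos hp.out.pos _), ?_⟩
  intro w hw w' hw' hww
  have hq := Pset_mul hw (Pset_inv hw')
  have hz1 : (w * w'⁻¹) ^ n = 1 := by
    rw [mul_pow, inv_pow, hww, mul_inv_cancel₀ (pow_ne_zero _ (Pset_ne hw'))]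
  obtain ⟨t, ht, htz⟩ := hq
  set z := w * w'⁻¹ with hz
  have hzn : ‖z‖ = 1 := by
    have := congrArg norm hz1
    rw [norm_pow, norm_one] at this
    exact (pow_eq_one_iff_of_nonneg (norm_nonneg _) hn.ne').1 this
  have htn : ‖t‖ = 1 := by
    have := congrArg norm htz
    rw [norm_pow, hzn] at this
    exact (pow_eq_one_iff_of_nonneg (norm_nonneg _)
      (Nat.totient_pos.2 (pow_pos hp.out.pos _)).ne').1 this
  let T : ℤ_[p] := ⟨t, htn.le⟩
  have hTu : IsUnit T := PadicInt.isUnit_iff.2 htn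
  have hmod : PadicInt.toZModPow j (T ^ Nat.totient (p ^ j) - 1) = 0 := by
    obtain ⟨u, hu⟩ := hTu.map (PadicInt.toZModPow (p := p) j)
    rw [map_sub, map_pow, ← hu, map_one, ← Units.val_pow_eq_pow_val, ZMod.pow_totient]
    simp
  rw [← RingHom.mem_ker, PadicInt.ker_toZModPow, ← PadicInt.norm_le_pow_iff_mem_span_pow] at hmod
  have hzj : ‖z - 1‖ < ‖(n : ℚ_[p])‖ := by
    refine lt_of_le_of_lt ?_ hj
    rw [← htz]
    rw [PadicInt.norm_def] at hmod
    push_cast at hmod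
    rw [← norm_pow, Padic.norm_p_pow]
    exact hmod
  by_contra hne
  have hz_ne : z - 1 ≠ 0 := by
    intro h
    apply hne
    have h1 : w * w'⁻¹ = 1 := by rw [← hz]; exact sub_eq_zero.1 h
    exact (mul_inv_eq_one₀ (Pset_ne hw')).1 h1
  have hsum : ∑ i ∈ Finset.range n, z ^ i = 0 := by
    have := geom_sum_mul z n
    rw [hz1, sub_self] at this
    exact (mul_eq_zero.1 this).resolve_right hz_ne
  have : ‖∑ i ∈ Finset.range n, z ^ i - n‖ < ‖(n : ℚ_[p])‖ := by
    have h2 : ∑ i ∈ Finset.range n, z ^ i - n = ∑ i ∈ Finset.range n, (z ^ i - 1) := by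
      rw [Finset.sum_sub_distrib]; simp
    rw [h2]
    exact sum_lt_of _ _ hn0 fun i _ => (pow_sub_one_le hzn.le i).trans_lt hzj
  have := norm_eq_of_sub_lt this
  rw [hsum, norm_zero] at this
  exact hn0.ne this

theorem CovOn.power {Q : Chart p V → Prop} (c : Chart p V) (hinj : Set.InjOn c.h c.Y)
    (n : ℕ) (hn : 0 < n)
    (hQ : ∀ (l : c.ι → ℚ_[p]) (_ : PSub.tor l) (Z : Set (c.ι → ℚ_[p])) (hs : SA Z)
      (ht : ∀ w ∈ Z, PSub.tor w) (_ : ∀ w ∈ Z, (fun i => l i * w i ^ n) ∈ c.Y),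
      Q ⟨c.ι, Z, fun w => c.h (fun i => l i * w i ^ n), hs, ht⟩) : CovOn Q c.img := by
  classical
  obtain ⟨M, hM, hMu⟩ := root_unique (p := p) n hn
  obtain ⟨Λ, hΛ, hcov⟩ := coset_reps (p := p) (M * n) (by positivity)
  have hlau : ∀ (l : c.ι → ℚ_[p]) (i : c.ι), Lau (fun w : c.ι → ℚ_[p] => l i * w i ^ n) :=
    fun l i => (Lau.const _).mul ((Lau.coord i).pow n)
  let Z : (c.ι → ℚ_[p]) → Set (c.ι → ℚ_[p]) := fun l =>
    {w | (PSub.tor w ∧ (fun i => l i * w i ^ n) ∈ c.Y) ∧ ∀ i, (PSub.tor w ∧ w i ∈ Pset p M)}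
  have hZs : ∀ l, SA (Z l) := fun l => SA.and (SA.lau_preimage c.sa (hlau l))
    (SA.all fun i => SA.lau_pow (Lau.coord i) M hM)
  let d : (c.ι → ℚ_[p]) → Chart p V := fun l =>
    ⟨c.ι, Z l, fun w => c.h (fun i => l i * w i ^ n), hZs l, fun w hw => hw.1.1⟩
  have hmemΛ : ∀ l ∈ Fintype.piFinset (fun _ : c.ι => Λ), ∀ i, l i ≠ 0 := fun l hl i =>
    hΛ _ (Fintype.mem_piFinset.1 hl i)
  have := CovOn.ofCover (Fintype.piFinset (fun _ : c.ι => Λ)) d (Q := Q) ?_ ?_ ?_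
  · refine this.of_eq ?_
    ext v
    constructor
    · rintro ⟨l, hl, w, hw, rfl⟩; exact ⟨_, hw.1.2, rfl⟩
    · rintro ⟨y, hy, rfl⟩
      choose l hl hP using fun i => hcov (y i) (c.tor y hy i)
      choose t ht0 ht using hP
      have hyl : (fun i => l i * (t i ^ M) ^ n) = y := by
        ext i
        rw [← pow_mul, ht i, mul_div_cancel₀ _ (hΛ _ (hl i))]
      refine ⟨l, Fintype.mem_piFinset.2 hl, fun i => t i ^ M, ⟨⟨fun i => pow_ne_zero _ (ht0 i),
        by rw [hyl]; exact hy⟩, fun i => ⟨fun i => pow_ne_zero _ (ht0 i), Pset_pow (ht0 i)⟩⟩, ?_⟩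
      change c.h (fun i => l i * (t i ^ M) ^ n) = c.h y
      rw [hyl]
  · intro l hl w hw w' hw' hh
    have := hinj hw.1.2 hw'.1.2 hh
    ext i
    have hi := congrFun this i
    exact hMu _ (hw.2 i).2 _ (hw'.2 i).2 (mul_left_cancel₀ (hmemΛ l hl i) hi)
  · intro l hl l' hl'
    convert SA.and (hZs l) (SA.all (fun i => SA.lau_pow ((Lau.const (l' i)⁻¹).mul (hlau l i))
      (M * n) (by positivity))) using 2
    ext w
    refine and_congr_right fun hw => ?_
    have hw1 : w ∈ Z l := hw
    constructor
    · rintro ⟨w', hw', hh⟩ i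
      refine ⟨hw1.1.1, ?_⟩
      have h1 := congrFun (hinj hw'.1.2 hw1.1.2 hh) i
      rw [← h1, inv_mul_cancel_left₀ (hmemΛ l' hl' i)]
      obtain ⟨t, ht0, ht⟩ := (hw'.2 i).2
      exact ⟨t, ht0, by rw [pow_mul, ht]⟩
    · intro hP
      choose t ht0 ht using fun i => (hP i).2
      have hyl : (fun i => l' i * (t i ^ M) ^ n) = (fun i => l i * w i ^ n) := by
        ext i
        rw [← pow_mul, ht i, mul_inv_cancel_left₀ (hmemΛ l' hl' i)]
      refine ⟨fun i => t i ^ M, ⟨⟨fun i => pow_ne_zero _ (ht0 i), ?_⟩,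
        fun i => ⟨fun i => pow_ne_zero _ (ht0 i), Pset_pow (ht0 i)⟩⟩, ?_⟩
      · rw [hyl]; exact hw1.1.2
      · change c.h (fun i => l' i * (t i ^ M) ^ n) = c.h (fun i => l i * w i ^ n)
        rw [hyl]
  · intro l hl Z' hZ' hs
    exact hQ l (hmemΛ l hl) Z' hs (fun w hw => (hZ' hw).1.1) (fun w hw => (hZ' hw).1.2)

end PSub
end Part4


section Part5
open PadicSub

namespace PSub

variable {p : ℕ} [hp : Fact p.Prime]

/-! ### Limits of polynomials over `ℤ_p` -/

theorem dvd_iff_norm (x : ℤ_[p]) (n : ℕ) : (p : ℤ_[p]) ^ n ∣ x ↔ ‖x‖ ≤ (p : ℝ) ^ (-n : ℤ) := by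
  rw [PadicInt.norm_le_pow_iff_mem_span_pow, Ideal.mem_span_singleton]

theorem eq_zero_of_dvd (x : ℤ_[p]) (h : ∀ n : ℕ, (p : ℤ_[p]) ^ n ∣ x) : x = 0 := by
  by_contra hx
  obtain ⟨n, hn⟩ := PadicInt.exists_pow_neg_lt p (norm_pos_iff.2 hx)
  exact absurd ((dvd_iff_norm x n).1 (h n)) (not_le.2 hn)

theorem dvd_of_step {A : Type*} [CommRing A] (q : A) (u : ℕ → A)
    (h : ∀ n, q ^ n ∣ u (n + 1) - u n) (m k : ℕ) : q ^ m ∣ u (m + k) - u m := by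
  induction k with
  | zero => simp
  | succ k ih =>
    have h1 : q ^ m ∣ u (m + k + 1) - u (m + k) := (pow_dvd_pow q (Nat.le_add_right m k)).trans (h _)
    have := dvd_add h1 ih
    rwa [sub_add_sub_cancel] at this

theorem exists_lim (u : ℕ → ℤ_[p]) (h : ∀ n, (p : ℤ_[p]) ^ n ∣ u (n + 1) - u n) :
    ∃ a : ℤ_[p], ∀ n, (p : ℤ_[p]) ^ n ∣ a - u n := by
  have hc : CauchySeq u := by
    have hp1 : ((p : ℝ)⁻¹) < 1 := inv_lt_one_of_one_lt₀ (one_lt_p (p := p))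
    refine cauchySeq_of_le_geometric _ 1 hp1 fun n => ?_
    have := (dvd_iff_norm _ n).1 (h n)
    rw [dist_comm, dist_eq_norm]
    simpa using this
  obtain ⟨a, ha⟩ := cauchySeq_tendsto_of_complete hc
  refine ⟨a, fun n => (dvd_iff_norm _ n).2 ?_⟩
  refine le_of_tendsto (((ha.sub_const (u n)).norm)) ?_
  filter_upwards [Filter.eventually_ge_atTop n] with m hm
  obtain ⟨k, rfl⟩ := Nat.exists_eq_add_of_le hm
  exact (dvd_iff_norm _ n).1 (dvd_of_step _ u h n k)

variable {M : ℕ}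

/-- Functions on `ℤ_p^M` given by restricted power series over `ℤ_p`. -/
def IsT (F : (Fin M → ℤ_[p]) → ℤ_[p]) : Prop :=
  ∃ Q : ℕ → MvPolynomial (Fin M) ℤ_[p],
    (∀ n, (p : MvPolynomial (Fin M) ℤ_[p]) ^ n ∣ Q (n + 1) - Q n) ∧
    ∀ n x, (p : ℤ_[p]) ^ n ∣ F x - MvPolynomial.eval x (Q n)

theorem dvd_eval {q : MvPolynomial (Fin M) ℤ_[p]} {n : ℕ}
    (h : (p : MvPolynomial (Fin M) ℤ_[p]) ^ n ∣ q) (x : Fin M → ℤ_[p]) :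
    (p : ℤ_[p]) ^ n ∣ MvPolynomial.eval x q := by
  have := (MvPolynomial.eval x).map_dvd h
  simpa using this

theorem dvd_coeff {q : MvPolynomial (Fin M) ℤ_[p]} {n : ℕ}
    (h : (p : MvPolynomial (Fin M) ℤ_[p]) ^ n ∣ q) (i : Fin M →₀ ℕ) :
    (p : ℤ_[p]) ^ n ∣ MvPolynomial.coeff i q := by
  have hC : (p : MvPolynomial (Fin M) ℤ_[p]) ^ n = MvPolynomial.C ((p : ℤ_[p]) ^ n) := by simp
  rw [hC] at h
  exact MvPolynomial.C_dvd_iff_dvd_coeff _ _ |>.1 h i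

theorem isT_lim (Q : ℕ → MvPolynomial (Fin M) ℤ_[p])
    (hQ : ∀ n, (p : MvPolynomial (Fin M) ℤ_[p]) ^ n ∣ Q (n + 1) - Q n) :
    ∃ F : (Fin M → ℤ_[p]) → ℤ_[p], IsT F ∧
      ∀ n x, (p : ℤ_[p]) ^ n ∣ F x - MvPolynomial.eval x (Q n) := by
  have : ∀ x, ∃ a : ℤ_[p], ∀ n, (p : ℤ_[p]) ^ n ∣ a - MvPolynomial.eval x (Q n) := by
    intro x
    refine exists_lim _ fun n => ?_
    have := dvd_eval (hQ n) x
    rwa [map_sub] at this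
  choose F hF using this
  exact ⟨F, ⟨Q, hQ, fun n x => hF x n⟩, fun n x => hF x n⟩

theorem tsum_norm_le {α : Type*} {f : α → ℚ_[p]} (hf : Summable f) {r : ℝ} (hr : 0 ≤ r)
    (h : ∀ a, ‖f a‖ ≤ r) : ‖∑' a, f a‖ ≤ r :=
  le_of_tendsto hf.hasSum.norm (Filter.Eventually.of_forall fun s =>
    sum_le_of s f hr fun a _ => h a)

theorem IsT.ranal {F : (Fin M → ℤ_[p]) → ℤ_[p]} (hF : IsT F) :
    ∃ a : (Fin M → ℕ) → ℚ_[p], IsRestrictedCoeffs p a ∧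
      ∀ x : Fin M → ℤ_[p], ranalFn p a (fun i => (x i : ℚ_[p])) = F x := by
  obtain ⟨Q, hQ, hF⟩ := hF
  let E : (Fin M →₀ ℕ) ≃ (Fin M → ℕ) := Finsupp.equivFunOnFinite
  have : ∀ i : Fin M → ℕ, ∃ a : ℤ_[p], ∀ n,
      (p : ℤ_[p]) ^ n ∣ a - MvPolynomial.coeff (E.symm i) (Q n) := by
    intro i
    refine exists_lim _ fun n => ?_
    have := dvd_coeff (hQ n) (E.symm i)
    rwa [MvPolynomial.coeff_sub] at this
  choose a ha using this
  have hpn : ∀ n : ℕ, (0 : ℝ) ≤ (p : ℝ) ^ (-n : ℤ) := fun n => by positivity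
  have hsm : ∀ ε : ℝ, 0 < ε → ∃ n : ℕ, (p : ℝ) ^ (-n : ℤ) < ε := fun ε hε =>
    PadicInt.exists_pow_neg_lt p hε
  have hr : IsRestrictedCoeffs p (fun i => (a i : ℚ_[p])) := by
    rw [IsRestrictedCoeffs, Metric.tendsto_nhds]
    intro ε hε
    obtain ⟨n, hn⟩ := hsm ε hε
    rw [Filter.eventually_cofinite]
    refine ((Q n).support.finite_toSet.image E).subset ?_
    intro i hi
    refine ⟨E.symm i, ?_, by simp⟩
    by_contra hns
    apply hi
    have h1 := (dvd_iff_norm _ _).1 (ha i n)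
    have h0 : MvPolynomial.coeff (E.symm i) (Q n) = 0 := by
      simpa using hns
    rw [h0, sub_zero] at h1
    rw [dist_zero_right]
    exact lt_of_le_of_lt h1 hn
  refine ⟨_, hr, fun x => ?_⟩
  have hx : ∀ j, ‖((x j : ℤ_[p]) : ℚ_[p])‖ ≤ 1 := fun j => (x j).2
  have hprod : ∀ i : Fin M → ℕ, ‖∏ j, ((x j : ℤ_[p]) : ℚ_[p]) ^ i j‖ ≤ 1 := by
    intro i
    rw [norm_prod]
    refine Finset.prod_le_one (fun _ _ => norm_nonneg _) fun j _ => ?_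
    rw [norm_pow]; exact pow_le_one₀ (norm_nonneg _) (hx j)
  have hsum : Summable fun i : Fin M → ℕ => (a i : ℚ_[p]) * ∏ j, ((x j : ℤ_[p]) : ℚ_[p]) ^ i j := by
    apply NonarchimedeanAddGroup.summable_of_tendsto_cofinite_zero
    refine squeeze_zero_norm (fun i => ?_) (tendsto_zero_iff_norm_tendsto_zero.1 hr)
    rw [norm_mul]
    exact mul_le_of_le_one_right (norm_nonneg _) (hprod i)
  rw [ranalFn, if_pos hx]
  rw [← sub_eq_zero, ← norm_eq_zero]
  refine le_antisymm (le_of_forall_pos_lt_add fun ε hε => ?_) (norm_nonneg _)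
  rw [zero_add]
  obtain ⟨n, hn⟩ := hsm ε hε
  refine lt_of_le_of_lt ?_ hn
  -- compare with the polynomial
  let b : (Fin M → ℕ) → ℚ_[p] := fun i =>
    ((MvPolynomial.coeff (E.symm i) (Q n) : ℤ_[p]) : ℚ_[p]) * ∏ j, ((x j : ℤ_[p]) : ℚ_[p]) ^ i j
  have hb : HasSum b ((MvPolynomial.eval x (Q n) : ℤ_[p]) : ℚ_[p]) := by
    have hb1 : HasSum b (∑ i ∈ (Q n).support.map E.toEmbedding, b i) := by
      refine hasSum_sum_of_ne_finset_zero fun i hi => ?_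
      have : MvPolynomial.coeff (E.symm i) (Q n) = 0 := by
        by_contra hne
        apply hi
        rw [Finset.mem_map]
        exact ⟨E.symm i, MvPolynomial.mem_support_iff.2 hne, by simp⟩
      simp [b, this]
    convert hb1 using 1
    rw [Finset.sum_map, MvPolynomial.eval_eq']
    change PadicInt.Coe.ringHom _ = _
    simp only [map_sum, map_mul, map_prod, map_pow]
    refine Finset.sum_congr rfl fun i _ => ?_
    simp only [b, Equiv.coe_toEmbedding, Equiv.symm_apply_apply]
    rfl
  have h1 : HasSum (fun i => (a i : ℚ_[p]) * ∏ j, ((x j : ℤ_[p]) : ℚ_[p]) ^ i j - b i) _ :=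
    hsum.hasSum.sub hb
  have h2 := tsum_norm_le h1.summable (hpn n) (fun i => by
    simp only [b]
    rw [← sub_mul, norm_mul]
    refine (mul_le_of_le_one_right (norm_nonneg _) (hprod i)).trans ?_
    exact_mod_cast (dvd_iff_norm _ _).1 (ha i n))
  rw [h1.tsum_eq] at h2
  have h3 := (dvd_iff_norm _ _).1 (hF n x)
  have h4 : ‖((F x : ℤ_[p]) : ℚ_[p]) - ((MvPolynomial.eval x (Q n) : ℤ_[p]) : ℚ_[p])‖ ≤
      (p : ℝ) ^ (-n : ℤ) := by exact_mod_cast h3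
  have := sub_le_of h2 h4
  rwa [sub_sub_sub_cancel_right] at this

/-- The Hensel function. -/
theorem hensel_fn (D : ℕ) : ∃ ζ : (Fin (D + 1) → ℚ_[p]) → ℚ_[p], DF ζ ∧
    ∀ e : Fin (D + 1) → ℚ_[p], (∀ i, ‖e i‖ ≤ 1) → ‖ζ e‖ ≤ 1 ∧
      p * e 0 + ζ e + p * ∑ k ∈ Finset.univ.filter (fun k : Fin (D + 1) => 2 ≤ (k : ℕ)),
        e k * ζ e ^ (k : ℕ) = 0 := by
  let s : Finset (Fin (D + 1)) := Finset.univ.filter (fun k : Fin (D + 1) => 2 ≤ (k : ℕ))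
  let X : Fin (D + 1) → MvPolynomial (Fin (D + 1)) ℤ_[p] := MvPolynomial.X
  let z : ℕ → MvPolynomial (Fin (D + 1)) ℤ_[p] := fun n => Nat.rec 0
    (fun _ z => - (p * (X 0 + ∑ k ∈ s, X k * z ^ (k : ℕ)))) n
  have hz : ∀ n, z (n + 1) = - (p * (X 0 + ∑ k ∈ s, X k * z n ^ (k : ℕ))) := fun n => rfl
  have hd : ∀ n, (p : MvPolynomial (Fin (D + 1)) ℤ_[p]) ^ (n + 1) ∣ z (n + 1) - z n := by
    intro n
    induction n with
    | zero =>
      rw [hz, zero_add, pow_one, show z 0 = 0 from rfl, sub_zero]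
      exact (Dvd.intro _ rfl).neg_right
    | succ n ih =>
      have : z (n + 1 + 1) - z (n + 1) = - (p * ∑ k ∈ s, X k * (z (n + 1) ^ (k : ℕ) - z n ^ (k : ℕ))) := by
        rw [hz (n + 1)]
        conv_lhs => rw [hz n]
        simp only [mul_sub, Finset.sum_sub_distrib]
        rw [← hz n]
        ring
      rw [this, pow_succ' _ (n + 1)]
      refine (mul_dvd_mul_left _ (Finset.dvd_sum fun k _ => ?_)).neg_right
      exact ((ih.trans (sub_dvd_pow_sub_pow _ _ _))).mul_left _
  obtain ⟨F, hFT, hF⟩ := isT_lim z fun n => (pow_dvd_pow _ (Nat.le_succ n)).trans (hd n)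
  obtain ⟨a, ha, hE⟩ := hFT.ranal
  refine ⟨ranalFn p a, DF.ranal a ha (fun i y => y i) DF.coord, fun e he => ?_⟩
  let x : Fin (D + 1) → ℤ_[p] := fun i => ⟨e i, he i⟩
  have hex : e = fun i => ((x i : ℤ_[p]) : ℚ_[p]) := rfl
  rw [hex, hE]
  refine ⟨(F x).2, ?_⟩
  have : (p : ℤ_[p]) * x 0 + F x + p * ∑ k ∈ s, x k * F x ^ (k : ℕ) = 0 := by
    refine eq_zero_of_dvd _ fun n => ?_
    have h1 : (p : ℤ_[p]) ^ n ∣ F x - MvPolynomial.eval x (z (n + 1)) :=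
      (pow_dvd_pow _ (Nat.le_succ n)).trans (hF (n + 1) x)
    have h2 : (p : ℤ_[p]) ^ n ∣ p * ∑ k ∈ s, x k * (F x ^ (k : ℕ) - MvPolynomial.eval x (z n) ^ (k : ℕ)) := by
      refine (Finset.dvd_sum fun k _ => ?_).mul_left _
      exact ((hF n x).trans (sub_dvd_pow_sub_pow _ _ _)).mul_left _
    have := dvd_add h1 h2
    convert this using 1
    rw [hz]
    simp only [mul_sub, Finset.sum_sub_distrib, map_neg, map_mul, map_natCast, map_add, map_sum,
      map_pow, X, MvPolynomial.eval_X]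
    ring
  have := congrArg (PadicInt.Coe.ringHom) this
  simp only [map_sum, map_mul, map_add, map_pow, map_natCast, map_zero] at this
  exact this

end PSub
end Part5


section Part6
open PadicSub

namespace PSub

variable {p : ℕ} [hp : Fact p.Prime]

/-! ### Estimates for polynomials -/

open Polynomial

/-- `x` times the derivative of `g` at `x`. -/
noncomputable def ed (g : ℚ_[p][X]) (s : ℚ_[p]) : ℚ_[p] := s * g.derivative.eval s

def Est (δ : ℝ) (g : ℚ_[p][X]) (s : ℚ_[p]) : Prop :=
  ∀ i, δ * (‖g.coeff i‖ * ‖s‖ ^ i) ≤ ‖g.eval s‖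

def DEst (δ : ℝ) (g : ℚ_[p][X]) (s : ℚ_[p]) : Prop :=
  ∀ i, 1 ≤ i → δ * (‖g.coeff i‖ * ‖s‖ ^ i) ≤ ‖ed g s‖

theorem Est.mono {δ δ' : ℝ} (hδ : δ' ≤ δ) {g : ℚ_[p][X]} {s : ℚ_[p]} (h : Est δ g s) :
    Est δ' g s := fun i => (mul_le_mul_of_nonneg_right hδ (by positivity)).trans (h i)

theorem DEst.mono {δ δ' : ℝ} (hδ : δ' ≤ δ) {g : ℚ_[p][X]} {s : ℚ_[p]} (h : DEst δ g s) :
    DEst δ' g s := fun i hi => (mul_le_mul_of_nonneg_right hδ (by positivity)).trans (h i hi)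

theorem eval_sum {g : ℚ_[p][X]} {D : ℕ} (hg : g.natDegree ≤ D) (s : ℚ_[p]) :
    g.eval s = ∑ i ∈ Finset.range (D + 1), g.coeff i * s ^ i :=
  eval_eq_sum_range' (Nat.lt_succ_of_le hg) s

theorem ed_sum {g : ℚ_[p][X]} {D : ℕ} (hg : g.natDegree ≤ D) (s : ℚ_[p]) :
    ed g s = ∑ i ∈ Finset.range (D + 1), (i : ℚ_[p]) * (g.coeff i * s ^ i) := by
  rw [ed, derivative_eval, sum_over_range' _ _ (D + 1) (Nat.lt_succ_of_le hg), Finset.mul_sum]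
  · refine Finset.sum_congr rfl fun i _ => ?_
    rcases i with _ | i
    · simp
    · simp [pow_succ]; ring
  · simp

theorem norm_nat_le (i : ℕ) : ‖(i : ℚ_[p])‖ ≤ 1 := by
  exact_mod_cast Padic.norm_int_le_one (p := p) (i : ℤ)

theorem norm_nat_lower (d : ℕ) : ∃ c : ℝ, 0 < c ∧ c ≤ 1 ∧
    ∀ i : ℕ, 1 ≤ i → i ≤ d → c ≤ ‖(i : ℚ_[p])‖ := by
  induction d with
  | zero => exact ⟨1, one_pos, le_rfl, fun i h1 h2 => by omega⟩
  | succ d ih =>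
    obtain ⟨c, h0, h1, h⟩ := ih
    have hd : 0 < ‖((d + 1 : ℕ) : ℚ_[p])‖ := by rw [norm_pos_iff]; exact_mod_cast d.succ_ne_zero
    refine ⟨min c ‖((d + 1 : ℕ) : ℚ_[p])‖, lt_min h0 hd, (min_le_left _ _).trans h1,
      fun i hi hid => ?_⟩
    rcases Nat.lt_or_ge i (d + 1) with hlt | hge
    · exact (min_le_left _ _).trans (h i hi (by omega))
    · obtain rfl : i = d + 1 := by omega
      exact min_le_right _ _

/-- An estimate for the derivative gives a `DEst`. -/
theorem DEst.of_deriv (d : ℕ) : ∃ c : ℝ, 0 < c ∧ c ≤ 1 ∧ ∀ (g : ℚ_[p][X]) (s : ℚ_[p]) (δ : ℝ),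
    0 ≤ δ → g.natDegree ≤ d → Est δ g.derivative s → DEst (c * δ) g s := by
  obtain ⟨c, h0, h1, h⟩ := norm_nat_lower (p := p) d
  refine ⟨c, h0, h1, fun g s δ hδ hg hE i hi => ?_⟩
  rcases Nat.lt_or_ge d i with hlt | hle
  · rw [coeff_eq_zero_of_natDegree_lt (lt_of_le_of_lt hg hlt)]; simp
  obtain ⟨j, rfl⟩ : ∃ j, i = j + 1 := ⟨i - 1, by omega⟩
  have h2 := hE j
  rw [coeff_derivative, norm_mul] at h2
  have h3 := h (j + 1) (by omega) hle
  push_cast at h3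
  rw [ed, norm_mul]
  calc c * δ * (‖g.coeff (j + 1)‖ * ‖s‖ ^ (j + 1))
      ≤ ‖(j : ℚ_[p]) + 1‖ * δ * (‖g.coeff (j + 1)‖ * ‖s‖ ^ (j + 1)) := by gcongr
    _ = ‖s‖ * (δ * (‖g.coeff (j + 1)‖ * ‖(j : ℚ_[p]) + 1‖ * ‖s‖ ^ j)) := by ring
    _ ≤ _ := by gcongr

/-- Closeness of coefficients. -/
def CoefClose (η : ℝ) (g g' : ℚ_[p][X]) : Prop :=
  ∀ i, ‖g'.coeff i - g.coeff i‖ ≤ η * ‖g.coeff i‖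

theorem CoefClose.refl {η : ℝ} (hη : 0 ≤ η) (g : ℚ_[p][X]) : CoefClose η g g := fun i => by
  rw [sub_self, norm_zero]; positivity

theorem CoefClose.norm {η : ℝ} (hη : η < 1) {g g' : ℚ_[p][X]} (h : CoefClose η g g') (i : ℕ) :
    ‖g'.coeff i‖ = ‖g.coeff i‖ := norm_eq_of_sub_le hη (h i)

theorem CoefClose.symm {η : ℝ} (hη : η < 1) {g g' : ℚ_[p][X]} (h : CoefClose η g g') :
    CoefClose η g' g := fun i => by
  rw [norm_sub_rev, h.norm hη]; exact h i

theorem pow_close {s s' : ℚ_[p]} {η : ℝ} (hη0 : 0 ≤ η) (hη : η < 1) (h : ‖s' - s‖ ≤ η * ‖s‖) (i : ℕ) :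
    ‖s' ^ i - s ^ i‖ ≤ η * ‖s‖ ^ i := by
  by_cases hs : s = 0
  · subst hs
    have : s' = 0 := by simpa using h
    subst this
    rw [sub_self, norm_zero]; positivity
  have hs0 : 0 < ‖s‖ := norm_pos_iff.2 hs
  have h1 : ‖s' / s - 1‖ ≤ η := by
    rw [div_sub_one hs, norm_div, div_le_iff₀ hs0]; exact h
  have h2 : ‖s' / s‖ ≤ 1 := by
    rw [norm_div, norm_eq_of_sub_le hη h, div_self hs0.ne']
  have h3 := (pow_sub_one_le h2 i).trans h1
  rw [div_pow, div_sub_one (pow_ne_zero _ hs), norm_div, norm_pow s i, div_le_iff₀ (by positivity)] at h3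
  exact h3

theorem term_close {g g' : ℚ_[p][X]} {s s' : ℚ_[p]} {η : ℝ} (hη0 : 0 ≤ η) (hη : η < 1)
    (hg : CoefClose η g g') (hs : ‖s' - s‖ ≤ η * ‖s‖) (i : ℕ) :
    ‖g'.coeff i * s' ^ i - g.coeff i * s ^ i‖ ≤ η * (‖g.coeff i‖ * ‖s‖ ^ i) := by
  have e : g'.coeff i * s' ^ i - g.coeff i * s ^ i
      = (g'.coeff i - g.coeff i) * s' ^ i + g.coeff i * (s' ^ i - s ^ i) := by ring
  rw [e]
  apply add_le_of
  · rw [norm_mul, norm_pow, norm_eq_of_sub_le hη hs, ← mul_assoc]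
    gcongr; exact hg i
  · rw [norm_mul, mul_left_comm]
    gcongr; exact pow_close hη0 hη hs i

theorem ed_close {g g' : ℚ_[p][X]} {D : ℕ} (hD : g.natDegree ≤ D) (hD' : g'.natDegree ≤ D)
    {s s' : ℚ_[p]} {η δ : ℝ} (hη0 : 0 ≤ η) (hη : η < 1) (hδ : 0 < δ)
    (hg : CoefClose η g g') (hs : ‖s' - s‖ ≤ η * ‖s‖) (h : DEst δ g s) :
    ‖ed g' s' - ed g s‖ ≤ η / δ * ‖ed g s‖ := by
  rw [ed_sum hD, ed_sum hD', ← Finset.sum_sub_distrib, ← ed_sum hD]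
  refine sum_le_of _ _ (by positivity) fun i _ => ?_
  rcases i with _ | i
  · simp; positivity
  rw [← mul_sub, norm_mul]
  calc _ ≤ 1 * (η * (‖g.coeff (i + 1)‖ * ‖s‖ ^ (i + 1))) :=
        mul_le_mul (norm_nat_le _) (term_close hη0 hη hg hs _) (norm_nonneg _) zero_le_one
    _ = η / δ * (δ * (‖g.coeff (i + 1)‖ * ‖s‖ ^ (i + 1))) := by field_simp
    _ ≤ _ := by gcongr; exact h _ (by omega)

theorem DEst.close {g g' : ℚ_[p][X]} {D : ℕ} (hD : g.natDegree ≤ D) (hD' : g'.natDegree ≤ D)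
    {s s' : ℚ_[p]} {η δ : ℝ} (hη0 : 0 ≤ η) (hηδ : η < δ) (hδ : 0 < δ) (hδ1 : δ ≤ 1)
    (hg : CoefClose η g g') (hs : ‖s' - s‖ ≤ η * ‖s‖) (h : DEst δ g s) :
    DEst δ g' s' ∧ ‖ed g' s'‖ = ‖ed g s‖ := by
  have hη : η < 1 := by linarith
  have h1 := norm_eq_of_sub_le (by rwa [div_lt_one hδ]) (ed_close hD hD' hη0 hη hδ hg hs h)
  refine ⟨fun i hi => ?_, h1⟩
  rw [h1, hg.norm hη, norm_eq_of_sub_le hη hs]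
  exact h i hi

theorem eval_close {g g' : ℚ_[p][X]} {D : ℕ} (hD : g.natDegree ≤ D) (hD' : g'.natDegree ≤ D)
    {s s' : ℚ_[p]} {η δ B : ℝ} (hη0 : 0 ≤ η) (hη : η < 1) (hδ : 0 < δ) (hδ1 : δ ≤ 1)
    (hg : CoefClose η g g') (hs : ‖s' - s‖ ≤ η * ‖s‖) (h : DEst δ g s) (hB : η / δ ≤ B)
    (hB1 : B ≤ 1) (hv : ‖g.eval s‖ ≤ B * ‖ed g s‖) : ‖g'.eval s'‖ ≤ B * ‖ed g s‖ := by
  have hB0 : 0 ≤ B := le_trans (by positivity) hB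
  have hall : ∀ i, ‖g.coeff i‖ * ‖s‖ ^ i ≤ δ⁻¹ * ‖ed g s‖ := by
    have hpos : ∀ i, 1 ≤ i → ‖g.coeff i‖ * ‖s‖ ^ i ≤ δ⁻¹ * ‖ed g s‖ := by
      intro i hi
      rw [inv_mul_eq_div, le_div_iff₀ hδ, mul_comm]
      exact h i hi
    intro i
    rcases i with _ | i
    · have e : g.coeff 0 = g.eval s - ∑ i ∈ Finset.range D, g.coeff (i + 1) * s ^ (i + 1) := by
        rw [eval_sum hD, Finset.sum_range_succ']; simp
      rw [pow_zero, mul_one, e]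
      apply sub_le_of
      · refine hv.trans ?_
        gcongr
        exact hB1.trans (by rw [one_le_inv₀ hδ]; exact hδ1)
      · refine sum_le_of _ _ (by positivity) fun i _ => ?_
        rw [norm_mul, norm_pow]; exact hpos _ (by omega)
    · exact hpos _ (by omega)
  have e : g'.eval s' = (∑ i ∈ Finset.range (D + 1), (g'.coeff i * s' ^ i - g.coeff i * s ^ i))
      + g.eval s := by
    rw [Finset.sum_sub_distrib, ← eval_sum hD, ← eval_sum hD']; ring
  rw [e]
  refine add_le_of (sum_le_of _ _ (by positivity) fun i _ => ?_) hv
  calc _ ≤ η * (‖g.coeff i‖ * ‖s‖ ^ i) := term_close hη0 hη hg hs _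
    _ ≤ η * (δ⁻¹ * ‖ed g s‖) := mul_le_mul_of_nonneg_left (hall i) hη0
    _ = η / δ * ‖ed g s‖ := by ring
    _ ≤ _ := by gcongr

/-- Coefficients of `g(m(1+x))`. -/
noncomputable def tc (D : ℕ) (a : ℕ → ℚ_[p]) (m : ℚ_[p]) (k : ℕ) : ℚ_[p] :=
  ∑ i ∈ Finset.range (D + 1), (i.choose k : ℚ_[p]) * (a i * m ^ i)

theorem eval_tc {g : ℚ_[p][X]} {D : ℕ} (hD : g.natDegree ≤ D) (m x : ℚ_[p]) :
    g.eval (m * (1 + x)) = ∑ k ∈ Finset.range (D + 1), tc D g.coeff m k * x ^ k := by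
  rw [eval_sum hD]
  simp only [tc, Finset.sum_mul]
  rw [Finset.sum_comm]
  refine Finset.sum_congr rfl fun i hi => ?_
  rw [mul_pow, add_comm 1 x, add_pow]
  rw [← Finset.sum_subset (Finset.range_mono (show i + 1 ≤ D + 1 by
    rw [Finset.mem_range] at hi; omega))]
  · rw [Finset.mul_sum, Finset.mul_sum]
    refine Finset.sum_congr rfl fun k _ => ?_
    simp; ring
  · intro k _ hk
    rw [Finset.mem_range, not_lt] at hk
    rw [Nat.choose_eq_zero_of_lt (by omega)]; simp

theorem tc_zero {g : ℚ_[p][X]} {D : ℕ} (hD : g.natDegree ≤ D) (m : ℚ_[p]) :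
    tc D g.coeff m 0 = g.eval m := by rw [eval_sum hD]; simp [tc]

theorem tc_one {g : ℚ_[p][X]} {D : ℕ} (hD : g.natDegree ≤ D) (m : ℚ_[p]) :
    tc D g.coeff m 1 = ed g m := by rw [ed_sum hD]; simp [tc]

theorem tc_le {g : ℚ_[p][X]} {D : ℕ} {δ : ℝ} (hδ : 0 < δ) {m : ℚ_[p]}
    (h : DEst δ g m) (k : ℕ) (hk : 1 ≤ k) : ‖tc D g.coeff m k‖ ≤ δ⁻¹ * ‖ed g m‖ := by
  refine sum_le_of _ _ (by positivity) fun i _ => ?_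
  rcases i with _ | i
  · rw [Nat.choose_eq_zero_of_lt (by omega)]; simp; positivity
  rw [norm_mul]
  refine (mul_le_of_le_one_left (norm_nonneg _) (norm_nat_le _)).trans ?_
  rw [inv_mul_eq_div, le_div_iff₀ hδ, mul_comm, norm_mul, norm_pow]
  exact h _ (by omega)

theorem root_uniq {g : ℚ_[p][X]} {δ : ℝ} (hδ : 0 < δ) (hδ1 : δ ≤ 1) {s s' : ℚ_[p]}
    (h : DEst δ g s) (hne : ed g s ≠ 0) (hs : g.eval s = 0) (hs' : g.eval s' = 0)
    (hc : ‖s' - s‖ < δ * ‖s‖) : s' = s := by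
  have hs0 : s ≠ 0 := fun h0 => hne (by rw [h0, ed, zero_mul])
  have hn0 : 0 < ‖s‖ := norm_pos_iff.2 hs0
  obtain ⟨x, rfl⟩ : ∃ x, s' = s * (1 + x) := ⟨s' / s - 1, by field_simp; ring⟩
  have hx : ‖x‖ < δ := by
    have : s * (1 + x) - s = s * x := by ring
    rw [this, norm_mul, mul_comm] at hc
    exact lt_of_mul_lt_mul_right hc hn0.le
  by_cases hx0 : x = 0
  · simp [hx0]
  exfalso
  have hxp : 0 < ‖x‖ := norm_pos_iff.2 hx0
  have hE : 0 < ‖ed g s‖ := norm_pos_iff.2 hne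
  have hD : g.natDegree ≤ g.natDegree + 1 := Nat.le_succ _
  rw [eval_tc hD, Finset.sum_range_succ', Finset.sum_range_succ', tc_zero hD, hs] at hs'
  simp only [zero_add, pow_one, zero_mul, add_zero, tc_one hD] at hs'
  have h1 : ‖ed g s * x‖ < ‖ed g s‖ * ‖x‖ := by
    rw [eq_neg_of_add_eq_zero_right hs', norm_neg]
    refine sum_lt_of _ _ (by positivity) fun k _ => ?_
    rw [norm_mul, norm_pow]
    calc _ ≤ δ⁻¹ * ‖ed g s‖ * ‖x‖ ^ (k + 1 + 1) := by gcongr; exact tc_le hδ h _ (by omega)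
      _ = ‖ed g s‖ * ‖x‖ * (δ⁻¹ * (‖x‖ * ‖x‖ ^ k)) := by ring
      _ < ‖ed g s‖ * ‖x‖ * 1 := by
        gcongr
        rw [inv_mul_eq_div, div_lt_one hδ]
        refine lt_of_le_of_lt ?_ hx
        exact mul_le_of_le_one_right hxp.le (pow_le_one₀ hxp.le (by linarith))
      _ = _ := mul_one _
  rw [norm_mul] at h1
  exact lt_irrefl _ h1

/-- Hensel's lemma with the root given by a D-function of the coefficients and the approximation. -/
theorem hensel_root (D : ℕ) (δ ε : ℝ) (hδ : 0 < δ) (hδ1 : δ ≤ 1) (hε : 0 < ε) :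
    ∃ β : ℝ, 0 < β ∧ β ≤ 1 ∧ ∃ Φ : (Option (Fin (D + 1)) → ℚ_[p]) → ℚ_[p], DF Φ ∧
    ∀ (g : ℚ_[p][X]) (m : ℚ_[p]), g.natDegree ≤ D → ed g m ≠ 0 → DEst δ g m →
      ‖g.eval m‖ ≤ β * ‖ed g m‖ →
      ∀ a : Option (Fin (D + 1)) → ℚ_[p], a none = m → (∀ i, a (some i) = g.coeff i) →
        g.eval (Φ a) = 0 ∧ ‖Φ a - m‖ ≤ ε * ‖m‖ := by
  obtain ⟨ζ, hζ, hζp⟩ := hensel_fn (p := p) D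
  have hpp := norm_p_pos (p := p)
  obtain ⟨N, hN⟩ : ∃ N : ℕ, ‖(p : ℚ_[p])‖ ^ N < min ε (δ * ‖(p : ℚ_[p])‖) :=
    exists_pow_lt_of_lt_one (lt_min hε (by positivity)) norm_p_lt
  set ϖ : ℚ_[p] := (p : ℚ_[p]) ^ N with hϖ
  have hϖ0 : ϖ ≠ 0 := pow_ne_zero _ p_ne
  have hϖn : ‖ϖ‖ < min ε (δ * ‖(p : ℚ_[p])‖) := by rw [hϖ, norm_pow]; exact hN
  have hϖε : ‖ϖ‖ ≤ ε := (hϖn.trans_le (min_le_left _ _)).le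
  have hϖδ : ‖ϖ‖ ≤ δ * ‖(p : ℚ_[p])‖ := (hϖn.trans_le (min_le_right _ _)).le
  have hϖ1 : ‖ϖ‖ ≤ 1 := by
    rw [hϖ, norm_pow]; exact pow_le_one₀ (norm_nonneg _) norm_p_lt.le
  have hϖp : 0 < ‖ϖ‖ := norm_pos_iff.2 hϖ0
  let T : ℕ → (Option (Fin (D + 1)) → ℚ_[p]) → ℚ_[p] := fun k a =>
    ∑ i : Fin (D + 1), (((i : ℕ).choose k : ℕ) : ℚ_[p]) * (a (some i) * a none ^ (i : ℕ))
  have hT : ∀ k, DF (T k) := fun k => DF.sum _ fun i _ => DF.mul _ _ (DF.const _)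
    (DF.mul _ _ (DF.coord _) ((DF.coord none).pow _))
  let e : (Option (Fin (D + 1)) → ℚ_[p]) → Fin (D + 1) → ℚ_[p] := fun a k =>
    if (k : ℕ) = 0 then (T 0 a * (T 1 a)⁻¹) * (p * ϖ)⁻¹ else
    if (k : ℕ) = 1 then 0 else (T k a * (T 1 a)⁻¹) * (ϖ ^ ((k : ℕ) - 1) * (p : ℚ_[p])⁻¹)
  have he : ∀ k, DF (fun a => e a k) := by
    intro k
    simp only [e]
    split_ifs
    · exact DF.mul _ _ (DF.mul _ _ (hT 0) (DF.inv _ (hT 1))) (DF.const _)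
    · exact DF.const _
    · exact DF.mul _ _ (DF.mul _ _ (hT _) (DF.inv _ (hT 1))) (DF.const _)
  refine ⟨‖p * ϖ‖, by rw [norm_mul]; positivity, ?_,
    fun a => a none * (1 + ϖ * ζ (fun k => e a k)),
    DF.mul _ _ (DF.coord _) (DF.add _ _ (DF.const _) (DF.mul _ _ (DF.const _) (hζ.subst he))), ?_⟩
  · rw [norm_mul]; exact mul_le_one₀ norm_p_lt.le (norm_nonneg _) hϖ1
  intro g m hg hne hE hv a ham hag
  have hTk : ∀ k, T k a = tc D g.coeff m k := by
    intro k
    simp only [T, tc, hag, ham]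
    exact Fin.sum_univ_eq_sum_range (fun i => ((i.choose k : ℕ) : ℚ_[p]) * (g.coeff i * m ^ i)) (D + 1)
  have hG : 0 < ‖ed g m‖ := norm_pos_iff.2 hne
  have hT0 : T 0 a = g.eval m := by rw [hTk, tc_zero hg]
  have hT1 : T 1 a = ed g m := by rw [hTk, tc_one hg]
  have hpϖ : (p : ℚ_[p]) * ϖ ≠ 0 := mul_ne_zero p_ne hϖ0
  have he1 : ∀ k, ‖e a k‖ ≤ 1 := by
    intro k
    simp only [e]
    split_ifs with h0 h1
    · rw [hT0, hT1, ← div_eq_mul_inv, ← div_eq_mul_inv, norm_div, norm_div, div_div,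
        div_le_one (mul_pos hG (norm_pos_iff.2 hpϖ)), mul_comm]
      exact hv
    · simp
    · obtain ⟨j, hj⟩ : ∃ j, (k : ℕ) = j + 2 := ⟨k - 2, by omega⟩
      rw [hTk, hT1, hj, show j + 2 - 1 = j + 1 from rfl, norm_mul, norm_mul, norm_mul, norm_inv,
        norm_inv, norm_pow]
      have h2 := tc_le (D := D) hδ hE (j + 2) (by omega)
      calc _ ≤ δ⁻¹ * ‖ed g m‖ * ‖ed g m‖⁻¹ * (‖ϖ‖ ^ (j + 1) * ‖(p : ℚ_[p])‖⁻¹) := by gcongr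
        _ = (δ * ‖(p : ℚ_[p])‖)⁻¹ * (‖ϖ‖ * ‖ϖ‖ ^ j) := by rw [pow_succ']; field_simp
        _ ≤ (δ * ‖(p : ℚ_[p])‖)⁻¹ * (‖ϖ‖ * 1) := by
          gcongr; exact pow_le_one₀ hϖp.le hϖ1
        _ ≤ 1 := by rw [mul_one, inv_mul_le_iff₀ (by positivity), mul_one]; exact hϖδ
  obtain ⟨hz1, hz⟩ := hζp _ he1
  set z := ζ (e a) with hzdef
  have hfun : (fun k => e a k) = e a := rfl
  simp only [ham, hfun, ← hzdef]
  constructor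
  · rw [eval_tc hg, ← Fin.sum_univ_eq_sum_range (fun k => tc D g.coeff m k * (ϖ * z) ^ k) (D + 1)]
    have hsplit : ∀ F : Fin (D + 1) → ℚ_[p], ∑ k, F k =
        (∑ k : Fin (D + 1), if (k : ℕ) = 0 then F k else 0) + (∑ k : Fin (D + 1), if (k : ℕ) = 1 then F k else 0) +
        ∑ k ∈ Finset.univ.filter (fun k : Fin (D + 1) => 2 ≤ (k : ℕ)), F k := by
      intro F
      rw [Finset.sum_filter, ← Finset.sum_add_distrib, ← Finset.sum_add_distrib]
      refine Finset.sum_congr rfl fun k _ => ?_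
      rcases Nat.lt_or_ge (k : ℕ) 2 with h | h
      · interval_cases hk : (k : ℕ) <;> simp
      · rw [if_neg (by omega), if_neg (by omega), if_pos h]; simp
    have hD1 : 1 ≤ D := by
      rcases Nat.eq_zero_or_pos D with rfl | h
      · exfalso; apply hne; rw [ed_sum hg]; simp
      · exact h
    have s0 : ∀ F : Fin (D + 1) → ℚ_[p], (∑ k : Fin (D + 1), if (k : ℕ) = 0 then F k else 0) = F 0 := by
      intro F
      rw [Finset.sum_eq_single 0]
      · simp
      · intro b _ hb; rw [if_neg]; intro h; exact hb (Fin.ext h)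
      · simp
    have s1 : ∀ F : Fin (D + 1) → ℚ_[p], (∑ k : Fin (D + 1), if (k : ℕ) = 1 then F k else 0) = F ⟨1, by omega⟩ := by
      intro F
      rw [Finset.sum_eq_single (⟨1, by omega⟩ : Fin (D + 1))]
      · simp
      · intro b _ hb; rw [if_neg]; intro h; exact hb (Fin.ext h)
      · simp
    rw [hsplit, s0, s1]
    simp only [Fin.val_zero, pow_zero, mul_one, pow_one, tc_one hg]
    have e0 : tc D g.coeff m 0 = ed g m * ϖ * (p * e a 0) := by
      simp only [e, Fin.val_zero, if_true]
      rw [hT1, hTk]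
      have := p_ne (p := p)
      field_simp
    have ek : ∑ k ∈ Finset.univ.filter (fun k : Fin (D + 1) => 2 ≤ (k : ℕ)),
        tc D g.coeff m k * (ϖ * z) ^ (k : ℕ) = ed g m * ϖ * (p *
        ∑ k ∈ Finset.univ.filter (fun k : Fin (D + 1) => 2 ≤ (k : ℕ)), e a k * z ^ (k : ℕ)) := by
      rw [Finset.mul_sum, Finset.mul_sum]
      refine Finset.sum_congr rfl fun k hk => ?_
      have hk2 : 2 ≤ (k : ℕ) := (Finset.mem_filter.1 hk).2
      obtain ⟨j, hj⟩ : ∃ j, (k : ℕ) = j + 2 := ⟨k - 2, by omega⟩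
      have : e a k = (T k a * (T 1 a)⁻¹) * (ϖ ^ ((k : ℕ) - 1) * (p : ℚ_[p])⁻¹) := by
        simp only [e]; rw [if_neg (by omega), if_neg (by omega)]
      rw [this, hT1, hTk, hj, show j + 2 - 1 = j + 1 from rfl]
      have := p_ne (p := p)
      field_simp
      ring
    rw [e0, ek]
    linear_combination (ed g m * ϖ) * hz
  · have : m * (1 + ϖ * z) - m = (ϖ * z) * m := by ring
    rw [this, norm_mul, norm_mul]
    gcongr
    calc ‖ϖ‖ * ‖z‖ ≤ ‖ϖ‖ * 1 := by gcongr
      _ ≤ ε := by rw [mul_one]; exact hϖε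

/-- Estimates persist under recentring. -/
theorem Est.taylor {g : ℚ_[p][X]} {δ : ℝ} (hδ : 0 < δ) {r s : ℚ_[p]}
    (hs : ‖s‖ ≤ ‖r‖) (hr : ‖r + s‖ = ‖r‖) (h : Est δ g (r + s)) :
    Est δ (Polynomial.taylor r g) s := by
  intro k
  rw [taylor_eval, add_comm s r]
  have hb : ‖(Polynomial.taylor r g).coeff k‖ * ‖s‖ ^ k ≤ δ⁻¹ * ‖g.eval (r + s)‖ := by
    rw [taylor_coeff, hasseDeriv_apply, sum_def, eval_finsetSum, ← norm_pow, ← norm_mul,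
      Finset.sum_mul]
    refine sum_le_of _ _ (by positivity) fun i _ => ?_
    rw [eval_monomial, norm_mul, norm_mul, norm_mul, norm_pow, norm_pow]
    rcases Nat.lt_or_ge i k with hik | hik
    · rw [Nat.choose_eq_zero_of_lt hik]; simp; positivity
    · have h1 := h i
      rw [hr] at h1
      rw [inv_mul_eq_div, le_div_iff₀ hδ, mul_comm]
      refine le_trans (mul_le_mul_of_nonneg_left ?_ hδ.le) h1
      calc ‖((i.choose k : ℕ) : ℚ_[p])‖ * ‖g.coeff i‖ * ‖r‖ ^ (i - k) * ‖s‖ ^ k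
          ≤ 1 * ‖g.coeff i‖ * ‖r‖ ^ (i - k) * ‖r‖ ^ k := by gcongr; exact norm_nat_le _
        _ = ‖g.coeff i‖ * ‖r‖ ^ i := by
          rw [one_mul, mul_assoc, ← pow_add, Nat.sub_add_cancel hik]
  calc _ ≤ δ * (δ⁻¹ * ‖g.eval (r + s)‖) := by gcongr
    _ = _ := by field_simp

end PSub
end Part6


section Part7
open PadicSub

namespace PSub

variable {p : ℕ} [hp : Fact p.Prime]

open Polynomial

/-! ### Roots on charts -/

theorem twice_max {α : Type*} (s : Finset α) (t : α → ℚ_[p]) (h0 : ∑ i ∈ s, t i = 0)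
    (hne : ∃ i ∈ s, t i ≠ 0) : ∃ i ∈ s, ∃ j ∈ s, i ≠ j ∧ ‖t i‖ = ‖t j‖ ∧ t i ≠ 0 := by
  classical
  obtain ⟨i0, hi0, hti0⟩ := hne
  obtain ⟨i, hi, hmax⟩ := s.exists_max_image (fun i => ‖t i‖) ⟨i0, hi0⟩
  have hti : 0 < ‖t i‖ := lt_of_lt_of_le (norm_pos_iff.2 hti0) (hmax i0 hi0)
  by_contra hcon
  push Not at hcon
  have h1 : ‖∑ j ∈ s.erase i, t j‖ < ‖t i‖ := by
    refine sum_lt_of _ _ hti fun j hj => ?_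
    rw [Finset.mem_erase] at hj
    refine lt_of_le_of_ne (hmax j hj.2) fun heq => ?_
    exact norm_pos_iff.1 hti (hcon i hi j hj.2 (Ne.symm hj.1) heq.symm)
  rw [← Finset.add_sum_erase s t hi] at h0
  rw [eq_neg_of_add_eq_zero_left h0, norm_neg] at h1
  exact lt_irrefl _ h1

/-- The relevant roots. -/
def RZ (δ : ℝ) (g : ℚ_[p][X]) (r : ℚ_[p]) : Prop := g.eval r = 0 ∧ ed g r ≠ 0 ∧ DEst δ g r

theorem RZ.ne {δ : ℝ} {g : ℚ_[p][X]} {r : ℚ_[p]} (h : RZ δ g r) : r ≠ 0 := fun h0 =>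
  h.2.1 (by rw [h0, ed, zero_mul])

theorem rootCov (D : ℕ) (δ ε : ℝ) (hδ : 0 < δ) (hδ1 : δ ≤ 1) (hε : 0 < ε) :
    ∃ ε1 : ℝ, 0 < ε1 ∧ ε1 < 1 ∧ ∀ {ι : Type} [Fintype ι] (Y : Set (ι → ℚ_[p])) (_ : SA Y)
      (_ : ∀ y ∈ Y, tor y) (g : (ι → ℚ_[p]) → ℚ_[p][X]) (_ : ∀ y ∈ Y, (g y).natDegree ≤ D)
      (_ : ∀ i ≤ D, DOn (fun y => (g y).coeff i) Y)
      (c : ℕ → ℚ_[p]) (e : ℕ → ι → ℤ) (_ : ∀ i k, (D.factorial : ℤ) ∣ e i k)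
      (_ : ∀ i ≤ D, ∀ y ∈ Y, ‖(g y).coeff i - mon (c i) (e i) y‖ ≤ ε1 * ‖mon (c i) (e i) y‖),
      ∃ (s : Finset ((ℕ × ℕ) × ℚ_[p])) (A : (ℕ × ℕ) × ℚ_[p] → Set (ι → ℚ_[p]))
        (r : (ℕ × ℕ) × ℚ_[p] → (ι → ℚ_[p]) → ℚ_[p]),
        (∀ a ∈ s, SA (A a) ∧ A a ⊆ Y ∧ DOn (r a) (A a) ∧ MonOn ε (r a) (A a) ∧
          ∀ y ∈ A a, RZ δ (g y) (r a y)) ∧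
        (∀ y ∈ Y, ∀ r0, RZ δ (g y) r0 → ∃ a ∈ s, y ∈ A a ∧ r a y = r0) ∧
        (∀ a ∈ s, ∀ b ∈ s, SA {y | y ∈ A a ∧ y ∈ A b ∧ r a y = r b y}) := by
  classical
  obtain ⟨ε', hε'0, hε'⟩ : ∃ ε' : ℝ, 0 < ε' ∧ ε' < min ε δ := exists_between (lt_min hε hδ)
  have hε'ε : ε' ≤ ε := (hε'.trans_le (min_le_left _ _)).le
  have hε'δ : ε' < δ := hε'.trans_le (min_le_right _ _)
  have hε'1 : ε' < 1 := by linarith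
  obtain ⟨β, hβ0, hβ1, Φ, hΦ, hH⟩ := hensel_root (p := p) D δ ε' hδ hδ1 hε'0
  obtain ⟨η, hη0, hη⟩ : ∃ η : ℝ, 0 < η ∧ η < min ε' (β * δ) := exists_between (lt_min hε'0 (by positivity))
  have hηε' : η < ε' := (hη.trans_le (min_le_left _ _))
  have hηβ : η / δ ≤ β := by
    rw [div_le_iff₀ hδ]; exact (hη.trans_le (min_le_right _ _)).le
  have hη1 : η < 1 := by linarith
  have hηδ : η < δ := by linarith
  obtain ⟨Θ, hΘ1, hΘ⟩ := unit_net (p := p) η hη0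
  refine ⟨η, hη0, hη1, ?_⟩
  intro ι _ Y hYs hYt g hgD hgdon c e he hce
  -- the approximating polynomial
  let G : (ι → ℚ_[p]) → ℚ_[p][X] := fun y =>
    ∑ i ∈ Finset.range (D + 1), monomial i (mon (c i) (e i) y)
  have hGD : ∀ y, (G y).natDegree ≤ D := fun y => by
    refine natDegree_sum_le_of_forall_le _ _ fun i hi => ?_
    exact (natDegree_monomial_le _).trans (by rw [Finset.mem_range] at hi; omega)
  have hGc : ∀ y i, i ≤ D → (G y).coeff i = mon (c i) (e i) y := by
    intro y i hi
    simp only [G, finsetSum_coeff, coeff_monomial]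
    rw [Finset.sum_ite_eq' (Finset.range (D + 1)) i, if_pos (by rw [Finset.mem_range]; omega)]
  have hclose : ∀ y ∈ Y, CoefClose η (G y) (g y) := by
    intro y hy i
    rcases Nat.lt_or_ge D i with h | h
    · rw [coeff_eq_zero_of_natDegree_lt ((hGD y).trans_lt h),
        coeff_eq_zero_of_natDegree_lt ((hgD y hy).trans_lt h)]; simp
    · rw [hGc y i h]; exact hce i h y hy
  -- the scaling constants
  have hκ : ∀ q : ℕ × ℕ, ∃ κ : ℚ_[p], κ ≠ 0 ∧ ((∃ κ' : ℚ_[p], κ' ≠ 0 ∧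
      ‖κ'‖ ^ (q.2 - q.1) * ‖c q.2‖ = ‖c q.1‖) → ‖κ‖ ^ (q.2 - q.1) * ‖c q.2‖ = ‖c q.1‖) := by
    intro q
    by_cases h : ∃ κ' : ℚ_[p], κ' ≠ 0 ∧ ‖κ'‖ ^ (q.2 - q.1) * ‖c q.2‖ = ‖c q.1‖
    · obtain ⟨κ', h0, h1⟩ := h; exact ⟨κ', h0, fun _ => h1⟩
    · exact ⟨1, one_ne_zero, fun h' => absurd h' h⟩
  choose κ hκ0 hκ using hκ
  let ex : ℕ × ℕ → ι → ℤ := fun q k => (e q.1 k - e q.2 k) / ((q.2 : ℤ) - q.1)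
  have hex : ∀ i j, i < j → j ≤ D → ((j - i : ℕ) : ℤ) • ex (i, j) = e i - e j := by
    intro i j hij hj
    ext k
    simp only [ex, Pi.smul_apply, Pi.sub_apply, smul_eq_mul]
    rw [Nat.cast_sub hij.le]
    apply Int.mul_ediv_cancel'
    have h1 : (((j - i : ℕ) : ℤ)) ∣ (D.factorial : ℤ) := by
      exact_mod_cast Nat.dvd_factorial (by omega) (by omega)
    rw [Nat.cast_sub hij.le] at h1
    exact h1.trans (dvd_sub (he i k) (he j k))
  let m : (ℕ × ℕ) × ℚ_[p] → (ι → ℚ_[p]) → ℚ_[p] := fun a => mon (a.2 * κ a.1) (ex a.1)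
  let s : Finset ((ℕ × ℕ) × ℚ_[p]) := (Finset.range (D + 1) ×ˢ Finset.range (D + 1)) ×ˢ Θ
  have hsΘ : ∀ a ∈ s, a.2 ∈ Θ := fun a ha => (Finset.mem_product.1 ha).2
  have hm0 : ∀ a ∈ s, ∀ y ∈ Y, m a y ≠ 0 := fun a ha y hy => by
    refine mon_ne (mul_ne_zero ?_ (hκ0 _)) _ (hYt y hy)
    rw [← norm_pos_iff, hΘ1 _ (hsΘ a ha)]; exact one_pos
  let A : (ℕ × ℕ) × ℚ_[p] → Set (ι → ℚ_[p]) := fun a => {y | y ∈ Y ∧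
    (ed (G y) (m a y) ≠ 0 ∧ DEst δ (G y) (m a y) ∧ ‖(G y).eval (m a y)‖ ≤ β * ‖ed (G y) (m a y)‖)}
  let r : (ℕ × ℕ) × ℚ_[p] → (ι → ℚ_[p]) → ℚ_[p] := fun a y =>
    Φ (fun o => o.elim (m a y) (fun i => (g y).coeff i))
  -- properties on A
  have hA1 : ∀ a ∈ s, ∀ y ∈ A a, RZ δ (g y) (r a y) ∧ ‖r a y - m a y‖ ≤ ε' * ‖m a y‖ := by
    intro a ha y hy
    obtain ⟨hyY, h1, h2, h3⟩ := hy
    have hz : ‖m a y - m a y‖ ≤ η * ‖m a y‖ := by rw [sub_self, norm_zero]; positivity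
    obtain ⟨h4, h5⟩ := h2.close (hGD y) (hgD y hyY) hη0.le hηδ hδ hδ1 (hclose y hyY) hz
    have h6 := eval_close (hGD y) (hgD y hyY) hη0.le hη1 hδ hδ1 (hclose y hyY) hz h2 hηβ hβ1 h3
    rw [← h5] at h6
    have h7 : ed (g y) (m a y) ≠ 0 := by rw [← norm_pos_iff, h5, norm_pos_iff]; exact h1
    obtain ⟨h8, h9⟩ := hH (g y) (m a y) (hgD y hyY) h7 h4 h6
      (fun o => o.elim (m a y) (fun i => (g y).coeff i)) rfl (fun i => rfl)
    obtain ⟨h10, h11⟩ := h4.close (hgD y hyY) (hgD y hyY) hε'0.le hε'δ hδ hδ1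
      (CoefClose.refl hε'0.le _) h9
    refine ⟨⟨h8, ?_, h10⟩, h9⟩
    rw [← norm_pos_iff, h11, norm_pos_iff]; exact h7
  have hrm : ∀ a ∈ s, ∀ y ∈ A a, ‖r a y‖ = ‖m a y‖ := fun a ha y hy =>
    norm_eq_of_sub_le hε'1 (hA1 a ha y hy).2
  have hsub : ∀ {a b c : ℚ_[p]} {t : ℝ}, ‖a - b‖ < t → ‖b - c‖ < t → ‖a - c‖ < t := by
    intro a b c t h1 h2
    have : a - c = (a - b) + (b - c) := by ring
    rw [this]; exact add_lt_of h1 h2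
  have hlm : ∀ a, Lau (m a) := fun a => Lau.mon _ _
  have hAs : ∀ a ∈ s, SA (A a) := by
    intro a ha
    have l1 : Lau (fun y => ed (G y) (m a y)) := by
      have : (fun y => ed (G y) (m a y)) = fun y => ∑ i ∈ Finset.range (D + 1),
          (i : ℚ_[p]) * (mon (c i) (e i) y * m a y ^ i) := by
        ext y
        rw [ed_sum (hGD y)]
        refine Finset.sum_congr rfl fun i hi => ?_
        rw [hGc y i (by rw [Finset.mem_range] at hi; omega)]
      rw [this]
      exact Lau.sum _ fun i _ => (Lau.const _).mul ((Lau.mon _ _).mul ((hlm a).pow i))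
    have l2 : Lau (fun y => (G y).eval (m a y)) := by
      have : (fun y => (G y).eval (m a y)) = fun y => ∑ i ∈ Finset.range (D + 1),
          (mon (c i) (e i) y * m a y ^ i) := by
        ext y
        rw [eval_sum (hGD y)]
        refine Finset.sum_congr rfl fun i hi => ?_
        rw [hGc y i (by rw [Finset.mem_range] at hi; omega)]
      rw [this]
      exact Lau.sum _ fun i _ => ((Lau.mon _ _).mul ((hlm a).pow i))
    have h1 := SA.and hYs (SA.and (SA.not (SA.lau_zero l1)) (SA.and
      (SA.finset_all (Finset.range (D + 1)) fun i _ => SA.or (SA.const (i = 0))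
        (SA.lau_le ((Lau.mon (c i) (e i)).mul ((hlm a).pow i)) l1 δ⁻¹ (by positivity)))
      (SA.lau_le l2 l1 β hβ0.le)))
    convert h1 using 2
    ext y
    refine and_congr_right fun hy => ?_
    have ht := hYt y hy
    simp only [ht, true_and]
    refine and_congr_right fun _ => and_congr_left fun _ => ?_
    constructor
    · intro h i hi
      rcases Nat.eq_zero_or_pos i with h0 | h0
      · exact Or.inl h0
      · right
        have := h i h0
        rw [hGc y i (by rw [Finset.mem_range] at hi; omega)] at this
        rw [norm_mul, norm_pow, inv_mul_eq_div, le_div_iff₀ hδ, mul_comm]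
        exact this
    · intro h i hi
      rcases Nat.lt_or_ge D i with h0 | h0
      · rw [coeff_eq_zero_of_natDegree_lt ((hGD y).trans_lt h0)]; simp
      · rcases h i (by rw [Finset.mem_range]; omega) with h2 | h2
        · omega
        · rw [norm_mul, norm_pow, inv_mul_eq_div, le_div_iff₀ hδ, mul_comm] at h2
          rw [hGc y i h0]; exact h2
  refine ⟨s, A, r, ?_, ?_, ?_⟩
  · intro a ha
    refine ⟨hAs a ha, fun y hy => hy.1, ?_, ?_, fun y hy => (hA1 a ha y hy).1⟩
    · refine DOn.subst (g := fun o y => o.elim (m a y) (fun i => (g y).coeff i)) hΦ fun o => ?_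
      rcases o with _ | i
      · exact (DF.mon _ _).don
      · exact (hgdon i (by omega)).mono fun y hy => hy.1
    · exact ⟨a.2 * κ a.1, ex a.1, fun y hy => ((hA1 a ha y hy).2).trans (by gcongr)⟩
  · intro y hy r0 hr0
    have hr0n := hr0.ne
    have hrp : 0 < ‖r0‖ := norm_pos_iff.2 hr0n
    obtain ⟨i, hi, j, hj, hij, hn, hne⟩ := twice_max (Finset.range (D + 1))
      (fun i => (g y).coeff i * r0 ^ i) (by rw [← eval_sum (hgD y hy)]; exact hr0.1) (by
        by_contra hall
        push Not at hall
        apply hr0.2.1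
        rw [ed_sum (hgD y hy)]
        exact Finset.sum_eq_zero fun i hi => by rw [hall i hi, mul_zero])
    -- wlog i < j
    obtain ⟨i, j, hlt, hjD, hn, hne⟩ : ∃ i j, i < j ∧ j ≤ D ∧
        ‖(g y).coeff i‖ * ‖r0‖ ^ i = ‖(g y).coeff j‖ * ‖r0‖ ^ j ∧ (g y).coeff j ≠ 0 := by
      rw [Finset.mem_range] at hi hj
      simp only [norm_mul, norm_pow] at hn
      have hgi : (g y).coeff i ≠ 0 := fun h => hne (by rw [h, zero_mul])
      have hgj : (g y).coeff j ≠ 0 := fun h => by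
        rw [h, norm_zero, zero_mul] at hn
        have : 0 < ‖(g y).coeff i‖ := norm_pos_iff.2 hgi
        exact absurd hn (by positivity)
      rcases lt_or_gt_of_ne hij with h | h
      · exact ⟨i, j, h, by omega, hn, hgj⟩
      · exact ⟨j, i, h, by omega, hn.symm, hgi⟩
    have hkey : ‖mon (c i) (e i) y‖ = ‖mon (c j) (e j) y‖ * ‖r0‖ ^ (j - i) := by
      rw [← hGc y i (by omega), ← hGc y j hjD, ← (hclose y hy).norm hη1, ← (hclose y hy).norm hη1]
      have : ‖r0‖ ^ j = ‖r0‖ ^ (j - i) * ‖r0‖ ^ i := by rw [← pow_add]; congr 1; omega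
      rw [this, ← mul_assoc] at hn
      exact mul_right_cancel₀ (by positivity) hn
    have hcj : mon (c j) (e j) y ≠ 0 := by
      rw [← hGc y j hjD, ← norm_pos_iff, ← (hclose y hy).norm hη1]; exact norm_pos_iff.2 hne
    -- separate the monomial part
    have hy0 := hYt y hy
    set μ := mon 1 (ex (i, j)) y with hμ
    have hμ0 : μ ≠ 0 := mon_ne one_ne_zero _ hy0
    have hμp : 0 < ‖μ‖ := norm_pos_iff.2 hμ0
    have hei : ∀ k, mon (c k) (e k) y = c k * mon 1 (e k) y := fun k => by
      rw [← mon_smul, mul_one]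
    have hμpow : mon 1 (e i) y = mon 1 (e j) y * μ ^ (j - i) := by
      have h1 := mon_zpow (1 : ℚ_[p]) (ex (i, j)) ((j - i : ℕ) : ℤ) y
      rw [hex i j hlt hjD, one_zpow, zpow_natCast] at h1
      rw [hμ, ← h1, ← mon_mul _ _ _ _ _ hy0]
      congr 1 <;> simp
    have hej : 0 < ‖mon 1 (e j) y‖ := norm_pos_iff.2 (mon_ne one_ne_zero _ hy0)
    have hrat : ‖c i‖ * ‖μ‖ ^ (j - i) = ‖c j‖ * ‖r0‖ ^ (j - i) := by
      rw [hei, hei, hμpow] at hkey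
      simp only [norm_mul, norm_pow] at hkey
      have : ‖mon 1 (e j) y‖ * (‖c i‖ * ‖μ‖ ^ (j - i)) =
        ‖mon 1 (e j) y‖ * (‖c j‖ * ‖r0‖ ^ (j - i)) := by linarith
      exact mul_left_cancel₀ hej.ne' this
    have hcj0 : c j ≠ 0 := fun h => hcj (by rw [hei, h, zero_mul])
    have hκij := hκ (i, j) ⟨r0 / μ, div_ne_zero hr0n hμ0, by
      simp only
      rw [norm_div, div_pow, div_mul_eq_mul_div, div_eq_iff (by positivity), hrat]; ring⟩
    simp only at hκij
    have hmn : ‖κ (i, j) * μ‖ = ‖r0‖ := by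
      have h1 : ‖κ (i, j) * μ‖ ^ (j - i) = ‖r0‖ ^ (j - i) := by
        have h2 : ‖c j‖ ≠ 0 := norm_ne_zero_iff.2 hcj0
        apply mul_left_cancel₀ h2
        rw [← hrat, ← hκij, norm_mul, mul_pow]; ring
      exact (pow_left_inj₀ (norm_nonneg _) (norm_nonneg _) (by omega)).1 h1
    have hκμ0 : κ (i, j) * μ ≠ 0 := mul_ne_zero (hκ0 _) hμ0
    obtain ⟨θ, hθ, hθu⟩ := hΘ (r0 / (κ (i, j) * μ)) (by rw [norm_div, hmn, div_self hrp.ne'])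
    have has : ((i, j), θ) ∈ s := by
      simp only [s, Finset.mem_product, Finset.mem_range]
      exact ⟨⟨by omega, by omega⟩, hθ⟩
    have hma : m ((i, j), θ) y = θ * (κ (i, j) * μ) := by
      simp only [m]
      rw [hμ, ← mon_smul, ← mon_smul, mul_one]
    have hmr : ‖m ((i, j), θ) y - r0‖ ≤ η * ‖r0‖ := by
      have : m ((i, j), θ) y - r0 = (θ - r0 / (κ (i, j) * μ)) * (κ (i, j) * μ) := by
        rw [hma, sub_mul, div_mul_cancel₀ _ hκμ0]
      rw [this, norm_mul, hmn, norm_sub_rev]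
      gcongr
    have hgG := (hclose y hy).symm hη1
    obtain ⟨h1, h2⟩ := hr0.2.2.close (hgD y hy) (hGD y) hη0.le hηδ hδ hδ1 hgG hmr
    have h3 := eval_close (hgD y hy) (hGD y) hη0.le hη1 hδ hδ1 hgG hmr hr0.2.2 hηβ hβ1
      (by rw [hr0.1, norm_zero]; positivity)
    have hyA : y ∈ A ((i, j), θ) := ⟨hy, by rw [← norm_pos_iff, h2, norm_pos_iff]; exact hr0.2.1,
      h1, by rw [h2]; exact h3⟩
    refine ⟨_, has, hyA, ?_⟩
    obtain ⟨h4, h5⟩ := hA1 _ has y hyA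
    refine root_uniq hδ hδ1 hr0.2.2 hr0.2.1 hr0.1 h4.1 (hsub (b := m ((i, j), θ) y) ?_ ?_)
    · rw [norm_eq_of_sub_le hη1 hmr] at h5
      exact h5.trans_lt (by gcongr)
    · exact hmr.trans_lt (by gcongr)
  · intro a ha b hb
    have h1 := SA.and (hAs a ha) (SA.and (hAs b hb) (SA.lau_lt ((hlm a).sub (hlm b)) (hlm b) δ hδ))
    convert h1 using 2
    ext y
    refine and_congr_right fun hya => and_congr_right fun hyb => ?_
    have ht := hYt y hya.1
    simp only [ht, true_and]
    have hmb : 0 < ‖m b y‖ := norm_pos_iff.2 (hm0 b hb y hya.1)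
    have hka := (hA1 a ha y hya).2
    have hkb := (hA1 b hb y hyb).2
    have hkb' : ‖r b y - m b y‖ < δ * ‖m b y‖ := hkb.trans_lt (by gcongr)
    constructor
    · intro heq
      have hn : ‖m a y‖ = ‖m b y‖ := by rw [← hrm a ha y hya, heq, hrm b hb y hyb]
      rw [hn] at hka
      refine hsub (b := r a y) (by rw [norm_sub_rev]; exact hka.trans_lt (by gcongr)) ?_
      rw [heq]; exact hkb'
    · intro hlt
      have hn : ‖m a y‖ = ‖m b y‖ := norm_eq_of_sub_lt (lt_of_lt_of_le hlt (by nlinarith))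
      rw [hn] at hka
      have hB := (hA1 b hb y hyb).1
      refine root_uniq hδ hδ1 hB.2.2 hB.2.1 hB.1 (hA1 a ha y hya).1.1 ?_
      rw [hrm b hb y hyb]
      refine hsub (b := m a y) (hka.trans_lt (by gcongr)) (hsub (b := m b y) hlt ?_)
      rw [norm_sub_rev]; exact hkb'

end PSub
end Part7


section Part8
open PadicSub

namespace PSub

variable {p : ℕ} [hp : Fact p.Prime]

open Polynomial

theorem near_root {g : ℚ_[p][X]} {δ B : ℝ} (hδ : 0 < δ) (hδ1 : δ ≤ 1) {s x : ℚ_[p]}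
    (h : RZ δ g s) (hx : ‖x‖ ≤ B) (hB : B < δ) :
    ‖g.eval (s * (1 + x)) - ed g s * x‖ ≤ B / δ * (‖ed g s‖ * ‖x‖) := by
  obtain ⟨h0, hne, hd⟩ := h
  have hB0 : 0 ≤ B := (norm_nonneg _).trans hx
  have hD : g.natDegree ≤ g.natDegree + 1 := Nat.le_succ _
  rw [eval_tc hD, Finset.sum_range_succ', Finset.sum_range_succ', tc_zero hD, h0]
  simp only [zero_add, pow_one, zero_mul, add_zero, tc_one hD, add_sub_cancel_right]
  refine sum_le_of _ _ (by positivity) fun k _ => ?_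
  rw [norm_mul, norm_pow]
  have hx1 : ‖x‖ ≤ 1 := hx.trans (hB.le.trans hδ1)
  calc _ ≤ δ⁻¹ * ‖ed g s‖ * ‖x‖ ^ (k + 1 + 1) := by gcongr; exact tc_le hδ hd _ (by omega)
    _ = δ⁻¹ * ‖ed g s‖ * (‖x‖ ^ k * ‖x‖ * ‖x‖) := by ring
    _ ≤ δ⁻¹ * ‖ed g s‖ * (1 * B * ‖x‖) := by
      gcongr
      exact pow_le_one₀ (norm_nonneg _) hx1
    _ = _ := by field_simp

theorem near_root_norm {g : ℚ_[p][X]} {δ B : ℝ} (hδ : 0 < δ) (hδ1 : δ ≤ 1) {s x : ℚ_[p]}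
    (h : RZ δ g s) (hx : ‖x‖ ≤ B) (hB : B < δ) :
    ‖g.eval (s * (1 + x))‖ = ‖ed g s‖ * ‖x‖ := by
  have := near_root hδ hδ1 h hx hB
  rw [← norm_mul]
  rw [← norm_mul] at this
  exact norm_eq_of_sub_le ((div_lt_one hδ).2 hB) this

theorem root_diff {g : ℚ_[p][X]} {δ ε : ℝ} (hδ : 0 < δ) (hδ1 : δ ≤ 1) (hε : 0 < ε) (hε1 : ε < 1)
    {r c : ℚ_[p]} (h : RZ δ g r) (hc : ‖c - r‖ ≤ δ * ε * ‖r‖) :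
    ‖(r - c) - (-(g.eval c / g.derivative.eval c))‖
      ≤ ε * ‖-(g.eval c / g.derivative.eval c)‖ := by
  have hr0 := h.ne
  have hn0 : 0 < ‖r‖ := norm_pos_iff.2 hr0
  have hB : δ * ε < δ := by nlinarith
  have hBe : δ * ε ≤ ε := by nlinarith
  have hec := ed_close (D := g.natDegree) le_rfl le_rfl (η := δ * ε) (by positivity)
    (by nlinarith) hδ (CoefClose.refl (by positivity) g) hc h.2.2
  rw [mul_div_cancel_left₀ _ hδ.ne'] at hec
  have hen := norm_eq_of_sub_le hε1 hec
  have hE : 0 < ‖ed g r‖ := norm_pos_iff.2 h.2.1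
  obtain ⟨x, rfl⟩ : ∃ x, c = r * (1 + x) := ⟨c / r - 1, by field_simp; ring⟩
  have hx : ‖x‖ ≤ δ * ε := by
    have : r * (1 + x) - r = r * x := by ring
    rw [this, norm_mul, mul_comm] at hc
    exact le_of_mul_le_mul_right hc hn0
  have h1 := near_root hδ hδ1 h hx hB
  have h2 := near_root_norm hδ hδ1 h hx hB
  rw [mul_div_cancel_left₀ _ hδ.ne'] at h1
  have hcn : ‖r * (1 + x)‖ = ‖r‖ := norm_eq_of_sub_le (by nlinarith) hc
  set c := r * (1 + x) with hcdef
  have hc0 : c ≠ 0 := norm_pos_iff.1 (hcn ▸ hn0)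
  have hedc : ed g c ≠ 0 := norm_pos_iff.1 (hen ▸ hE)
  have hd0 : g.derivative.eval c ≠ 0 := fun h0 => hedc (by rw [ed, h0, mul_zero])
  have key : ‖r * x * (ed g c - ed g r) + r * (ed g r * x - g.eval c) + (r - c) * g.eval c‖
      ≤ ε * (‖r‖ * ‖x‖ * ‖ed g r‖) := by
    refine add_le_of (add_le_of ?_ ?_) ?_
    · rw [norm_mul, norm_mul]
      calc _ ≤ ‖r‖ * ‖x‖ * (ε * ‖ed g r‖) := by gcongr
        _ = _ := by ring
    · rw [norm_mul, norm_sub_rev]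
      calc _ ≤ ‖r‖ * (ε * (‖ed g r‖ * ‖x‖)) := by gcongr
        _ = _ := by ring
    · have : r - c = - (r * x) := by rw [hcdef]; ring
      rw [norm_mul, this, norm_neg, norm_mul, h2]
      calc _ = ‖x‖ * (‖r‖ * ‖x‖ * ‖ed g r‖) := by ring
        _ ≤ _ := by gcongr; exact hx.trans hBe
  have e1 : (r - c) - (-(g.eval c / g.derivative.eval c))
      = -(r * x * (ed g c - ed g r) + r * (ed g r * x - g.eval c) + (r - c) * g.eval c) / ed g c := by
    have : ed g c = c * g.derivative.eval c := rfl
    rw [eq_div_iff hedc, this]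
    have hrc : r - c = - (r * x) := by rw [hcdef]; ring
    field_simp
    have hcc : c = r + r * x := by rw [hcdef]; ring
    linear_combination (-c * g.derivative.eval c) * hrc.symm.symm + (0 : ℚ_[p]) * hcc
  have e2 : ‖-(g.eval c / g.derivative.eval c)‖ = ‖r‖ * ‖x‖ := by
    have : ‖g.derivative.eval c‖ = ‖ed g r‖ / ‖r‖ := by
      rw [← hen, ed, norm_mul, hcn]; field_simp
    rw [norm_neg, norm_div, h2, this]
    field_simp
  rw [e1, e2, norm_div, norm_neg, hen, div_le_iff₀ hE]
  linarith

theorem est_root {g : ℚ_[p][X]} {δ B : ℝ} (hδ : 0 < δ) (hδ1 : δ ≤ 1) {r s : ℚ_[p]}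
    (h : RZ δ g r) (hs : ‖s‖ ≤ B * ‖r‖) (hB : B < δ) : Est δ (taylor r g) s := by
  have hr0 := h.ne
  have hn0 : 0 < ‖r‖ := norm_pos_iff.2 hr0
  obtain ⟨x, rfl⟩ : ∃ x, s = r * x := ⟨s / r, by field_simp⟩
  have hx : ‖x‖ ≤ B := by
    rw [norm_mul, mul_comm] at hs
    exact le_of_mul_le_mul_right hs hn0
  have hx1 : ‖x‖ ≤ 1 := hx.trans (hB.le.trans hδ1)
  intro k
  have e0 : r * x + r = r * (1 + x) := by ring
  rw [taylor_eval, e0, near_root_norm hδ hδ1 h hx hB]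
  rcases Nat.eq_zero_or_pos k with rfl | hk
  · simp [h.1]; positivity
  have hb : ‖(taylor r g).coeff k‖ * ‖r‖ ^ k ≤ δ⁻¹ * ‖ed g r‖ := by
    rw [taylor_coeff, hasseDeriv_apply, sum_def, eval_finsetSum, ← norm_pow, ← norm_mul,
      Finset.sum_mul]
    refine sum_le_of _ _ (by positivity) fun i _ => ?_
    rw [eval_monomial, norm_mul, norm_mul, norm_mul, norm_pow, norm_pow]
    rcases Nat.lt_or_ge i k with hik | hik
    · rw [Nat.choose_eq_zero_of_lt hik]; simp; positivity
    · rw [inv_mul_eq_div, le_div_iff₀ hδ, mul_comm]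
      refine le_trans (mul_le_mul_of_nonneg_left ?_ hδ.le) (h.2.2 i (by omega))
      calc ‖((i.choose k : ℕ) : ℚ_[p])‖ * ‖g.coeff i‖ * ‖r‖ ^ (i - k) * ‖r‖ ^ k
          ≤ 1 * ‖g.coeff i‖ * ‖r‖ ^ (i - k) * ‖r‖ ^ k := by gcongr; exact norm_nat_le _
        _ = ‖g.coeff i‖ * ‖r‖ ^ i := by
          rw [one_mul, mul_assoc, ← pow_add, Nat.sub_add_cancel hik]
  rw [norm_mul, mul_pow]
  calc _ = δ * (‖(taylor r g).coeff k‖ * ‖r‖ ^ k) * ‖x‖ ^ k := by ring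
    _ ≤ δ * (δ⁻¹ * ‖ed g r‖) * ‖x‖ ^ 1 := by
      gcongr ?_ * ?_
      · gcongr
      · exact pow_le_pow_of_le_one (norm_nonneg _) hx1 hk
    _ = _ := by rw [pow_one]; field_simp

/-- Off the neighbourhoods of roots the estimate holds. -/
theorem est_off {g : ℚ_[p][X]} {δ α : ℝ} (hδ : 0 < δ) (hδ1 : δ ≤ 1) (hα : 0 < α) (hα1 : α ≤ 1)
    {s : ℚ_[p]} (h : DEst δ g s) (hW : ¬ (ed g s ≠ 0 ∧ ‖g.eval s‖ ≤ α * ‖ed g s‖)) :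
    Est (α * δ) g s := by
  have h1 : ∀ i, 1 ≤ i → α * δ * (‖g.coeff i‖ * ‖s‖ ^ i) ≤ ‖g.eval s‖ := by
    intro i hi
    have := h i hi
    by_cases he : ed g s = 0
    · rw [he, norm_zero] at this
      have h2 : α * δ * (‖g.coeff i‖ * ‖s‖ ^ i) ≤ 0 := by
        rw [mul_assoc]; exact mul_nonpos_of_nonneg_of_nonpos hα.le this
      exact h2.trans (norm_nonneg _)
    · push Not at hW
      calc _ = α * (δ * (‖g.coeff i‖ * ‖s‖ ^ i)) := by ring
        _ ≤ α * ‖ed g s‖ := by gcongr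
        _ ≤ _ := (hW he).le
  intro i
  rcases Nat.eq_zero_or_pos i with rfl | hi
  · rw [pow_zero, mul_one]
    have e : g.coeff 0 = g.eval s - ∑ i ∈ Finset.range g.natDegree, g.coeff (i + 1) * s ^ (i + 1) := by
      rw [eval_sum le_rfl, Finset.sum_range_succ']; simp
    have hαδ : 0 < α * δ := by positivity
    have : ‖g.coeff 0‖ ≤ (α * δ)⁻¹ * ‖g.eval s‖ := by
      rw [e]
      refine sub_le_of ?_ (sum_le_of _ _ (by positivity) fun i _ => ?_)
      · exact le_mul_of_one_le_left (norm_nonneg _) ((one_le_inv₀ hαδ).2 (by nlinarith))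
      · rw [inv_mul_eq_div, le_div_iff₀ hαδ, mul_comm, norm_mul, norm_pow]
        exact h1 _ (by omega)
    calc _ ≤ α * δ * ((α * δ)⁻¹ * ‖g.eval s‖) := by gcongr
      _ = _ := by field_simp
  · exact h1 i hi

theorem pseudo_div {R : Type} [CommRing R] (d : ℕ) (f : R[X]) (hf : f.natDegree ≤ d + 1) (P : R[X]) :
    ∃ (k : ℕ) (Q R0 : R[X]), C (f.coeff (d + 1) ^ k) * P = Q * f + R0 ∧ R0.natDegree ≤ d := by
  suffices h : ∀ n, ∀ P : R[X], P.natDegree ≤ n → ∃ (k : ℕ) (Q R0 : R[X]),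
      C (f.coeff (d + 1) ^ k) * P = Q * f + R0 ∧ R0.natDegree ≤ d from h _ P le_rfl
  intro n
  induction n with
  | zero => exact fun P hP => ⟨0, 0, P, by simp, hP.trans (Nat.zero_le _)⟩
  | succ n ih =>
    intro P hP
    by_cases hn : n + 1 ≤ d
    · exact ⟨0, 0, P, by simp, hP.trans hn⟩
    push Not at hn
    obtain ⟨k, Q, R0, h, hR⟩ := ih (C (f.coeff (d + 1)) * P
      - C (P.coeff (n + 1)) * X ^ (n - d) * f) (by
        rw [natDegree_le_iff_coeff_eq_zero]
        intro N hN
        rw [coeff_sub, coeff_C_mul, mul_assoc, coeff_C_mul, coeff_X_pow_mul']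
        rw [if_pos (by omega)]
        rcases Nat.lt_or_ge (n + 1) N with h1 | h1
        · rw [coeff_eq_zero_of_natDegree_lt (hP.trans_lt h1),
            coeff_eq_zero_of_natDegree_lt (hf.trans_lt (by omega : d + 1 < N - (n - d)))]
          simp
        · have : N = n + 1 := by omega
          subst this
          have : n + 1 - (n - d) = d + 1 := by omega
          rw [this]; ring)
    refine ⟨k + 1, Q + C (f.coeff (d + 1) ^ k) * (C (P.coeff (n + 1)) * X ^ (n - d)), R0, ?_, hR⟩
    rw [pow_succ, C_mul]
    linear_combination h

/-- Ref for evaluation of polynomials under an estimate. -/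
theorem estRef (D : ℕ) (δ ε : ℝ) (hδ : 0 < δ) (hε : 0 < ε) : ∃ ε1 : ℝ, 0 < ε1 ∧ ε1 < 1 ∧
    ∀ {ι : Type} [Fintype ι] (Y : Set (ι → ℚ_[p])) (_ : SA Y) (_ : ∀ y ∈ Y, tor y)
      (g : (ι → ℚ_[p]) → ℚ_[p][X]) (_ : ∀ y ∈ Y, (g y).natDegree ≤ D)
      (_ : ∀ i ≤ D, MonOn ε1 (fun y => (g y).coeff i) Y)
      (σ : (ι → ℚ_[p]) → ℚ_[p]) (_ : MonOn ε1 σ Y) (_ : ∀ y ∈ Y, Est δ (g y) (σ y)),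
      Ref (MonOn ε (fun y => (g y).eval (σ y))) Y := by
  obtain ⟨ε1, h1, h2, h⟩ := PW1 (p := p) δ ε hδ hε
  refine ⟨ε1, h1, h2, fun {ι} _ Y hY ht g hD hg σ hσ hE => ?_⟩
  have := h (Finset.range (D + 1)) (fun i y => (g y).coeff i * σ y ^ i) Y ht hY
    (fun i hi => MonOn.mul h2.le h1.le ht (hg i (Nat.lt_succ_iff.1 (Finset.mem_range.1 hi)))
      (hσ.pow h2.le h1.le ht i)) (fun y hy i _ => by
        rw [← eval_sum (hD y hy), norm_mul, norm_pow]; exact hE y hy i)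
  refine this.bind fun Z hZ hs hM => Ref.one _ hs (hM.congr fun y hy => ?_)
  exact eval_sum (hD y (hZ hy)) _

section
variable {V W R R' : Type} [CommRing R] [CommRing R'] {ev : V → R →+* ℚ_[p]} {S : Set V}

theorem Good.map (h : Good ev S) {ev' : W → R' →+* ℚ_[p]} (φ : V → W) (ψ : R' → R)
    (hφ : Set.InjOn φ S) (he : ∀ v a, ev' (φ v) a = ev v (ψ a)) : Good ev' (φ '' S) := by
  intro L hL ε hε
  refine (h (ψ '' L) (hL.image _) ε hε).image φ hφ fun c _ hc a ha => ?_
  have := hc (ψ a) ⟨a, ha, rfl⟩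
  unfold Prep at this ⊢
  refine ⟨this.1.congr fun y _ => he _ _, this.2.congr fun y _ => he _ _⟩

theorem Good.union {S T : Set V} (hST : Disjoint S T) (h : Good ev S) (h' : Good ev T) :
    Good ev (S ∪ T) := fun L hL ε hε => CovOn.union _ _ hST (h L hL ε hε) (h' L hL ε hε)

theorem Good.zero_aux (h : Good ev S) (a : R) (P : Prop → Prop) :
    Good ev {v | v ∈ S ∧ P (ev v a = 0)} := by
  intro L hL ε hε
  have h1 := h (insert a L) (hL.insert a) (min ε (1/2)) (by positivity)
  refine CovOn.fib _ (fun w v => w = v) h1 (fun w hw => ⟨w, hw.1, rfl⟩)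
    (fun w _ v _ v' _ e e' => e ▸ e' ▸ rfl) fun c hc hinj himg => ?_
  have hz := (hc a (Set.mem_insert _ _)).2.zero_or ((min_le_right _ _).trans_lt (by norm_num)) c.tor
  have hgood : CovOn (fun c => ∀ a ∈ L, Prep ε (fun v => ev v a) c) c.img :=
    CovOn.chart c (fun b hb => ⟨(hc b (Set.mem_insert_of_mem _ hb)).1,
      (hc b (Set.mem_insert_of_mem _ hb)).2.mono (min_le_left _ _) subset_rfl⟩) hinj
  have key : (∀ v ∈ c.img, P (ev v a = 0)) ∨ (∀ v ∈ c.img, ¬ P (ev v a = 0)) := by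
    rcases hz with hz | hz
    · by_cases hP : P True
      · left; rintro _ ⟨y, hy, rfl⟩; rw [eq_true (hz y hy)]; exact hP
      · right; rintro _ ⟨y, hy, rfl⟩; rw [eq_true (hz y hy)]; exact hP
    · by_cases hP : P False
      · left; rintro _ ⟨y, hy, rfl⟩; rw [eq_false (hz y hy)]; exact hP
      · right; rintro _ ⟨y, hy, rfl⟩; rw [eq_false (hz y hy)]; exact hP
  rcases key with hk | hk
  · refine hgood.of_eq ?_
    ext v
    simp only [Set.mem_ofPred_eq]
    exact ⟨fun hv => ⟨⟨himg hv, hk v hv⟩, v, hv, rfl⟩, by rintro ⟨_, v', hv', rfl⟩; exact hv'⟩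
  · refine CovOn.empty.of_eq ?_
    ext v
    simp only [Set.mem_ofPred_eq, Set.mem_empty_iff_false, false_iff]
    rintro ⟨⟨_, h2⟩, v', hv', rfl⟩
    exact hk v hv' h2

theorem Dfn.sub {C : Set (V × ℚ_[p])} (h : Dfn ev S C) {S' : Set V} (hS : S' ⊆ S) :
    Dfn ev S' C := h.pull (ev' := ev) id id (fun v hv => hS hv) (fun _ _ => rfl)

theorem Dfn.congr {C C' : Set (V × ℚ_[p])} (h : Dfn ev S C)
    (hC : ∀ v ∈ S, ∀ s, (v, s) ∈ C' ↔ (v, s) ∈ C) : Dfn ev S C' := by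
  obtain ⟨L, hL, ε, hε, h⟩ := h
  refine ⟨L, hL, ε, hε, fun c hc hM σ hσ => ?_⟩
  convert h c hc hM σ hσ using 1
  ext y
  simp only [Set.mem_ofPred_eq]
  exact and_congr_right fun hy => hC _ (hc ⟨y, hy, rfl⟩) _

/-- Preparation with exponents divisible by `n`. -/
def PrepD (n : ℕ) (ε : ℝ) (f : V → ℚ_[p]) (c : Chart p V) : Prop :=
  DOn (fun y => f (c.h y)) c.Y ∧ ∃ c0 e, (∀ k, (n : ℤ) ∣ e k) ∧
    ∀ y ∈ c.Y, ‖f (c.h y) - mon c0 e y‖ ≤ ε * ‖mon c0 e y‖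

theorem PrepD.prep {n : ℕ} {ε : ℝ} {f : V → ℚ_[p]} {c : Chart p V} (h : PrepD n ε f c) :
    Prep ε f c := by
  obtain ⟨h, c0, e, _, he⟩ := h
  exact ⟨h, c0, e, he⟩

theorem Good.div (h : Good ev S) (n : ℕ) (hn : 0 < n) (L : Set R) (hL : L.Finite) (ε : ℝ)
    (hε : 0 < ε) : CovOn (fun c => ∀ a ∈ L, PrepD n ε (fun v => ev v a) c) S := by
  refine (h L hL ε hε).bind fun c hc hinj _ => ?_
  refine CovOn.power c hinj n hn fun l hl Z hs ht hZ a ha => ?_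
  obtain ⟨h1, c0, e, he⟩ := hc a ha
  refine ⟨h1.comp (m := fun w i => l i * w i ^ n)
    (fun i => ((DF.const _).mul _ _ ((DF.coord i).pow n)).don) hZ,
    c0 * ∏ i, l i ^ e i, fun k => n * e k, fun k => dvd_mul_right _ _, fun w hw => ?_⟩
  have : mon (c0 * ∏ i, l i ^ e i) (fun k => n * e k) w = mon c0 e (fun i => l i * w i ^ n) := by
    simp only [mon, mul_zpow, Finset.prod_mul_distrib, zpow_mul, zpow_natCast]
    ring
  have h2 := he _ (hZ w hw)
  rw [← this] at h2
  exact h2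

end

end PSub
end Part8


section Part9
open PadicSub

namespace PSub

variable {p : ℕ} [hp : Fact p.Prime]

open Polynomial

section
variable {V W R R' : Type} [CommRing R] [CommRing R'] {ev : V → R →+* ℚ_[p]} {S : Set V}

noncomputable def evX (ev : V → R →+* ℚ_[p]) (q : V × ℚ_[p]) : R[X] →+* ℚ_[p] :=
  eval₂RingHom (ev q.1) q.2

theorem evX_apply (ev : V → R →+* ℚ_[p]) (q : V × ℚ_[p]) (f : R[X]) :
    evX ev q f = (f.map (ev q.1)).eval q.2 := by
  rw [evX, coe_eval₂RingHom, eval_map]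

theorem SA.congr {ι : Type} {A B : Set (ι → ℚ_[p])} (hA : SA A) (h : ∀ y, y ∈ B ↔ y ∈ A) : SA B := by
  have : B = A := Set.ext h
  rw [this]; exact hA

theorem ed_close_iff {g g' : ℚ_[p][X]} {D : ℕ} (hD : g.natDegree ≤ D) (hD' : g'.natDegree ≤ D)
    {s s' : ℚ_[p]} {η δ γ : ℝ} (hη0 : 0 ≤ η) (hηδ : η < δ) (hδ : 0 < δ) (hδ1 : δ ≤ 1)
    (hγ1 : γ ≤ 1) (hηγ : η / δ ≤ γ)
    (hg : CoefClose η g g') (hs : ‖s' - s‖ ≤ η * ‖s‖) (h : DEst δ g s) :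
    (ed g s ≠ 0 ∧ ‖g.eval s‖ ≤ γ * ‖ed g s‖) ↔ (ed g' s' ≠ 0 ∧ ‖g'.eval s'‖ ≤ γ * ‖ed g' s'‖) := by
  have hη1 : η < 1 := hηδ.trans_le hδ1
  obtain ⟨h', hn⟩ := DEst.close hD hD' hη0 hηδ hδ hδ1 hg hs h
  have h0 : ed g s ≠ 0 ↔ ed g' s' ≠ 0 := by
    rw [← norm_pos_iff, ← norm_pos_iff, hn]
  have hsn := norm_eq_of_sub_le hη1 hs
  have hs2 : ‖s - s'‖ ≤ η * ‖s'‖ := by rw [norm_sub_rev, hsn]; exact hs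
  constructor
  · rintro ⟨a, b⟩
    refine ⟨h0.1 a, ?_⟩
    rw [hn]
    exact eval_close hD hD' hη0 hη1 hδ hδ1 hg hs h hηγ hγ1 b
  · rintro ⟨a, b⟩
    refine ⟨h0.2 a, ?_⟩
    rw [← hn]
    exact eval_close hD' hD hη0 hη1 hδ hδ1 (hg.symm hη1) hs2 h' hηγ hγ1 b

theorem Dfn.near {C : Set (V × ℚ_[p])} (hC : Dfn ev S C) (G : R[X]) {D : ℕ} (hG : G.natDegree ≤ D)
    {δ γ : ℝ} (hδ : 0 < δ) (hδ1 : δ ≤ 1) (hγ : 0 < γ) (hγ1 : γ ≤ 1)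
    (hd : ∀ q ∈ C, DEst δ (G.map (ev q.1)) q.2) :
    Dfn ev S {q | q ∈ C ∧ ed (G.map (ev q.1)) q.2 ≠ 0 ∧
      ‖(G.map (ev q.1)).eval q.2‖ ≤ γ * ‖ed (G.map (ev q.1)) q.2‖} := by
  obtain ⟨L, hL, ε, hε, h⟩ := hC
  set η := min ε (δ * γ / 2) with hη
  have hη0 : 0 < η := by positivity
  have hη2 : η ≤ δ * γ / 2 := min_le_right _ _
  have hηγ : η / δ ≤ γ := by
    rw [div_le_iff₀ hδ]
    nlinarith [mul_pos hδ hγ]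
  have hηδ : η < δ := hη2.trans_lt (by nlinarith [mul_pos hδ hγ])
  have hη1 : η < 1 := hηδ.trans_le hδ1
  have hηε : η ≤ ε := min_le_left _ _
  clear_value η
  have hfin : ((fun i => G.coeff i) '' (Set.Iic D)).Finite := Set.Finite.image _ (Set.finite_Iic D)
  refine ⟨L ∪ (fun i => G.coeff i) '' (Set.Iic D), hL.union hfin, η, hη0, ?_⟩
  intro c hc hM σ hσ
  have h0 := h c hc (fun a ha => (hM a (Or.inl ha)).mono hηε subset_rfl) σ
    (hσ.mono hηε subset_rfl)
  have hco : ∀ i, ∃ c0 e, i ≤ D → ∀ y ∈ c.Y,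
      ‖ev (c.h y) (G.coeff i) - mon c0 e y‖ ≤ η * ‖mon c0 e y‖ := by
    intro i
    by_cases hi : i ≤ D
    · obtain ⟨c0, e, he⟩ := hM (G.coeff i) (Or.inr ⟨i, hi, rfl⟩)
      exact ⟨c0, e, fun _ => he⟩
    · exact ⟨0, 0, fun h => absurd h hi⟩
  choose c0 e he using hco
  obtain ⟨cs, es, hes⟩ := hσ
  obtain ⟨g', hcoef⟩ : ∃ g' : (c.ι → ℚ_[p]) → ℚ_[p][X], ∀ y i, (g' y).coeff i =
      if i ≤ D then mon (c0 i) (e i) y else 0 := by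
    refine ⟨fun y => ∑ i ∈ Finset.range (D + 1), monomial i (mon (c0 i) (e i) y), fun y i => ?_⟩
    simp only [finsetSum_coeff, coeff_monomial, Finset.sum_ite_eq', Finset.mem_range,
      Nat.lt_succ_iff]
  have hD' : ∀ y, (g' y).natDegree ≤ D := by
    intro y
    rw [natDegree_le_iff_coeff_eq_zero]
    intro N hN
    rw [hcoef, if_neg (by omega)]
  have hDm : ∀ v, (G.map (ev v)).natDegree ≤ D := fun v => natDegree_map_le.trans hG
  have hev : Lau (fun y => (g' y).eval (mon cs es y)) := by
    have : (fun y => (g' y).eval (mon cs es y)) = fun y => ∑ i ∈ Finset.range (D + 1),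
        mon (c0 i) (e i) y * mon cs es y ^ i := by
      funext y
      rw [eval_sum (hD' y)]
      refine Finset.sum_congr rfl fun i hi => ?_
      rw [hcoef, if_pos (Nat.lt_succ_iff.1 (Finset.mem_range.1 hi))]
    rw [this]
    exact Lau.sum _ fun i _ => (Lau.mon _ _).mul ((Lau.mon _ _).pow i)
  have hed : Lau (fun y => ed (g' y) (mon cs es y)) := by
    have : (fun y => ed (g' y) (mon cs es y)) = fun y => ∑ i ∈ Finset.range (D + 1),
        (i : ℚ_[p]) * (mon (c0 i) (e i) y * mon cs es y ^ i) := by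
      funext y
      rw [ed_sum (hD' y)]
      refine Finset.sum_congr rfl fun i hi => ?_
      rw [hcoef, if_pos (Nat.lt_succ_iff.1 (Finset.mem_range.1 hi))]
    rw [this]
    exact Lau.sum _ fun i _ => (Lau.const _).mul ((Lau.mon _ _).mul ((Lau.mon _ _).pow i))
  have hSA := (h0.diff (SA.lau_zero hed)).inter _ _ (SA.lau_le hev hed γ hγ.le)
  refine SA.congr hSA fun y => ?_
  simp only [Set.mem_ofPred_eq, Set.mem_inter_iff, Set.mem_sdiff]
  have key : ∀ _ : y ∈ c.Y, ∀ _ : (c.h y, σ y) ∈ C,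
      ((ed (G.map (ev (c.h y))) (σ y) ≠ 0 ∧ ‖(G.map (ev (c.h y))).eval (σ y)‖ ≤
        γ * ‖ed (G.map (ev (c.h y))) (σ y)‖) ↔ (ed (g' y) (mon cs es y) ≠ 0 ∧
        ‖(g' y).eval (mon cs es y)‖ ≤ γ * ‖ed (g' y) (mon cs es y)‖)) := by
    intro hy hyC
    have h1 : CoefClose η (g' y) (G.map (ev (c.h y))) := by
      intro i
      rw [coeff_map, hcoef]
      split_ifs with hi
      · exact he i hi y hy
      · rw [coeff_eq_zero_of_natDegree_lt (lt_of_le_of_lt hG (not_le.1 hi))]; simp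
    have h2 : ‖mon cs es y - σ y‖ ≤ η * ‖σ y‖ := by
      have := hes y hy
      rw [norm_sub_rev, norm_eq_of_sub_le hη1 this]; exact this
    have h3 := hd (c.h y, σ y) hyC
    exact ed_close_iff (hDm (c.h y)) (hD' y) hη0.le hηδ hδ hδ1 hγ1 hηγ (h1.symm hη1) h2 h3
  constructor
  · rintro ⟨hy, hyC, h1⟩
    have := (key hy hyC).1 h1
    exact ⟨⟨⟨hy, hyC⟩, fun h => this.1 h.2⟩, c.tor y hy, this.2⟩
  · rintro ⟨⟨⟨hy, hyC⟩, h1⟩, _, h2⟩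
    exact ⟨hy, hyC, (key hy hyC).2 ⟨fun h => h1 ⟨c.tor y hy, h⟩, h2⟩⟩

end

section
variable {V R : Type} [CommRing R]

structure Cells (ev : V → R →+* ℚ_[p]) (S : Set V) (L : Set R[X]) where
  R1 : Type
  [cr : CommRing R1]
  V1 : Type
  ev1 : V1 → R1 →+* ℚ_[p]
  S1 : Set V1
  good : Good ev1 S1
  j : R →+* R1
  π : V1 → V
  hπ : ∀ v ∈ S1, π v ∈ S
  hj : ∀ v a, ev1 v (j a) = ev (π v) a
  c : R1
  C : Set (V1 × ℚ_[p])
  hC : ∀ q ∈ C, q.1 ∈ S1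
  dfn : Dfn ev1 S1 C
  ε : ℝ
  hε : 0 < ε
  inv : ∀ v s s', (v, s) ∈ C → ‖s' - s‖ ≤ ε * ‖s‖ → (v, s') ∈ C
  ex : ∀ v ∈ S, ∀ t, ∃ v1, π v1 = v ∧ (v1, t - ev1 v1 c) ∈ C
  uniq : ∀ v1 s1 v2 s2, (v1, s1) ∈ C → (v2, s2) ∈ C → π v1 = π v2 →
    ev1 v1 c + s1 = ev1 v2 c + s2 → v1 = v2
  δ : ℝ
  hδ : 0 < δ
  est : ∀ f ∈ L, ∀ q ∈ C, Est δ (taylor (ev1 q.1 c) (f.map (ev (π q.1)))) q.2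

attribute [instance] Cells.cr

def Cells.mono {ev : V → R →+* ℚ_[p]} {S : Set V} {L L' : Set R[X]} (K : Cells ev S L)
    (h : L' ⊆ L) : Cells ev S L' :=
  { K with est := fun f hf q hq => K.est f (h hf) q hq }

def HStmt (p : ℕ) [Fact p.Prime] (d : ℕ) : Prop :=
  ∀ (V R : Type) [CommRing R] (ev : V → R →+* ℚ_[p]) (S : Set V) (_ : Good ev S)
    (U : Set (V × ℚ_[p])) (_ : ∀ q ∈ U, q.1 ∈ S) (_ : Dfn ev S U) (f : R[X])
    (_ : f.natDegree ≤ d) (δ : ℝ) (_ : 0 < δ) (_ : δ ≤ 1)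
    (_ : ∀ q ∈ U, evX ev q f = 0 → RZ δ (f.map (ev q.1)) q.2),
    Good (evX ev) {q | q ∈ U ∧ evX ev q f = 0}

def CStmt (p : ℕ) [Fact p.Prime] (d : ℕ) : Prop :=
  ∀ (V R : Type) [CommRing R] (ev : V → R →+* ℚ_[p]) (S : Set V) (_ : Good ev S)
    (L : Set R[X]) (_ : L.Finite) (_ : ∀ f ∈ L, f.natDegree ≤ d), Nonempty (Cells ev S L)

theorem C0 : CStmt p 0 := by
  intro V R _ ev S hS L _ hd
  refine ⟨Cells.mk (R1 := R) (V1 := V) (ev1 := ev) (S1 := S) (good := hS) (j := RingHom.id R)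
    (π := id) (hπ := fun v hv => hv) (hj := fun _ _ => rfl) (c := 0) (C := {q | q.1 ∈ S})
    (hC := fun q hq => hq)
    (dfn := ⟨∅, Set.finite_empty, 1, one_pos, fun c hc _ σ _ => ?_⟩) (ε := 1) (hε := one_pos)
    (inv := fun v s s' h _ => h) (ex := fun v hv t => ⟨v, rfl, hv⟩)
    (uniq := fun v1 s1 v2 s2 _ _ h _ => h) (δ := 1) (hδ := one_pos)
    (est := fun f hf q _ i => ?_)⟩
  · convert c.sa using 1
    ext y
    exact ⟨fun h => h.1, fun h => ⟨h, hc ⟨y, h, rfl⟩⟩⟩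
  · rw [map_zero, taylor_zero, eval_eq_sum_range' (n := 1)
      (Nat.lt_succ_iff.2 (natDegree_map_le.trans (hd f hf)))]
    simp only [Finset.range_one, Finset.sum_singleton, pow_zero, mul_one, one_mul]
    rcases i with _ | i
    · simp
    · rw [coeff_eq_zero_of_natDegree_lt (by
        have := (natDegree_map_le (f := ev (id q.1)) (p := f)).trans (hd f hf); omega)]
      simp

end

end PSub
end Part9


section Part10
open PadicSub

namespace PSub

variable {p : ℕ} [hp : Fact p.Prime]

open Polynomial

theorem diffRef (B ε : ℝ) (hB : 0 < B) (hB1 : B ≤ 1) (hε : 0 < ε) : ∃ ε1 : ℝ, 0 < ε1 ∧ ε1 < 1 ∧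
    ∀ {ι : Type} [Fintype ι] (Y : Set (ι → ℚ_[p])) (_ : SA Y) (_ : ∀ y ∈ Y, tor y)
      (r c : (ι → ℚ_[p]) → ℚ_[p]) (_ : MonOn ε1 r Y) (_ : MonOn ε1 c Y),
      Ref (fun Z => (∀ y ∈ Z, ‖c y - r y‖ ≤ B * ‖r y‖) ∨ MonOn ε (fun y => r y - c y) Z) Y := by
  obtain ⟨ε0, h0, h01, hP⟩ := PW1 (p := p) B ε hB hε
  obtain ⟨ε1, hε1, h1a, h1b, h1c⟩ : ∃ ε1 : ℝ, 0 < ε1 ∧ ε1 ≤ ε0 ∧ ε1 < 1 ∧ ε1 ≤ B :=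
    ⟨min ε0 B, by positivity, min_le_left _ _, (min_le_left _ _).trans_lt h01, min_le_right _ _⟩
  refine ⟨ε1, hε1, h1b, fun {ι} _ Y hY ht r c hr hc => ?_⟩
  obtain ⟨cr, er, hr'⟩ := id hr
  obtain ⟨cc, ec, hc'⟩ := id hc
  have key : ∀ y ∈ Y, ‖mon cr er y - mon cc ec y‖ ≤ B * ‖mon cr er y‖ ↔
      ‖c y - r y‖ ≤ B * ‖r y‖ := by
    intro y hy
    have e1 := norm_eq_of_sub_le h1b (hr' y hy)
    have e2 := norm_eq_of_sub_le h1b (hc' y hy)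
    rcases le_or_gt ‖c y‖ ‖r y‖ with hle | hlt
    · have hd : ‖(r y - c y) - (mon cr er y - mon cc ec y)‖ ≤ B * ‖r y‖ := by
        have : (r y - c y) - (mon cr er y - mon cc ec y)
          = (r y - mon cr er y) - (c y - mon cc ec y) := by ring
        rw [this]
        refine sub_le_of ?_ ?_
        · refine (hr' y hy).trans ?_
          rw [← e1]; gcongr
        · refine (hc' y hy).trans ?_
          rw [← e2]; gcongr
      rw [norm_sub_rev (c y), ← e1]
      constructor
      · intro h
        have := add_le_of hd h
        rwa [sub_add_cancel] at this
      · intro h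
        have := sub_le_of h hd
        rwa [sub_sub_cancel] at this
    · have n1 : ‖c y - r y‖ = ‖c y‖ := norm_eq_of_sub_lt (by rwa [sub_sub_cancel_left, norm_neg])
      have n2 : ‖mon cr er y - mon cc ec y‖ = ‖mon cc ec y‖ := by
        rw [norm_sub_rev]
        exact norm_eq_of_sub_lt (by rw [sub_sub_cancel_left, norm_neg, ← e1, ← e2]; exact hlt)
      rw [n1, n2, ← e1, ← e2]
  have hA := SA.lau_le ((Lau.mon cr er).sub (Lau.mon cc ec)) (Lau.mon cr er) B hB.le
  refine Ref.split Y _ hA ?_ ?_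
  · exact Ref.one _ (SA.inter _ _ hY hA) (Or.inl fun y hy => (key y hy.1).1 hy.2.2)
  · have hs : SA (Y \ {y | tor y ∧ ‖mon cr er y - mon cc ec y‖ ≤ B * ‖mon cr er y‖}) := hY.diff hA
    have := hP (Finset.univ : Finset Bool) (fun b y => bif b then r y else - c y) _
      (fun y hy => ht y hy.1) hs (by
        rintro (_ | _) _
        · exact (hc.mono h1a Set.sdiff_subset).neg
        · exact hr.mono h1a Set.sdiff_subset) (by
        intro y hy b _
        simp only [Fintype.univ_bool, Finset.mem_singleton, Bool.true_eq_false, not_false_eq_true,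
          Finset.sum_insert, cond_true, Finset.sum_singleton, cond_false]
        have hn : ¬ ‖c y - r y‖ ≤ B * ‖r y‖ := fun h => hy.2 ⟨ht y hy.1, (key y hy.1).2 h⟩
        rw [not_le, norm_sub_rev] at hn
        rw [← sub_eq_add_neg]
        rcases b with _ | _
        · simp only [cond_false, norm_neg]
          rcases le_or_gt ‖c y‖ ‖r y‖ with hle | hlt
          · exact (mul_le_mul_of_nonneg_left hle hB.le).trans hn.le
          · have n1 : ‖c y - r y‖ = ‖c y‖ :=
              norm_eq_of_sub_lt (by rwa [sub_sub_cancel_left, norm_neg])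
            rw [norm_sub_rev, n1]
            exact mul_le_of_le_one_left (norm_nonneg _) hB1
        · exact hn.le)
    refine this.bind fun Z _ hs hZ => Ref.one _ hs (Or.inr (hZ.congr fun y _ => ?_))
    simp [sub_eq_add_neg]

section
variable {V R : Type} [CommRing R] {ev : V → R →+* ℚ_[p]} {S : Set V} {L : Set R[X]}

theorem Cells.fmap (K : Cells ev S L) (v : K.V1) (f : R[X]) :
    (f.map K.j).map (K.ev1 v) = f.map (ev (K.π v)) := by
  rw [Polynomial.map_map]
  congr 1
  ext a
  exact K.hj v a

theorem Cells.tay (K : Cells ev S L) (v : K.V1) (f : R[X]) :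
    (taylor K.c (f.map K.j)).map (K.ev1 v) = taylor (K.ev1 v K.c) (f.map (ev (K.π v))) := by
  rw [← K.fmap, map_taylor]

theorem Cells.evalc (K : Cells ev S L) (v : K.V1) (f : R[X]) :
    K.ev1 v ((f.map K.j).eval K.c) = (f.map (ev (K.π v))).eval (K.ev1 v K.c) := by
  rw [← K.fmap, eval_map_apply]

theorem H0 : HStmt p 0 := by
  intro V R _ ev S _ U _ _ f hf δ _ _ h L _ ε _
  refine CovOn.empty.of_eq ?_
  ext q
  simp only [Set.mem_empty_iff_false, Set.mem_ofPred_eq, false_iff]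
  rintro ⟨hU, h0⟩
  refine (h q hU h0).2.1 ?_
  rw [ed, derivative_map, derivative_of_natDegree_zero (Nat.le_zero.1 hf)]
  simp

end

end PSub
end Part10


section Part11
open PadicSub

namespace PSub

variable {p : ℕ} [hp : Fact p.Prime]

open Polynomial

theorem s1Ref (δ ε : ℝ) (hδ : 0 < δ) (hδ1 : δ ≤ 1) (hε : 0 < ε) : ∃ ε1 : ℝ, 0 < ε1 ∧ ε1 < 1 ∧
    ∀ {ι : Type} [Fintype ι] (Y : Set (ι → ℚ_[p])) (_ : SA Y) (_ : ∀ y ∈ Y, tor y)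
      (g : (ι → ℚ_[p]) → ℚ_[p][X]) (r c : (ι → ℚ_[p]) → ℚ_[p]) (_ : MonOn ε1 r Y)
      (_ : MonOn ε1 c Y) (_ : MonOn ε1 (fun y => (g y).eval (c y)) Y)
      (_ : MonOn ε1 (fun y => (g y).derivative.eval (c y)) Y)
      (_ : ∀ y ∈ Y, RZ δ (g y) (r y)), Ref (MonOn ε (fun y => r y - c y)) Y := by
  obtain ⟨ε', hε', hε'ε, hε'1⟩ : ∃ ε' : ℝ, 0 < ε' ∧ ε' ≤ ε ∧ ε' < 1 :=
    ⟨min ε (1/2), by positivity, min_le_left _ _, (min_le_right _ _).trans_lt (by norm_num)⟩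
  obtain ⟨ε0, h0, h01, hP⟩ := diffRef (p := p) (δ * ε') ε (by positivity)
    (by nlinarith) hε
  obtain ⟨ε1, hε1, h1a, h1b, h1c⟩ : ∃ ε1 : ℝ, 0 < ε1 ∧ ε1 ≤ ε0 ∧ ε1 < 1 ∧ ε1 ≤ ε' :=
    ⟨min ε0 ε', by positivity, min_le_left _ _, (min_le_left _ _).trans_lt h01, min_le_right _ _⟩
  refine ⟨ε1, hε1, h1b, fun {ι} _ Y hY ht g r c hr hc hg hg' hz => ?_⟩
  refine (hP Y hY ht r c (hr.mono h1a subset_rfl) (hc.mono h1a subset_rfl)).bind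
    fun Z hZ hs hQ => Ref.one _ hs ?_
  rcases hQ with hQ | hQ
  · have m1 : MonOn ε' (fun y => -((g y).eval (c y) / (g y).derivative.eval (c y))) Z := by
      have a1 := hg.mono h1c hZ
      have a2 := (hg'.mono h1c hZ).inv hε'1
      have a3 := (a1.mul hε'1.le hε'.le (fun y hy => ht y (hZ hy)) a2).neg
      exact a3.congr fun y _ => by rw [div_eq_mul_inv]
    have m2 := m1.close (g := fun y => r y - c y) hε'1 hε'.le
      (fun y hy => root_diff hδ hδ1 hε' hε'1 (hz y (hZ hy)) (hQ y hy))
    exact m2.mono hε'ε subset_rfl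
  · exact hQ

section
variable {V R : Type} [CommRing R] {ev : V → R →+* ℚ_[p]} {S : Set V}

theorem CovOn.refine {ε : ℝ} {T : Set V} (L : Set R) (hL : L.Finite)
    (h : CovOn (fun c : Chart p V => ∀ a ∈ L, DOn (fun y => ev (c.h y) a) c.Y ∧
      ∀ Z ⊆ c.Y, SA Z → Ref (MonOn ε (fun y => ev (c.h y) a)) Z) T) :
    CovOn (fun c => ∀ a ∈ L, Prep ε (fun v => ev v a) c) T := by
  refine h.bind fun c hc hinj _ => ?_
  have hr := Ref.finset hL.toFinset (fun a => MonOn ε (fun y => ev (c.h y) a))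
    (fun a _ Y Z hZ hY => hY.mono le_rfl hZ) c.Y c.sa
    (fun a ha Z hZ hs => (hc a (hL.mem_toFinset.1 ha)).2 Z hZ hs)
  exact CovOn.ofRef c hinj hr fun Z hZ hs hQ a ha =>
    ⟨(hc a ha).1.mono hZ, hQ a (hL.mem_toFinset.2 ha)⟩

theorem DOn.poly {ι : Type} {Y : Set (ι → ℚ_[p])} {g : (ι → ℚ_[p]) → ℚ_[p][X]} {D : ℕ}
    (hD : ∀ y ∈ Y, (g y).natDegree ≤ D) (hc : ∀ i ≤ D, DOn (fun y => (g y).coeff i) Y)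
    {σ : (ι → ℚ_[p]) → ℚ_[p]} (hσ : DOn σ Y) : DOn (fun y => (g y).eval (σ y)) Y := by
  have := DOn.sum (Y := Y) (Finset.range (D + 1)) (l := fun i y => (g y).coeff i * σ y ^ i)
    (fun i hi => (hc i (Nat.lt_succ_iff.1 (Finset.mem_range.1 hi))).mul (hσ.pow i))
  exact this.congr fun y hy => eval_sum (hD y hy) _

theorem Hcore (d : ℕ) (hCd : CStmt p d) (hS : Good ev S)
    (U : Set (V × ℚ_[p])) (hU : ∀ q ∈ U, q.1 ∈ S) (hUd : Dfn ev S U) (f : R[X])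
    (hf : f.natDegree ≤ d + 1) (hlead : ∀ v ∈ S, ev v (f.coeff (d + 1)) ≠ 0)
    (δ : ℝ) (hδ : 0 < δ) (hδ1 : δ ≤ 1)
    (hRZ : ∀ q ∈ U, evX ev q f = 0 → RZ δ (f.map (ev q.1)) q.2) :
    Good (evX ev) {q | q ∈ U ∧ evX ev q f = 0} := by
  intro L hL ε hε
  choose k Q R0 hdiv hR0 using pseudo_div d f hf
  obtain ⟨K⟩ := hCd V R ev S hS (R0 '' L) (hL.image _) (by rintro _ ⟨P, _, rfl⟩; exact hR0 P)
  let _ := K.cr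
  obtain ⟨ε', hε', hε'ε, hε'1⟩ : ∃ ε' : ℝ, 0 < ε' ∧ ε' ≤ ε ∧ ε' < 1 :=
    ⟨min ε (1/2), by positivity, min_le_left _ _, (min_le_right _ _).trans_lt (by norm_num)⟩
  obtain ⟨ε2, hε2, hε21, hest⟩ := estRef (p := p) d K.δ ε' K.hδ hε'
  obtain ⟨LU, hLU, εU, hεU, hDU⟩ := hUd.pull (ev' := K.ev1) (S' := K.S1) K.j K.π K.hπ K.hj
  obtain ⟨LC, hLC, εC, hεC, hDC⟩ := K.dfn
  obtain ⟨ε4, hε4, hε41, hs1⟩ := s1Ref (p := p) δ (min ε2 εC) hδ hδ1 (by positivity)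
  obtain ⟨ε5, hε5, hε51, hroot⟩ := rootCov (p := p) (d + 1) δ (min εU ε4) hδ hδ1 (by positivity)
  obtain ⟨η, hη, hη1, hη2, hη3, hη4, hη5, hη6⟩ : ∃ η : ℝ, 0 < η ∧ η ≤ ε' ∧ η ≤ ε2 ∧ η ≤ εU ∧
      η ≤ εC ∧ η ≤ ε4 ∧ η ≤ ε5 :=
    ⟨min ε' (min ε2 (min εU (min εC (min ε4 ε5)))), by positivity, by simp, by simp, by simp,
      by simp, by simp, by simp⟩
  set LL : Set K.R1 := LU ∪ LC ∪ {K.c, (f.map K.j).eval K.c, (f.derivative.map K.j).eval K.c} ∪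
    (fun i => K.j (f.coeff i)) '' (Set.Iic (d + 1)) ∪
    (⋃ P ∈ L, (fun i => (taylor K.c ((R0 P).map K.j)).coeff i) '' (Set.Iic d)) ∪
    (⋃ P ∈ L, (fun i => K.j (P.coeff i)) '' (Set.Iic P.natDegree)) with hLL
  have hLLfin : LL.Finite := by
    refine (((((hLU.union hLC).union (by simp)).union ?_).union ?_).union ?_)
    · exact (Set.finite_Iic _).image _
    · exact hL.biUnion fun P _ => (Set.finite_Iic _).image _
    · exact hL.biUnion fun P _ => (Set.finite_Iic _).image _
  have hcov := K.good.div (d + 1).factorial (Nat.factorial_pos _) LL hLLfin η hη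
  refine CovOn.refine (ev := evX ev) L hL ?_
  refine CovOn.fib _ (fun (q : V × ℚ_[p]) (v1 : K.V1) => K.π v1 = q.1 ∧ (v1, q.2 - K.ev1 v1 K.c) ∈ K.C)
    hcov ?_ ?_ ?_
  · rintro ⟨v, t⟩ ⟨hq, _⟩
    obtain ⟨v1, h1, h2⟩ := K.ex v (hU _ hq) t
    exact ⟨v1, K.hC _ h2, h1, h2⟩
  · rintro ⟨v, t⟩ _ v1 _ v2 _ ⟨h1, h2⟩ ⟨h3, h4⟩
    exact K.uniq _ _ _ _ h2 h4 (h1.trans h3.symm) (by simp)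
  intro ch hprep hinj himg
  have mU : ∀ a ∈ LU, a ∈ LL := fun a ha => by simp only [hLL, Set.mem_union]; tauto
  have mC : ∀ a ∈ LC, a ∈ LL := fun a ha => by simp only [hLL, Set.mem_union]; tauto
  have mc : K.c ∈ LL := by simp [hLL]
  have me : (f.map K.j).eval K.c ∈ LL := by simp [hLL]
  have me' : (f.derivative.map K.j).eval K.c ∈ LL := by simp [hLL]
  have mf : ∀ i ≤ d + 1, K.j (f.coeff i) ∈ LL := fun i hi => by
    simp only [hLL, Set.mem_union]
    exact Or.inl (Or.inl (Or.inr ⟨i, hi, rfl⟩))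
  have mt : ∀ P ∈ L, ∀ i ≤ d, (taylor K.c ((R0 P).map K.j)).coeff i ∈ LL := fun P hP i hi => by
    simp only [hLL, Set.mem_union]
    exact Or.inl (Or.inr (Set.mem_biUnion hP ⟨i, hi, rfl⟩))
  have mP : ∀ P ∈ L, ∀ i ≤ P.natDegree, K.j (P.coeff i) ∈ LL := fun P hP i hi => by
    simp only [hLL, Set.mem_union]
    exact Or.inr (Set.mem_biUnion hP ⟨i, hi, rfl⟩)
  clear_value LL
  have hmon : ∀ a ∈ LL, MonOn η (fun y => K.ev1 (ch.h y) a) ch.Y := fun a ha => (hprep a ha).prep.2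
  have hdon : ∀ a ∈ LL, DOn (fun y => K.ev1 (ch.h y) a) ch.Y := fun a ha => (hprep a ha).1
  set g : (ch.ι → ℚ_[p]) → ℚ_[p][X] := fun y => f.map (ev (K.π (ch.h y))) with hg
  have hgc : ∀ i y, (g y).coeff i = K.ev1 (ch.h y) (K.j (f.coeff i)) := fun i y => by
    simp [hg, coeff_map, K.hj]
  have hgd : ∀ y, (g y).natDegree ≤ d + 1 := fun y => natDegree_map_le.trans hf
  have hpr : ∀ i, ∃ c0 e, (∀ l, ((d + 1).factorial : ℤ) ∣ e l) ∧ (i ≤ d + 1 → ∀ y ∈ ch.Y,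
      ‖(g y).coeff i - mon c0 e y‖ ≤ ε5 * ‖mon c0 e y‖) := by
    intro i
    by_cases hi : i ≤ d + 1
    · obtain ⟨_, c0, e, he, h⟩ := hprep _ (mf i hi)
      refine ⟨c0, e, he, fun _ y hy => ?_⟩
      rw [hgc]
      exact (h y hy).trans (by gcongr)
    · exact ⟨0, 0, fun l => dvd_zero _, fun h => absurd h hi⟩
  choose c0 e0 he0 hce using hpr
  obtain ⟨s, A, r, hA, hAcov, hAov⟩ := hroot ch.Y ch.sa ch.tor g (fun y _ => hgd y)
    (fun i hi => (hdon _ (mf i hi)).congr fun y _ => hgc i y) c0 e0 he0 (fun i hi => hce i hi)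
  set B : (ℕ × ℕ) × ℚ_[p] → Set (ch.ι → ℚ_[p]) := fun a =>
    {y | y ∈ A a ∧ (K.π (ch.h y), r a y) ∈ U ∧ (ch.h y, r a y - K.ev1 (ch.h y) K.c) ∈ K.C} with hB
  have hsR : ∀ a ∈ s, ∀ Z ⊆ A a, SA Z →
      Ref (MonOn (min ε2 εC) (fun y => r a y - K.ev1 (ch.h y) K.c)) Z := by
    intro a ha Z hZ hs
    obtain ⟨-, hAY, -, hm, hz⟩ := hA a ha
    have hZY : Z ⊆ ch.Y := hZ.trans hAY
    refine hs1 Z hs (fun y hy => ch.tor y (hZY hy)) g (r a) _ (hm.mono (min_le_right _ _) hZ)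
      ((hmon _ mc).mono hη5 hZY) ?_ ?_ (fun y hy => hz y (hZ hy))
    · exact ((hmon _ me).mono hη5 hZY).congr fun y _ => (K.evalc _ _).symm
    · refine ((hmon _ me').mono hη5 hZY).congr fun y _ => ?_
      rw [K.evalc, hg, derivative_map]
  have hBs : ∀ a ∈ s, SA (B a) := by
    intro a ha
    obtain ⟨hAs, hAY, -, hm, hz⟩ := hA a ha
    have h1 := hDU (ch.restr (A a) hAY hAs) (by
        rintro _ ⟨y, hy, rfl⟩; exact himg ⟨y, hAY hy, rfl⟩)
      (fun b hb => (hmon b (mU b hb)).mono hη3 hAY) (r a) (hm.mono (min_le_left _ _) subset_rfl)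
    have h2 : SA {y | y ∈ A a ∧ (ch.h y, r a y - K.ev1 (ch.h y) K.c) ∈ K.C} := by
      refine SA.of_ref ((hsR a ha _ subset_rfl hAs).bind fun Z hZ hs hQ => Ref.one _ hs ?_)
      exact hDC (ch.restr Z (hZ.trans hAY) hs) (by
        rintro _ ⟨y, hy, rfl⟩; exact himg ⟨y, hAY (hZ hy), rfl⟩)
        (fun b hb => (hmon b (mC b hb)).mono hη4 (hZ.trans hAY)) _
        (hQ.mono (min_le_right _ _) subset_rfl)
    refine (SA.inter _ _ h1 h2).congr fun y => ?_
    constructor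
    · rintro ⟨h1, h2, h3⟩; exact ⟨⟨h1, h2⟩, h1, h3⟩
    · rintro ⟨⟨h1, h2⟩, _, h3⟩; exact ⟨h1, h2, h3⟩
  have hBA : ∀ a, B a ⊆ A a := fun a y hy => hy.1
  have hBY : ∀ a ∈ s, B a ⊆ ch.Y := fun a ha => (hBA a).trans (hA a ha).2.1
  have hBq : ∀ a ∈ s, ∀ b ∈ s, ∀ y ∈ B a, ∀ y' ∈ B b, K.π (ch.h y) = K.π (ch.h y') →
      r a y = r b y' → y = y' := by
    intro a ha b hb y hy y' hy' h1 h2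
    exact hinj (hBY a ha hy) (hBY b hb hy')
      (K.uniq _ _ _ _ hy.2.2 hy'.2.2 h1 (by simpa using h2))
  let cc : {a // a ∈ s} → Chart p (V × ℚ_[p]) := fun a =>
    ⟨ch.ι, B a, fun y => (K.π (ch.h y), r a y), hBs a a.2, fun y hy => ch.tor y (hBY a a.2 hy)⟩
  have hfin := CovOn.ofCover (Q := fun c : Chart p (V × ℚ_[p]) =>
      ∀ a ∈ L, DOn (fun y => evX ev (c.h y) a) c.Y ∧
      ∀ Z ⊆ c.Y, SA Z → Ref (MonOn ε (fun y => evX ev (c.h y) a)) Z) s.attach cc ?_ ?_ ?_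
  · refine hfin.of_eq ?_
    ext ⟨v, t⟩
    simp only [Set.mem_ofPred_eq]
    constructor
    · rintro ⟨a, _, y, hy, hye⟩
      obtain ⟨rfl, rfl⟩ := Prod.ext_iff.1 hye
      refine ⟨⟨hy.2.1, ?_⟩, ch.h y, ⟨y, hBY a a.2 hy, rfl⟩, rfl, hy.2.2⟩
      rw [evX_apply]
      exact ((hA a a.2).2.2.2.2 y hy.1).1
    · rintro ⟨⟨hq, hz⟩, _, ⟨y, hy, rfl⟩, h1, h2⟩
      have h1 : K.π (ch.h y) = v := h1
      subst h1
      obtain ⟨a, ha, hya, hra⟩ := hAcov y hy t (hRZ _ hq hz)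
      subst hra
      exact ⟨⟨a, ha⟩, Finset.mem_attach _ _, y, ⟨hya, hq, h2⟩, rfl⟩
  · intro a _ y hy y' hy' h
    obtain ⟨h1, h2⟩ := Prod.ext_iff.1 h
    exact hBq a a.2 a a.2 y hy y' hy' h1 h2
  · intro a _ b _
    refine (SA.inter _ _ (hBs a a.2) (hAov a a.2 b b.2)).congr fun y => ?_
    constructor
    · rintro ⟨hy, y', hy', h⟩
      obtain ⟨h1, h2⟩ := Prod.ext_iff.1 h
      have := hBq b b.2 a a.2 y' hy' y hy h1 h2
      subst this
      exact ⟨hy, hy.1, hy'.1, h2.symm⟩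
    · rintro ⟨hy, _, h2, h3⟩
      refine ⟨hy, y, ⟨h2, ?_⟩, ?_⟩
      · rw [← h3]; exact hy.2
      · exact Prod.ext rfl h3.symm
  · rintro ⟨a, ha⟩ _ Z hZ hs P hP
    obtain ⟨hAs, hAY, hdr, hm, hz⟩ := hA a ha
    have hZA : Z ⊆ A a := fun y hy => (hZ hy).1
    have hZY : Z ⊆ ch.Y := hZA.trans hAY
    have hev : ∀ P y, evX ev (K.π (ch.h y), r a y) P
        = (P.map (ev (K.π (ch.h y)))).eval (r a y) := fun P y => evX_apply _ _ _
    constructor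
    · have := DOn.poly (Y := Z) (g := fun y => P.map (ev (K.π (ch.h y)))) (D := P.natDegree)
        (fun y _ => natDegree_map_le) (fun i hi => ((hdon _ (mP P hP i hi)).mono hZY).congr
          fun y _ => by rw [coeff_map, K.hj]) (hdr.mono hZA)
      exact this.congr fun y _ => hev P y
    · intro Z' hZ' hs'
      change Z' ⊆ Z at hZ'
      change Ref (MonOn ε (fun y => evX ev (K.π (ch.h y), r a y) P)) Z'
      refine (hsR a ha Z' (hZ'.trans hZA) hs').bind fun Z2 hZ2 hs2 hQ => ?_
      have hZ2Z : Z2 ⊆ Z := hZ2.trans hZ'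
      have hZ2Y : Z2 ⊆ ch.Y := hZ2Z.trans hZY
      have ht2 : ∀ y ∈ Z2, tor y := fun y hy => ch.tor y (hZ2Y hy)
      have key := hest Z2 hs2 ht2
        (fun y => taylor (K.ev1 (ch.h y) K.c) ((R0 P).map (ev (K.π (ch.h y)))))
        (fun y _ => by rw [natDegree_taylor]; exact natDegree_map_le.trans (hR0 P))
        (fun i hi => ((hmon _ (mt P hP i hi)).mono hη2 hZ2Y).congr fun y _ => by
          rw [← K.tay, coeff_map])
        (fun y => r a y - K.ev1 (ch.h y) K.c) (hQ.mono (min_le_left _ _) subset_rfl)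
        (fun y hy => K.est _ ⟨P, hP, rfl⟩ (ch.h y, _) (hZ (hZ2Z hy)).2.2)
      refine key.bind fun Z3 hZ3 hs3 hQ3 => Ref.one _ hs3 ?_
      have hZ3Y := hZ3.trans hZ2Y
      have m1 := ((((hmon _ (mf (d + 1) le_rfl)).mono hη1 hZ3Y).inv hε'1).pow hε'1.le hε'.le
        (fun y hy => ht2 y (hZ3 hy)) (k P))
      have m2 := hQ3.mul hε'1.le hε'.le (fun y hy => ht2 y (hZ3 hy)) m1
      refine (m2.mono hε'ε subset_rfl).congr fun y hy => ?_
      have hyU := (hZ (hZ2Z (hZ3 hy))).2.1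
      have hne := hlead _ (hU _ hyU)
      have hroot0 := (hz y (hZA (hZ2Z (hZ3 hy)))).1
      have hd := congrArg (fun q => evX ev (K.π (ch.h y), r a y) q) (hdiv P)
      simp only [hev, Polynomial.map_mul, Polynomial.map_add, Polynomial.map_C, Polynomial.map_pow,
        eval_mul, eval_add, eval_pow, eval_C, map_pow] at hd
      have hroot1 : (f.map (ev (K.π (ch.h y)))).eval (r a y) = 0 := hroot0
      rw [hroot1, mul_zero, zero_add] at hd
      rw [hev, taylor_eval, sub_add_cancel, ← hd, K.hj]
      simp only at hne
      rw [mul_comm (_ ^ k P), mul_assoc, ← mul_pow, mul_inv_cancel₀ hne, one_pow, mul_one]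

end

end PSub
end Part11


section Part12
open PadicSub

namespace PSub

variable {p : ℕ} [hp : Fact p.Prime]

open Polynomial

theorem Hsucc (d : ℕ) (hH : HStmt p d) (hC : CStmt p d) : HStmt p (d + 1) := by
  intro V R _ ev S hS U hU hUd f hf δ hδ hδ1 h
  set S0 : Set V := {v | v ∈ S ∧ ev v (f.coeff (d + 1)) = 0} with hS0
  set S1 : Set V := {v | v ∈ S ∧ ¬ ev v (f.coeff (d + 1)) = 0} with hS1
  have g0 : Good ev S0 := hS.zero_aux _ (fun P => P)
  have g1 : Good ev S1 := hS.zero_aux _ (fun P => ¬ P)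
  set U0 : Set (V × ℚ_[p]) := {q | q ∈ U ∧ q.1 ∈ S0} with hU0
  set U1 : Set (V × ℚ_[p]) := {q | q ∈ U ∧ q.1 ∈ S1} with hU1
  have d0 : Dfn ev S0 U0 := (hUd.sub (fun v hv => hv.1)).congr fun v hv s =>
    ⟨fun h => h.1, fun h => ⟨h, hv⟩⟩
  have d1 : Dfn ev S1 U1 := (hUd.sub (fun v hv => hv.1)).congr fun v hv s =>
    ⟨fun h => h.1, fun h => ⟨h, hv⟩⟩
  have hfe : (f.erase (d + 1)).natDegree ≤ d := by
    rw [natDegree_le_iff_coeff_eq_zero]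
    intro i hi
    rw [coeff_erase]
    split_ifs with h0
    · rfl
    · exact coeff_eq_zero_of_natDegree_lt (by omega)
  have hmap : ∀ v ∈ S0, (f.erase (d + 1)).map (ev v) = f.map (ev v) := by
    intro v hv
    ext i
    rw [coeff_map, coeff_map, coeff_erase]
    split_ifs with h0
    · rw [h0, hv.2, map_zero]
    · rfl
  have hev : ∀ q ∈ U0, evX ev q (f.erase (d + 1)) = evX ev q f := by
    intro q hq
    rw [evX_apply, evX_apply, hmap _ hq.2]
  have r0 := hH V R ev S0 g0 U0 (fun q hq => hq.2) d0 _ hfe δ hδ hδ1 (by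
    intro q hq h0
    rw [hmap _ hq.2]
    exact h q hq.1 (by rwa [hev q hq] at h0))
  have r1 := Hcore d hC g1 U1 (fun q hq => hq.2) d1 f hf (fun v hv => hv.2) δ hδ hδ1
    (fun q hq h0 => h q hq.1 h0)
  have hun := Good.union (S := {q | q ∈ U0 ∧ evX ev q (f.erase (d + 1)) = 0})
    (T := {q | q ∈ U1 ∧ evX ev q f = 0}) ?_ r0 r1
  · convert hun using 1
    ext q
    simp only [Set.mem_ofPred_eq, Set.mem_union]
    constructor
    · rintro ⟨hq, h0⟩
      by_cases hz : ev q.1 (f.coeff (d + 1)) = 0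
      · have hq0 : q ∈ U0 := ⟨hq, hU q hq, hz⟩
        exact Or.inl ⟨hq0, by rw [hev q hq0]; exact h0⟩
      · exact Or.inr ⟨⟨hq, hU q hq, hz⟩, h0⟩
    · rintro (⟨hq, h0⟩ | ⟨hq, h0⟩)
      · exact ⟨hq.1, by rwa [hev q hq] at h0⟩
      · exact ⟨hq.1, h0⟩
  · rw [Set.disjoint_left]
    rintro q ⟨hq, _⟩ ⟨hq', _⟩
    exact hq'.2.2 hq.2.2

end PSub
end Part12


section Part13
open PadicSub

namespace PSub

variable {p : ℕ} [hp : Fact p.Prime]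

open Polynomial

section
variable {V1 R1 V2 R2 : Type} [CommRing R1] [CommRing R2]

noncomputable def sumEv (ev1 : V1 → R1 →+* ℚ_[p]) (ev2 : V2 → R2 →+* ℚ_[p]) : V1 ⊕ V2 → (R1 × R2) →+* ℚ_[p]
  | .inl v => (ev1 v).comp (RingHom.fst R1 R2)
  | .inr v => (ev2 v).comp (RingHom.snd R1 R2)

variable {ev1 : V1 → R1 →+* ℚ_[p]} {ev2 : V2 → R2 →+* ℚ_[p]} {S1 : Set V1} {S2 : Set V2}

theorem Good.sum (h1 : Good ev1 S1) (h2 : Good ev2 S2) :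
    Good (sumEv ev1 ev2) (Sum.inl '' S1 ∪ Sum.inr '' S2) := by
  refine Good.union ?_ (h1.map Sum.inl Prod.fst Sum.inl_injective.injOn fun v a => rfl)
    (h2.map Sum.inr Prod.snd Sum.inr_injective.injOn fun v a => rfl)
  rw [Set.disjoint_left]
  rintro _ ⟨v, _, rfl⟩ ⟨w, _, h⟩
  cases h

theorem Dfn.sum {C1 : Set (V1 × ℚ_[p])} {C2 : Set (V2 × ℚ_[p])} (h1 : Dfn ev1 S1 C1)
    (h2 : Dfn ev2 S2 C2) : Dfn (sumEv ev1 ev2) (Sum.inl '' S1 ∪ Sum.inr '' S2)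
      {x | Sum.elim (fun v => (v, x.2) ∈ C1) (fun v => (v, x.2) ∈ C2) x.1} := by
  obtain ⟨L1, hL1, ε1, hε1, h1⟩ := h1
  obtain ⟨L2, hL2, ε2, hε2, h2⟩ := h2
  refine ⟨{(1, 0)} ∪ (fun a => (a, 0)) '' L1 ∪ (fun a => (0, a)) '' L2, ?_,
    min ε1 (min ε2 (1/2)), by positivity, ?_⟩
  · exact ((Set.finite_singleton _).union (hL1.image _)).union (hL2.image _)
  intro c hc hM σ hσ
  have hone := (hM (1, 0) (Or.inl (Or.inl rfl))).zero_or
    ((min_le_right _ _).trans_lt ((min_le_right _ _).trans_lt (by norm_num))) c.tor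
  rcases c.Y.eq_empty_or_nonempty with hemp | ⟨y0, hy0⟩
  · refine SA.empty.congr fun y => ?_
    simp [hemp]
  rcases hone with hz | hz
  · have hr : ∀ y ∈ c.Y, ∃ v ∈ S2, c.h y = Sum.inr v := by
      intro y hy
      rcases hc ⟨y, hy, rfl⟩ with ⟨v, hv, he⟩ | ⟨v, hv, he⟩
      · have := hz y hy
        rw [← he] at this
        exact absurd this (by simp [sumEv])
      · exact ⟨v, hv, he.symm⟩
    obtain ⟨v0, -, -⟩ := hr y0 hy0
    let c' : Chart p V2 := ⟨c.ι, c.Y, fun y => Sum.elim (fun _ => v0) id (c.h y), c.sa, c.tor⟩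
    have := h2 c' (by
      rintro _ ⟨y, hy, rfl⟩
      obtain ⟨v, hv, he⟩ := hr y hy
      change Sum.elim _ _ (c.h y) ∈ S2
      rw [he]; exact hv) (by
      intro a ha
      refine ((hM (0, a) (Or.inr ⟨a, ha, rfl⟩)).mono ((min_le_right _ _).trans (min_le_left _ _))
        subset_rfl).congr ?_
      intro y hy
      obtain ⟨v, hv, he⟩ := hr y hy
      simp [c', he, sumEv]) σ (hσ.mono ((min_le_right _ _).trans (min_le_left _ _)) subset_rfl)
    refine this.congr fun y => ?_
    refine and_congr_right fun hy => ?_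
    obtain ⟨v, hv, he⟩ := hr y hy
    simp [c', he]
  · have hr : ∀ y ∈ c.Y, ∃ v ∈ S1, c.h y = Sum.inl v := by
      intro y hy
      rcases hc ⟨y, hy, rfl⟩ with ⟨v, hv, he⟩ | ⟨v, hv, he⟩
      · exact ⟨v, hv, he.symm⟩
      · have := hz y hy
        rw [← he] at this
        exact absurd (by simp [sumEv]) this
    obtain ⟨v0, -, -⟩ := hr y0 hy0
    let c' : Chart p V1 := ⟨c.ι, c.Y, fun y => Sum.elim id (fun _ => v0) (c.h y), c.sa, c.tor⟩
    have := h1 c' (by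
      rintro _ ⟨y, hy, rfl⟩
      obtain ⟨v, hv, he⟩ := hr y hy
      change Sum.elim _ _ (c.h y) ∈ S1
      rw [he]; exact hv) (by
      intro a ha
      refine ((hM (a, 0) (Or.inl (Or.inr ⟨a, ha, rfl⟩))).mono (min_le_left _ _)
        subset_rfl).congr ?_
      intro y hy
      obtain ⟨v, hv, he⟩ := hr y hy
      simp [c', he, sumEv]) σ (hσ.mono (min_le_left _ _) subset_rfl)
    refine this.congr fun y => ?_
    refine and_congr_right fun hy => ?_
    obtain ⟨v, hv, he⟩ := hr y hy
    simp [c', he]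

theorem Dfn.ball (Z : Set (V1 × ℚ_[p])) (γ : ℝ) (hγ : 0 ≤ γ) :
    Dfn (evX ev1) Z {x | x.1 ∈ Z ∧ ‖x.2‖ ≤ γ * ‖x.1.2‖} := by
  refine ⟨{X}, Set.finite_singleton _, 1/2, by norm_num, fun c hc hM σ hσ => ?_⟩
  have := MonOn.sa_le (by norm_num) c.tor c.sa hσ (hM X rfl) γ hγ
  refine this.congr fun y => and_congr_right fun hy => ?_
  have h1 : evX ev1 (c.h y) X = (c.h y).2 := by rw [evX_apply]; simp
  rw [h1]
  exact ⟨fun h => h.2, fun h => ⟨hc ⟨y, hy, rfl⟩, h⟩⟩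

end

theorem derivative_taylor' {R : Type} [CommRing R] (r : R) (f : R[X]) :
    derivative (taylor r f) = taylor r (derivative f) := by
  rw [taylor_apply, taylor_apply, derivative_comp]
  simp

section
variable {V R : Type} [CommRing R] {ev : V → R →+* ℚ_[p]} {S : Set V} {A : Set R[X]}

theorem Cells.dest (K : Cells ev S A) (f : R[X]) (d : ℕ) (hf : f.natDegree ≤ d)
    (hA : derivative f ∈ A) : ∃ δ : ℝ, 0 < δ ∧ δ ≤ 1 ∧ ∀ q ∈ K.C,
      DEst δ (taylor (K.ev1 q.1 K.c) (f.map (ev (K.π q.1)))) q.2 := by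
  obtain ⟨c, hc, hc1, h⟩ := DEst.of_deriv (p := p) d
  refine ⟨min 1 (c * K.δ), lt_min one_pos (mul_pos hc K.hδ), min_le_left _ _, fun q hq => ?_⟩
  refine (h _ _ K.δ K.hδ.le ?_ ?_).mono (min_le_right _ _)
  · rw [natDegree_taylor]; exact natDegree_map_le.trans hf
  · rw [derivative_taylor', derivative_map]
    exact K.est _ hA q hq

theorem rel_x {s r : ℚ_[p]} (hr : r ≠ 0) : s = r * (1 + (s - r) / r) := by field_simp; ring

theorem near_iff {g : ℚ_[p][X]} {δ γ : ℝ} (hδ : 0 < δ) (hδ1 : δ ≤ 1) {r s : ℚ_[p]}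
    (h : RZ δ g r) (hγ : γ < δ) (hs : ‖s - r‖ ≤ γ * ‖r‖) (hγ0 : 0 ≤ γ) :
    ed g s ≠ 0 ∧ ‖g.eval s‖ ≤ γ * ‖ed g s‖ := by
  have hr : r ≠ 0 := h.ne
  have hed := (DEst.close le_rfl le_rfl hγ0 hγ hδ hδ1 (CoefClose.refl hγ0 g) hs h.2.2).2
  have hx : ‖(s - r) / r‖ ≤ γ := by
    rw [norm_div]; exact (div_le_iff₀ (norm_pos_iff.2 hr)).2 hs
  have hn := near_root_norm hδ hδ1 h hx hγ
  rw [← rel_x hr] at hn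
  refine ⟨fun h0 => h.2.1 ?_, ?_⟩
  · rw [h0, norm_zero] at hed; exact norm_eq_zero.1 hed.symm
  · rw [hn, hed, mul_comm]; gcongr

theorem near_conv {g : ℚ_[p][X]} {δ γ ε : ℝ} (hδ : 0 < δ) (hδ1 : δ ≤ 1) {r s : ℚ_[p]}
    (hds : DEst δ g s) (hdr : DEst δ g r) (hε0 : 0 ≤ ε) (hε : ε < δ)
    (hr0 : g.eval r = 0) (hrs : ‖r - s‖ ≤ ε * ‖s‖)
    (h : ed g s ≠ 0 ∧ ‖g.eval s‖ ≤ γ * ‖ed g s‖) : RZ δ g r ∧ ‖s - r‖ ≤ γ * ‖r‖ := by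
  have hed := (DEst.close le_rfl le_rfl hε0 hε hδ hδ1 (CoefClose.refl hε0 g) hrs hds).2
  have hedr : ed g r ≠ 0 := fun h0 => h.1 (by
    rw [h0, norm_zero] at hed; exact norm_eq_zero.1 hed.symm)
  have hz : RZ δ g r := ⟨hr0, hedr, hdr⟩
  refine ⟨hz, ?_⟩
  have hr : r ≠ 0 := hz.ne
  have hrn : ‖r‖ = ‖s‖ := norm_eq_of_sub_le (hε.trans_le hδ1) hrs
  have hx : ‖(s - r) / r‖ ≤ ε := by
    rw [norm_div]; refine (div_le_iff₀ (norm_pos_iff.2 hr)).2 ?_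
    rw [norm_sub_rev, hrn]; exact hrs
  have hn := near_root_norm hδ hδ1 hz hx hε
  rw [← rel_x hr] at hn
  have h2 := h.2
  rw [hn, ← hed, mul_comm γ] at h2
  have h3 := le_of_mul_le_mul_left h2 (norm_pos_iff.2 hedr)
  rw [norm_div, div_le_iff₀ (norm_pos_iff.2 hr)] at h3
  exact h3

theorem Cells.step (d : ℕ) (hH : HStmt p d) (K : Cells ev S A) (f : R[X]) (hf : f.natDegree ≤ d)
    (hA : derivative f ∈ A) : Nonempty (Cells ev S (insert f A)) := by
  let _ := K.cr
  obtain ⟨δ, hδ, hδ1, hD⟩ := K.dest f d hf hA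
  obtain ⟨ε0, hε0, hεδ0, hεK0⟩ : ∃ ε0 : ℝ, 0 < ε0 ∧ ε0 < δ ∧ ε0 ≤ K.ε :=
    ⟨min (δ / 2) K.ε, lt_min (by positivity) K.hε,
      (min_le_left _ _).trans_lt (by linarith), min_le_right _ _⟩
  obtain ⟨β, hβ, hβ1, Φ, -, hΦ⟩ := hensel_root (p := p) d δ ε0 hδ hδ1 hε0
  obtain ⟨γ, hγ, hγβ, hγδ, hγK⟩ : ∃ γ : ℝ, 0 < γ ∧ γ ≤ β ∧ γ < δ ∧ γ ≤ K.ε :=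
    ⟨min β (min (δ / 2) K.ε), lt_min hβ (lt_min (by positivity) K.hε), min_le_left _ _,
      (min_le_right _ _).trans_lt ((min_le_left _ _).trans_lt (by linarith)),
      (min_le_right _ _).trans (min_le_right _ _)⟩
  have hγ1 : γ < 1 := hγδ.trans_le hδ1
  set G : K.R1[X] := taylor K.c (f.map K.j) with hG
  have hGd : G.natDegree ≤ d := by
    rw [hG, natDegree_taylor]; exact natDegree_map_le.trans hf
  have hGm : ∀ v, G.map (K.ev1 v) = taylor (K.ev1 v K.c) (f.map (ev (K.π v))) :=
    fun v => K.tay v f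
  have hD' : ∀ q ∈ K.C, DEst δ (G.map (K.ev1 q.1)) q.2 := fun q hq => by
    rw [hGm]; exact hD q hq
  clear_value G
  set W : Set (K.V1 × ℚ_[p]) := {q | q ∈ K.C ∧ ed (G.map (K.ev1 q.1)) q.2 ≠ 0 ∧
      ‖(G.map (K.ev1 q.1)).eval q.2‖ ≤ γ * ‖ed (G.map (K.ev1 q.1)) q.2‖} with hW
  have hWd : Dfn K.ev1 K.S1 W := K.dfn.near G hGd hδ hδ1 hγ hγ1.le hD'
  set Z : Set (K.V1 × ℚ_[p]) := {q | q ∈ W ∧ evX K.ev1 q G = 0} with hZ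
  have hRZ : ∀ q ∈ W, evX K.ev1 q G = 0 → RZ δ (G.map (K.ev1 q.1)) q.2 := by
    intro q hq h0
    rw [evX_apply] at h0
    exact ⟨h0, hq.2.1, hD' q hq.1⟩
  have hZg : Good (evX K.ev1) Z :=
    hH K.V1 K.R1 K.ev1 K.S1 K.good W (fun q hq => K.hC q hq.1) hWd G hGd δ hδ hδ1 hRZ
  have hZr : ∀ v r, (v, r) ∈ Z → RZ δ (G.map (K.ev1 v)) r := fun v r h => hRZ _ h.1 h.2
  -- key facts
  have k1 : ∀ v s, (v, s) ∈ W → ∃ r, (v, r) ∈ Z ∧ ‖s - r‖ ≤ γ * ‖r‖ := by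
    rintro v s ⟨hC, hed, hle⟩
    simp only at hed hle
    have hle' : ‖(G.map (K.ev1 v)).eval s‖ ≤ β * ‖ed (G.map (K.ev1 v)) s‖ :=
      hle.trans (mul_le_mul_of_nonneg_right hγβ (norm_nonneg _))
    have hdv : DEst δ (G.map (K.ev1 v)) s := hD' (v, s) hC
    have hdeg : (G.map (K.ev1 v)).natDegree ≤ d := natDegree_map_le.trans hGd
    have hex : ∃ r, (G.map (K.ev1 v)).eval r = 0 ∧ ‖r - s‖ ≤ ε0 * ‖s‖ := by
      obtain ⟨h0, hc⟩ := hΦ (G.map (K.ev1 v)) s hdeg hed hdv hle' (fun o => o.elim s fun i => (G.map (K.ev1 v)).coeff i) rfl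
        (fun i => rfl)
      exact ⟨_, h0, hc⟩
    clear hΦ
    obtain ⟨r, h0, hc⟩ := hex
    have hrC : (v, r) ∈ K.C := K.inv v s r hC (hc.trans (by gcongr))
    have hdr : DEst δ (G.map (K.ev1 v)) r := hD' (v, r) hrC
    obtain ⟨hz, hsr⟩ := near_conv hδ hδ1 hdv hdr hε0.le hεδ0 h0 hc ⟨hed, hle⟩
    refine ⟨r, ⟨⟨hrC, hz.2.1, ?_⟩, ?_⟩, hsr⟩
    · simp only
      rw [h0, norm_zero]; positivity
    · rw [evX_apply]; exact h0
  have k2 : ∀ v r s, (v, r) ∈ Z → ‖s - r‖ ≤ γ * ‖r‖ → (v, s) ∈ W := by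
    intro v r s hz hs
    exact ⟨K.inv v r s hz.1.1 (hs.trans (by gcongr)), near_iff hδ hδ1 (hZr v r hz) hγδ hs hγ.le⟩
  have k3 : ∀ v r r' s, (v, r) ∈ Z → (v, r') ∈ Z → ‖s - r‖ ≤ γ * ‖r‖ → ‖s - r'‖ ≤ γ * ‖r'‖ →
      r = r' := by
    intro v r r' s hz hz' hs hs'
    have h1 := norm_eq_of_sub_le hγ1 hs
    have h2 := norm_eq_of_sub_le hγ1 hs'
    have hz1 := hZr v r hz
    refine (root_uniq hδ hδ1 hz1.2.2 hz1.2.1 hz1.1 (hZr v r' hz').1 ?_).symm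
    have h3 : ‖r' - r‖ ≤ γ * ‖r‖ := by
      have := sub_le_of hs (h1 ▸ h2 ▸ hs')
      rwa [sub_sub_sub_cancel_left] at this
    exact h3.trans_lt (mul_lt_mul_of_pos_right hγδ (norm_pos_iff.2 hz1.ne))
  have k4 : ∀ v r s, (v, r) ∈ Z → ‖s‖ ≤ γ * ‖r‖ → (v, r + s) ∈ W := by
    intro v r s hz hs
    exact k2 v r _ hz (by rwa [add_sub_cancel_left])
  have evc : ∀ v r, sumEv K.ev1 (evX K.ev1) (Sum.inr (v, r)) (K.c, Polynomial.C K.c + X)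
      = K.ev1 v K.c + r := by
    intro v r
    change evX K.ev1 (v, r) (Polynomial.C K.c + X) = _
    rw [evX_apply]; simp
  obtain ⟨η, hη, hηK, hηδ, hηγ⟩ : ∃ η : ℝ, 0 < η ∧ η ≤ K.ε ∧ η < δ ∧ η / δ ≤ γ :=
    ⟨min K.ε (γ * δ / 2), lt_min K.hε (by positivity), min_le_left _ _,
      (min_le_right _ _).trans_lt (by nlinarith [mul_pos hγ hδ]), by
        rw [div_le_iff₀ hδ]; exact (min_le_right _ _).trans (by nlinarith [mul_pos hγ hδ])⟩
  refine ⟨Cells.mk (R1 := K.R1 × K.R1[X]) (V1 := K.V1 ⊕ (K.V1 × ℚ_[p]))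
    (ev1 := sumEv K.ev1 (evX K.ev1)) (S1 := Sum.inl '' K.S1 ∪ Sum.inr '' Z)
    (good := K.good.sum hZg) (j := RingHom.prod K.j (Polynomial.C.comp K.j))
    (π := Sum.elim K.π (fun q => K.π q.1)) (hπ := ?_) (hj := ?_)
    (c := (K.c, Polynomial.C K.c + X))
    (C := {x | Sum.elim (fun v => (v, x.2) ∈ K.C ∩ Wᶜ)
      (fun v => (v, x.2) ∈ {x : (K.V1 × ℚ_[p]) × ℚ_[p] | x.1 ∈ Z ∧ ‖x.2‖ ≤ γ * ‖x.1.2‖}) x.1})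
    (hC := ?_) (dfn := (K.dfn.inter hWd.compl).sum (Dfn.ball Z γ hγ.le)) (ε := η) (hε := hη)
    (inv := ?_) (ex := ?_) (uniq := ?_) (δ := min K.δ (γ * δ))
    (hδ := lt_min K.hδ (by positivity)) (est := ?_)⟩
  · rintro _ (⟨v, hv, rfl⟩ | ⟨⟨v, r⟩, hv, rfl⟩)
    · exact K.hπ v hv
    · exact K.hπ v (K.hC _ hv.1.1)
  · rintro (v | ⟨v, r⟩) a
    · exact K.hj v a
    · change evX K.ev1 (v, r) (Polynomial.C (K.j a)) = _
      rw [evX_apply]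
      simp [K.hj]
  · rintro ⟨v | q, s⟩ h
    · exact Or.inl ⟨v, K.hC _ h.1, rfl⟩
    · exact Or.inr ⟨q, h.1, rfl⟩
  · rintro (v | ⟨v, r⟩) s s' h hs
    · obtain ⟨h1, h2⟩ := h
      refine ⟨K.inv v s s' h1 (hs.trans (by gcongr)), fun hw => h2 ⟨h1, ?_⟩⟩
      exact (ed_close_iff le_rfl le_rfl hη.le hηδ hδ hδ1 hγ1.le hηγ (CoefClose.refl hη.le _) hs
        (hD' _ h1)).2 hw.2
    · obtain ⟨h1, h2⟩ := h
      refine ⟨h1, ?_⟩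
      have := norm_eq_of_sub_le (hηδ.trans_le hδ1) hs
      simp only at h2 ⊢
      rwa [this]
  · intro v hv t
    obtain ⟨v1, hv1, hC⟩ := K.ex v hv t
    by_cases hw : (v1, t - K.ev1 v1 K.c) ∈ W
    · obtain ⟨r, hr, hs⟩ := k1 _ _ hw
      refine ⟨Sum.inr (v1, r), hv1, hr, ?_⟩
      simp only [evc]
      rwa [← sub_sub]
    · exact ⟨Sum.inl v1, hv1, hC, hw⟩
  · rintro (v | ⟨v, r⟩) s (v' | ⟨v', r'⟩) s' h h' hp he
    · rw [K.uniq v s v' s' h.1 h'.1 hp he]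
    · obtain ⟨h1, h2⟩ := h'
      rw [evc] at he
      have hw := k4 v' r' s' h1 h2
      rw [add_assoc] at he
      have := K.uniq v s v' _ h.1 hw.1 hp he
      subst this
      have hss : s = r' + s' := by
        have : K.ev1 v K.c + s = K.ev1 v K.c + (r' + s') := he
        exact add_left_cancel this
      exact absurd (hss ▸ hw) h.2
    · obtain ⟨h1, h2⟩ := h
      rw [evc] at he
      have hw := k4 v r s h1 h2
      rw [add_assoc] at he
      have := K.uniq v _ v' s' hw.1 h'.1 hp he
      subst this
      have hss : r + s = s' := by
        have : K.ev1 v K.c + (r + s) = K.ev1 v K.c + s' := he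
        exact add_left_cancel this
      exact absurd (hss ▸ hw) h'.2
    · obtain ⟨h1, h2⟩ := h
      obtain ⟨h1', h2'⟩ := h'
      rw [evc, evc, add_assoc, add_assoc] at he
      have := K.uniq v _ v' _ (k4 v r s h1 h2).1 (k4 v' r' s' h1' h2').1 hp he
      subst this
      have hss := add_left_cancel he
      have := k3 v r r' (r + s) h1 h1' (by rwa [add_sub_cancel_left])
        (by rw [hss]; rwa [add_sub_cancel_left])
      rw [this]
  · rintro g hg ⟨v | ⟨v, r⟩, s⟩ h
    · rcases hg with rfl | hg
      · refine Est.mono (min_le_right _ _) ?_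
        have h2 : ¬ (ed (G.map (K.ev1 v)) s ≠ 0 ∧ ‖(G.map (K.ev1 v)).eval s‖ ≤
          γ * ‖ed (G.map (K.ev1 v)) s‖) := fun hh => h.2 ⟨h.1, hh⟩
        have := est_off hδ hδ1 hγ hγ1.le (hD' _ h.1) h2
        rw [hGm] at this
        exact this
      · exact (K.est g hg (v, s) h.1).mono (min_le_left _ _)
    · obtain ⟨h1, h2⟩ := h
      change Est _ (taylor (sumEv K.ev1 (evX K.ev1) (Sum.inr (v, r)) (K.c, Polynomial.C K.c + X))
        (g.map (ev (K.π v)))) s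
      rw [evc, add_comm, ← taylor_taylor]
      rcases hg with rfl | hg
      · have hz := hZr v r h1
        rw [hGm] at hz
        refine (est_root hδ hδ1 hz h2 hγδ).mono ((min_le_right _ _).trans ?_)
        exact mul_le_of_le_one_left hδ.le hγ1.le
      · refine Est.mono (min_le_left _ _) ?_
        have hz := hZr v r h1
        have h2 : ‖s‖ ≤ γ * ‖r‖ := h2
        refine Est.taylor K.hδ ?_ ?_ (K.est g hg (v, r + s) (k4 v r s h1 h2).1)
        · exact h2.trans (mul_le_of_le_one_left (norm_nonneg _) hγ1.le)
        · exact norm_eq_of_sub_le hγ1 (by rwa [add_sub_cancel_left])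

end

end PSub
end Part13


section Part14
open PadicSub

namespace PSub

variable {p : ℕ} [hp : Fact p.Prime]

open Polynomial

theorem Csucc (d : ℕ) (hH : HStmt p (d + 1)) (hC : CStmt p d) : CStmt p (d + 1) := by
  intro V R _ ev S hS L hL hd
  obtain ⟨K0⟩ := hC V R ev S hS (derivative '' L) (hL.image _) (by
    rintro _ ⟨f, hf, rfl⟩
    exact (natDegree_derivative_le f).trans (by have := hd f hf; omega))
  have key : ∀ L' : Set R[X], L'.Finite → L' ⊆ L → Nonempty (Cells ev S (derivative '' L ∪ L')) := by
    intro L' hL'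
    induction L', hL' using Set.Finite.induction_on with
    | empty => intro _; rw [Set.union_empty]; exact ⟨K0⟩
    | @insert f s _ _ ih =>
      intro hs
      obtain ⟨K⟩ := ih ((Set.subset_insert _ _).trans hs)
      have hf : f ∈ L := hs (Set.mem_insert _ _)
      rw [Set.union_insert]
      exact K.step (d + 1) hH f (hd f hf) (Or.inl ⟨f, hf, rfl⟩)
  obtain ⟨K⟩ := key L hL subset_rfl
  exact ⟨K.mono Set.subset_union_right⟩

theorem HC (d : ℕ) : HStmt p d ∧ CStmt p d := by
  induction d with
  | zero => exact ⟨H0, C0⟩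
  | succ d ih =>
    have h := Hsucc d ih.1 ih.2
    exact ⟨h, Csucc d h ih.2⟩

end PSub
end Part14


section Part15
open PadicSub

namespace PSub

variable {p : ℕ} [hp : Fact p.Prime]

open Polynomial

section
variable {V R : Type} [CommRing R] {ev : V → R →+* ℚ_[p]} {S : Set V} {A : Set R[X]}

theorem MonOn.some {ι : Type} [Fintype ι] {ε : ℝ} {f : (ι → ℚ_[p]) → ℚ_[p]} {Y : Set (ι → ℚ_[p])}
    (h : MonOn ε f Y) {Z : Set (Option ι → ℚ_[p])} (hZ : ∀ z ∈ Z, (fun i => z (some i)) ∈ Y) :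
    MonOn ε (fun z : Option ι → ℚ_[p] => f fun i => z (Option.some i)) Z := by
  obtain ⟨c, e, h⟩ := h
  refine ⟨c, fun o => o.elim 0 e, fun z hz => ?_⟩
  have := h _ (hZ z hz)
  have e1 : PSub.mon c (fun o : Option ι => o.elim 0 e) z = PSub.mon c e (fun i => z (Option.some i)) := by
    simp [PSub.mon, Fintype.prod_option]
  rw [e1]; exact this

theorem DOn.some {ι : Type} {f : (ι → ℚ_[p]) → ℚ_[p]} {Y : Set (ι → ℚ_[p])}
    (h : DOn f Y) {Z : Set (Option ι → ℚ_[p])} (hZ : ∀ z ∈ Z, (fun i => z (some i)) ∈ Y) :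
    DOn (fun z : Option ι → ℚ_[p] => f fun i => z (Option.some i)) Z :=
  h.comp (fun i => (DF.coord (Option.some i)).don) hZ

theorem thmA_chart (K : Cells ev S A) (f : R[X]) (D : ℕ) (hf : f.natDegree ≤ D) (hA : f ∈ A)
    (ε : ℝ) (hε : 0 < ε) : ∃ ε1 : ℝ, 0 < ε1 ∧ ε1 < 1 ∧ ∀ {κ : Type} [Fintype κ]
      (Y : Set (κ → ℚ_[p])) (_ : SA Y) (_ : ∀ y ∈ Y, tor y)
      (h : (κ → ℚ_[p]) → K.V1) (σ : (κ → ℚ_[p]) → ℚ_[p]) (_ : ∀ y ∈ Y, (h y, σ y) ∈ K.C)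
      (_ : MonOn ε1 σ Y) (_ : DOn σ Y)
      (_ : ∀ i ≤ D, letI := K.cr
        MonOn ε1 (fun y => K.ev1 (h y) ((taylor K.c (f.map K.j)).coeff i)) Y)
      (_ : ∀ i ≤ D, letI := K.cr
        DOn (fun y => K.ev1 (h y) ((taylor K.c (f.map K.j)).coeff i)) Y),
      DOn (fun y => evX ev (K.π (h y), (letI := K.cr; K.ev1 (h y) K.c) + σ y) f) Y ∧
        ∀ Z ⊆ Y, SA Z →
          Ref (MonOn ε (fun y => evX ev (K.π (h y), (letI := K.cr; K.ev1 (h y) K.c) + σ y) f)) Z := by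
  let _ := K.cr
  obtain ⟨ε1, h1, h2, hr⟩ := estRef (p := p) D K.δ ε K.hδ hε
  refine ⟨ε1, h1, h2, ?_⟩
  intro κ _ Y hY htor h σ hC hσ hσD hm hd
  have hg : ∀ y, evX ev (K.π (h y), K.ev1 (h y) K.c + σ y) f
      = (((taylor K.c (f.map K.j)).map (K.ev1 (h y)))).eval (σ y) := by
    intro y
    rw [K.tay, evX_apply, taylor_eval, add_comm]
  have hdeg : ∀ y, ((taylor K.c (f.map K.j)).map (K.ev1 (h y))).natDegree ≤ D := fun y =>
    natDegree_map_le.trans (by rw [natDegree_taylor]; exact natDegree_map_le.trans hf)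
  refine ⟨?_, fun Z hZ hZs => ?_⟩
  · have := DOn.poly (Y := Y) (g := fun y => (taylor K.c (f.map K.j)).map (K.ev1 (h y)))
      (fun y _ => hdeg y) (fun i hi => by
        refine (hd i hi).congr fun y _ => ?_
        rw [coeff_map]) hσD
    exact this.congr fun y _ => hg y
  · have a1 : ∀ i ≤ D, MonOn ε1
        (fun y => ((taylor K.c (f.map K.j)).map (K.ev1 (h y))).coeff i) Z := by
      intro i hi
      refine ((hm i hi).mono le_rfl hZ).congr fun y _ => ?_
      rw [coeff_map]
    have a2 : ∀ y ∈ Z, Est K.δ ((taylor K.c (f.map K.j)).map (K.ev1 (h y))) (σ y) := by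
      intro y hy
      have := K.est f hA _ (hC y (hZ hy))
      rw [K.tay]; exact this
    have := hr Z hZs (fun y hy => htor y (hZ hy))
      (fun y => (taylor K.c (f.map K.j)).map (K.ev1 (h y))) (fun y _ => hdeg y)
      a1 σ (hσ.mono le_rfl hZ) a2
    have e : (fun y => evX ev (K.π (h y), K.ev1 (h y) K.c + σ y) f)
      = fun y => (((taylor K.c (f.map K.j)).map (K.ev1 (h y)))).eval (σ y) := funext hg
    rw [e]; exact this

theorem exists_common {α : Type*} {L : Set α} (hL : L.Finite) (P : α → ℝ → Prop)
    (h : ∀ a ∈ L, ∃ ε : ℝ, 0 < ε ∧ ε < 1 ∧ P a ε) (hm : ∀ a ε ε', 0 < ε' → ε' ≤ ε → P a ε → P a ε') :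
    ∃ ε : ℝ, 0 < ε ∧ ε < 1 ∧ ∀ a ∈ L, P a ε := by
  induction L, hL using Set.Finite.induction_on with
  | empty => exact ⟨1/2, by norm_num, by norm_num, by simp⟩
  | @insert a s _ _ ih =>
    obtain ⟨ε1, h1, h1', h2⟩ := ih fun b hb => h b (Or.inr hb)
    obtain ⟨ε2, h3, h3', h4⟩ := h a (Or.inl rfl)
    refine ⟨min ε1 ε2, lt_min h1 h3, (min_le_left _ _).trans_lt h1', ?_⟩
    rintro b (rfl | hb)
    · exact hm _ _ _ (lt_min h1 h3) (min_le_right _ _) h4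
    · exact hm _ _ _ (lt_min h1 h3) (min_le_left _ _) (h2 b hb)

theorem thmA (hS : Good ev S) : Good (evX ev) {q | q.1 ∈ S} := by
  intro L hL ε hε
  obtain ⟨D, hD⟩ : ∃ D, ∀ f ∈ L, f.natDegree ≤ D := by
    obtain ⟨D, hD⟩ := (hL.image natDegree).bddAbove
    exact ⟨D, fun f hf => hD ⟨f, hf, rfl⟩⟩
  obtain ⟨K⟩ := (HC (p := p) D).2 V R ev S hS L hL hD
  let _ := K.cr
  refine CovOn.refine L hL ?_
  obtain ⟨ε1, hε1, hε11, hch⟩ := exists_common hL _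
    (fun f hf => thmA_chart K f D (hD f hf) hf ε hε) (by
      intro f ε1 ε2 h0 hle h κ _ Y hY ht h' σ hC hσ hσD hm hd
      exact h Y hY ht h' σ hC (hσ.mono hle subset_rfl) hσD
        (fun i hi => (hm i hi).mono hle subset_rfl) hd)
  obtain ⟨L0, hL0, ε0, hε0, hdfn⟩ := K.dfn
  let L1 : Set K.R1 := {K.c} ∪ L0 ∪
    (fun x : R[X] × ℕ => (taylor K.c (x.1.map K.j)).coeff x.2) '' (L ×ˢ Set.Iic D)
  have hL1 : L1.Finite := ((Set.finite_singleton _).union hL0).union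
    ((hL.prod (Set.finite_Iic D)).image _)
  have hcov := K.good L1 hL1 (min ε0 ε1) (lt_min hε0 hε1)
  have hcf : ∀ f ∈ L, ∀ i ≤ D, (taylor K.c (f.map K.j)).coeff i ∈ L1 := fun f hf i hi =>
    Or.inr ⟨(f, i), ⟨hf, hi⟩, rfl⟩
  refine CovOn.fib _ (fun w v => K.π v = w.1 ∧ (v, w.2 - K.ev1 v K.c) ∈ K.C) hcov ?_ ?_ ?_
  · rintro ⟨v, t⟩ hv
    obtain ⟨v1, h1, h2⟩ := K.ex v hv t
    exact ⟨v1, K.hC _ h2, h1, h2⟩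
  · rintro ⟨v, t⟩ hv v1 _ v2 _ h1 h2
    exact K.uniq _ _ _ _ h1.2 h2.2 (h1.1.trans h2.1.symm) (by ring)
  intro c hc hinj hcS
  have hm : ∀ a ∈ L1, MonOn (min ε0 ε1) (fun y => K.ev1 (c.h y) a) c.Y := fun a ha => (hc a ha).2
  have hd : ∀ a ∈ L1, DOn (fun y => K.ev1 (c.h y) a) c.Y := fun a ha => (hc a ha).1
  have hmin : 0 < min ε0 ε1 := lt_min hε0 hε1
  -- the chart with `σ = 0`
  let Y0 : Set (c.ι → ℚ_[p]) := {y | y ∈ c.Y ∧ (c.h y, 0) ∈ K.C}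
  have hY0 : SA Y0 := hdfn c hcS (fun a ha => (hm a (Or.inl (Or.inr ha))).mono (min_le_left _ _)
    subset_rfl) (fun _ => 0) (MonOn.const hε0.le 0)
  let c0 : Chart p (V × ℚ_[p]) := ⟨c.ι, Y0, fun y => (K.π (c.h y), K.ev1 (c.h y) K.c + 0), hY0,
    fun y hy => c.tor y hy.1⟩
  -- the chart with `σ ≠ 0`
  let Y' : Set (Option c.ι → ℚ_[p]) := {y | (fun i => y (some i)) ∈ c.Y ∧ y none ≠ 0}
  have hY' : SA Y' := SA.and (c.sa.reindex some) (SA.not (by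
    have := SA.zero (p := p) (MvPolynomial.X (none : Option c.ι)); simpa using this))
  let cO : Chart p K.V1 := ⟨Option c.ι, Y', fun y => c.h fun i => y (some i), hY', by
    rintro y hy (_ | i)
    · exact hy.2
    · exact c.tor _ hy.1 i⟩
  let Y1 : Set (Option c.ι → ℚ_[p]) := {y | y ∈ Y' ∧ (c.h (fun i => y (some i)), y none) ∈ K.C}
  have hY1 : SA Y1 := hdfn cO (by
      rintro _ ⟨y, hy, rfl⟩
      exact hcS ⟨_, hy.1, rfl⟩) (fun a ha => ((hm a (Or.inl (Or.inr ha))).mono (min_le_left _ _)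
    subset_rfl).some (fun z hz => hz.1)) (fun y => y none) (MonOn.coord hε0.le none)
  let c1 : Chart p (V × ℚ_[p]) := ⟨Option c.ι, Y1, fun y => (K.π (c.h fun i => y (some i)),
    K.ev1 (c.h fun i => y (some i)) K.c + y none), hY1, fun y hy => cO.tor y hy.1⟩
  have hle1 : min ε0 ε1 ≤ ε1 := min_le_right _ _
  have q0 := CovOn.chart (Q := fun c : Chart p (V × ℚ_[p]) => ∀ a ∈ L,
      DOn (fun y => evX ev (c.h y) a) c.Y ∧
      ∀ Z ⊆ c.Y, SA Z → Ref (MonOn ε (fun y => evX ev (c.h y) a)) Z) c0 (by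
    intro f hf
    exact hch f hf Y0 hY0 c0.tor c.h (fun _ => 0) (fun y hy => hy.2) (MonOn.const hε1.le 0)
      (DF.const 0).don
      (fun i hi => (hm _ (hcf f hf i hi)).mono hle1 fun y hy => hy.1)
      (fun i hi => (hd _ (hcf f hf i hi)).mono fun y hy => hy.1)) (by
    intro y hy y' hy' he
    have h1 := congrArg Prod.fst he
    have h2 := congrArg Prod.snd he
    exact hinj hy.1 hy'.1 (K.uniq _ _ _ _ hy.2 hy'.2 h1 h2))
  have q1 := CovOn.chart (Q := fun c : Chart p (V × ℚ_[p]) => ∀ a ∈ L,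
      DOn (fun y => evX ev (c.h y) a) c.Y ∧
      ∀ Z ⊆ c.Y, SA Z → Ref (MonOn ε (fun y => evX ev (c.h y) a)) Z) c1 (by
    intro f hf
    exact hch f hf Y1 hY1 c1.tor (fun y => c.h fun i => y (some i)) (fun y => y none)
      (fun y hy => hy.2) (MonOn.coord hε1.le none)
      (DF.coord none).don
      (fun i hi => ((hm _ (hcf f hf i hi)).mono hle1 subset_rfl).some fun y hy => hy.1.1)
      (fun i hi => (hd _ (hcf f hf i hi)).some fun y hy => hy.1.1)) (by
    intro y hy y' hy' he
    have h1 := congrArg Prod.fst he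
    have h2 := congrArg Prod.snd he
    have h3 := K.uniq _ _ _ _ hy.2 hy'.2 h1 h2
    have h4 := hinj hy.1.1 hy'.1.1 h3
    funext o
    rcases o with _ | i
    · simp only [c1] at h2
      rw [h3] at h2
      exact add_left_cancel h2
    · exact congrFun h4 i)
  refine (CovOn.union _ _ ?_ q0 q1).of_eq ?_
  · rw [Set.disjoint_left]
    rintro _ ⟨y, hy, rfl⟩ ⟨y', hy', he⟩
    have h1 := congrArg Prod.fst he
    have h2 := congrArg Prod.snd he
    have h3 := K.uniq _ _ _ _ hy'.2 hy.2 h1 h2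
    simp only [c1, c0] at h2
    rw [h3] at h2
    exact hy'.1.2 (add_left_cancel h2)
  · ext ⟨v, t⟩
    constructor
    · rintro (⟨y, hy, he⟩ | ⟨y, hy, he⟩)
      · obtain ⟨rfl, rfl⟩ := Prod.ext_iff.1 he
        refine ⟨K.hπ _ (hcS ⟨y, hy.1, rfl⟩), _, ⟨y, hy.1, rfl⟩, rfl, ?_⟩
        simpa [c0] using hy.2
      · obtain ⟨rfl, rfl⟩ := Prod.ext_iff.1 he
        refine ⟨K.hπ _ (hcS ⟨_, hy.1.1, rfl⟩), _, ⟨_, hy.1.1, rfl⟩, rfl, ?_⟩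
        simpa [c1] using hy.2
    · rintro ⟨hv, _, ⟨y, hy, rfl⟩, rfl, hC⟩
      by_cases h0 : t - K.ev1 (c.h y) K.c = 0
      · left
        refine ⟨y, ⟨hy, ?_⟩, ?_⟩
        · simp only at hC; rwa [h0] at hC
        · simp only [c0]
          rw [← h0]; simp
      · right
        refine ⟨fun o => o.elim (t - K.ev1 (c.h y) K.c) y, ⟨⟨hy, h0⟩, hC⟩, ?_⟩
        simp [c1]

end

end PSub
end Part15


section Part16
open PadicSub

namespace PSub

variable {p : ℕ} [hp : Fact p.Prime]

open Polynomial

/-! ### Weierstrass preparation, coordinate changes -/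

theorem weier {A : Type} [CommRing A] (π : A[X]) (Qs : ℕ → A[X]) (g0 : A[X]) (hg : g0.Monic)
    (hQ : ∀ n, π ^ (n + 1) ∣ Qs (n + 1) - Qs n) (h0 : π ∣ Qs 0 - g0) (a0 : A) (ha0 : π = C a0) :
    ∃ q P : ℕ → A[X], q 0 = 1 ∧ ∀ n, π ^ (n + 1) ∣ q n * Qs n - P n ∧
      (P n).natDegree ≤ g0.natDegree ∧ π ^ (n + 1) ∣ q (n + 1) - q n ∧
      π ^ (n + 1) ∣ P (n + 1) - P n := by
  have hQ0 : ∀ n, π ∣ Qs n - g0 := by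
    intro n
    induction n with
    | zero => exact h0
    | succ n ih =>
      have := (Dvd.intro_left (π ^ n) (by ring : π ^ n * π = π ^ (n + 1))).trans (hQ n)
      have := dvd_add this ih
      simpa using this
  let cond : ℕ → A[X] × A[X] → Prop := fun n x => π ^ (n + 1) ∣ x.1 * Qs n - x.2 ∧
    x.2.natDegree ≤ g0.natDegree
  have step : ∀ n x, cond n x → ∃ y, cond (n + 1) y ∧ π ^ (n + 1) ∣ y.1 - x.1 ∧
      π ^ (n + 1) ∣ y.2 - x.2 := by
    rintro n ⟨q, P⟩ ⟨h1, h2⟩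
    simp only at h1 h2
    obtain ⟨E, hE⟩ : π ^ (n + 1) ∣ q * Qs (n + 1) - P := by
      have := dvd_add h1 (dvd_mul_of_dvd_right (hQ n) q)
      convert this using 1; ring
    obtain ⟨b, hb⟩ := hQ0 (n + 1)
    have hdm := modByMonic_add_div E g0
    refine ⟨(q - π ^ (n + 1) * (E /ₘ g0), P + π ^ (n + 1) * (E %ₘ g0)), ⟨?_, ?_⟩, ?_, ?_⟩
    · refine ⟨-(E /ₘ g0) * b, ?_⟩
      have e1 : q * Qs (n + 1) = P + π ^ (n + 1) * E := by rw [← hE]; ring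
      have e2 : Qs (n + 1) = g0 + π * b := by rw [← hb]; ring
      calc _ = q * Qs (n + 1) - π ^ (n + 1) * (E /ₘ g0) * Qs (n + 1) - P
              - π ^ (n + 1) * (E %ₘ g0) := by ring
        _ = _ := by rw [e1, e2]; nth_rewrite 1 [← hdm]; ring
    · refine (natDegree_add_le _ _).trans (max_le h2 ?_)
      rw [ha0, ← C_pow]
      refine (natDegree_C_mul_le _ _).trans ?_
      exact natDegree_modByMonic_le _ hg
    · simp
    · simp
  have hstart : cond 0 (1, g0) := ⟨by simpa using h0, le_rfl⟩
  choose! f hf using step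
  let s : ℕ → A[X] × A[X] := fun n => Nat.rec (1, g0) (fun n x => f n x) n
  have hs : ∀ n, cond n (s n) := by
    intro n
    induction n with
    | zero => exact hstart
    | succ n ih => exact (hf n _ ih).1
  exact ⟨fun n => (s n).1, fun n => (s n).2, rfl, fun n => ⟨(hs n).1, (hs n).2,
    (hf n _ (hs n)).2.1, (hf n _ (hs n)).2.2⟩⟩

theorem digits_inj (N : ℕ) : ∀ (n : ℕ) (a b : Fin n → ℕ), (∀ i, a i < N) → (∀ i, b i < N) →
    ∑ i, a i * N ^ (i : ℕ) = ∑ i, b i * N ^ (i : ℕ) → a = b := by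
  intro n
  induction n with
  | zero => intro a b _ _ _; exact Subsingleton.elim _ _
  | succ n ih =>
    intro a b ha hb h
    have hsum : ∀ c : Fin (n + 1) → ℕ, ∑ i, c i * N ^ (i : ℕ)
        = c 0 + N * ∑ i : Fin n, c i.succ * N ^ (i : ℕ) := by
      intro c
      rw [Fin.sum_univ_succ, Finset.mul_sum]
      simp only [Fin.val_zero, pow_zero, mul_one, Fin.val_succ, pow_succ]
      congr 1
      refine Finset.sum_congr rfl fun i _ => by ring
    rw [hsum, hsum] at h
    have h0 : a 0 = b 0 := by
      have := congrArg (· % N) h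
      simp only [Nat.add_mul_mod_self_left] at this
      rwa [Nat.mod_eq_of_lt (ha 0), Nat.mod_eq_of_lt (hb 0)] at this
    have hN : 0 < N := (Nat.zero_le _).trans_lt (ha 0)
    rw [h0] at h
    have h1 := Nat.eq_of_mul_eq_mul_left hN (Nat.add_left_cancel h)
    have h2 := ih (fun i => a i.succ) (fun i => b i.succ) (fun i => ha _) (fun i => hb _) h1
    funext i
    refine Fin.cases h0 (fun i => congrFun h2 i) i

section
variable {M : ℕ}

/-- The substitution `X₀ ↦ X`, `X_{i+1} ↦ X_i + X^(N^(i+1))`. -/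
noncomputable def cc (p : ℕ) [Fact p.Prime] (M N : ℕ) :
    MvPolynomial (Fin (M + 1)) ℤ_[p] →+* (MvPolynomial (Fin M) ℤ_[p])[X] :=
  MvPolynomial.eval₂Hom (Polynomial.C.comp MvPolynomial.C)
    (Fin.cons X fun i : Fin M => C (MvPolynomial.X i) + X ^ (N ^ ((i : ℕ) + 1)))

/-- The corresponding map of points. -/
noncomputable def ccp (M N : ℕ) (x : Fin M → ℤ_[p]) (t : ℤ_[p]) : Fin (M + 1) → ℤ_[p] :=
  Fin.cons t fun i : Fin M => x i + t ^ (N ^ ((i : ℕ) + 1))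

theorem cc_eval (N : ℕ) (x : Fin M → ℤ_[p]) (t : ℤ_[p]) (Q : MvPolynomial (Fin (M + 1)) ℤ_[p]) :
    ((cc p M N Q).map (MvPolynomial.eval x)).eval t = MvPolynomial.eval (ccp M N x t) Q := by
  have : ((Polynomial.evalRingHom t).comp (Polynomial.mapRingHom (MvPolynomial.eval x))).comp
      (cc p M N) = MvPolynomial.eval (ccp M N x t) := by
    apply MvPolynomial.ringHom_ext
    · intro r; simp [cc]
    · intro i
      refine Fin.cases ?_ (fun i => ?_) i
      · simp [cc, ccp]
      · simp [cc, ccp]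
  exact congrArg (fun g => g Q) this

noncomputable def ccm (p : ℕ) [Fact p.Prime] (M N : ℕ) (m : Fin (M + 1) →₀ ℕ) :
    (MvPolynomial (Fin M) ℤ_[p])[X] :=
  ∏ i, (Fin.cons X fun i : Fin M => C (MvPolynomial.X i) + X ^ (N ^ ((i : ℕ) + 1)) :
    Fin (M + 1) → (MvPolynomial (Fin M) ℤ_[p])[X]) i ^ m i

theorem ccm_monic (N : ℕ) (hN : 0 < N) (m : Fin (M + 1) →₀ ℕ) : (ccm p M N m).Monic ∧
    (ccm p M N m).natDegree = ∑ i, m i * N ^ (i : ℕ) := by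
  have h : ∀ i : Fin (M + 1), ((Fin.cons X fun i : Fin M => C (MvPolynomial.X i) +
      X ^ (N ^ ((i : ℕ) + 1)) : Fin (M + 1) → (MvPolynomial (Fin M) ℤ_[p])[X]) i).Monic ∧
      ((Fin.cons X fun i : Fin M => C (MvPolynomial.X i) + X ^ (N ^ ((i : ℕ) + 1)) :
        Fin (M + 1) → (MvPolynomial (Fin M) ℤ_[p])[X]) i).natDegree = N ^ (i : ℕ) := by
    intro i
    refine Fin.cases ?_ (fun i => ?_) i
    · simp [monic_X]
    · have hpos : 0 < N ^ ((i : ℕ) + 1) := pow_pos hN _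
      simp only [Fin.cons_succ, Fin.val_succ]
      rw [add_comm]
      exact ⟨monic_X_pow_add_C _ hpos.ne', natDegree_X_pow_add_C⟩
  refine ⟨monic_prod_of_monic _ _ fun i _ => (h i).1.pow _, ?_⟩
  unfold ccm
  rw [natDegree_prod_of_monic _ _ fun i _ => (h i).1.pow _]
  refine Finset.sum_congr rfl fun i _ => ?_
  rw [(h i).1.natDegree_pow, (h i).2]

theorem cc_sum (N : ℕ) (Q : MvPolynomial (Fin (M + 1)) ℤ_[p]) :
    cc p M N Q = ∑ m ∈ Q.support, C (MvPolynomial.C (Q.coeff m)) * ccm p M N m := by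
  conv_lhs => rw [cc, MvPolynomial.coe_eval₂Hom, MvPolynomial.eval₂_eq']
  rfl

theorem dvd_of_coeff {σ : Type} (Q : MvPolynomial σ ℤ_[p]) (n : ℕ)
    (h : ∀ m, (p : ℤ_[p]) ^ n ∣ Q.coeff m) : (p : MvPolynomial σ ℤ_[p]) ^ n ∣ Q := by
  have : (p : MvPolynomial σ ℤ_[p]) ^ n = MvPolynomial.C ((p : ℤ_[p]) ^ n) := by simp
  rw [this, MvPolynomial.C_dvd_iff_dvd_coeff]
  exact h

theorem unit_of_not_dvd {x : ℤ_[p]} (h : ¬ (p : ℤ_[p]) ∣ x) : IsUnit x := by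
  rw [PadicInt.isUnit_iff]
  refine le_antisymm x.norm_le_one (not_lt.1 fun hx => h ?_)
  exact (PadicInt.norm_lt_one_iff_dvd x).1 hx

/-- Regularity after the coordinate change. -/
theorem cc_reg (Q : MvPolynomial (Fin (M + 1)) ℤ_[p])
    (hQ : ¬ (p : MvPolynomial (Fin (M + 1)) ℤ_[p]) ∣ Q) :
    ∃ N0 : ℕ, ∀ N ≥ N0, ∃ (u : ℤ_[p]) (g0 : (MvPolynomial (Fin M) ℤ_[p])[X]), IsUnit u ∧
      g0.Monic ∧ (p : (MvPolynomial (Fin M) ℤ_[p])[X]) ∣ C (MvPolynomial.C u) * cc p M N Q - g0 := by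
  classical
  refine ⟨Q.totalDegree + 1, fun N hN => ?_⟩
  have hN0 : 0 < N := by omega
  let s := Q.support.filter fun m => ¬ (p : ℤ_[p]) ∣ Q.coeff m
  have hs : s.Nonempty := by
    by_contra hs
    rw [Finset.not_nonempty_iff_eq_empty, Finset.filter_eq_empty_iff] at hs
    refine hQ ?_
    have := dvd_of_coeff Q 1 fun m => ?_
    · simpa using this
    · by_cases hm : m ∈ Q.support
      · simpa using hs hm
      · rw [MvPolynomial.notMem_support_iff.1 hm]; simp
  obtain ⟨m0, hm0, hmax⟩ := s.exists_max_image (fun m => (ccm p M N m).natDegree) hs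
  have hc0 := unit_of_not_dvd (Finset.mem_filter.1 hm0).2
  have hdig : ∀ m ∈ s, ∀ i, m i < N := by
    intro m hm i
    have h1 := MvPolynomial.le_totalDegree (Finset.mem_filter.1 hm).1
    have h2 : m i ≤ m.sum fun _ e => e := by
      by_cases hi : i ∈ m.support
      · exact Finset.single_le_sum (f := fun i => m i) (fun _ _ => Nat.zero_le _) hi
      · rw [Finsupp.notMem_support_iff.1 hi]; exact Nat.zero_le _
    omega
  have hlt : ∀ m ∈ s, m ≠ m0 → (ccm p M N m).natDegree < (ccm p M N m0).natDegree := by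
    intro m hm hne
    refine lt_of_le_of_ne (hmax m hm) fun he => hne ?_
    rw [(ccm_monic N hN0 m).2, (ccm_monic N hN0 m0).2] at he
    exact DFunLike.coe_injective (digits_inj N _ _ _ (hdig m hm) (hdig m0 hm0) he)
  obtain ⟨u, hu⟩ := hc0.exists_left_inv
  let g := ∑ m ∈ s, C (MvPolynomial.C (u * Q.coeff m)) * ccm p M N m
  refine ⟨u, g, IsUnit.of_mul_eq_one _ hu, ?_, ?_⟩
  · refine monic_of_natDegree_le_of_coeff_eq_one (ccm p M N m0).natDegree ?_ ?_
    · refine natDegree_sum_le_of_forall_le _ _ fun m hm => ?_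
      exact (natDegree_C_mul_le _ _).trans (hmax m hm)
    · rw [finsetSum_coeff, Finset.sum_eq_single m0]
      · rw [coeff_C_mul, hu]
        have := (ccm_monic (p := p) N hN0 m0).1
        rw [Monic, leadingCoeff] at this
        rw [this]; simp
      · intro m hm hne
        rw [coeff_C_mul, coeff_eq_zero_of_natDegree_lt (hlt m hm hne), mul_zero]
      · intro h; exact absurd hm0 h
  · rw [cc_sum, Finset.mul_sum, ← Finset.sum_filter_add_sum_filter_not Q.support
      (fun m => ¬ (p : ℤ_[p]) ∣ Q.coeff m)]
    have e : ∑ m ∈ s, C (MvPolynomial.C u) * (C (MvPolynomial.C (Q.coeff m)) * ccm p M N m) = g := by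
      refine Finset.sum_congr rfl fun m _ => ?_
      rw [MvPolynomial.C_mul, C_mul]; ring
    rw [show Q.support.filter (fun m => ¬ (p : ℤ_[p]) ∣ Q.coeff m) = s from rfl, e,
      add_sub_cancel_left]
    refine Finset.dvd_sum fun m hm => ?_
    have := (Finset.mem_filter.1 hm).2
    rw [not_not] at this
    obtain ⟨b, hb⟩ := this
    rw [hb]
    refine ⟨C (MvPolynomial.C u) * (C (MvPolynomial.C b) * ccm p M N m), ?_⟩
    simp only [map_mul, map_natCast]
    ring

/-- Normalisation of restricted power series. -/
theorem IsT.norm {F : (Fin M → ℤ_[p]) → ℤ_[p]} (hF : IsT F) : (∀ x, F x = 0) ∨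
    ∃ (k : ℕ) (Qs : ℕ → MvPolynomial (Fin M) ℤ_[p]),
      (∀ n, (p : MvPolynomial (Fin M) ℤ_[p]) ^ (n + 1) ∣ Qs (n + 1) - Qs n) ∧
      ¬ (p : MvPolynomial (Fin M) ℤ_[p]) ∣ Qs 0 ∧
      ∀ x, ∃ y : ℤ_[p], F x = p ^ k * y ∧ ∀ n, (p : ℤ_[p]) ^ (n + 1) ∣ y - MvPolynomial.eval x (Qs n) := by
  classical
  obtain ⟨Q, hQ, hFQ⟩ := hF
  by_cases hall : ∀ n, (p : MvPolynomial (Fin M) ℤ_[p]) ^ n ∣ Q n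
  · left
    intro x
    refine eq_zero_of_dvd _ fun n => ?_
    have := dvd_add (hFQ n x) (dvd_eval (hall n) x)
    simpa using this
  right
  push Not at hall
  have hp0 : (p : ℤ_[p]) ≠ 0 := by exact_mod_cast hp.out.ne_zero
  have hpM : (p : MvPolynomial (Fin M) ℤ_[p]) ≠ 0 := by exact_mod_cast hp.out.ne_zero
  obtain ⟨k, hk, hmin⟩ : ∃ k, ¬ (p : MvPolynomial (Fin M) ℤ_[p]) ^ (k + 1) ∣ Q (k + 1) ∧
      (p : MvPolynomial (Fin M) ℤ_[p]) ^ k ∣ Q k := by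
    have h1 := Nat.find_spec hall
    have h2 : Nat.find hall ≠ 0 := fun h => h1 (by rw [h]; simp)
    obtain ⟨k, hk⟩ := Nat.exists_eq_succ_of_ne_zero h2
    refine ⟨k, ?_, ?_⟩
    · rw [← Nat.succ_eq_add_one, ← hk]; exact h1
    · have := Nat.find_min hall (m := k) (by omega)
      simpa using this
  have hdv : ∀ n, (p : MvPolynomial (Fin M) ℤ_[p]) ^ k ∣ Q (k + n) := by
    intro n
    have := dvd_add (dvd_of_step _ Q hQ k n) hmin
    simpa using this
  choose R hR using hdv
  have hco : ∀ n, (p : MvPolynomial (Fin M) ℤ_[p]) ^ n ∣ R (n + 1) - R n := by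
    intro n
    have := hQ (k + n)
    rw [add_assoc, hR, hR, ← mul_sub, pow_add] at this
    exact (mul_dvd_mul_iff_left (pow_ne_zero k hpM)).1 this
  refine ⟨k, fun n => R (n + 1), fun n => hco (n + 1), fun h => hk ?_, fun x => ?_⟩
  · rw [hR 1, pow_succ]
    exact mul_dvd_mul_left _ h
  · have h1 : (p : ℤ_[p]) ^ k ∣ F x := by
      have := dvd_add (hFQ k x) (dvd_eval hmin x)
      simpa using this
    obtain ⟨y, hy⟩ := h1
    refine ⟨y, hy, fun n => ?_⟩
    have := hFQ (k + (n + 1)) x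
    rw [hR, hy, map_mul, map_pow, map_natCast, ← mul_sub, pow_add] at this
    exact (mul_dvd_mul_iff_left (pow_ne_zero k hp0)).1 this

end

end PSub
end Part16


section Part17
open PadicSub

namespace PSub

variable {p : ℕ} [hp : Fact p.Prime]

open Polynomial

section
variable {M : ℕ}

theorem IsT.ofPoly (Q : MvPolynomial (Fin M) ℤ_[p]) : IsT (fun x => MvPolynomial.eval x Q) :=
  ⟨fun _ => Q, fun n => by simp, fun n x => by simp⟩

theorem IsT.add {F G : (Fin M → ℤ_[p]) → ℤ_[p]} (hF : IsT F) (hG : IsT G) :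
    IsT (fun x => F x + G x) := by
  obtain ⟨Q, h1, h2⟩ := hF
  obtain ⟨Q', h1', h2'⟩ := hG
  refine ⟨fun n => Q n + Q' n, fun n => ?_, fun n x => ?_⟩
  · rw [add_sub_add_comm]; exact dvd_add (h1 n) (h1' n)
  · rw [map_add, add_sub_add_comm]; exact dvd_add (h2 n x) (h2' n x)

theorem IsT.mul {F G : (Fin M → ℤ_[p]) → ℤ_[p]} (hF : IsT F) (hG : IsT G) :
    IsT (fun x => F x * G x) := by
  obtain ⟨Q, h1, h2⟩ := hF
  obtain ⟨Q', h1', h2'⟩ := hG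
  refine ⟨fun n => Q n * Q' n, fun n => ?_, fun n x => ?_⟩
  · rw [mul_sub_mul_comm']; exact dvd_add (dvd_mul_of_dvd_right (h1' n) _) (dvd_mul_of_dvd_left (h1 n) _)
  · rw [map_mul, mul_sub_mul_comm']; exact dvd_add (dvd_mul_of_dvd_right (h2' n x) _) (dvd_mul_of_dvd_left (h2 n x) _)
where
  mul_sub_mul_comm' {A : Type} [CommRing A] {a b c d : A} :
    a * b - c * d = a * (b - d) + (a - c) * d := by ring

def TT (p : ℕ) [Fact p.Prime] (M : ℕ) : Subring ((Fin M → ℤ_[p]) → ℤ_[p]) where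
  carrier := {F | IsT F}
  mul_mem' := fun hF hG => IsT.mul hF hG
  one_mem' := by
    have := IsT.ofPoly (p := p) (M := M) 1
    simp only [map_one] at this; exact this
  add_mem' := fun hF hG => IsT.add hF hG
  zero_mem' := by
    have := IsT.ofPoly (p := p) (M := M) 0
    simp only [map_zero] at this; exact this
  neg_mem' := by
    intro F hF
    have := (IsT.ofPoly (p := p) (M := M) (-1)).mul hF
    simp only [map_neg, map_one, neg_mul, one_mul] at this; exact this

noncomputable def evT (v : Fin M → ℤ_[p]) : TT p M →+* ℚ_[p] :=
  (PadicInt.Coe.ringHom.comp (Pi.evalRingHom (fun _ : Fin M → ℤ_[p] => ℤ_[p]) v)).comp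
    (TT p M).subtype

theorem evT_apply (v : Fin M → ℤ_[p]) (F : TT p M) : evT v F = ((F.1 v : ℤ_[p]) : ℚ_[p]) := rfl

noncomputable def polyT (p : ℕ) [Fact p.Prime] (M : ℕ) : MvPolynomial (Fin M) ℤ_[p] →+* TT p M where
  toFun Q := ⟨fun x => MvPolynomial.eval x Q, IsT.ofPoly Q⟩
  map_one' := by ext; simp
  map_mul' := by intros; ext; simp
  map_zero' := by ext; simp
  map_add' := by intros; ext; simp

theorem evT_polyT (x : Fin M → ℤ_[p]) :
    (evT x).comp (polyT p M) = PadicInt.Coe.ringHom.comp (MvPolynomial.eval x) := rfl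

noncomputable def ee (x : Fin M → ℤ_[p]) (t : ℤ_[p]) : (MvPolynomial (Fin M) ℤ_[p])[X] →+* ℤ_[p] :=
  (Polynomial.evalRingHom t).comp (Polynomial.mapRingHom (MvPolynomial.eval x))

theorem ee_apply (x : Fin M → ℤ_[p]) (t : ℤ_[p]) (f : (MvPolynomial (Fin M) ℤ_[p])[X]) :
    ee x t f = (f.map (MvPolynomial.eval x)).eval t := rfl

theorem evX_polyT (x : Fin M → ℤ_[p]) (t : ℤ_[p]) (f : (MvPolynomial (Fin M) ℤ_[p])[X]) :
    evX evT (x, (t : ℚ_[p])) (f.map (polyT p M)) = ((ee x t f : ℤ_[p]) : ℚ_[p]) := by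
  rw [evX_apply, Polynomial.map_map, evT_polyT, ee_apply, ← Polynomial.map_map]
  rw [Polynomial.eval_map]
  exact Polynomial.eval₂_at_apply PadicInt.Coe.ringHom t

theorem prepF {F : (Fin (M + 1) → ℤ_[p]) → ℤ_[p]} (hF : IsT F) : ∃ N0 : ℕ, ∀ N ≥ N0, ∀ j : ℕ,
    ∃ (c : ℚ_[p]) (P qj : (TT p M)[X]), ∀ (x : Fin M → ℤ_[p]) (t : ℤ_[p]), ∃ q : ℚ_[p], ‖q‖ = 1 ∧
      (F (ccp M N x t) : ℚ_[p]) * q = c * evX evT (x, (t : ℚ_[p])) P ∧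
      ‖q - evX evT (x, (t : ℚ_[p])) qj‖ ≤ (p : ℝ) ^ (-((j + 1 : ℕ) : ℤ)) := by
  rcases hF.norm with h0 | ⟨k, Qs, hQs, hQ0, hFy⟩
  · refine ⟨0, fun N _ j => ⟨0, 0, 1, fun x t => ⟨1, norm_one, ?_, ?_⟩⟩⟩
    · rw [h0]; simp
    · rw [map_one, sub_self, norm_zero]; positivity
  obtain ⟨N0, hN0⟩ := cc_reg (Qs 0) hQ0
  refine ⟨N0, fun N hN j => ?_⟩
  obtain ⟨u, g0, hu, hg0, hdv⟩ := hN0 N hN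
  obtain ⟨q, P, hq0, hw⟩ := weier (p : (MvPolynomial (Fin M) ℤ_[p])[X])
    (fun n => C (MvPolynomial.C u) * cc p M N (Qs n)) g0 hg0 (by
      intro n
      rw [← mul_sub, ← map_sub]
      refine dvd_mul_of_dvd_right ?_ _
      obtain ⟨b, hb⟩ := hQs n
      rw [hb, map_mul, map_pow, map_natCast]
      exact dvd_mul_right _ _) hdv (p : MvPolynomial (Fin M) ℤ_[p]) (by simp)
  have hpe : ∀ (x : Fin M → ℤ_[p]) (t : ℤ_[p]) (n : ℕ) (f : (MvPolynomial (Fin M) ℤ_[p])[X]),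
      (p : (MvPolynomial (Fin M) ℤ_[p])[X]) ^ n ∣ f → (p : ℤ_[p]) ^ n ∣ ee x t f := by
    rintro x t n f ⟨b, rfl⟩
    rw [map_mul, map_pow, map_natCast]; exact dvd_mul_right _ _
  have hsucc : ∀ {A : Type} [CommRing A] (n : ℕ) (a : A), (p : A) ^ (n + 1) ∣ a → (p : A) ^ n ∣ a :=
    fun n a h => (pow_dvd_pow _ (Nat.le_succ n)).trans h
  have hlim : ∀ i, ∃ G : (Fin M → ℤ_[p]) → ℤ_[p], IsT G ∧
      ∀ n x, (p : ℤ_[p]) ^ n ∣ G x - MvPolynomial.eval x ((P n).coeff i) := by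
    intro i
    refine isT_lim (fun n => (P n).coeff i) fun n => ?_
    have := hsucc n _ (hw n).2.2.2
    rw [show (p : (MvPolynomial (Fin M) ℤ_[p])[X]) ^ n = C ((p : MvPolynomial (Fin M) ℤ_[p]) ^ n) by simp,
      C_dvd_iff_dvd_coeff] at this
    rw [← coeff_sub]; exact this i
  choose G hG hGl using hlim
  set d := g0.natDegree
  obtain ⟨w, hwu⟩ := hu.exists_left_inv
  refine ⟨(((p : ℤ_[p]) ^ k * w : ℤ_[p]) : ℚ_[p]), ∑ i ∈ Finset.range (d + 1), C ⟨G i, hG i⟩ * X ^ i,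
    (q (j + 1)).map (polyT p M), fun x t => ?_⟩
  obtain ⟨qx, hqx⟩ := exists_lim (fun n => ee x t (q n)) (fun n => by
    rw [← map_sub]; exact hpe _ _ _ _ (hsucc n _ (hw n).2.2.1))
  obtain ⟨y, hy, hyn⟩ := hFy (ccp M N x t)
  have hPe : ∀ n, ee x t (P n) = ∑ i ∈ Finset.range (d + 1), MvPolynomial.eval x ((P n).coeff i) * t ^ i := by
    intro n
    rw [ee_apply, eval_eq_sum_range' (n := d + 1)]
    · simp
    · exact Nat.lt_succ_of_le (natDegree_map_le.trans (hw n).2.1)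
  have hmain : qx * (u * y) = ∑ i ∈ Finset.range (d + 1), G i x * t ^ i := by
    rw [← sub_eq_zero]
    refine eq_zero_of_dvd _ fun n => ?_
    have h1 : (p : ℤ_[p]) ^ n ∣ ee x t (q n) * (u * MvPolynomial.eval (ccp M N x t) (Qs n))
        - ee x t (P n) := by
      have := hpe x t _ _ (hsucc n _ (hw n).1)
      rw [map_sub, map_mul, map_mul] at this
      have e2 : ee x t (cc p M N (Qs n)) = MvPolynomial.eval (ccp M N x t) (Qs n) := cc_eval N x t _
      have e3 : ee x t (C (MvPolynomial.C u)) = u := by rw [ee_apply]; simp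
      rwa [e2, e3] at this
    have h2 : (p : ℤ_[p]) ^ n ∣ y - MvPolynomial.eval (ccp M N x t) (Qs n) := hsucc n _ (hyn n)
    have h3 : (p : ℤ_[p]) ^ n ∣ ∑ i ∈ Finset.range (d + 1), G i x * t ^ i - ee x t (P n) := by
      rw [hPe, ← Finset.sum_sub_distrib]
      refine Finset.dvd_sum fun i _ => ?_
      rw [← sub_mul]; exact dvd_mul_of_dvd_left (hGl i n x) _
    have := dvd_sub (dvd_add h1 (dvd_add (dvd_mul_of_dvd_left (hqx n) (u * y))
      (dvd_mul_of_dvd_right h2 (ee x t (q n) * u)))) h3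
    convert this using 1; ring
  refine ⟨(qx : ℚ_[p]), ?_, ?_, ?_⟩
  · have h1 : (p : ℤ_[p]) ∣ qx - 1 := by
      have a := hqx 1
      have b := hpe x t _ _ (hw 0).2.2.1
      rw [map_sub, hq0, map_one] at b
      have := dvd_add a b
      simpa using this
    have hu1 : IsUnit qx := by
      refine unit_of_not_dvd fun h => ?_
      have := dvd_sub h h1
      rw [sub_sub_cancel] at this
      exact PadicInt.p_nonunit (isUnit_of_dvd_one this)
    have := PadicInt.isUnit_iff.1 hu1
    rwa [PadicInt.norm_def] at this
  · have e : evX evT (x, (t : ℚ_[p])) (∑ i ∈ Finset.range (d + 1), C (⟨G i, hG i⟩ : TT p M) * X ^ i)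
        = ((∑ i ∈ Finset.range (d + 1), G i x * t ^ i : ℤ_[p]) : ℚ_[p]) := by
      rw [map_sum, PadicInt.coe_sum]
      refine Finset.sum_congr rfl fun i _ => ?_
      rw [evX_apply]
      simp [evT_apply]
    rw [e, ← hmain, hy]
    have e5 : (p : ℤ_[p]) ^ k * y * qx = (p : ℤ_[p]) ^ k * w * (qx * (u * y)) :=
      calc (p : ℤ_[p]) ^ k * y * qx = (w * u) * ((p : ℤ_[p]) ^ k * y * qx) := by rw [hwu, one_mul]
        _ = _ := by ring
    rw [← PadicInt.coe_mul, ← PadicInt.coe_mul, e5]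
  · rw [evX_polyT]
    have := (dvd_iff_norm _ _).1 (hqx (j + 1))
    rw [PadicInt.norm_def] at this
    push_cast at this ⊢
    exact this

end

end PSub
end Part17


section Part18
open PadicSub

namespace PSub

variable {p : ℕ} [hp : Fact p.Prime]

open Polynomial

theorem CovOn.cut {V : Type} {Q Q' : Chart p V → Prop} {S T : Set V} (h : CovOn Q S) (hT : T ⊆ S)
    (hsa : ∀ c : Chart p V, c.img ⊆ S → Q c → SA {y | y ∈ c.Y ∧ c.h y ∈ T})
    (hQ : ∀ (c : Chart p V) Z (hZ : Z ⊆ c.Y) (hs : SA Z), Q c → Q' (c.restr Z hZ hs)) : CovOn Q' T := by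
  refine CovOn.fib T (fun w v => w = v) h (fun w hw => ⟨w, hT hw, rfl⟩)
    (fun w _ v _ v' _ e e' => e ▸ e' ▸ rfl) fun c hc hinj himg => ?_
  refine CovOn.ofChart (c.restr _ (fun y hy => hy.1) (hsa c himg hc))
    (hinj.mono fun y hy => hy.1) (hQ c _ _ _ hc) ?_
  ext w
  constructor
  · rintro ⟨y, hy, rfl⟩
    exact ⟨hy.2, c.h y, ⟨y, hy.1, rfl⟩, rfl⟩
  · rintro ⟨hw, _, ⟨y, hy, rfl⟩, rfl⟩
    exact ⟨y, ⟨hy, hw⟩, rfl⟩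

theorem ccp_zero (M N : ℕ) (x : Fin M → ℤ_[p]) (t : ℤ_[p]) : ccp M N x t 0 = t := rfl

theorem ccp_succ (M N : ℕ) (x : Fin M → ℤ_[p]) (t : ℤ_[p]) (i : Fin M) :
    ccp M N x t i.succ = x i + t ^ (N ^ ((i : ℕ) + 1)) := rfl

noncomputable def mkZ (t : ℚ_[p]) (h : ‖t‖ ≤ 1) : ℤ_[p] := ⟨t, h⟩

theorem mkZ_coe (t : ℚ_[p]) (h : ‖t‖ ≤ 1) : ((mkZ t h : ℤ_[p]) : ℚ_[p]) = t := rfl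

open Classical in
noncomputable def phiT (M N : ℕ) (q : (Fin M → ℤ_[p]) × ℚ_[p]) : Fin (M + 1) → ℤ_[p] :=
  if h : ‖q.2‖ ≤ 1 then ccp M N q.1 (mkZ q.2 h) else 0

theorem phiT_eq {M N : ℕ} {q : (Fin M → ℤ_[p]) × ℚ_[p]} (h : ‖q.2‖ ≤ 1) :
    phiT M N q = ccp M N q.1 (mkZ q.2 h) := dif_pos h

theorem phiT_inj (M N : ℕ) : Set.InjOn (phiT (p := p) M N) {q | ‖q.2‖ ≤ 1} := by
  rintro ⟨x, t⟩ (ht : ‖t‖ ≤ 1) ⟨x', t'⟩ (ht' : ‖t'‖ ≤ 1) h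
  rw [phiT_eq ht, phiT_eq ht'] at h
  have h0 := congrFun h 0
  rw [ccp_zero, ccp_zero] at h0
  have h0' : t = t' := congrArg Subtype.val h0
  subst h0'
  have : x = x' := by
    funext i
    have := congrFun h i.succ
    rw [ccp_succ, ccp_succ] at this
    exact add_right_cancel this
  rw [this]

theorem phiT_surj (M N : ℕ) : phiT (p := p) M N '' {q | ‖q.2‖ ≤ 1} = Set.univ := by
  rw [Set.eq_univ_iff_forall]
  intro z
  refine ⟨(fun i => z i.succ - z 0 ^ (N ^ ((i : ℕ) + 1)), ((z 0 : ℤ_[p]) : ℚ_[p])), (z 0).2, ?_⟩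
  rw [phiT_eq (z 0).2]
  funext i
  refine Fin.cases ?_ (fun i => ?_) i
  · rfl
  · exact sub_add_cancel _ _

theorem exists_ppow (ε : ℝ) (hε : 0 < ε) : ∃ j : ℕ, (p : ℝ) ^ (-((j + 1 : ℕ) : ℤ)) ≤ ε := by
  obtain ⟨n, hn⟩ := exists_pow_lt_of_lt_one hε (inv_lt_one_of_one_lt₀ (one_lt_p (p := p)))
  refine ⟨n, ?_⟩
  rw [zpow_neg, zpow_natCast, ← inv_pow]
  refine le_trans (pow_le_pow_of_le_one (by positivity) (inv_le_one_of_one_le₀ one_lt_p.le) (Nat.le_succ n)) hn.le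

theorem goodT (M : ℕ) : Good (evT (p := p) (M := M)) Set.univ := by
  induction M with
  | zero =>
    intro L hL ε hε
    let c : Chart p (Fin 0 → ℤ_[p]) := ⟨Fin 0, Set.univ, fun _ i => i.elim0, SA.univ, fun y _ i => i.elim0⟩
    refine CovOn.ofChart c (fun y _ y' _ _ => Subsingleton.elim _ _) (fun a _ => ⟨?_, ?_⟩) ?_
    · exact (DF.const (evT (p := p) (fun i : Fin 0 => i.elim0) a)).don
    · exact MonOn.const hε.le (evT (p := p) (fun i : Fin 0 => i.elim0) a)
    · rw [Set.eq_univ_iff_forall]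
      exact fun z => ⟨fun i => i.elim0, trivial, Subsingleton.elim _ _⟩
  | succ M ih =>
    intro L hL ε hε
    choose N0 hN0 using fun F : TT p (M + 1) => prepF F.2
    obtain ⟨N, hN⟩ : ∃ N, ∀ F ∈ L, N0 F ≤ N := by
      obtain ⟨D, hD⟩ := (hL.image N0).bddAbove
      exact ⟨D, fun f hf => hD ⟨f, hf, rfl⟩⟩
    set ε' := min ε (1/2) with hε'
    have hε'0 : 0 < ε' := by positivity
    have hε'1 : ε' < 1 := (min_le_right _ _).trans_lt (by norm_num)
    obtain ⟨j, hj⟩ := exists_ppow (p := p) ε' hε'0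
    have hex : ∀ F : TT p (M + 1), ∃ (c : ℚ_[p]) (P qj : (TT p M)[X]), F ∈ L →
        ∀ (x : Fin M → ℤ_[p]) (t : ℤ_[p]), ∃ q : ℚ_[p], ‖q‖ = 1 ∧
      (F.1 (ccp M N x t) : ℚ_[p]) * q = c * evX evT (x, (t : ℚ_[p])) P ∧
      ‖q - evX evT (x, (t : ℚ_[p])) qj‖ ≤ (p : ℝ) ^ (-((j + 1 : ℕ) : ℤ)) := by
      intro F
      by_cases hF : F ∈ L
      · obtain ⟨c, P, qj, h⟩ := hN0 F N (hN F hF) j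
        exact ⟨c, P, qj, fun _ => h⟩
      · exact ⟨0, 0, 0, fun h => absurd h hF⟩
    choose c0 P qj hP using hex
    let co : Fin M → (TT p M)[X] := fun i => Polynomial.C (polyT p M (MvPolynomial.X i))
    have hco : ∀ (q : (Fin M → ℤ_[p]) × ℚ_[p]) i, evX evT q (co i) = ((q.1 i : ℤ_[p]) : ℚ_[p]) := by
      intro q i
      rw [evX_apply]
      simp [co, evT_apply, polyT]
    have hX : ∀ (q : (Fin M → ℤ_[p]) × ℚ_[p]), evX evT q (X : (TT p M)[X]) = q.2 := by
      intro q; rw [evX_apply]; simp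
    let L' : Set (TT p M)[X] := ({X} ∪ Set.range co) ∪ (P '' L ∪ qj '' L)
    have hL' : L'.Finite := ((Set.finite_singleton _).union (Set.finite_range _)).union
      ((hL.image _).union (hL.image _))
    have hA := thmA ih L' hL' ε' hε'0
    have hB : CovOn (fun c => ∀ a ∈ L', Prep ε' (fun v => evX evT v a) c)
        {q : (Fin M → ℤ_[p]) × ℚ_[p] | ‖q.2‖ ≤ 1} := by
      refine hA.cut (fun q _ => trivial) (fun c _ hc => ?_) (fun c Z hZ hs hc a ha =>
        (hc a ha).restr le_rfl Z hZ hs)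
      have h1 := (hc X (Or.inl (Or.inl rfl))).2
      have h3 := MonOn.sa_le hε'1 c.tor c.sa h1 (MonOn.const hε'0.le 1) 1 zero_le_one
      refine h3.congr fun y => ?_
      simp only [Set.mem_ofPred_eq, hX, norm_one, mul_one]
    rw [← phiT_surj M N]
    refine hB.image _ (phiT_inj M N) fun c hcS hc F hF => ?_
    have ht : ∀ y ∈ c.Y, ‖(c.h y).2‖ ≤ 1 := fun y hy => hcS ⟨y, hy, rfl⟩
    constructor
    · obtain ⟨a, ha, haF⟩ := F.2.ranal
      have hg : ∀ i : Fin (M + 1), DOn (fun y => ((phiT M N (c.h y) i : ℤ_[p]) : ℚ_[p])) c.Y := by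
        have h0 : DOn (fun y => evX evT (c.h y) (X : (TT p M)[X])) c.Y := (hc X (Or.inl (Or.inl rfl))).1
        intro i
        refine Fin.cases ?_ (fun i => ?_) i
        · refine h0.congr fun y hy => ?_
          rw [phiT_eq (ht y hy), hX]
          rw [ccp_zero, mkZ_coe]
        · have h1 : DOn (fun y => evX evT (c.h y) (co i)) c.Y := (hc _ (Or.inl (Or.inr ⟨i, rfl⟩))).1
          refine (h1.add (h0.pow (N ^ ((i : ℕ) + 1)))).congr fun y hy => ?_
          rw [phiT_eq (ht y hy), hX, hco]
          rw [ccp_succ, PadicInt.coe_add, PadicInt.coe_pow, mkZ_coe]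
      have hs := DOn.subst (DF.ranal a ha (fun i y => y i) fun i => DF.coord i) hg
      refine hs.congr fun y hy => ?_
      exact (haF _).symm
    · have hq : ∀ y, ∃ q : ℚ_[p], y ∈ c.Y → ‖q‖ = 1 ∧
          evT (phiT M N (c.h y)) F * q = c0 F * evX evT (c.h y) (P F) ∧
          ‖q - evX evT (c.h y) (qj F)‖ ≤ ε' := by
        intro y
        by_cases hy : y ∈ c.Y
        · obtain ⟨q, h1, h2, h3⟩ := hP F hF (c.h y).1 (mkZ (c.h y).2 (ht y hy))
          refine ⟨q, fun _ => ⟨h1, ?_, h3.trans hj⟩⟩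
          rw [phiT_eq (ht y hy)]
          exact h2
        · exact ⟨0, fun h => absurd h hy⟩
      choose q hq using hq
      have m1 : MonOn ε' (fun y => evX evT (c.h y) (P F)) c.Y := (hc _ (Or.inr (Or.inl ⟨F, hF, rfl⟩))).2
      have m2 : MonOn ε' (fun y => evX evT (c.h y) (qj F)) c.Y := (hc _ (Or.inr (Or.inr ⟨F, hF, rfl⟩))).2
      have m3 : MonOn ε' q c.Y := by
        refine m2.close hε'1 hε'0.le fun y hy => ?_
        obtain ⟨h1, _, h3⟩ := hq y hy
        have : ‖q y‖ = ‖evX evT (c.h y) (qj F)‖ :=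
          norm_eq_of_sub_lt' (h3.trans_lt (by rw [h1]; exact hε'1))
        rw [← this, h1, mul_one]; exact h3
      have m4 := ((MonOn.const (Y := c.Y) hε'0.le (c0 F)).mul hε'1.le hε'0.le c.tor m1).mul hε'1.le hε'0.le c.tor
        (m3.inv hε'1)
      refine (m4.mono (min_le_left _ _) subset_rfl).congr fun y hy => ?_
      obtain ⟨h1, h2, _⟩ := hq y hy
      have hne : q y ≠ 0 := by rw [← norm_ne_zero_iff, h1]; exact one_ne_zero
      change evT (phiT M N (c.h y)) F = _
      rw [← h2, mul_inv_cancel_right₀ hne]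

end PSub
end Part18


section Part19
open PadicSub

namespace PSub

variable {p : ℕ} [hp : Fact p.Prime]

theorem IsT.reindex {m M : ℕ} {F : (Fin m → ℤ_[p]) → ℤ_[p]} (hF : IsT F) (σ : Fin m → Fin M) :
    IsT (fun x : Fin M → ℤ_[p] => F (fun i => x (σ i))) := by
  obtain ⟨Q, h1, h2⟩ := hF
  refine ⟨fun n => MvPolynomial.rename σ (Q n), fun n => ?_, fun n x => ?_⟩
  · obtain ⟨b, hb⟩ := h1 n
    refine ⟨MvPolynomial.rename σ b, ?_⟩
    rw [← map_sub, hb, map_mul, map_pow, map_natCast]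
  · rw [MvPolynomial.eval_rename]
    exact h2 n _

theorem isT_of_ranal {m : ℕ} (a : (Fin m → ℕ) → ℚ_[p]) (ha : IsRestrictedCoeffs p a) :
    ∃ (c : ℚ_[p]) (F : (Fin m → ℤ_[p]) → ℤ_[p]), c ≠ 0 ∧ IsT F ∧
      ∀ x, (F x : ℚ_[p]) = c * ranalFn p a (fun i => (x i : ℚ_[p])) := by
  classical
  have hfin : ∀ ε : ℝ, 0 < ε → {i | ε ≤ ‖a i‖}.Finite := by
    intro ε hε
    have := (Metric.tendsto_nhds.1 ha) ε hε
    rw [Filter.eventually_cofinite] at this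
    refine this.subset fun i hi => ?_
    simpa using hi
  obtain ⟨k, hk⟩ : ∃ k : ℕ, ∀ i, ‖(p : ℚ_[p]) ^ k * a i‖ ≤ 1 := by
    obtain ⟨B, hB⟩ := ((hfin 1 one_pos).image fun i => ‖a i‖).bddAbove
    obtain ⟨k, hk⟩ := exists_ppow (p := p) (1 / (max B 1)) (by positivity)
    refine ⟨k + 1, fun i => ?_⟩
    have hai : ‖a i‖ ≤ max B 1 := by
      by_cases h : 1 ≤ ‖a i‖
      · exact le_max_of_le_left (hB ⟨i, h, rfl⟩)
      · exact le_max_of_le_right (le_of_not_ge h)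
    rw [norm_mul, Padic.norm_p_pow]
    calc _ ≤ (1 / (max B 1)) * max B 1 := mul_le_mul hk hai (norm_nonneg _) (by positivity)
      _ = 1 := by field_simp
  let b : (Fin m → ℕ) → ℤ_[p] := fun i => mkZ _ (hk i)
  have hb : ∀ i, ((b i : ℤ_[p]) : ℚ_[p]) = (p : ℚ_[p]) ^ k * a i := fun i => rfl
  have hpk : (0 : ℝ) < ‖(p : ℚ_[p]) ^ k‖ := by rw [norm_pos_iff]; exact pow_ne_zero _ p_ne
  have hS : ∀ n : ℕ, {i | ¬ (p : ℤ_[p]) ^ n ∣ b i}.Finite := by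
    intro n
    refine (hfin ((p : ℝ) ^ (-n : ℤ) / ‖(p : ℚ_[p]) ^ k‖) (by
      have := one_lt_p (p := p); positivity)).subset fun i hi => ?_
    rw [Set.mem_ofPred_eq, dvd_iff_norm, not_le, PadicInt.norm_def, hb, norm_mul] at hi
    rw [Set.mem_ofPred_eq, div_le_iff₀ hpk, mul_comm]
    exact hi.le
  let E : (Fin m →₀ ℕ) ≃ (Fin m → ℕ) := Finsupp.equivFunOnFinite
  let Q : ℕ → MvPolynomial (Fin m) ℤ_[p] := fun n => ∑ i ∈ (hS n).toFinset, MvPolynomial.monomial (E.symm i) (b i)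
  have hQ : ∀ n, (p : MvPolynomial (Fin m) ℤ_[p]) ^ n ∣ Q (n + 1) - Q n := by
    intro n
    have hsub : (hS n).toFinset ⊆ (hS (n + 1)).toFinset := by
      intro i hi
      rw [Set.Finite.mem_toFinset] at hi ⊢
      exact fun h => hi ((pow_dvd_pow _ (Nat.le_succ n)).trans h)
    have : Q (n + 1) - Q n = ∑ i ∈ (hS (n + 1)).toFinset \ (hS n).toFinset,
        MvPolynomial.monomial (E.symm i) (b i) := by
      rw [sub_eq_iff_eq_add]; exact (Finset.sum_sdiff hsub).symm
    rw [this]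
    refine Finset.dvd_sum fun i hi => ?_
    rw [Finset.mem_sdiff, Set.Finite.mem_toFinset, Set.Finite.mem_toFinset] at hi
    obtain ⟨e, he⟩ : (p : ℤ_[p]) ^ n ∣ b i := by
      by_contra h; exact hi.2 h
    refine ⟨MvPolynomial.monomial (E.symm i) e, ?_⟩
    rw [he, ← MvPolynomial.C_mul_monomial, map_pow, map_natCast]
  have hprod : ∀ (x : Fin m → ℤ_[p]) (i : Fin m → ℕ), ‖∏ j, ((x j : ℤ_[p]) : ℚ_[p]) ^ i j‖ ≤ 1 := by
    intro x i
    rw [norm_prod]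
    refine Finset.prod_le_one (fun _ _ => norm_nonneg _) fun j _ => ?_
    rw [norm_pow]; exact pow_le_one₀ (norm_nonneg _) (x j).2
  have hsum : ∀ x : Fin m → ℤ_[p], Summable fun i : Fin m → ℕ => a i * ∏ j, ((x j : ℤ_[p]) : ℚ_[p]) ^ i j := by
    intro x
    apply NonarchimedeanAddGroup.summable_of_tendsto_cofinite_zero
    refine squeeze_zero_norm (fun i => ?_) (tendsto_zero_iff_norm_tendsto_zero.1 ha)
    rw [norm_mul]
    exact mul_le_of_le_one_right (norm_nonneg _) (hprod x i)
  have hr : ∀ x : Fin m → ℤ_[p], ranalFn p a (fun i => (x i : ℚ_[p]))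
      = ∑' i : Fin m → ℕ, a i * ∏ j, ((x j : ℤ_[p]) : ℚ_[p]) ^ i j := by
    intro x
    rw [ranalFn, if_pos fun j => (x j).2]
  have hsum' : ∀ x : Fin m → ℤ_[p], Summable fun i : Fin m → ℕ =>
      (b i : ℚ_[p]) * ∏ j, ((x j : ℤ_[p]) : ℚ_[p]) ^ i j := by
    intro x
    refine ((hsum x).mul_left ((p : ℚ_[p]) ^ k)).congr fun i => ?_
    rw [hb, mul_assoc]
  have hr' : ∀ x : Fin m → ℤ_[p], (p : ℚ_[p]) ^ k * ranalFn p a (fun i => (x i : ℚ_[p]))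
      = ∑' i : Fin m → ℕ, (b i : ℚ_[p]) * ∏ j, ((x j : ℤ_[p]) : ℚ_[p]) ^ i j := by
    intro x
    rw [hr, ← tsum_mul_left]
    exact tsum_congr fun i => by rw [hb, mul_assoc]
  have hle : ∀ x : Fin m → ℤ_[p], ‖(p : ℚ_[p]) ^ k * ranalFn p a (fun i => (x i : ℚ_[p]))‖ ≤ 1 := by
    intro x
    rw [hr']
    refine tsum_norm_le (hsum' x) zero_le_one fun i => ?_
    rw [norm_mul]
    exact mul_le_one₀ (b i).2 (norm_nonneg _) (hprod x i)
  refine ⟨(p : ℚ_[p]) ^ k, fun x => mkZ _ (hle x), pow_ne_zero _ p_ne, ⟨Q, hQ, fun n x => ?_⟩, fun x => rfl⟩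
  rw [dvd_iff_norm, PadicInt.norm_def, PadicInt.coe_sub, mkZ_coe, hr']
  have hev : ((MvPolynomial.eval x (Q n) : ℤ_[p]) : ℚ_[p]) = ∑ i ∈ (hS n).toFinset,
      (b i : ℚ_[p]) * ∏ j, ((x j : ℤ_[p]) : ℚ_[p]) ^ i j := by
    simp only [Q, map_sum, PadicInt.coe_sum]
    refine Finset.sum_congr rfl fun i _ => ?_
    rw [MvPolynomial.eval_monomial, PadicInt.coe_mul, Finsupp.prod_fintype _ _ (fun _ => pow_zero _)]
    congr 1
    have : ∀ s : Finset (Fin m), ((∏ j ∈ s, x j ^ (E.symm i) j : ℤ_[p]) : ℚ_[p])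
        = ∏ j ∈ s, ((x j : ℤ_[p]) : ℚ_[p]) ^ i j := by
      intro s
      rw [show ((∏ j ∈ s, x j ^ (E.symm i) j : ℤ_[p]) : ℚ_[p])
        = PadicInt.Coe.ringHom (∏ j ∈ s, x j ^ (E.symm i) j) from rfl, map_prod]
      refine Finset.prod_congr rfl fun j _ => ?_
      rw [map_pow]; rfl
    exact this _
  rw [hev]
  let g : (Fin m → ℕ) → ℚ_[p] := fun i => (b i : ℚ_[p]) * ∏ j, ((x j : ℤ_[p]) : ℚ_[p]) ^ i j
  let g' : (Fin m → ℕ) → ℚ_[p] := fun i => if i ∈ (hS n).toFinset then g i else 0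
  have hg' : HasSum g' (∑ i ∈ (hS n).toFinset, g i) := by
    have : ∑ i ∈ (hS n).toFinset, g i = ∑ i ∈ (hS n).toFinset, g' i :=
      Finset.sum_congr rfl fun i hi => by simp only [g', if_pos hi]
    rw [this]
    exact hasSum_sum_of_ne_finset_zero fun i hi => by simp only [g', if_neg hi]
  have hd := (hsum' x).hasSum.sub hg'
  rw [← hd.tsum_eq]
  refine tsum_norm_le hd.summable (by positivity) fun i => ?_
  by_cases hi : i ∈ (hS n).toFinset
  · simp only [g', if_pos hi, g, sub_self, norm_zero]; positivity
  · simp only [g', if_neg hi, sub_zero]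
    rw [norm_mul]
    have h1 : (p : ℤ_[p]) ^ n ∣ b i := by
      by_contra h; exact hi ((hS n).mem_toFinset.2 h)
    rw [dvd_iff_norm, PadicInt.norm_def] at h1
    exact (mul_le_of_le_one_right (norm_nonneg _) (hprod x i)).trans h1

end PSub
end Part19


section Part20
open PadicSub

namespace PSub

variable {p : ℕ} [hp : Fact p.Prime]

inductive Atom {M : ℕ} : ((Fin M → ℚ_[p]) → ℚ_[p]) → Prop
  | poly (q : MvPolynomial (Fin M) ℚ_[p]) : Atom (fun u => MvPolynomial.eval u q)
  | ranal {m : ℕ} (a : (Fin m → ℕ) → ℚ_[p]) (ha : IsRestrictedCoeffs p a) (σ : Fin m → Fin M)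
      (k : Fin M) : Atom (fun u => u k - ranalFn p a (fun i => u (σ i)))

section
variable {M : ℕ}

open Classical in
noncomputable def phiI (T : Set (Fin M)) (z : Fin M → ℤ_[p]) : Fin M → ℚ_[p] :=
  fun i => if i ∈ T then ((z i : ℤ_[p]) : ℚ_[p])⁻¹ else ((z i : ℤ_[p]) : ℚ_[p])

def ST (p : ℕ) [Fact p.Prime] (T : Set (Fin M)) : Set (Fin M → ℤ_[p]) :=
  {z | ∀ i ∈ T, ((z i : ℤ_[p]) : ℚ_[p]) ≠ 0 ∧ ‖((z i : ℤ_[p]) : ℚ_[p])‖ < 1}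

def RT (T : Set (Fin M)) (f : (Fin M → ℚ_[p]) → ℚ_[p]) : Prop :=
  ∃ d F : TT p M, ∀ z ∈ ST p T, evT z d ≠ 0 ∧ f (phiI T z) = evT z F / evT z d

theorem evT_C (z : Fin M → ℤ_[p]) (a : ℤ_[p]) : evT z (polyT p M (MvPolynomial.C a)) = (a : ℚ_[p]) := by
  simp [evT_apply, polyT]

theorem evT_X (z : Fin M → ℤ_[p]) (i : Fin M) :
    evT z (polyT p M (MvPolynomial.X i)) = ((z i : ℤ_[p]) : ℚ_[p]) := by
  simp [evT_apply, polyT]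

variable {T : Set (Fin M)} {f g : (Fin M → ℚ_[p]) → ℚ_[p]}

theorem RT.const (c : ℚ_[p]) : RT T (fun _ => c) := by
  by_cases h : ‖c‖ ≤ 1
  · refine ⟨1, polyT p M (MvPolynomial.C (mkZ c h)), fun z _ => ⟨?_, ?_⟩⟩
    · rw [map_one]; exact one_ne_zero
    · rw [evT_C, map_one, mkZ_coe, div_one]
  · have h0 : c ≠ 0 := by rintro rfl; exact h (by simp)
    have h' : ‖c⁻¹‖ ≤ 1 := by
      rw [norm_inv]; exact inv_le_one_of_one_le₀ (le_of_not_ge h)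
    refine ⟨polyT p M (MvPolynomial.C (mkZ c⁻¹ h')), 1, fun z _ => ⟨?_, ?_⟩⟩
    · rw [evT_C, mkZ_coe]; exact inv_ne_zero h0
    · rw [evT_C, map_one, mkZ_coe, one_div, inv_inv]

theorem RT.coord (i : Fin M) : RT T (fun u : Fin M → ℚ_[p] => u i) := by
  by_cases h : i ∈ T
  · refine ⟨polyT p M (MvPolynomial.X i), 1, fun z hz => ⟨?_, ?_⟩⟩
    · rw [evT_X]; exact (hz i h).1
    · dsimp only
      rw [evT_X, map_one, phiI, if_pos h, one_div]
  · refine ⟨1, polyT p M (MvPolynomial.X i), fun z hz => ⟨?_, ?_⟩⟩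
    · rw [map_one]; exact one_ne_zero
    · dsimp only
      rw [evT_X, map_one, phiI, if_neg h, div_one]

theorem RT.add (hf : RT T f) (hg : RT T g) : RT T (fun u => f u + g u) := by
  obtain ⟨d, F, h⟩ := hf
  obtain ⟨d', F', h'⟩ := hg
  refine ⟨d * d', F * d' + d * F', fun z hz => ?_⟩
  obtain ⟨h1, h2⟩ := h z hz
  obtain ⟨h1', h2'⟩ := h' z hz
  rw [map_mul, map_add, map_mul, map_mul]
  dsimp only
  rw [h2, h2']
  exact ⟨mul_ne_zero h1 h1', div_add_div _ _ h1 h1'⟩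

theorem RT.mul (hf : RT T f) (hg : RT T g) : RT T (fun u => f u * g u) := by
  obtain ⟨d, F, h⟩ := hf
  obtain ⟨d', F', h'⟩ := hg
  refine ⟨d * d', F * F', fun z hz => ?_⟩
  obtain ⟨h1, h2⟩ := h z hz
  obtain ⟨h1', h2'⟩ := h' z hz
  rw [map_mul, map_mul]
  dsimp only
  rw [h2, h2']
  exact ⟨mul_ne_zero h1 h1', div_mul_div_comm _ _ _ _⟩

theorem RT.poly (q : MvPolynomial (Fin M) ℚ_[p]) : RT T (fun u => MvPolynomial.eval u q) := by
  induction q using MvPolynomial.induction_on with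
  | C a => simpa using RT.const a
  | add q r hq hr => simpa using hq.add hr
  | mul_X q i hq => simpa using hq.mul (RT.coord i)

theorem RT.congr (hf : RT T f) (h : ∀ z ∈ ST p T, g (phiI T z) = f (phiI T z)) : RT T g := by
  obtain ⟨d, F, h'⟩ := hf
  exact ⟨d, F, fun z hz => by rw [h z hz]; exact h' z hz⟩

theorem RT.atom (hf : Atom f) : RT T f := by
  cases hf with
  | poly q => exact RT.poly q
  | @ranal m a ha σ k =>
    have hr : RT T (fun u => ranalFn p a (fun i => u (σ i))) := by
      by_cases h : ∃ i, σ i ∈ T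
      · obtain ⟨i, hi⟩ := h
        refine (RT.const 0).congr fun z hz => ?_
        rw [ranalFn, if_neg]
        intro hall
        have := hall i
        rw [phiI, if_pos hi, norm_inv] at this
        obtain ⟨h1, h2⟩ := hz _ hi
        have h3 := one_lt_inv₀ (norm_pos_iff.2 h1) |>.2 h2
        linarith
      · push Not at h
        obtain ⟨c, F, hc, hF, hcF⟩ := isT_of_ranal a ha
        have h1 : RT T (fun u => c * ranalFn p a (fun i => u (σ i))) := by
          refine ⟨1, ⟨_, hF.reindex σ⟩, fun z _ => ⟨by rw [map_one]; exact one_ne_zero, ?_⟩⟩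
          rw [map_one, div_one, evT_apply, hcF]
          have : (fun i => phiI T z (σ i)) = fun i => ((z (σ i) : ℤ_[p]) : ℚ_[p]) := by
            funext i
            rw [phiI, if_neg (h i)]
          dsimp only
          rw [this]
        refine ((RT.const c⁻¹).mul h1).congr fun z _ => ?_
        exact (inv_mul_cancel_left₀ hc _).symm
    have := (RT.coord (T := T) k).add ((RT.const (-1)).mul hr)
    refine this.congr fun z _ => ?_
    ring

theorem CovOn.tau {V α : Type} {Q : Chart p V → Prop} (τ : V → α) (s : Finset α)
    (h : ∀ a ∈ s, CovOn Q {v | τ v = a}) : CovOn Q {v | τ v ∈ s} := by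
  classical
  induction s using Finset.induction_on with
  | empty => exact CovOn.empty.of_eq (by ext; simp)
  | insert a s ha ih =>
    refine (CovOn.union _ _ ?_ (h a (Finset.mem_insert_self _ _))
      (ih fun b hb => h b (Finset.mem_insert_of_mem hb))).of_eq ?_
    · rw [Set.disjoint_left]
      intro v (hv : τ v = a) (hv' : τ v ∈ s)
      rw [hv] at hv'; exact ha hv'
    · ext v; simp

theorem phiI_img (T : Set (Fin M)) :
    phiI T '' (ST p T) = {u : Fin M → ℚ_[p] | {i | 1 < ‖u i‖} = T} := by
  ext u
  constructor
  · rintro ⟨z, hz, rfl⟩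
    ext i
    rw [Set.mem_ofPred_eq]
    by_cases h : i ∈ T
    · obtain ⟨h1, h2⟩ := hz _ h
      rw [phiI, if_pos h, norm_inv]
      exact ⟨fun _ => h, fun _ => one_lt_inv₀ (norm_pos_iff.2 h1) |>.2 h2⟩
    · rw [phiI, if_neg h]
      exact ⟨fun h' => absurd (z i).2 (not_le.2 h'), fun h' => absurd h' h⟩
  · intro hu
    have hu' : ∀ i, 1 < ‖u i‖ ↔ i ∈ T := fun i => by
      rw [← (hu : {i | 1 < ‖u i‖} = T)]; rfl
    have hz : ∀ i, ∃ z : ℤ_[p], (i ∈ T → (z : ℚ_[p]) = (u i)⁻¹) ∧ (i ∉ T → (z : ℚ_[p]) = u i) := by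
      intro i
      by_cases h : i ∈ T
      · refine ⟨mkZ (u i)⁻¹ ?_, fun _ => rfl, fun h' => absurd h h'⟩
        rw [norm_inv]; exact inv_le_one_of_one_le₀ ((hu' i).2 h).le
      · exact ⟨mkZ (u i) (le_of_not_gt fun h' => h ((hu' i).1 h')), fun h' => absurd h' h, fun _ => rfl⟩
    choose z hz1 hz2 using hz
    refine ⟨z, fun i hi => ?_, ?_⟩
    · rw [hz1 i hi]
      have := (hu' i).2 hi
      have h0 : u i ≠ 0 := by rw [← norm_pos_iff]; linarith
      refine ⟨inv_ne_zero h0, ?_⟩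
      rw [norm_inv]; exact inv_lt_one_of_one_lt₀ this
    · funext i
      by_cases h : i ∈ T
      · rw [phiI, if_pos h, hz1 i h, inv_inv]
      · rw [phiI, if_neg h, hz2 i h]

theorem phiI_inj (T : Set (Fin M)) : Set.InjOn (phiI T) (ST p T) := by
  intro z _ z' _ h
  funext i
  have := congrFun h i
  apply Subtype.ext
  by_cases hi : i ∈ T
  · rw [phiI, phiI, if_pos hi, if_pos hi] at this
    exact inv_injective this
  · rw [phiI, phiI, if_neg hi, if_neg hi] at this
    exact this

theorem atomsT (s : Set ((Fin M → ℚ_[p]) → ℚ_[p])) (hs : s.Finite) (hA : ∀ A ∈ s, Atom A)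
    (ε : ℝ) (hε : 0 < ε) (T : Set (Fin M)) :
    CovOn (fun c => ∀ A ∈ s, Prep ε A c) {u : Fin M → ℚ_[p] | {i | 1 < ‖u i‖} = T} := by
  have hRT : ∀ A : (Fin M → ℚ_[p]) → ℚ_[p], ∃ d F : TT p M, A ∈ s →
      ∀ z ∈ ST p T, evT z d ≠ 0 ∧ A (phiI T z) = evT z F / evT z d := by
    intro A
    by_cases h : A ∈ s
    · obtain ⟨d, F, h'⟩ := RT.atom (T := T) (hA A h)
      exact ⟨d, F, fun _ => h'⟩
    · exact ⟨0, 0, fun h' => absurd h' h⟩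
  choose d F hdF using hRT
  let co : Fin M → TT p M := fun i => polyT p M (MvPolynomial.X i)
  let L : Set (TT p M) := Set.range co ∪ (d '' s ∪ F '' s)
  have hL : L.Finite := (Set.finite_range _).union ((hs.image _).union (hs.image _))
  have hε'0 : 0 < min ε (1/2) := by positivity
  have hε'1 : min ε (1/2) < 1 := (min_le_right _ _).trans_lt (by norm_num)
  have h1 := goodT M L hL _ hε'0
  have h2 : CovOn (fun c => ∀ a ∈ L, Prep (min ε (1/2)) (fun v => evT v a) c) (ST p T) := by
    refine h1.cut (fun _ _ => trivial) (fun c _ hc => ?_) fun c Z hZ hs hc a ha =>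
      (hc a ha).restr le_rfl Z hZ hs
    have hm : ∀ i, MonOn (min ε (1/2)) (fun y => evT (c.h y) (co i)) c.Y :=
      fun i => (hc _ (Or.inl ⟨i, rfl⟩)).2
    have hsa : SA {y | y ∈ c.Y ∧ ∀ i, (i ∉ T ∨ (y ∈ c.Y ∧ ¬ (y ∈ c.Y ∧ evT (c.h y) (co i) = 0)) ∧
        ¬ (y ∈ c.Y ∧ ‖(1 : ℚ_[p])‖ ≤ 1 * ‖evT (c.h y) (co i)‖))} := by
      refine SA.and c.sa (SA.all fun i => SA.or (SA.const _) (SA.and (SA.and c.sa (SA.not ?_)) (SA.not ?_)))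
      · exact MonOn.sa_zero hε'1 c.tor c.sa (hm i)
      · exact MonOn.sa_le hε'1 c.tor c.sa (MonOn.const hε'0.le 1) (hm i) 1 zero_le_one
    refine hsa.congr fun y => and_congr_right fun hy => forall_congr' fun i => ?_
    rw [evT_X, norm_one, one_mul]
    by_cases hi : i ∈ T
    · simp only [hi, hy, true_and, forall_true_left, not_true, false_or, not_le]
    · simp only [hi, not_false_eq_true, true_or, false_imp_iff]
  rw [← phiI_img]
  refine h2.image _ (phiI_inj T) fun c hcS hc A hAs => ?_
  have hz : ∀ y ∈ c.Y, c.h y ∈ ST p T := fun y hy => hcS ⟨y, hy, rfl⟩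
  obtain ⟨d1, d2⟩ := hc _ (Or.inr (Or.inl ⟨A, hAs, rfl⟩))
  obtain ⟨f1, f2⟩ := hc _ (Or.inr (Or.inr ⟨A, hAs, rfl⟩))
  have key : ∀ y ∈ c.Y, A (phiI T (c.h y)) = evT (c.h y) (F A) * (evT (c.h y) (d A))⁻¹ := by
    intro y hy
    rw [(hdF A hAs _ (hz y hy)).2, div_eq_mul_inv]
  refine ⟨(f1.mul d1.inv).congr key, ?_⟩
  exact ((f2.mul hε'1.le hε'0.le c.tor (d2.inv hε'1)).mono (min_le_left _ _) subset_rfl).congr key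

theorem atoms_cov (s : Set ((Fin M → ℚ_[p]) → ℚ_[p])) (hs : s.Finite) (hA : ∀ A ∈ s, Atom A)
    (ε : ℝ) (hε : 0 < ε) : CovOn (fun c => ∀ A ∈ s, Prep ε A c) (Set.univ : Set (Fin M → ℚ_[p])) := by
  classical
  refine (CovOn.tau (fun u : Fin M → ℚ_[p] => {i | 1 < ‖u i‖}) (Finset.univ : Finset (Set (Fin M)))
    fun T _ => atomsT s hs hA ε hε T).of_eq ?_
  ext; simp

end

end PSub
end Part20


section Part21
open PadicSub

namespace PSub

variable {p : ℕ} [hp : Fact p.Prime]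

section
variable {ι : Type} {M : ℕ}

theorem Atom.succ {A : (Fin M → ℚ_[p]) → ℚ_[p]} (hA : Atom A) :
    Atom (fun u : Fin (M + 1) → ℚ_[p] => A (fun i => u i.succ)) := by
  cases hA with
  | poly q =>
    have := Atom.poly (p := p) (MvPolynomial.rename Fin.succ q)
    simp only [MvPolynomial.eval_rename] at this
    exact this
  | ranal a ha σ k => exact Atom.ranal a ha (fun i => (σ i).succ) k.succ

def Flat (w : (ι → ℚ_[p]) → Fin M → ℚ_[p]) : Prop :=
  (∃ j : ι → Fin M, ∀ x i, w x (j i) = x i) ∧ ∃ s : Set ((Fin M → ℚ_[p]) → ℚ_[p]), s.Finite ∧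
    (∀ A ∈ s, Atom A) ∧ ∀ u, (∀ A ∈ s, A u = 0) ↔ ∃ x, w x = u

theorem Flat.step {w : (ι → ℚ_[p]) → Fin M → ℚ_[p]} (hw : Flat w) (ψ : (Fin M → ℚ_[p]) → ℚ_[p])
    (s' : Set ((Fin (M + 1) → ℚ_[p]) → ℚ_[p])) (hs' : s'.Finite) (hA' : ∀ A ∈ s', Atom A)
    (h : ∀ u : Fin (M + 1) → ℚ_[p], (∀ A ∈ s', A u = 0) ↔ u 0 = ψ fun i => u i.succ) :
    Flat (fun x => (Fin.cons (ψ (w x)) (w x) : Fin (M + 1) → ℚ_[p])) := by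
  obtain ⟨⟨j, hj⟩, s, hs, hA, hw⟩ := hw
  refine ⟨⟨fun i => (j i).succ, fun x i => hj x i⟩,
    s' ∪ (fun A u => A (fun i : Fin M => u i.succ)) '' s, hs'.union (hs.image _), ?_, fun u => ?_⟩
  · rintro A (h | ⟨A, h, rfl⟩)
    · exact hA' A h
    · exact (hA A h).succ
  · constructor
    · intro hu
      have h1 := (h u).1 fun A hA => hu A (Or.inl hA)
      obtain ⟨x, hx⟩ := (hw fun i => u i.succ).1 fun A hA => hu _ (Or.inr ⟨A, hA, rfl⟩)
      refine ⟨x, ?_⟩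
      funext i
      refine Fin.cases ?_ (fun i => ?_) i
      · rw [h1, ← hx]; rfl
      · exact congrFun hx i
    · rintro ⟨x, rfl⟩ A (hA | ⟨A, hA, rfl⟩)
      · exact (h _).2 rfl A hA
      · exact (hw (w x)).2 ⟨x, rfl⟩ A hA

/-- Extension property. -/
def EP (φ : (ι → ℚ_[p]) → ℚ_[p]) : Prop :=
  ∀ (M : ℕ) (w : (ι → ℚ_[p]) → Fin M → ℚ_[p]), Flat w →
    ∃ (M' : ℕ) (w' : (ι → ℚ_[p]) → Fin M' → ℚ_[p]) (s : Fin M → Fin M'), Flat w' ∧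
      (∀ x k, w' x (s k) = w x k) ∧ ∃ k0, ∀ x, w' x k0 = φ x

theorem EP.family {n : ℕ} : ∀ (φ : Fin n → (ι → ℚ_[p]) → ℚ_[p]), (∀ i, EP (φ i)) →
  ∀ (M : ℕ) (w : (ι → ℚ_[p]) → Fin M → ℚ_[p]), Flat w →
    ∃ (M' : ℕ) (w' : (ι → ℚ_[p]) → Fin M' → ℚ_[p]) (s : Fin M → Fin M'), Flat w' ∧
      (∀ x k, w' x (s k) = w x k) ∧ ∃ k0 : Fin n → Fin M', ∀ x i, w' x (k0 i) = φ i x := by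
  induction n with
  | zero => exact fun φ _ M w hw => ⟨M, w, id, hw, fun _ _ => rfl, fun i => i.elim0, fun _ i => i.elim0⟩
  | succ n ih =>
    intro φ hφ M w hw
    obtain ⟨M1, w1, s1, hw1, hs1, k1, hk1⟩ := ih (fun i => φ i.succ) (fun i => hφ _) M w hw
    obtain ⟨M2, w2, s2, hw2, hs2, k2, hk2⟩ := hφ 0 M1 w1 hw1
    refine ⟨M2, w2, fun k => s2 (s1 k), hw2, fun x k => by rw [hs2, hs1],
      Fin.cons k2 fun i => s2 (k1 i), fun x i => ?_⟩
    refine Fin.cases ?_ (fun i => ?_) i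
    · exact hk2 x
    · exact (hs2 x _).trans (hk1 x i)

theorem EP.comp {n : ℕ} (φ : Fin n → (ι → ℚ_[p]) → ℚ_[p]) (hφ : ∀ i, EP (φ i))
    (Ψ : (Fin n → ℚ_[p]) → ℚ_[p])
    (H : ∀ {M : ℕ} (k : Fin n → Fin M), ∃ s' : Set ((Fin (M + 1) → ℚ_[p]) → ℚ_[p]),
      s'.Finite ∧ (∀ A ∈ s', Atom A) ∧
      ∀ u : Fin (M + 1) → ℚ_[p], (∀ A ∈ s', A u = 0) ↔ u 0 = Ψ fun i => u (k i).succ) :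
    EP (fun x => Ψ fun i => φ i x) := by
  intro M w hw
  obtain ⟨M1, w1, s1, hw1, hs1, k1, hk1⟩ := EP.family φ hφ M w hw
  obtain ⟨s', h1, h2, h3⟩ := H k1
  refine ⟨M1 + 1, _, fun k => (s1 k).succ, hw1.step (fun u => Ψ fun i => u (k1 i)) s' h1 h2 h3,
    fun x k => hs1 x k, 0, fun x => ?_⟩
  change Ψ (fun i => w1 x (k1 i)) = _
  simp only [hk1]

theorem EP.poly1 {n : ℕ} (φ : Fin n → (ι → ℚ_[p]) → ℚ_[p]) (hφ : ∀ i, EP (φ i))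
    (q : MvPolynomial (Fin n) ℚ_[p]) :
    EP (fun x => MvPolynomial.eval (fun i => φ i x) q) := by
  refine EP.comp φ hφ (fun u => MvPolynomial.eval u q) fun {M} k => ?_
  refine ⟨{fun u => MvPolynomial.eval u (MvPolynomial.X 0 - MvPolynomial.rename (fun i => (k i).succ) q)},
    Set.finite_singleton _, ?_, fun u => ?_⟩
  · rintro A rfl; exact Atom.poly _
  · simp only [Set.mem_singleton_iff, forall_eq, map_sub, MvPolynomial.eval_X, MvPolynomial.eval_rename,
      sub_eq_zero]
    rfl

theorem EP.of_DF {φ : (ι → ℚ_[p]) → ℚ_[p]} (hφ : DF φ) : EP φ := by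
  induction hφ with
  | const c =>
    have := EP.poly1 (fun i : Fin 0 => (i.elim0 : (ι → ℚ_[p]) → ℚ_[p])) (fun i => i.elim0) (MvPolynomial.C c)
    simpa using this
  | coord i =>
    intro M w hw
    obtain ⟨j, hj⟩ := hw.1
    exact ⟨M, w, id, hw, fun _ _ => rfl, j i, fun x => hj x i⟩
  | add f g _ _ hf hg =>
    have := EP.poly1 ![f, g] (by intro i; fin_cases i <;> assumption) (MvPolynomial.X 0 + MvPolynomial.X 1)
    simpa using this
  | mul f g _ _ hf hg =>
    have := EP.poly1 ![f, g] (by intro i; fin_cases i <;> assumption) (MvPolynomial.X 0 * MvPolynomial.X 1)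
    simpa using this
  | inv f _ hf =>
    refine EP.comp (fun _ : Fin 1 => f) (fun _ => hf) (fun u => (u 0)⁻¹) fun {M} k => ?_
    let a : MvPolynomial (Fin (M + 1)) ℚ_[p] := MvPolynomial.X 0
    let b : MvPolynomial (Fin (M + 1)) ℚ_[p] := MvPolynomial.X (k 0).succ
    refine ⟨{fun u => MvPolynomial.eval u (a ^ 2 * b - a), fun u => MvPolynomial.eval u (b ^ 2 * a - b)},
      by simp, ?_, fun u => ?_⟩
    · rintro A (rfl | rfl) <;> exact Atom.poly _
    · simp only [Set.mem_insert_iff, Set.mem_singleton_iff, forall_eq_or_imp, forall_eq, a, b, map_sub,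
        map_mul, map_pow, MvPolynomial.eval_X, sub_eq_zero]
      by_cases h : u (k 0).succ = 0
      · rw [h]; simp [eq_comm]
      · constructor
        · rintro ⟨_, h2⟩
          refine eq_inv_of_mul_eq_one_left ?_
          apply mul_left_cancel₀ h
          linear_combination h2
        · intro h2
          rw [h2]
          constructor <;> field_simp
  | ranal a ha g _ hg =>
    refine EP.comp g hg (ranalFn p a) fun {M} k => ?_
    refine ⟨{fun u => u 0 - ranalFn p a (fun i => u ((k i).succ))}, Set.finite_singleton _, ?_, fun u => ?_⟩
    · rintro A rfl; exact Atom.ranal a ha (fun i => (k i).succ) 0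
    · simp only [Set.mem_singleton_iff, forall_eq, sub_eq_zero]

/-- Theorem C. -/
theorem thmC {m n : ℕ} (φ : Fin n → (Fin m → ℚ_[p]) → ℚ_[p]) (hφ : ∀ i, DF (φ i)) (ε : ℝ) (hε : 0 < ε) :
    CovOn (fun c => (∀ i, Prep ε (φ i) c) ∧ ∀ i, Prep ε (fun x => x i) c)
      (Set.univ : Set (Fin m → ℚ_[p])) := by
  have h0 : Flat (fun x : Fin m → ℚ_[p] => x) :=
    ⟨⟨id, fun _ _ => rfl⟩, ∅, Set.finite_empty, by simp, by simp⟩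
  obtain ⟨M, w, s, hw, hs, k, hk⟩ := EP.family φ (fun i => EP.of_DF (hφ i)) m _ h0
  obtain ⟨_, a, ha, hA, hwa⟩ := hw
  let co : Fin M → (Fin M → ℚ_[p]) → ℚ_[p] := fun i u => u i
  have hε'0 : 0 < min ε (1/2) := by positivity
  have hε'1 : min ε (1/2) < 1 := (min_le_right _ _).trans_lt (by norm_num)
  have h1 := atoms_cov (a ∪ Set.range co) (ha.union (Set.finite_range _)) (by
    rintro A (h | ⟨i, rfl⟩)
    · exact hA A h
    · have := Atom.poly (p := p) (MvPolynomial.X i)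
      simpa using this) _ hε'0
  have h2 : CovOn (fun c => ∀ i, Prep ε (co i) c) (Set.range w) := by
    refine h1.cut (Set.subset_univ _) (fun c _ hc => ?_) (fun c Z hZ hs hc i =>
      (hc _ (Or.inr ⟨i, rfl⟩)).restr (min_le_left _ _) Z hZ hs)
    have hsa : SA {y | y ∈ c.Y ∧ ∀ A ∈ ha.toFinset, (y ∈ c.Y ∧ A (c.h y) = 0)} := by
      refine SA.and c.sa (SA.finset_all _ fun A hAa => ?_)
      exact MonOn.sa_zero hε'1 c.tor c.sa (hc A (Or.inl (ha.mem_toFinset.1 hAa))).2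
    refine hsa.congr fun y => and_congr_right fun hy => ?_
    simp only [ha.mem_toFinset, hy, true_and]
    rw [hwa]; rfl
  have h3 := h2.image (Q' := fun c => (∀ i, Prep ε (φ i) c) ∧ ∀ i, Prep ε (fun x => x i) c)
    (fun (u : Fin M → ℚ_[p]) i => u (s i)) (by
      rintro _ ⟨x, rfl⟩ _ ⟨x', rfl⟩ h
      have : x = x' := by
        funext i
        have := congrFun h i
        simpa only [hs] using this
      rw [this]) (by
      intro c hcS hc
      have hcw : ∀ y ∈ c.Y, ∃ x, w x = c.h y := fun y hy => hcS ⟨y, hy, rfl⟩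
      refine ⟨fun i => ⟨(hc (k i)).1.congr fun y hy => ?_, (hc (k i)).2.congr fun y hy => ?_⟩,
        fun i => ⟨(hc (s i)).1, (hc (s i)).2⟩⟩
      all_goals
        obtain ⟨x, hx⟩ := hcw y hy
        change φ i (fun i => c.h y (s i)) = c.h y (k i)
        rw [← hx, hk]
        congr 1
        funext i
        exact hs x i)
  refine h3.of_eq ?_
  rw [Set.eq_univ_iff_forall]
  intro x
  exact ⟨w x, ⟨x, rfl⟩, funext fun i => hs x i⟩

end

end PSub
end Part21


section Part22
open PadicSub
namespace PSub
variable {p : ℕ} [hp : Fact p.Prime]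

/-- Positive Boolean combinations of sets from a class `B`. -/
inductive Pos {T : Type} (B : Set T → Prop) : Set T → Prop
  | univ : Pos B Set.univ
  | empty : Pos B ∅
  | basic (A : Set T) : B A → Pos B A
  | inter (A C : Set T) : Pos B A → Pos B C → Pos B (A ∩ C)
  | union (A C : Set T) : Pos B A → Pos B C → Pos B (A ∪ C)

section Pos
variable {T T' : Type} {B : Set T → Prop} {B' : Set T' → Prop}

theorem Pos.finset_iInter {α : Type*} (s : Finset α) {A : α → Set T} (h : ∀ i ∈ s, Pos B (A i)) :
    Pos B {x | ∀ i ∈ s, x ∈ A i} := by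
  classical
  induction s using Finset.induction_on with
  | empty => simpa using Pos.univ
  | insert a s ha ih =>
    have h1 := Pos.inter _ _ (h a (by simp)) (ih fun i hi => h i (by simp [hi]))
    convert h1 using 1
    ext x; simp

theorem Pos.finset_iUnion {α : Type*} (s : Finset α) {A : α → Set T} (h : ∀ i ∈ s, Pos B (A i)) :
    Pos B {x | ∃ i ∈ s, x ∈ A i} := by
  classical
  induction s using Finset.induction_on with
  | empty => simpa using Pos.empty
  | insert a s ha ih =>
    have h1 := Pos.union _ _ (h a (by simp)) (ih fun i hi => h i (by simp [hi]))
    convert h1 using 1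
    ext x; simp

theorem Pos.all {n : ℕ} {A : Fin n → Set T} (h : ∀ i, Pos B (A i)) : Pos B {x | ∀ i, x ∈ A i} := by
  have h1 := Pos.finset_iInter Finset.univ (A := A) fun i _ => h i
  simpa using h1

theorem Pos.ex {n : ℕ} {A : Fin n → Set T} (h : ∀ i, Pos B (A i)) : Pos B {x | ∃ i, x ∈ A i} := by
  have h1 := Pos.finset_iUnion Finset.univ (A := A) fun i _ => h i
  simpa using h1

theorem Pos.pull (σ : T' → T) (hB : ∀ A, B A → B' (σ ⁻¹' A)) {X : Set T} (h : Pos B X) :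
    Pos B' (σ ⁻¹' X) := by
  induction h with
  | univ => exact Pos.univ
  | empty => exact Pos.empty
  | basic A hA => exact Pos.basic _ (hB A hA)
  | inter A C _ _ h1 h2 => exact Pos.inter _ _ h1 h2
  | union A C _ _ h1 h2 => exact Pos.union _ _ h1 h2

theorem Pos.compl (hB : ∀ A, B A → Pos B Aᶜ) {X : Set T} (h : Pos B X) : Pos B Xᶜ := by
  induction h with
  | univ => simpa using Pos.empty
  | empty => simpa using Pos.univ
  | basic A hA => exact hB A hA
  | inter A C _ _ h1 h2 => rw [Set.compl_inter]; exact Pos.union _ _ h1 h2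
  | union A C _ _ h1 h2 => rw [Set.compl_union]; exact Pos.inter _ _ h1 h2

theorem Pos.dnf_list {X : Set T} (h : Pos B X) :
    ∃ L : List (List (Set T)), (∀ l ∈ L, ∀ A ∈ l, B A) ∧ X = {x | ∃ l ∈ L, ∀ A ∈ l, x ∈ A} := by
  induction h with
  | univ => exact ⟨[[]], by simp, by ext; simp⟩
  | empty => exact ⟨[], by simp, by ext; simp⟩
  | basic A hA => exact ⟨[[A]], by simpa using hA, by ext; simp⟩
  | union A C _ _ h1 h2 =>
    obtain ⟨L1, hL1, e1⟩ := h1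
    obtain ⟨L2, hL2, e2⟩ := h2
    refine ⟨L1 ++ L2, ?_, ?_⟩
    · intro l hl
      rcases List.mem_append.1 hl with hl | hl
      · exact hL1 l hl
      · exact hL2 l hl
    · ext x
      rw [e1, e2]
      simp only [Set.mem_union, Set.mem_ofPred_eq, List.mem_append]
      constructor
      · rintro (⟨l, hl, h⟩ | ⟨l, hl, h⟩)
        · exact ⟨l, Or.inl hl, h⟩
        · exact ⟨l, Or.inr hl, h⟩
      · rintro ⟨l, hl | hl, h⟩
        · exact Or.inl ⟨l, hl, h⟩
        · exact Or.inr ⟨l, hl, h⟩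
  | inter A C _ _ h1 h2 =>
    obtain ⟨L1, hL1, e1⟩ := h1
    obtain ⟨L2, hL2, e2⟩ := h2
    refine ⟨L1.flatMap fun l1 => L2.map fun l2 => l1 ++ l2, ?_, ?_⟩
    · intro l hl A hA
      simp only [List.mem_flatMap, List.mem_map] at hl
      obtain ⟨l1, h1, l2, h2, rfl⟩ := hl
      rcases List.mem_append.1 hA with hA | hA
      · exact hL1 l1 h1 A hA
      · exact hL2 l2 h2 A hA
    · ext x
      rw [e1, e2]
      simp only [Set.mem_inter_iff, Set.mem_ofPred_eq, List.mem_flatMap, List.mem_map]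
      constructor
      · rintro ⟨⟨l1, h1, k1⟩, ⟨l2, h2, k2⟩⟩
        refine ⟨_, ⟨l1, h1, l2, h2, rfl⟩, fun A hA => ?_⟩
        rcases List.mem_append.1 hA with hA | hA
        · exact k1 A hA
        · exact k2 A hA
      · rintro ⟨_, ⟨l1, h1, l2, h2, rfl⟩, k⟩
        exact ⟨⟨l1, h1, fun A hA => k A (List.mem_append_left _ hA)⟩,
          ⟨l2, h2, fun A hA => k A (List.mem_append_right _ hA)⟩⟩

theorem Pos.dnf (hB : B Set.univ) {X : Set T} (h : Pos B X) :
    ∃ (r s : ℕ) (F : Fin r → Fin s → Set T), (∀ i j, B (F i j)) ∧ X = ⋃ i, ⋂ j, F i j := by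
  obtain ⟨L, hL, rfl⟩ := h.dnf_list
  refine ⟨L.length, (L.map List.length).sum, fun i j => (L.get i).getD j Set.univ, ?_, ?_⟩
  · intro i j
    dsimp only
    by_cases hj : (j : ℕ) < (L.get i).length
    · rw [List.getD_eq_getElem _ _ hj]
      exact hL _ (List.get_mem _ _) _ (List.getElem_mem _)
    · rw [List.getD_eq_default _ _ (by omega)]
      exact hB
  · ext x
    simp only [Set.mem_ofPred_eq, Set.mem_iUnion, Set.mem_iInter]
    constructor
    · rintro ⟨l, hl, hx⟩
      obtain ⟨i, rfl⟩ := List.mem_iff_get.1 hl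
      refine ⟨i, fun j => ?_⟩
      by_cases hj : (j : ℕ) < (L.get i).length
      · rw [List.getD_eq_getElem _ _ hj]
        exact hx _ (List.getElem_mem _)
      · rw [List.getD_eq_default _ _ (by omega)]
        trivial
    · rintro ⟨i, hx⟩
      refine ⟨_, List.get_mem L i, fun A hA => ?_⟩
      obtain ⟨k, rfl⟩ := List.mem_iff_get.1 hA
      have hle : (L.get i).length ≤ (L.map List.length).sum :=
        List.le_sum_of_mem (List.mem_map_of_mem (List.get_mem L i))
      have h1 := hx ⟨k, lt_of_lt_of_le k.2 hle⟩
      rw [List.getD_eq_getElem _ _ k.2] at h1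
      exact h1

theorem Pos.of_dnf {r s : ℕ} {F : Fin r → Fin s → Set T} (hF : ∀ i j, B (F i j)) {X : Set T}
    (hX : X = ⋃ i, ⋂ j, F i j) : Pos B X := by
  have h1 : Pos B {x | ∃ i, x ∈ {x | ∀ j, x ∈ F i j}} :=
    Pos.ex fun i => Pos.all fun j => Pos.basic _ (hF i j)
  convert h1 using 1
  rw [hX]; ext x; simp
end Pos

/-- basic semialgebraic sets -/
def BA {ι : Type} (A : Set (ι → ℚ_[p])) : Prop :=
  (∃ f : MvPolynomial ι ℚ_[p], A = {x | MvPolynomial.eval x f = 0}) ∨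
    (∃ (f : MvPolynomial ι ℚ_[p]) (n : ℕ), 0 < n ∧ A = {x | MvPolynomial.eval x f ∈ Pset p n})

/-- basic subanalytic sets -/
def BD {ι : Type} (A : Set (ι → ℚ_[p])) : Prop :=
  (∃ f : (ι → ℚ_[p]) → ℚ_[p], DF f ∧ A = {x | f x = 0}) ∨
    (∃ (f : (ι → ℚ_[p]) → ℚ_[p]) (n : ℕ), DF f ∧ 0 < n ∧ A = {x | f x ∈ Pset p n})

theorem BA.compl {ι : Type} (A : Set (ι → ℚ_[p])) (hA : BA A) : Pos BA Aᶜ := by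
  classical
  rcases hA with ⟨q, rfl⟩ | ⟨q, n, hn, rfl⟩
  · refine Pos.basic _ (Or.inr ⟨q, 1, one_pos, ?_⟩)
    ext x
    simp only [Set.mem_compl_iff, Set.mem_ofPred_eq]
    constructor
    · intro h; exact ⟨_, h, pow_one _⟩
    · intro h; exact Pset_ne h
  · obtain ⟨Λ, hΛ, h⟩ := coset_reps (p := p) n hn
    have h1 : Pos BA {x : ι → ℚ_[p] | ∃ l ∈ Λ.filter (fun l => l ∉ Pset p n),
        x ∈ {x | MvPolynomial.eval x (MvPolynomial.C l⁻¹ * q) ∈ Pset p n}} :=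
      Pos.finset_iUnion _ fun l _ => Pos.basic _ (Or.inr ⟨_, n, hn, rfl⟩)
    have h2 : Pos BA {x : ι → ℚ_[p] | MvPolynomial.eval x q = 0} := Pos.basic _ (Or.inl ⟨q, rfl⟩)
    convert Pos.union _ _ h2 h1 using 1
    ext x
    simp only [Set.mem_compl_iff, Set.mem_ofPred_eq, Set.mem_union, Finset.mem_filter, map_mul,
      MvPolynomial.eval_C]
    constructor
    · intro hx
      by_cases h0 : MvPolynomial.eval x q = 0
      · exact Or.inl h0
      · obtain ⟨l, hl, hl2⟩ := h _ h0
        refine Or.inr ⟨l, ⟨hl, fun hln => hx ?_⟩, ?_⟩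
        · have := Pset_mul hl2 hln
          rwa [div_mul_cancel₀ _ (hΛ l hl)] at this
        · rwa [div_eq_inv_mul] at hl2
    · rintro (h0 | ⟨l, ⟨hl, hln⟩, hl2⟩) hx
      · exact Pset_ne hx h0
      · have h3 := (Pset_mul_iff hx).1 hl2
        exact hln (by simpa using Pset_inv h3)

theorem SA.pos {ι : Type} {Y : Set (ι → ℚ_[p])} (h : SA Y) : Pos BA Y := by
  induction h with
  | zero q => exact Pos.basic _ (Or.inl ⟨q, rfl⟩)
  | pow q n hn => exact Pos.basic _ (Or.inr ⟨q, n, hn, rfl⟩)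
  | compl A _ ih => exact Pos.compl BA.compl ih
  | inter A C _ _ h1 h2 => exact Pos.inter _ _ h1 h2

theorem SA.toSemialg {m : ℕ} {Y : Set (Fin m → ℚ_[p])} (h : SA Y) : IsSemialgebraic p Y := by
  obtain ⟨r, s, F, hF, e⟩ := h.pos.dnf (Or.inl ⟨0, by ext; simp⟩)
  exact ⟨r, s, F, hF, e⟩

theorem Pos.toSubanalytic {m : ℕ} {X : Set (Fin m → ℚ_[p])} (h : Pos BD X) : IsSubanalytic p X := by
  obtain ⟨r, s, F, hF, e⟩ := h.dnf (Or.inl ⟨fun _ => 0, DF.const 0, by ext; simp⟩)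
  refine ⟨r, s, F, fun i j => ?_, e⟩
  rcases hF i j with ⟨f, hf, h⟩ | ⟨f, n, hf, hn, h⟩
  · exact Or.inl ⟨f, hf.toD, h⟩
  · exact Or.inr ⟨f, n, hf.toD, hn, h⟩

theorem Pos.ofSubanalytic {m : ℕ} {X : Set (Fin m → ℚ_[p])} (h : IsSubanalytic p X) : Pos BD X := by
  obtain ⟨r, s, F, hF, e⟩ := h
  refine Pos.of_dnf (F := F) (fun i j => ?_) e
  rcases hF i j with ⟨f, hf, h⟩ | ⟨f, n, hf, hn, h⟩
  · exact Or.inl ⟨f, DF.ofD hf, h⟩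
  · exact Or.inr ⟨f, n, DF.ofD hf, hn, h⟩

theorem BD.pull {ι κ : Type} (σ : ι → κ) (A : Set (ι → ℚ_[p])) (hA : BD A) :
    BD ((fun (w : κ → ℚ_[p]) i => w (σ i)) ⁻¹' A) := by
  rcases hA with ⟨f, hf, rfl⟩ | ⟨f, n, hf, hn, rfl⟩
  · exact Or.inl ⟨_, hf.subst (g := fun i w => w (σ i)) fun i => DF.coord _, rfl⟩
  · exact Or.inr ⟨_, n, hf.subst (g := fun i w => w (σ i)) fun i => DF.coord _, hn, rfl⟩

theorem BA.pull {ι κ : Type} (σ : ι → κ) (A : Set (ι → ℚ_[p])) (hA : BA A) :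
    BD ((fun (w : κ → ℚ_[p]) i => w (σ i)) ⁻¹' A) := by
  apply BD.pull
  rcases hA with ⟨f, rfl⟩ | ⟨f, n, hn, rfl⟩
  · exact Or.inl ⟨_, DF.mvpoly f, rfl⟩
  · exact Or.inr ⟨_, n, DF.mvpoly f, hn, rfl⟩

/-- Sets cut out semialgebraically in any chart preparing finitely many D-functions. -/
theorem Pos.cut {ι : Type} {X : Set (ι → ℚ_[p])} (h : Pos BD X) :
    ∃ Φ : List ((ι → ℚ_[p]) → ℚ_[p]), (∀ φ ∈ Φ, DF φ) ∧ ∃ η : ℝ, 0 < η ∧ η < 1 ∧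
      ∀ ε ≤ η, ∀ c : Chart p (ι → ℚ_[p]), (∀ φ ∈ Φ, MonOn ε (fun y => φ (c.h y)) c.Y) →
        SA {y | y ∈ c.Y ∧ c.h y ∈ X} := by
  induction h with
  | univ =>
    refine ⟨[], by simp, 1 / 2, by norm_num, by norm_num, fun ε _ c _ => ?_⟩
    exact c.sa.congr fun y => by simp
  | empty =>
    refine ⟨[], by simp, 1 / 2, by norm_num, by norm_num, fun ε _ c _ => ?_⟩
    exact SA.empty.congr fun y => by simp
  | basic A hA =>
    rcases hA with ⟨f, hf, rfl⟩ | ⟨f, n, hf, hn, rfl⟩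
    · refine ⟨[f], by simpa using hf, 1 / 2, by norm_num, by norm_num, fun ε hε c hc => ?_⟩
      exact MonOn.sa_zero (by linarith) c.tor c.sa (hc f (by simp))
    · obtain ⟨η, h0, h1, h2⟩ := MonOn.sa_pow (p := p) n hn
      refine ⟨[f], by simpa using hf, η, h0, h1, fun ε hε c hc => ?_⟩
      exact h2 c.tor c.sa ((hc f (by simp)).mono hε subset_rfl)
  | inter A C _ _ h1 h2 =>
    obtain ⟨Φ1, d1, η1, a1, b1, c1⟩ := h1
    obtain ⟨Φ2, d2, η2, a2, b2, c2⟩ := h2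
    refine ⟨Φ1 ++ Φ2, fun φ hφ => (List.mem_append.1 hφ).elim (d1 φ) (d2 φ), min η1 η2,
      lt_min a1 a2, lt_of_le_of_lt (min_le_left _ _) b1, fun ε hε c hc => ?_⟩
    have e1 := c1 ε (hε.trans (min_le_left _ _)) c fun φ hφ => hc φ (List.mem_append_left _ hφ)
    have e2 := c2 ε (hε.trans (min_le_right _ _)) c fun φ hφ => hc φ (List.mem_append_right _ hφ)
    exact (SA.inter _ _ e1 e2).congr fun y => by
      simp only [Set.mem_inter_iff, Set.mem_ofPred_eq]; tauto
  | union A C _ _ h1 h2 =>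
    obtain ⟨Φ1, d1, η1, a1, b1, c1⟩ := h1
    obtain ⟨Φ2, d2, η2, a2, b2, c2⟩ := h2
    refine ⟨Φ1 ++ Φ2, fun φ hφ => (List.mem_append.1 hφ).elim (d1 φ) (d2 φ), min η1 η2,
      lt_min a1 a2, lt_of_le_of_lt (min_le_left _ _) b1, fun ε hε c hc => ?_⟩
    have e1 := c1 ε (hε.trans (min_le_left _ _)) c fun φ hφ => hc φ (List.mem_append_left _ hφ)
    have e2 := c2 ε (hε.trans (min_le_right _ _)) c fun φ hφ => hc φ (List.mem_append_right _ hφ)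
    exact (SA.union e1 e2).congr fun y => by
      simp only [Set.mem_union, Set.mem_ofPred_eq]; tauto

theorem thmD {m : ℕ} {X : Set (Fin m → ℚ_[p])} (h : Pos BD X) :
    ∃ ε : ℝ, ε < 1 ∧ CovOn (fun c => ∀ i, Prep ε (fun x : Fin m → ℚ_[p] => x i) c) X := by
  obtain ⟨Φ, hΦ, η, h0, h1, h2⟩ := h.cut
  refine ⟨η, h1, ?_⟩
  have h3 := thmC (fun i : Fin Φ.length => Φ.get i) (fun i => hΦ _ (List.get_mem _ _)) η h0
  refine h3.cut (Set.subset_univ _) (fun c _ hc => ?_) fun c Z hZ hs hc i => ?_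
  · refine h2 η le_rfl c fun φ hφ => ?_
    obtain ⟨i, rfl⟩ := List.mem_iff_get.1 hφ
    exact (hc.1 i).2
  · exact (hc.2 i).restr le_rfl Z hZ hs
end PSub
end Part22


section Part23
open PadicSub
namespace PSub
variable {p : ℕ} [hp : Fact p.Prime]

/-- A single semialgebraic parametrization of `S`, with semialgebraic functions having the same
norms as the coordinates. -/
structure Par {M : ℕ} (S : Set (Fin M → ℚ_[p])) (ι : Type) (Y : Set (ι → ℚ_[p]))
    (h : (ι → ℚ_[p]) → (Fin M → ℚ_[p])) (g : Fin M → (ι → ℚ_[p]) → ℚ_[p]) : Prop where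
  sa : SA Y
  inj : Set.InjOn h Y
  img : h '' Y = S
  don : ∀ j, DOn (fun y => h y j) Y
  gsa : ∀ j, SA {z : Option ι → ℚ_[p] | (fun i => z (some i)) ∈ Y ∧ g j (fun i => z (some i)) = z none}
  nrm : ∀ j, ∀ y ∈ Y, ‖g j y‖ = ‖h y j‖

theorem Par.empty {M : ℕ} : Par (∅ : Set (Fin M → ℚ_[p])) Empty ∅ (fun _ _ => 0) (fun _ _ => 0) where
  sa := SA.empty
  inj := by simp
  img := by simp
  don := fun j => ⟨fun _ => 0, DF.const 0, by simp⟩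
  gsa := fun j => SA.empty.congr fun y => by simp
  nrm := by simp

theorem mon_graph {ι : Type} [Fintype ι] {Y : Set (ι → ℚ_[p])} (hY : SA Y) (ht : ∀ y ∈ Y, tor y)
    (c : ℚ_[p]) (e : ι → ℤ) :
    SA {z : Option ι → ℚ_[p] | (fun i => z (some i)) ∈ Y ∧ mon c e (fun i => z (some i)) = z none} := by
  let q : MvPolynomial (Option ι) ℚ_[p] :=
    MvPolynomial.C c * ∏ i, MvPolynomial.X (some i) ^ (e i).toNat
      - MvPolynomial.X none * ∏ i, MvPolynomial.X (some i) ^ (-e i).toNat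
  refine (SA.inter _ _ (hY.reindex (fun i => some i)) (SA.zero q)).congr fun z => ?_
  simp only [Set.mem_inter_iff, Set.mem_ofPred_eq]
  refine and_congr_right fun hz => ?_
  have hz' : ∀ i, z (some i) ≠ 0 := ht _ hz
  simp only [q, map_sub, map_mul, map_prod, map_pow, MvPolynomial.eval_C, MvPolynomial.eval_X, mon]
  have h1 : ∏ i, z (some i) ^ e i = (∏ i, z (some i) ^ (e i).toNat) / ∏ i, z (some i) ^ (-e i).toNat := by
    rw [← Finset.prod_div_distrib]
    refine Finset.prod_congr rfl fun i _ => ?_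
    rw [← zpow_natCast, ← zpow_natCast, ← zpow_sub₀ (hz' i), Int.toNat_sub_toNat_neg]
  have h2 : ∏ i, z (some i) ^ (-e i).toNat ≠ 0 := Finset.prod_ne_zero_iff.2 fun i _ => pow_ne_zero _ (hz' i)
  rw [h1, sub_eq_zero, ← mul_div_assoc, div_eq_iff h2]

theorem Par.chart {M : ℕ} {ε : ℝ} (hε : ε < 1) (c : Chart p (Fin M → ℚ_[p]))
    (hc : ∀ i, Prep ε (fun x : Fin M → ℚ_[p] => x i) c) (hinj : Set.InjOn c.h c.Y) :
    ∃ g, Par c.img c.ι c.Y c.h g := by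
  choose a e hae using fun i => (hc i).2
  exact ⟨fun j => mon (a j) (e j), c.sa, hinj, rfl, fun j => (hc j).1,
    fun j => mon_graph c.sa c.tor _ _, fun j y hy => (MonOn.norm_eq (f := fun y => c.h y j) hε (hae j y hy)).symm⟩

open Classical in
theorem Par.union {M : ℕ} {S T : Set (Fin M → ℚ_[p])} (hST : Disjoint S T) {ι κ : Type} [Fintype ι] [Fintype κ]
    {Y : Set (ι → ℚ_[p])} {h : (ι → ℚ_[p]) → (Fin M → ℚ_[p])} {g : Fin M → (ι → ℚ_[p]) → ℚ_[p]}
    {Z : Set (κ → ℚ_[p])} {k : (κ → ℚ_[p]) → (Fin M → ℚ_[p])} {l : Fin M → (κ → ℚ_[p]) → ℚ_[p]}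
    (h1 : Par S ι Y h g) (h2 : Par T κ Z k l) :
    Par (S ∪ T) (Option (ι ⊕ κ))
      {w | (w none = 0 ∧ (fun i => w (some (Sum.inl i))) ∈ Y ∧ ∀ j, w (some (Sum.inr j)) = 0) ∨
           (w none = 1 ∧ (fun i => w (some (Sum.inr i))) ∈ Z ∧ ∀ j, w (some (Sum.inl j)) = 0)}
      (fun w => if w none = 0 then h (fun i => w (some (Sum.inl i))) else k (fun i => w (some (Sum.inr i))))
      (fun j w => if w none = 0 then g j (fun i => w (some (Sum.inl i)))
        else l j (fun i => w (some (Sum.inr i)))) where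
  sa := by
    have a1 : SA {w : Option (ι ⊕ κ) → ℚ_[p] | w none = 0} :=
      (SA.zero (MvPolynomial.X none)).congr fun w => by simp
    have a2 : SA {w : Option (ι ⊕ κ) → ℚ_[p] | w none = 1} :=
      (SA.zero (MvPolynomial.X none - 1)).congr fun w => by simp [sub_eq_zero]
    have b : ∀ j, SA {w : Option (ι ⊕ κ) → ℚ_[p] | w (some j) = 0} := fun j =>
      (SA.zero (MvPolynomial.X (some j))).congr fun w => by simp
    exact SA.or (SA.and a1 (SA.and (h1.sa.reindex (fun i => some (Sum.inl i))) (SA.all fun j => b _)))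
      (SA.and a2 (SA.and (h2.sa.reindex (fun i => some (Sum.inr i))) (SA.all fun j => b _)))
  inj := by
    rintro w hw w' hw' e
    rcases hw with ⟨a, b, c⟩ | ⟨a, b, c⟩ <;> rcases hw' with ⟨a', b', c'⟩ | ⟨a', b', c'⟩
    · simp only [a, a', if_true] at e
      have e1 := h1.inj b b' e
      funext i
      rcases i with _ | i | i
      · rw [a, a']
      · exact congrFun e1 i
      · rw [c, c']
    · simp only [a, a', if_true, one_ne_zero, if_false] at e
      exact (Set.disjoint_left.1 hST (h1.img ▸ Set.mem_image_of_mem h b)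
        (e ▸ (h2.img ▸ Set.mem_image_of_mem k b'))).elim
    · simp only [a, a', if_true, one_ne_zero, if_false] at e
      exact (Set.disjoint_left.1 hST (h1.img ▸ Set.mem_image_of_mem h b')
        (e ▸ (h2.img ▸ Set.mem_image_of_mem k b))).elim
    · simp only [a, a', if_false, one_ne_zero] at e
      have e1 := h2.inj b b' e
      funext i
      rcases i with _ | i | i
      · rw [a, a']
      · rw [c, c']
      · exact congrFun e1 i
  img := by
    rw [← h1.img, ← h2.img]
    ext v
    simp only [Set.mem_union, Set.mem_image]
    constructor
    · rintro ⟨w, ⟨a, b, c⟩ | ⟨a, b, c⟩, rfl⟩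
      · left; exact ⟨_, b, by simp [a]⟩
      · right; exact ⟨_, b, by simp [a]⟩
    · rintro (⟨y, hy, rfl⟩ | ⟨y, hy, rfl⟩)
      · exact ⟨fun o => o.elim 0 (Sum.elim y 0), Or.inl ⟨rfl, hy, fun _ => rfl⟩, by simp⟩
      · exact ⟨fun o => o.elim 1 (Sum.elim 0 y), Or.inr ⟨rfl, hy, fun _ => rfl⟩, by simp⟩
  don := fun j => by
    obtain ⟨φ, hφ, e1⟩ := h1.don j
    obtain ⟨ψ, hψ, e2⟩ := h2.don j
    have d1 := hφ.subst (g := fun i (w : Option (ι ⊕ κ) → ℚ_[p]) => w (some (Sum.inl i))) fun i => DF.coord _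
    have d2 := hψ.subst (g := fun i (w : Option (ι ⊕ κ) → ℚ_[p]) => w (some (Sum.inr i))) fun i => DF.coord _
    have d0 : DF (fun w : Option (ι ⊕ κ) → ℚ_[p] => w none) := DF.coord _
    refine ⟨_, DF.add _ _ (DF.mul _ _ (DF.sub (DF.const 1) d0) d1) (DF.mul _ _ d0 d2), ?_⟩
    rintro w (⟨a, b, c⟩ | ⟨a, b, c⟩)
    · have := e1 _ b
      simpa [a] using this
    · have := e2 _ b
      simpa [a] using this
  gsa := fun j => by
    have a1 : SA {w : Option (Option (ι ⊕ κ)) → ℚ_[p] | w (some none) = 0} :=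
      (SA.zero (MvPolynomial.X (some none))).congr fun w => by simp
    have a2 : SA {w : Option (Option (ι ⊕ κ)) → ℚ_[p] | w (some none) = 1} :=
      (SA.zero (MvPolynomial.X (some none) - 1)).congr fun w => by simp [sub_eq_zero]
    have b : ∀ j, SA {w : Option (Option (ι ⊕ κ)) → ℚ_[p] | w (some (some j)) = 0} := fun j =>
      (SA.zero (MvPolynomial.X (some (some j)))).congr fun w => by simp
    have c1 := (h1.gsa j).reindex (κ := Option (Option (ι ⊕ κ)))
      (fun o => o.elim none fun i => some (some (Sum.inl i)))
    have c2 := (h2.gsa j).reindex (κ := Option (Option (ι ⊕ κ)))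
      (fun o => o.elim none fun i => some (some (Sum.inr i)))
    refine (SA.or (SA.and a1 (SA.and c1 (SA.all fun j : κ => b (Sum.inr j))))
      (SA.and a2 (SA.and c2 (SA.all fun j : ι => b (Sum.inl j))))).congr fun w => ?_
    simp only [Set.mem_ofPred_eq, Option.elim_some, Option.elim_none]
    constructor
    · rintro ⟨⟨a, b, c⟩ | ⟨a, b, c⟩, e⟩
      · simp only [a, if_true] at e
        exact Or.inl ⟨a, ⟨b, e⟩, c⟩
      · simp only [a, if_false, one_ne_zero] at e
        exact Or.inr ⟨a, ⟨b, e⟩, c⟩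
    · rintro (⟨a, ⟨b, e⟩, c⟩ | ⟨a, ⟨b, e⟩, c⟩)
      · exact ⟨Or.inl ⟨a, b, c⟩, by simpa [a] using e⟩
      · exact ⟨Or.inr ⟨a, b, c⟩, by simpa [a] using e⟩
  nrm := fun j w hw => by
    rcases hw with ⟨a, b, c⟩ | ⟨a, b, c⟩
    · simpa [a] using h1.nrm j _ b
    · simpa [a] using h2.nrm j _ b

theorem Par.ofCov {M : ℕ} {S : Set (Fin M → ℚ_[p])} {ε : ℝ} (hε : ε < 1)
    (h : CovOn (fun c => ∀ i, Prep ε (fun x : Fin M → ℚ_[p] => x i) c) S) :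
    ∃ (ι : Type) (_ : Fintype ι) (Y : Set (ι → ℚ_[p])) (h : _) (g : _), Par S ι Y h g := by
  induction h with
  | empty => exact ⟨Empty, inferInstance, _, _, _, Par.empty⟩
  | chart c hc hinj =>
    obtain ⟨g, hg⟩ := Par.chart hε c hc hinj
    exact ⟨_, c.fin, _, _, g, hg⟩
  | union S T hST _ _ h1 h2 =>
    obtain ⟨ι, _, Y, h, g, h1⟩ := h1
    obtain ⟨κ, _, Z, k, l, h2⟩ := h2
    exact ⟨_, inferInstance, _, _, _, Par.union hST h1 h2⟩

theorem main (m r : ℕ) (X : Set (Fin m → ℚ_[p])) (hX : IsSubanalytic p X)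
    (f : Fin r → (Fin m → ℚ_[p]) → ℚ_[p]) (hf : ∀ i, IsSubanalyticFnOn p X (f i)) :
    ∃ (N : ℕ), 1 ≤ N ∧
      ∃ (Y : Set (Fin N → ℚ_[p])) (F : (Fin m → ℚ_[p]) → (Fin N → ℚ_[p]))
        (g : Fin r → (Fin N → ℚ_[p]) → ℚ_[p]),
        IsSemialgebraic p Y ∧
        IsSubanalytic p (graphMap p X F) ∧
        Set.BijOn F X Y ∧
        (∀ i, IsSemialgebraicFnOn p Y (g i)) ∧
        ∀ i, ∀ x ∈ X, ‖g i (F x)‖ = ‖f i x‖ := by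
  classical
  -- the common graph
  let Γ : Set (Fin (m + r) → ℚ_[p]) :=
    {z | (fun i => z (Fin.castAdd r i)) ∈ X ∧
      ∀ i, f i (fun j => z (Fin.castAdd r j)) = z (Fin.natAdd m i)}
  have hΓ : Pos BD Γ := by
    have a1 := (Pos.ofSubanalytic hX).pull _ (BD.pull (κ := Fin (m + r)) (Fin.castAdd r))
    have a2 := fun i => (Pos.ofSubanalytic (hf i)).pull _
      (BD.pull (κ := Fin (m + r)) (Fin.lastCases (Fin.natAdd m i) (Fin.castAdd r)))
    convert Pos.inter _ _ a1 (Pos.all a2) using 1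
    ext z
    simp only [Γ, Set.mem_ofPred_eq, Set.mem_inter_iff, Set.mem_preimage, graphFun, Fin.lastCases_castSucc,
      Fin.lastCases_last]
    exact and_congr_right fun hx => forall_congr' fun i => ⟨fun h => ⟨hx, h⟩, fun h => h.2⟩
  obtain ⟨ε, hε, hcov⟩ := thmD hΓ
  obtain ⟨ι₀, _, Y₀, h₀, g₀, hp₀⟩ := Par.ofCov hε hcov
  obtain ⟨ι, hι, hne, Y, h, g, hP⟩ : ∃ (ι : Type) (_ : Fintype ι) (_ : Nonempty ι)
      (Y : Set (ι → ℚ_[p])) (h : _) (g : _), Par Γ ι Y h g := by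
    have := Par.union (Set.disjoint_empty Γ) hp₀ Par.empty
    rw [Set.union_empty] at this
    exact ⟨Option (ι₀ ⊕ Empty), inferInstance, inferInstance, _, _, _, this⟩
  let e := Fintype.equivFin ι
  -- the point of `Y` over `x`
  have hex : ∀ x, ∃ y : ι → ℚ_[p], x ∈ X → y ∈ Y ∧ h y = Fin.append x (fun i => f i x) := by
    intro x
    by_cases hx : x ∈ X
    · have : Fin.append x (fun i => f i x) ∈ Γ := by
        simp only [Γ, Set.mem_ofPred_eq, Fin.append_left, Fin.append_right]
        exact ⟨hx, by simp⟩
      rw [← hP.img] at this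
      obtain ⟨y, hy, e⟩ := this
      exact ⟨y, fun _ => ⟨hy, e⟩⟩
    · exact ⟨0, fun h => (hx h).elim⟩
  choose G hG using hex
  have hΓ1 : ∀ y ∈ Y, (fun j => h y (Fin.castAdd r j)) ∈ X ∧
      G (fun j => h y (Fin.castAdd r j)) = y := by
    intro y hy
    have h1 : h y ∈ Γ := hP.img ▸ Set.mem_image_of_mem h hy
    refine ⟨h1.1, hP.inj (hG _ h1.1).1 hy ?_⟩
    rw [(hG _ h1.1).2]
    funext i
    refine Fin.addCases (fun j => ?_) (fun j => ?_) i
    · rw [Fin.append_left]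
    · rw [Fin.append_right]; exact h1.2 j
  have hfst : ∀ x ∈ X, (fun j => h (G x) (Fin.castAdd r j)) = x := by
    intro x hx
    rw [(hG x hx).2]
    funext j
    rw [Fin.append_left]
  refine ⟨Fintype.card ι, Fintype.card_pos, {w | (fun i => w (e i)) ∈ Y}, fun x k => G x (e.symm k),
    fun i w => g (Fin.natAdd m i) (fun k => w (e k)), ?_, ?_, ⟨?_, ?_, ?_⟩, ?_, ?_⟩
  · exact (hP.sa.reindex _).toSemialg
  · choose φ hφ hφe using fun j : Fin m => hP.don (Fin.castAdd r j)
    have a1 := hP.sa.pos.pull _ (BA.pull (κ := Fin (m + Fintype.card ι)) (fun i => Fin.natAdd m (e i)))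
    have a2 : Pos BD {z : Fin (m + Fintype.card ι) → ℚ_[p] | ∀ j : Fin m, z ∈ {z : Fin (m + Fintype.card ι) → ℚ_[p] |
        φ j (fun i => z (Fin.natAdd m (e i))) - z (Fin.castAdd _ j) = 0}} := by
      refine Pos.all fun j => Pos.basic _ (Or.inl ⟨_, ?_, rfl⟩)
      exact DF.sub ((hφ j).subst fun i => DF.coord _) (DF.coord _)
    refine Pos.toSubanalytic ?_
    convert Pos.inter _ _ a1 a2 using 1
    ext z
    simp only [graphMap, Set.mem_ofPred_eq, Set.mem_inter_iff, Set.mem_preimage, sub_eq_zero]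
    constructor
    · rintro ⟨hx, hy⟩
      have hy' : (fun i => z (Fin.natAdd m (e i))) = G (fun i => z (Fin.castAdd _ i)) := by
        funext i
        rw [← congrFun hy (e i), e.symm_apply_apply]
      rw [hy']
      refine ⟨(hG _ hx).1, fun j => ?_⟩
      rw [← hφe j _ (hG _ hx).1]
      exact congrFun (hfst _ hx) j
    · rintro ⟨hy, hx⟩
      have hx' : (fun i => z (Fin.castAdd (Fintype.card ι) i))
          = fun j => h (fun i => z (Fin.natAdd m (e i))) (Fin.castAdd r j) := by
        funext j
        rw [← hx j, ← hφe j _ hy]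
      rw [hx']
      obtain ⟨b1, b2⟩ := hΓ1 _ hy
      refine ⟨b1, ?_⟩
      funext k
      rw [b2]; dsimp only; rw [e.apply_symm_apply]
  · intro x hx
    simp only [Set.mem_ofPred_eq, e.symm_apply_apply]
    exact (hG x hx).1
  · intro x hx x' hx' hxx
    have : G x = G x' := by
      funext i
      simpa using congrFun hxx (e i)
    rw [← hfst x hx, ← hfst x' hx', this]
  · intro w hw
    obtain ⟨b1, b2⟩ := hΓ1 _ hw
    refine ⟨_, b1, ?_⟩
    funext k
    dsimp only
    rw [b2]; dsimp only; rw [e.apply_symm_apply]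
  · intro i
    have := (hP.gsa (Fin.natAdd m i)).reindex (κ := Fin (Fintype.card ι + 1))
      (fun o => o.elim (Fin.last _) fun k => (e k).castSucc)
    exact SA.toSemialg (this.congr fun z => by simp [graphFun])
  · intro i x hx
    simp only [e.symm_apply_apply]
    rw [hP.nrm _ _ (hG x hx).1, (hG x hx).2, Fin.append_right]
end PSub
end Part23

open PadicSub in
/-- Theorem 3.1 of the paper.  For any subanalytic set `X ⊆ ℚ_p^m` and subanalytic
functions `f₁, …, f_r : X → ℚ_p` there are a semialgebraic set `Y ⊆ ℚ_p^N`, a subanalytic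
bijection `F : X → Y` and semialgebraic maps `g_i : Y → ℚ_p` with
`|g_i(F(x))| = |f_i(x)|` for all `x ∈ X`. -/
theorem subanalytic_reduction_to_semialgebraic
    (p : ℕ) [Fact p.Prime] (m r : ℕ) (X : Set (Fin m → ℚ_[p])) (hX : IsSubanalytic p X)
    (f : Fin r → (Fin m → ℚ_[p]) → ℚ_[p]) (hf : ∀ i, IsSubanalyticFnOn p X (f i)) :
    ∃ (N : ℕ), 1 ≤ N ∧
      ∃ (Y : Set (Fin N → ℚ_[p])) (F : (Fin m → ℚ_[p]) → (Fin N → ℚ_[p]))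
        (g : Fin r → (Fin N → ℚ_[p]) → ℚ_[p]),
        IsSemialgebraic p Y ∧
        IsSubanalytic p (graphMap p X F) ∧
        Set.BijOn F X Y ∧
        (∀ i, IsSemialgebraicFnOn p Y (g i)) ∧
        ∀ i, ∀ x ∈ X, ‖g i (F x)‖ = ‖f i x‖ := PSub.main m r X hX f hf
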